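/- Let K be a congruence function field over 𝔽₂ with genus g_K = 4 and class number h_K = 1, and let k be its unique rational subfield with [K : k] = 5. If K/k were not normal, then the Galois closure K̃ of K/k would have exact field of constants 𝔽₂ and the extension K̃/K would be unramified. -/

import Mathlib

set_option synthInstance.maxHeartbeats 1000000
set_option maxHeartbeats 1000000

open scoped Classical

noncomputable section

namespace CFF

variable (F : Type*) [Field F]

/-- `K` is a (congruence) function field in one variable over `F`: a finitely
generated field extension of transcendence degree one. -/
def IsFunctionField (K : Type*) [Field K] [Algebra F K] : Prop :=
  ∃ x : K, Transcendental F x ∧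
    FiniteDimensional (IntermediateField.adjoin F {x}) K

/-- The exact field of constants of `K` is `F`: every element of `K` algebraic
over `F` already lies in `F`. -/
def HasExactConstants (K : Type*) [Field K] [Algebra F K] : Prop :=
  ∀ a : K, IsAlgebraic F a → a ∈ (algebraMap F K).range

variable (K : Type*) [Field K] [Algebra F K]

/-- A place of the function field `K/F`: a proper valuation subring of `K`
containing the constants. -/
def IsPlace (O : ValuationSubring K) : Prop :=
  O ≠ ⊤ ∧ ∀ c : F, algebraMap F K c ∈ O

/-- The type of places (prime divisors) of `K/F`. -/
def Place := {O : ValuationSubring K // IsPlace F K O}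

variable {K}

/-- `𝔪`-adic order of an element of a valuation subring. -/
def ordAux (O : ValuationSubring K) (x : O) : ℕ :=
  sSup {n : ℕ | x ∈ IsLocalRing.maximalIdeal O ^ n}

/-- The order (normalized valuation) of `f ∈ K` at a valuation subring `O`. -/
def ordAt (O : ValuationSubring K) (f : K) : ℤ :=
  if h : f ∈ O then (ordAux O ⟨f, h⟩ : ℤ)
  else -(ordAux O ⟨f⁻¹, (O.mem_or_inv_mem f).resolve_left h⟩ : ℤ)

/-- The constants embed into (the valuation ring of) any place. -/
def constHom (p : Place F K) : F →+* p.1 :=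
  (algebraMap F K).codRestrict p.1.toSubring fun c => p.2.2 c

/-- The map from the constants to the residue field of a place. -/
def residueHom (p : Place F K) : F →+* IsLocalRing.ResidueField p.1 :=
  (IsLocalRing.residue (p.1 : ValuationSubring K)).comp (constHom F p)

/-- The degree of a place: the dimension of its residue field over the
constants. -/
def placeDegree (p : Place F K) : ℕ :=
  letI := (residueHom F p).toAlgebra
  Module.finrank F (IsLocalRing.ResidueField p.1)

variable (K)

/-- The group of divisors of `K/F`. -/
abbrev Divisor := Place F K →₀ ℤ

/-- The degree homomorphism on divisors. -/
def degHom : Divisor F K →+ ℤ :=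
  Finsupp.liftAddHom fun p => AddMonoidHom.mulRight (placeDegree F p : ℤ)

variable {K}

/-- The Riemann-Roch space `L(D)` of a divisor `D` (the span coincides with the
set of `f` with `div f ≥ -D`, which is an `F`-subspace). -/
def RRspace (D : Divisor F K) : Submodule F K :=
  Submodule.span F {f : K | ∀ p : Place F K, 0 ≤ D p + ordAt p.1 f}

/-- `ℓ(D)`, the dimension of the Riemann-Roch space of `D`. -/
def ell (D : Divisor F K) : ℕ := Module.finrank F (RRspace F D)

variable (K)

/-- The genus of `K/F`, via Riemann's theorem: `g = max_D (deg D + 1 - ℓ(D))`. -/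
def genus : ℕ :=
  sSup {g : ℕ | ∃ D : Divisor F K, (g : ℤ) = degHom F K D + 1 - ell F D}

/-- The subgroup of divisors of degree zero. -/
def zeroDivisors : AddSubgroup (Divisor F K) := (degHom F K).ker

/-- The subgroup of principal divisors. -/
def principalDivisors : AddSubgroup (Divisor F K) :=
  AddSubgroup.closure
    {D : Divisor F K | ∃ f : K, f ≠ 0 ∧ ∀ p : Place F K, D p = ordAt p.1 f}

/-- The group of divisor classes of degree zero of `K/F`. -/
def ClassGroup0 :=
  zeroDivisors F K ⧸ (principalDivisors F K).addSubgroupOf (zeroDivisors F K)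

instance : AddGroup (ClassGroup0 F K) := by
  unfold ClassGroup0; infer_instance

/-- The class number of `K/F`: the order of the group of divisor classes of
degree zero. -/
def classNumber : ℕ := Nat.card (ClassGroup0 F K)

section Extension

variable {k L : Type*} [Field k] [Field L] [Algebra F k] [Algebra F L] [Algebra k L]

/-- A place `P` of `L` lies over the place `p` of `k`. -/
def LiesOver (P : Place F L) (p : Place F k) : Prop :=
  P.1.comap (algebraMap k L) = p.1

variable (L)

/-- `p` is inert in `L/k`: there is a unique place of `L` above `p`, and its
degree is `[L:k] · deg p` (i.e. the residue degree is `[L:k]`, so `e = 1`). -/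
def IsInert (p : Place F k) : Prop :=
  ∃ P : Place F L, LiesOver F P p ∧
    placeDegree F P = Module.finrank k L * placeDegree F p ∧
    ∀ P' : Place F L, LiesOver F P' p → P' = P

/-- `p` splits completely in `L/k`: there are `[L:k]` places above `p`, each of
the same degree as `p`. -/
def SplitsCompletely (p : Place F k) : Prop :=
  Nat.card {P : Place F L // LiesOver F P p} = Module.finrank k L ∧
    ∀ P : Place F L, LiesOver F P p → placeDegree F P = placeDegree F p

/-- `p` is totally ramified in `L/k`: there is a unique place above `p`, of the
same degree (so `f = 1` and `e = [L:k]`). -/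
def IsTotallyRamified (p : Place F k) : Prop :=
  ∃ P : Place F L, LiesOver F P p ∧ placeDegree F P = placeDegree F p ∧
    ∀ P' : Place F L, LiesOver F P' p → P' = P

/-- `p` is unramified in `L/k`: at every place above `p` the orders of elements
of `k` are preserved (`e = 1`). -/
def IsUnramifiedAt (p : Place F k) : Prop :=
  ∀ P : Place F L, LiesOver F P p →
    ∀ x : k, ordAt P.1 (algebraMap k L x) = ordAt p.1 x

end Extension

section Rational

/-- The valuation ring of the finite place of `𝔽₂(T)` corresponding to an
irreducible polynomial `P`: it contains all polynomials and `P` lies in its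
maximal ideal. -/
def IsFinitePlaceOf (O : ValuationSubring (RatFunc (ZMod 2)))
    (P : Polynomial (ZMod 2)) : Prop :=
  (∀ g : Polynomial (ZMod 2), algebraMap (Polynomial (ZMod 2)) (RatFunc (ZMod 2)) g ∈ O) ∧
    (algebraMap (Polynomial (ZMod 2)) (RatFunc (ZMod 2)) P)⁻¹ ∉ O

/-- The infinite place `𝔭_∞` of `𝔽₂(T)`: the place where `T` has a pole. -/
def IsInfinitePlace (O : ValuationSubring (RatFunc (ZMod 2))) : Prop :=
  RatFunc.X ∉ O

end Rational

end CFF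

namespace CFF

open IntermediateField Polynomial IntermediateField.algebraAdjoinAdjoin

/-- `K/F` is a function field in one variable with exact constant field `F`. -/
class IsCF (F K : Type) [Field F] [Field K] [Algebra F K] : Prop where
  ff : IsFunctionField F K
  const : HasExactConstants F K

section Basic

variable {F K : Type} [Field F] [Field K] [Algebra F K]

/-- The degree `[K : F(x)]`. -/
def fdeg (F : Type) {K : Type} [Field F] [Field K] [Algebra F K] (x : K) : ℕ :=
  Module.finrank (adjoin F {x}) K

theorem transcendental_of_not_mem [IsCF F K] {x : K} (hx : x ∉ (algebraMap F K).range) :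
    Transcendental F x := fun h => hx (IsCF.const x h)

theorem finiteDimensional_adjoin [IsCF F K] {x : K} (hx : Transcendental F x) :
    FiniteDimensional (adjoin F {x}) K := by
  obtain ⟨t, ht, hfin⟩ := IsCF.ff (F := F) (K := K)
  have hess : Algebra.EssFiniteType F K := by
    have : Algebra.EssFiniteType F (adjoin F {t}) :=
      essFiniteType_iff.2 ⟨{t}, by simp⟩
    exact Algebra.EssFiniteType.comp F (adjoin F {t}) K
  have hess' : Algebra.EssFiniteType (adjoin F {x}) K := Algebra.EssFiniteType.of_comp F _ K
  have hb : ∀ s : K, Transcendental F s → AlgebraicIndependent F (fun _ : Unit => s) := fun s hs =>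
    algebraicIndependent_unique_type_iff.2 hs
  have h1 : IsTranscendenceBasis F (fun _ : Unit => t) := by
    refine (hb t ht).isTranscendenceBasis_iff_isAlgebraic.2 ?_
    have h2 : Algebra.IsAlgebraic (adjoin F (Set.range fun _ : Unit => t)) K := by
      rw [Set.range_const]; infer_instance
    exact (isAlgebraic_adjoin_iff_top).1 h2
  have h3 : IsTranscendenceBasis F (fun _ : Unit => x) := by
    refine (hb x hx).isTranscendenceBasis_of_trdeg_le ?_ ?_
    · rw [← h1.cardinalMk_eq_trdeg]; simp
    · rw [← h1.cardinalMk_eq_trdeg]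
  have h4 := h3.isAlgebraic_field
  rw [Set.range_const] at h4
  exact Algebra.finite_of_essFiniteType_of_isAlgebraic

/-- Linear independence over `F(x)` can be tested with polynomials in `x`. -/
theorem linearIndependent_adjoin_iff {x : K} (hx : Transcendental F x) {ι : Type*} (u : ι → K) :
    LinearIndependent (adjoin F {x}) u ↔
      ∀ (s : Finset ι) (a : ι → F[X]), ∑ i ∈ s, aeval x (a i) * u i = 0 → ∀ i ∈ s, a i = 0 := by
  rw [← LinearIndependent.iff_fractionRing (Algebra.adjoin F {x}) (adjoin F {x}),
    linearIndependent_iff']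
  constructor
  · intro h s a hsum i hi
    have := h s (fun i => ⟨aeval x (a i), aeval_mem_adjoin_singleton F x⟩) (by
      rw [← hsum]; rfl) i hi
    have h0 : aeval x (a i) = 0 := congrArg Subtype.val this
    exact (transcendental_iff.1 hx) _ h0
  · intro h s g hsum i hi
    have hex : ∀ i, ∃ p : F[X], aeval x p = (g i : K) := fun i => by
      exact (Algebra.adjoin_singleton_eq_range_aeval F x).le (g i).2
    choose a ha using hex
    have := h s a (by rw [← hsum]; exact Finset.sum_congr rfl fun i _ => by rw [ha]; rfl) i hi
    apply Subtype.ext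
    rw [← ha, this]; simp

theorem fdeg_inv (x : K) : fdeg F x⁻¹ = fdeg F x := by
  have : adjoin F {x⁻¹} = adjoin F {x} := by
    apply le_antisymm
    · rw [adjoin_simple_le_iff]; exact inv_mem (mem_adjoin_simple_self F x)
    · rw [adjoin_simple_le_iff]
      simpa using inv_mem (mem_adjoin_simple_self F x⁻¹)
  unfold fdeg; rw [this]

theorem transcendental_inv {x : K} (hx : Transcendental F x) : Transcendental F x⁻¹ :=
  fun h => hx (by simpa using h.inv)

/-- If elements of an `F[x]`-submodule `S` are independent modulo `xS`, they are independent
over `F(x)`. -/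
theorem linearIndependent_of_mod {x : K} (hx : Transcendental F x) (S : Submodule F K)
    (hS : ∀ s ∈ S, x * s ∈ S) {ι : Type*} (u : ι → K) (huS : ∀ i, u i ∈ S)
    (hu : ∀ (s : Finset ι) (c : ι → F) (r : K), r ∈ S → ∑ i ∈ s, c i • u i = x * r →
      ∀ i ∈ s, c i = 0) : LinearIndependent (adjoin F {x}) u := by
  rw [linearIndependent_adjoin_iff hx]
  have hx0 : x ≠ 0 := fun h => hx (h ▸ isAlgebraic_zero)
  have hpol : ∀ p : F[X], ∀ s ∈ S, aeval x p * s ∈ S := by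
    intro p s hs
    induction p using Polynomial.induction_on' with
    | add p q hp hq => rw [map_add, add_mul]; exact S.add_mem hp hq
    | monomial n a =>
      rw [aeval_monomial]
      induction n with
      | zero =>
        rw [pow_zero, mul_one, ← Algebra.smul_def]; exact S.smul_mem _ hs
      | succ n ih =>
        have := hS _ ih
        rw [pow_succ]; convert this using 1; ring
  -- induct on a bound of the degrees
  have key : ∀ (N : ℕ) (s : Finset ι) (a : ι → F[X]), (∀ i ∈ s, (a i).natDegree < N) →
      ∑ i ∈ s, aeval x (a i) * u i = 0 → ∀ i ∈ s, a i = 0 := by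
    intro N
    induction N with
    | zero => intro s a h _ i hi; exact absurd (h i hi) (by simp)
    | succ N ih =>
      intro s a hN hsum
      have hdec : ∀ i, aeval x (a i) = x * aeval x (a i).divX + algebraMap F K ((a i).coeff 0) := by
        intro i
        conv_lhs => rw [← divX_mul_X_add (a i)]
        simp only [map_add, map_mul, aeval_X, aeval_C]; ring
      have h0 : ∀ i ∈ s, (a i).coeff 0 = 0 := by
        have h1 : ∑ i ∈ s, (a i).coeff 0 • u i =
            x * (-∑ i ∈ s, aeval x (a i).divX * u i) := by
          have : ∑ i ∈ s, aeval x (a i) * u i =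
              x * (∑ i ∈ s, aeval x (a i).divX * u i) + ∑ i ∈ s, (a i).coeff 0 • u i := by
            rw [Finset.mul_sum, ← Finset.sum_add_distrib]
            refine Finset.sum_congr rfl fun i _ => ?_
            rw [hdec i, Algebra.smul_def]; ring
          rw [hsum] at this
          linear_combination -this
        exact hu s _ _ (S.neg_mem (S.sum_mem fun i _ => hpol _ _ (huS i))) h1
      have hsum' : ∑ i ∈ s, aeval x (a i).divX * u i = 0 := by
        have : x * ∑ i ∈ s, aeval x (a i).divX * u i = 0 := by
          rw [← hsum, Finset.mul_sum]
          refine Finset.sum_congr rfl fun i hi => ?_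
          rw [hdec i, h0 i hi, map_zero]; ring
        exact (mul_eq_zero.1 this).resolve_left hx0
      by_cases hN0 : N = 0
      · intro i hi
        have h1 := hN i hi
        rw [eq_C_of_natDegree_eq_zero (p := a i) (by omega), h0 i hi, C_0]
      · intro i hi
        have := ih s (fun i => (a i).divX) (fun i hi => by
          have h1 := hN i hi
          have h2 := natDegree_divX_eq_natDegree_tsub_one (p := a i)
          omega) hsum' i hi
        rw [← divX_mul_X_add (a i), h0 i hi]
        simp [this]
  intro s a hsum
  exact key (s.sup (fun i => (a i).natDegree) + 1) s a
    (fun i hi => Nat.lt_succ_of_le (Finset.le_sup (f := fun i => (a i).natDegree) hi)) hsum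

theorem card_le_fdeg [IsCF F K] {x : K} (hx : Transcendental F x) {ι : Type*} [Fintype ι] (u : ι → K)
    (hu : LinearIndependent (adjoin F {x}) u) : Fintype.card ι ≤ fdeg F x := by
  have := finiteDimensional_adjoin hx
  exact hu.fintype_card_le_finrank

/-- `S / xS` has dimension at most `[K : F(x)]`. -/
theorem finrank_mod_le [IsCF F K] {x : K} (hx : Transcendental F x) (S : Submodule F K)
    (hS : ∀ s ∈ S, x * s ∈ S) (V : Type) [AddCommGroup V] [Module F V] (φ : S →ₗ[F] V)
    (hsurj : Function.Surjective φ)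
    (hker : ∀ (s : S) (r : K), r ∈ S → (s : K) = x * r → φ s = 0) :
    FiniteDimensional F V ∧ Module.finrank F V ≤ fdeg F x := by
  have key : ∀ {ι : Type} (v : ι → V), LinearIndependent F v → 
      ∃ u : ι → K, LinearIndependent (adjoin F {x}) u := by
    intro ι v hv
    choose w hw using fun i => hsurj (v i)
    refine ⟨fun i => w i, linearIndependent_of_mod hx S hS _ (fun i => (w i).2) ?_⟩
    intro s c r hr hsum
    refine (linearIndependent_iff'.1 hv) s c ?_
    have := hker (∑ i ∈ s, c i • w i) r hr (by simpa using hsum)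
    simpa [hw] using this
  have hfin := finiteDimensional_adjoin hx
  have hfd : FiniteDimensional F V := by
    obtain ⟨u, hu⟩ := key _ (Module.Basis.ofVectorSpace F V).linearIndependent
    have : Finite (Module.Basis.ofVectorSpaceIndex F V) := hu.finite
    exact FiniteDimensional.of_finite_basis (Module.Basis.ofVectorSpace F V)
      (Set.toFinite _)
  refine ⟨hfd, ?_⟩
  obtain ⟨u, hu⟩ := key _ (Module.finBasis F V).linearIndependent
  simpa using card_le_fdeg hx u hu

end Basic

end CFF

namespace CFF

open IntermediateField Polynomial

section Places

variable {F K : Type} [Field F] [Field K] [Algebra F K]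

theorem Place.const_mem (p : Place F K) (c : F) : algebraMap F K c ∈ p.1 := p.2.2 c

/-- The valuation ring of a place as an `F`-subspace. -/
def Osub (p : Place F K) : Submodule F K where
  carrier := {x | x ∈ p.1}
  add_mem' := p.1.add_mem _ _
  zero_mem' := p.1.zero_mem
  smul_mem' c x hx := by
    rw [Algebra.smul_def]; exact p.1.mul_mem _ _ (p.const_mem c) hx

@[simp] theorem mem_Osub {p : Place F K} {x : K} : x ∈ Osub p ↔ x ∈ p.1 := Iff.rfl

theorem not_mem_range_of_inv_not_mem {p : Place F K} {x : K} (h : x⁻¹ ∉ p.1) :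
    x ∉ (algebraMap F K).range := by
  rintro ⟨c, rfl⟩
  exact h (by rw [← map_inv₀]; exact p.const_mem _)

theorem coe_unit_inv (p : Place F K) (u : p.1ˣ) :
    ((u⁻¹ : p.1ˣ) : p.1) = ((u : p.1) : K)⁻¹ := by
  refine eq_inv_of_mul_eq_one_right ?_
  have := congrArg (algebraMap p.1 K) u.mul_inv
  rw [map_mul, map_one] at this
  exact this

theorem isUnit_iff_inv_mem (p : Place F K) {x : p.1} (hx : (x : K) ≠ 0) :
    IsUnit x ↔ (x : K)⁻¹ ∈ p.1 := by
  constructor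
  · rintro ⟨u, rfl⟩
    rw [← coe_unit_inv]
    exact Subtype.property _
  · intro h
    refine IsUnit.of_mul_eq_one ⟨_, h⟩ (Subtype.ext ?_)
    simpa using mul_inv_cancel₀ hx

theorem isNoetherianRing_place [IsCF F K] (p : Place F K) : IsNoetherianRing p.1 := by
  let _ : Algebra F p.1 := (constHom F p).toAlgebra
  rw [isNoetherianRing_iff_ideal_fg]
  intro I
  by_cases hI : I = ⊥
  · rw [hI]; exact Submodule.fg_bot
  obtain ⟨y, hyI, hy0⟩ := Submodule.exists_mem_ne_zero_of_ne_bot hI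
  have hyK : (y : K) ≠ 0 := fun h => hy0 (Subtype.ext h)
  by_cases hu : IsUnit y
  · rw [Ideal.eq_top_of_isUnit_mem I hyI hu]; exact ⟨{1}, by simp⟩
  have htr : Transcendental F (y : K) :=
    transcendental_of_not_mem (not_mem_range_of_inv_not_mem fun h =>
      hu ((isUnit_iff_inv_mem p hyK).2 h))
  let φ : Osub p →ₗ[F] (p.1 ⧸ Ideal.span {y}) :=
    { toFun := fun s => Ideal.Quotient.mk _ (⟨s.1, s.2⟩ : p.1)
      map_add' := fun a b => by
        rw [← map_add]; rfl
      map_smul' := fun c a => by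
        have : (⟨(c • a : Osub p).1, (c • a).2⟩ : p.1) = c • (⟨a.1, a.2⟩ : p.1) := by
          apply Subtype.ext
          change c • (a : K) = algebraMap F K c * a
          rw [Algebra.smul_def]
        rw [this]; rfl }
  have hfin := (finrank_mod_le htr (Osub p) (fun s hs => p.1.mul_mem _ _ y.2 hs) _ φ
    (fun v => by
      obtain ⟨w, rfl⟩ := Ideal.Quotient.mk_surjective v
      exact ⟨⟨w.1, w.2⟩, rfl⟩)
    (fun s r hr h => by
      change Ideal.Quotient.mk _ (⟨s.1, s.2⟩ : p.1) = 0
      rw [Ideal.Quotient.eq_zero_iff_mem, Ideal.mem_span_singleton]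
      exact ⟨⟨r, hr⟩, Subtype.ext h⟩)).1
  have hN : IsNoetherian p.1 (p.1 ⧸ Ideal.span {y}) := isNoetherian_of_tower F inferInstance
  refine Submodule.fg_of_fg_map_of_fg_inf_ker (Submodule.mkQ (Ideal.span {y}))
    (IsNoetherian.noetherian _) ?_
  rw [Submodule.ker_mkQ, inf_eq_right.2 ((Ideal.span_singleton_le_iff_mem _).2 hyI)]
  exact ⟨{y}, by simp⟩

theorem exists_nonunit (p : Place F K) : ∃ x : K, x ≠ 0 ∧ x ∈ p.1 ∧ x⁻¹ ∉ p.1 := by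
  obtain ⟨y, hy⟩ : ∃ y : K, y ∉ p.1 := by
    by_contra! h
    exact p.2.1 (ValuationSubring.ext _ _ fun x => ⟨fun _ => ValuationSubring.mem_top x, fun _ => h x⟩)
  refine ⟨y⁻¹, ?_, (p.1.mem_or_inv_mem y).resolve_left hy, by rwa [inv_inv]⟩
  rintro h
  rw [inv_eq_zero] at h
  exact hy (h ▸ p.1.zero_mem)

instance dvr_place [IsCF F K] (p : Place F K) : IsDiscreteValuationRing p.1 := by
  have hN := isNoetherianRing_place p
  have hP : IsPrincipalIdealRing p.1 := (IsBezout.TFAE.out 0 1).1 hN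
  refine { hP, (inferInstance : IsLocalRing p.1) with not_a_field' := ?_ }
  obtain ⟨x, hx0, hx, hxi⟩ := exists_nonunit p
  intro h
  have : (⟨x, hx⟩ : p.1) ∈ IsLocalRing.maximalIdeal p.1 := by
    rw [IsLocalRing.mem_maximalIdeal, mem_nonunits_iff, isUnit_iff_inv_mem p hx0]
    exact hxi
  rw [h, Ideal.mem_bot] at this
  exact hx0 (congrArg Subtype.val this)

/-- A uniformizer. -/
theorem exists_uniformizer [IsCF F K] (p : Place F K) :
    ∃ π : K, ∃ h : π ∈ p.1, π ≠ 0 ∧ Irreducible (⟨π, h⟩ : p.1) := by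
  obtain ⟨π, hπ⟩ := IsDiscreteValuationRing.exists_irreducible p.1
  exact ⟨π.1, π.2, fun h => hπ.ne_zero (Subtype.ext h), hπ⟩

def unif [IsCF F K] (p : Place F K) : K := (exists_uniformizer p).choose

theorem unif_mem [IsCF F K] (p : Place F K) : unif p ∈ p.1 := (exists_uniformizer p).choose_spec.choose

theorem unif_ne_zero [IsCF F K] (p : Place F K) : unif p ≠ 0 :=
  (exists_uniformizer p).choose_spec.choose_spec.1

theorem unif_irreducible [IsCF F K] (p : Place F K) :
    Irreducible (⟨unif p, unif_mem p⟩ : p.1) :=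
  (exists_uniformizer p).choose_spec.choose_spec.2

theorem ordAux_eq [IsCF F K] (p : Place F K) (n : ℕ) (u : p.1ˣ) :
    ordAux p.1 (u * ⟨unif p, unif_mem p⟩ ^ n) = n := by
  have hset : {m : ℕ | (u * ⟨unif p, unif_mem p⟩ ^ n : p.1) ∈ IsLocalRing.maximalIdeal p.1 ^ m} =
      Set.Iic n := by
    ext m
    rw [Set.mem_ofPred_eq, (unif_irreducible p).maximalIdeal_eq, Ideal.span_singleton_pow,
      Ideal.mem_span_singleton, Units.dvd_mul_left, Set.mem_Iic]
    exact pow_dvd_pow_iff (unif_irreducible p).ne_zero (unif_irreducible p).not_isUnit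
  rw [ordAux, hset]
  exact csSup_Iic

theorem exists_unit_mul_zpow [IsCF F K] (p : Place F K) {f : K} (hf : f ≠ 0) :
    ∃ (u : p.1ˣ) (n : ℤ), f = ((u : p.1) : K) * unif p ^ n := by
  have key : ∀ g : K, g ≠ 0 → g ∈ p.1 → ∃ (u : p.1ˣ) (n : ℕ), g = ((u : p.1) : K) * unif p ^ n := by
    intro g hg hgp
    obtain ⟨n, u, h⟩ := IsDiscreteValuationRing.eq_unit_mul_pow_irreducible
      (x := (⟨g, hgp⟩ : p.1)) (fun h => hg (congrArg Subtype.val h)) (unif_irreducible p)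
    refine ⟨u, n, ?_⟩
    have := congrArg Subtype.val h
    simpa using this
  rcases p.1.mem_or_inv_mem f with h | h
  · obtain ⟨u, n, h⟩ := key f hf h
    exact ⟨u, n, by rw [zpow_natCast]; exact h⟩
  · obtain ⟨u, n, h⟩ := key f⁻¹ (inv_ne_zero hf) h
    refine ⟨u⁻¹, -n, ?_⟩
    rw [← inv_inj, h, mul_inv, coe_unit_inv, inv_inv, ← zpow_neg, neg_neg, zpow_natCast]

theorem unit_ne_zero (p : Place F K) (u : p.1ˣ) : ((u : p.1) : K) ≠ 0 := fun h =>
  u.ne_zero (Subtype.ext h)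

theorem ordAt_unit_mul_zpow [IsCF F K] (p : Place F K) (u : p.1ˣ) (n : ℤ) :
    ordAt p.1 (((u : p.1) : K) * unif p ^ n) = n := by
  have hu : ((u : p.1) : K)⁻¹ = ((u⁻¹ : p.1ˣ) : p.1) := (coe_unit_inv p u).symm
  rcases lt_or_ge n 0 with hn | hn
  · obtain ⟨m, rfl⟩ : ∃ m : ℕ, n = -((m : ℤ) + 1) := ⟨(-n - 1).toNat, by omega⟩
    have hinv : (((u : p.1) : K) * unif p ^ (-((m : ℤ) + 1)))⁻¹ =
        (((u⁻¹ : p.1ˣ) * ⟨unif p, unif_mem p⟩ ^ (m + 1) : p.1) : K) := by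
      rw [mul_inv, hu, ← zpow_neg, neg_neg]; norm_cast
    have hnot : ((u : p.1) : K) * unif p ^ (-((m : ℤ) + 1)) ∉ p.1 := by
      intro h
      have hirr := unif_irreducible p
      apply hirr.not_isUnit
      rw [isUnit_iff_inv_mem p (unif_ne_zero p)]
      have h2 := p.1.mul_mem _ _ (p.1.mul_mem _ _ (u⁻¹ : p.1ˣ).1.2 h)
        (pow_mem (unif_mem p) m)
      convert h2 using 1
      rw [← hu, inv_mul_cancel_left₀ (unit_ne_zero p u), ← zpow_natCast, ← zpow_add₀ (unif_ne_zero p)]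
      simp
    rw [ordAt, dif_neg hnot]
    have : ordAux p.1 ⟨_, (p.1.mem_or_inv_mem _).resolve_left hnot⟩ = m + 1 := by
      rw [← ordAux_eq p (m + 1) u⁻¹]
      congr 1
      exact Subtype.ext hinv
    rw [this]; push_cast; ring
  · obtain ⟨m, rfl⟩ := Int.eq_ofNat_of_zero_le hn
    have hmem : ((u : p.1) : K) * unif p ^ (m : ℤ) ∈ p.1 := by
      rw [zpow_natCast]
      exact p.1.mul_mem _ _ u.1.2 (pow_mem (unif_mem p) m)
    rw [ordAt, dif_pos hmem]
    have : ordAux p.1 ⟨_, hmem⟩ = m := by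
      refine Eq.trans ?_ (ordAux_eq p m u)
      refine congrArg (ordAux p.1) (Subtype.ext ?_)
      simp [zpow_natCast]
    rw [this]

theorem ordAt_mul [IsCF F K] (p : Place F K) {f g : K} (hf : f ≠ 0) (hg : g ≠ 0) :
    ordAt p.1 (f * g) = ordAt p.1 f + ordAt p.1 g := by
  obtain ⟨u, n, rfl⟩ := exists_unit_mul_zpow p hf
  obtain ⟨v, m, rfl⟩ := exists_unit_mul_zpow p hg
  rw [ordAt_unit_mul_zpow, ordAt_unit_mul_zpow, ← ordAt_unit_mul_zpow p (u * v) (n + m),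
    zpow_add₀ (unif_ne_zero p)]
  congr 1
  push_cast
  ring

theorem mem_place_iff [IsCF F K] (p : Place F K) {f : K} (hf : f ≠ 0) :
    f ∈ p.1 ↔ 0 ≤ ordAt p.1 f := by
  constructor
  · intro h; rw [ordAt, dif_pos h]; positivity
  · intro h
    obtain ⟨u, n, rfl⟩ := exists_unit_mul_zpow p hf
    rw [ordAt_unit_mul_zpow] at h
    obtain ⟨m, rfl⟩ := Int.eq_ofNat_of_zero_le h
    rw [zpow_natCast]
    exact p.1.mul_mem _ _ u.1.2 (pow_mem (unif_mem p) m)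

@[simp] theorem ordAt_unif [IsCF F K] (p : Place F K) : ordAt p.1 (unif p) = 1 := by
  have := ordAt_unit_mul_zpow p 1 1
  simpa using this

@[simp] theorem ordAt_unif_zpow [IsCF F K] (p : Place F K) (n : ℤ) :
    ordAt p.1 (unif p ^ n) = n := by
  have := ordAt_unit_mul_zpow p 1 n
  simpa using this

theorem ordAt_one [IsCF F K] (p : Place F K) : ordAt p.1 (1 : K) = 0 := by
  simpa using ordAt_unif_zpow p 0

theorem ordAt_inv [IsCF F K] (p : Place F K) (f : K) : ordAt p.1 f⁻¹ = -ordAt p.1 f := by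
  by_cases hf : f = 0
  · subst hf
    have : ordAt p.1 (0 : K) = 0 := by
      rw [ordAt, dif_pos p.1.zero_mem]
      have : {n : ℕ | (⟨0, p.1.zero_mem⟩ : p.1) ∈ IsLocalRing.maximalIdeal p.1 ^ n} = Set.univ := by
        ext n; exact ⟨fun _ => trivial, fun _ => Ideal.zero_mem (IsLocalRing.maximalIdeal p.1 ^ n)⟩
      rw [ordAux, this]; simp
    rw [inv_zero, this, neg_zero]
  have := ordAt_mul p hf (inv_ne_zero hf)
  rw [mul_inv_cancel₀ hf, ordAt_one] at this
  omega

theorem ordAt_pow [IsCF F K] (p : Place F K) {f : K} (hf : f ≠ 0) (n : ℕ) :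
    ordAt p.1 (f ^ n) = n * ordAt p.1 f := by
  induction n with
  | zero => simp [ordAt_one]
  | succ n ih => rw [pow_succ, ordAt_mul p (pow_ne_zero _ hf) hf, ih]; push_cast; ring

theorem ordAt_const [IsCF F K] (p : Place F K) {c : F} : ordAt p.1 (algebraMap F K c) = 0 := by
  by_cases hc : c = 0
  · subst hc
    have := ordAt_inv p (0 : K)
    rw [inv_zero] at this
    rw [map_zero]; omega
  have hc' : algebraMap F K c ≠ 0 := by simpa using hc
  have h1 := (mem_place_iff p hc').1 (p.const_mem c)
  have h2 := (mem_place_iff p (inv_ne_zero hc')).1 (by rw [← map_inv₀]; exact p.const_mem _)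
  rw [ordAt_inv] at h2
  omega

/-- Functions of order at least `n` at `p`. -/
def lev [IsCF F K] (p : Place F K) (n : ℤ) : Submodule F K where
  carrier := {f | f * unif p ^ (-n) ∈ p.1}
  add_mem' ha hb := by
    simp only [Set.mem_ofPred_eq, add_mul] at *; exact p.1.add_mem _ _ ha hb
  zero_mem' := by simp [p.1.zero_mem]
  smul_mem' c x hx := by
    simp only [Set.mem_ofPred_eq, Algebra.smul_def, mul_assoc] at *
    exact p.1.mul_mem _ _ (p.const_mem c) hx

theorem mem_lev [IsCF F K] {p : Place F K} {n : ℤ} {f : K} :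
    f ∈ lev p n ↔ f * unif p ^ (-n) ∈ p.1 := Iff.rfl

theorem mem_lev_iff [IsCF F K] {p : Place F K} {n : ℤ} {f : K} (hf : f ≠ 0) :
    f ∈ lev p n ↔ n ≤ ordAt p.1 f := by
  rw [mem_lev, mem_place_iff p (mul_ne_zero hf (zpow_ne_zero _ (unif_ne_zero p))),
    ordAt_mul p hf (zpow_ne_zero _ (unif_ne_zero p)), ordAt_unif_zpow]
  omega

theorem mem_lev_zero [IsCF F K] {p : Place F K} {f : K} : f ∈ lev p 0 ↔ f ∈ p.1 := by
  rw [mem_lev]; simp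

theorem mul_mem_lev [IsCF F K] {p : Place F K} {n m : ℤ} {f g : K} (hf : f ∈ lev p n)
    (hg : g ∈ lev p m) : f * g ∈ lev p (n + m) := by
  rw [mem_lev] at *
  convert p.1.mul_mem _ _ hf hg using 1
  rw [neg_add, zpow_add₀ (unif_ne_zero p)]; ring

theorem lev_anti [IsCF F K] {p : Place F K} {n m : ℤ} (h : n ≤ m) : lev p m ≤ lev p n := by
  intro f hf
  by_cases hf0 : f = 0
  · rw [hf0]; exact Submodule.zero_mem _
  rw [mem_lev_iff hf0] at *
  omega

theorem mul_mem_lev_iff [IsCF F K] {p : Place F K} {n : ℤ} {f g : K} (hf : f ≠ 0) :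
    f * g ∈ lev p n ↔ g ∈ lev p (n - ordAt p.1 f) := by
  by_cases hg : g = 0
  · simp [hg]
  rw [mem_lev_iff hg, mem_lev_iff (mul_ne_zero hf hg), ordAt_mul p hf hg]
  omega

theorem ordAt_add_ge [IsCF F K] (p : Place F K) {f g : K} (hfg : f + g ≠ 0) {n : ℤ}
    (hf : f ∈ lev p n) (hg : g ∈ lev p n) : n ≤ ordAt p.1 (f + g) :=
  (mem_lev_iff hfg).1 (Submodule.add_mem _ hf hg)

/-- Distinct places have incomparable valuation rings. -/
theorem place_eq_of_le [IsCF F K] {p q : Place F K} (h : p.1 ≤ q.1) : p = q := by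
  apply Subtype.ext
  refine le_antisymm h ?_
  intro f hf
  by_contra hfp
  have hf0 : f ≠ 0 := fun h => hfp (h ▸ p.1.zero_mem)
  have hn : ordAt p.1 f < 0 := by
    rw [mem_place_iff p hf0] at hfp; omega
  obtain ⟨x, hx0, hx, hxi⟩ := exists_nonunit q
  -- some power of `f` times a suitable element lies in `p` but not in `q`
  set N := (ordAt p.1 x⁻¹).natAbs
  have h1 : x⁻¹ * (f ^ N)⁻¹ ∈ p.1 := by
    have hfN := pow_ne_zero N hf0
    rw [mem_place_iff p (mul_ne_zero (inv_ne_zero hx0) (inv_ne_zero hfN)),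
      ordAt_mul p (inv_ne_zero hx0) (inv_ne_zero hfN), ordAt_inv p (f ^ N), ordAt_pow p hf0]
    have : (ordAt p.1 x⁻¹).natAbs * ordAt p.1 f ≤ (ordAt p.1 x⁻¹).natAbs * (-1) := by
      apply mul_le_mul_of_nonneg_left <;> omega
    simp only [N]
    omega
  have h2 := q.1.mul_mem _ _ (h h1) (pow_mem hf N)
  rw [inv_mul_cancel_right₀ (pow_ne_zero _ hf0)] at h2
  exact hxi h2

end Places

end CFF

namespace CFF

section RelativeLength

variable {F M : Type*} [Field F] [AddCommGroup M] [Module F M]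

/-- The length of `W / (U ∩ W)`. -/
def rlen (U W : Submodule F M) : ℕ∞ := Module.length F (W ⧸ U.submoduleOf W)

theorem rlen_eq_of_surjective {U W : Submodule F M} {V : Type*} [AddCommGroup V] [Module F V]
    (φ : W →ₗ[F] V) (hφ : Function.Surjective φ) (hker : ∀ w : W, φ w = 0 ↔ (w : M) ∈ U) :
    rlen U W = Module.length F V := by
  have h : LinearMap.ker φ = U.submoduleOf W := by
    ext w; rw [LinearMap.mem_ker, hker]; rfl
  rw [rlen, ← h]
  exact (φ.quotKerEquivOfSurjective hφ).length_eq

theorem rlen_sup (U V : Submodule F M) : rlen U (V ⊔ U) = rlen U V := by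
  refine (LinearEquiv.length_eq ?_).symm
  have e := LinearMap.quotientInfEquivSupQuotient V U
  have : (V ⊓ U).submoduleOf V = U.submoduleOf V := by
    ext x; simp [Submodule.submoduleOf]
  exact (Submodule.quotEquivOfEq _ _ this.symm).trans e

theorem rlen_inf (U V : Submodule F M) : rlen (V ⊓ U) V = rlen U V := by
  have : (V ⊓ U).submoduleOf V = U.submoduleOf V := by
    ext x; simp [Submodule.submoduleOf]
  rw [rlen, rlen, this]

theorem rlen_add {U V W : Submodule F M} (hUV : U ≤ V) (hVW : V ≤ W) :
    rlen U V + rlen V W = rlen U W := by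
  have hsub : U.submoduleOf V ≤ (U.submoduleOf W).comap (Submodule.inclusion hVW) :=
    fun x hx => hx
  let f : (V ⧸ U.submoduleOf V) →ₗ[F] (W ⧸ U.submoduleOf W) :=
    Submodule.mapQ _ _ (Submodule.inclusion hVW) hsub
  let g : (W ⧸ U.submoduleOf W) →ₗ[F] (W ⧸ V.submoduleOf W) :=
    Submodule.factor (fun x hx => hUV hx)
  refine (Module.length_eq_add_of_exact f g ?_ ?_ ?_).symm
  · rw [injective_iff_map_eq_zero]
    intro a
    induction a using Submodule.Quotient.induction_on with | H a => ?_
    intro h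
    rw [Submodule.mapQ_apply, Submodule.Quotient.mk_eq_zero] at h
    exact (Submodule.Quotient.mk_eq_zero _).2 h
  · exact Submodule.factor_surjective _
  · intro a
    induction a using Submodule.Quotient.induction_on with | H a => ?_
    constructor
    · intro h
      have h' : a ∈ V.submoduleOf W := (Submodule.Quotient.mk_eq_zero _).1 h
      exact ⟨Submodule.Quotient.mk ⟨a.1, h'⟩, rfl⟩
    · rintro ⟨b, hb⟩
      induction b using Submodule.Quotient.induction_on with | H b => ?_
      rw [← hb]
      exact (Submodule.Quotient.mk_eq_zero _).2 b.2

theorem rlen_self (U : Submodule F M) : rlen U U = 0 := by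
  rw [rlen, Submodule.submoduleOf_self, Module.length_eq_zero_iff]
  infer_instance

theorem rlen_eq_zero {U W : Submodule F M} (h : rlen U W = 0) : W ≤ U := by
  rw [rlen, Module.length_eq_zero_iff, Submodule.Quotient.subsingleton_iff] at h
  intro w hw
  have : (⟨w, hw⟩ : W) ∈ U.submoduleOf W := by rw [h]; trivial
  exact this

theorem rlen_bot (W : Submodule F M) : rlen ⊥ W = Module.length F W :=
  rlen_eq_of_surjective LinearMap.id Function.surjective_id (fun w => by simp)

end RelativeLength

section Local

variable {F K : Type} [Field F] [Field K] [Algebra F K]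

/-- The residue field of a place. -/
abbrev Res (p : Place F K) : Type := IsLocalRing.ResidueField p.1

instance (p : Place F K) : Algebra F (Res p) := (residueHom F p).toAlgebra

theorem algebraMap_res (p : Place F K) (c : F) :
    algebraMap F (Res p) c = IsLocalRing.residue p.1 ⟨algebraMap F K c, p.const_mem c⟩ := rfl

theorem placeDegree_eq (p : Place F K) : placeDegree F p = Module.finrank F (Res p) := rfl

/-- The residue map on the valuation ring, as an `F`-linear map. -/
def resMap (p : Place F K) : Osub p →ₗ[F] Res p where
  toFun s := IsLocalRing.residue p.1 ⟨s.1, s.2⟩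
  map_add' _ _ := by rw [← map_add]; rfl
  map_smul' c a := by
    rw [RingHom.id_apply, Algebra.smul_def, algebraMap_res, ← map_mul]
    congr 1
    apply Subtype.ext
    change c • (a : K) = algebraMap F K c * a
    rw [Algebra.smul_def]

theorem residue_eq_zero_iff [IsCF F K] (p : Place F K) {f : K} (hf : f ∈ p.1) :
    IsLocalRing.residue p.1 ⟨f, hf⟩ = 0 ↔ f ∈ lev p 1 := by
  rw [IsLocalRing.residue_eq_zero_iff, (unif_irreducible p).maximalIdeal_eq,
    Ideal.mem_span_singleton, mem_lev]
  constructor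
  · rintro ⟨c, hc⟩
    have := congrArg Subtype.val hc
    simp only [MulMemClass.coe_mul] at this
    rw [this, zpow_neg_one, mul_comm, inv_mul_cancel_left₀ (unif_ne_zero p)]
    exact c.2
  · intro h
    refine ⟨⟨_, h⟩, Subtype.ext ?_⟩
    simp only [MulMemClass.coe_mul]
    rw [zpow_neg_one, mul_left_comm, mul_inv_cancel₀ (unif_ne_zero p), mul_one]

/-- The leading coefficient map. -/
def lead [IsCF F K] (p : Place F K) (n : ℤ) : lev p n →ₗ[F] Res p :=
  resMap p ∘ₗ
    { toFun := fun f => ⟨f.1 * unif p ^ (-n), f.2⟩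
      map_add' := fun a b => Subtype.ext (add_mul _ _ _)
      map_smul' := fun c a => Subtype.ext (smul_mul_assoc _ _ _) }

theorem lead_surjective [IsCF F K] (p : Place F K) (n : ℤ) : Function.Surjective (lead p n) := by
  intro r
  obtain ⟨y, rfl⟩ := IsLocalRing.residue_surjective r
  have h : y.1 * unif p ^ n * unif p ^ (-n) = y := by
    rw [mul_assoc, ← zpow_add₀ (unif_ne_zero p)]; simp
  refine ⟨⟨y.1 * unif p ^ n, by rw [mem_lev, h]; exact y.2⟩, ?_⟩
  change IsLocalRing.residue p.1 ⟨y.1 * unif p ^ n * unif p ^ (-n), _⟩ = _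
  congr 1
  exact Subtype.ext h

theorem lead_eq_zero_iff [IsCF F K] (p : Place F K) (n : ℤ) (f : lev p n) :
    lead p n f = 0 ↔ (f : K) ∈ lev p (n + 1) := by
  refine (residue_eq_zero_iff p f.2).trans ?_
  rw [mem_lev, mem_lev, mul_assoc, ← zpow_add₀ (unif_ne_zero p), neg_add]

instance finiteDimensional_res [IsCF F K] (p : Place F K) : FiniteDimensional F (Res p) := by
  obtain ⟨x, hx0, hx, hxi⟩ := exists_nonunit p
  refine (finrank_mod_le (transcendental_of_not_mem (not_mem_range_of_inv_not_mem hxi)) (Osub p)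
    (fun s hs => p.1.mul_mem _ _ hx hs) (Res p) (resMap p) ?_ ?_).1
  · intro r
    obtain ⟨y, rfl⟩ := IsLocalRing.residue_surjective r
    exact ⟨⟨y.1, y.2⟩, rfl⟩
  · intro s r hr h
    refine (residue_eq_zero_iff p s.2).2 ?_
    rw [h]
    by_cases hr0 : r = 0
    · simp [hr0]
    rw [mem_lev_iff (mul_ne_zero hx0 hr0), ordAt_mul p hx0 hr0]
    have h1 := (mem_place_iff p hx0).1 hx
    have h2 := (mem_place_iff p hr0).1 hr
    rw [mem_place_iff p (inv_ne_zero hx0), ordAt_inv] at hxi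
    omega

theorem placeDegree_pos [IsCF F K] (p : Place F K) : 0 < placeDegree F p := by
  rw [placeDegree_eq]; exact Module.finrank_pos

theorem rlen_lev_succ [IsCF F K] (p : Place F K) (n : ℤ) :
    rlen (lev p (n + 1)) (lev p n) = placeDegree F p := by
  rw [rlen_eq_of_surjective (lead p n) (lead_surjective p n) (lead_eq_zero_iff p n),
    Module.length_eq_finrank, placeDegree_eq]

theorem rlen_lev [IsCF F K] (p : Place F K) (n : ℤ) (k : ℕ) :
    rlen (lev p (n + k)) (lev p n) = (k * placeDegree F p : ℕ) := by
  induction k with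
  | zero => simp [rlen_self]
  | succ k ih =>
    rw [← rlen_add (V := lev p (n + k)) (lev_anti (by push_cast; omega)) (lev_anti (by omega)), ih]
    have := rlen_lev_succ p (n + k)
    rw [Nat.cast_succ, ← add_assoc, this]
    push_cast; ring

end Local

section Approximation

variable {F K : Type} [Field F] [Field K] [Algebra F K] [IsCF F K]

theorem ordAt_add_of_lt (p : Place F K) {f g : K} (hf : f ≠ 0) (hg : g ≠ 0)
    (h : ordAt p.1 f < ordAt p.1 g) : f + g ≠ 0 ∧ ordAt p.1 (f + g) = ordAt p.1 f := by
  have h0 : f + g ≠ 0 := by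
    intro h0
    have hfg : f = -1 * g := by linear_combination h0
    have : ordAt p.1 (-1 : K) = 0 := by
      have := ordAt_const p (c := (-1 : F)); simpa using this
    rw [hfg, ordAt_mul p (by simp) hg, this] at h
    omega
  refine ⟨h0, le_antisymm ?_ ?_⟩
  · by_contra! hlt
    have h1 : f + g ∈ lev p (ordAt p.1 f + 1) := (mem_lev_iff h0).2 (by omega)
    have h2 : g ∈ lev p (ordAt p.1 f + 1) := (mem_lev_iff hg).2 (by omega)
    have h3 := Submodule.sub_mem _ h1 h2
    rw [add_sub_cancel_right, mem_lev_iff hf] at h3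
    omega
  · exact ordAt_add_ge p h0 ((mem_lev_iff hf).2 le_rfl) ((mem_lev_iff hg).2 h.le)

theorem exists_sep_pair {p q : Place F K} (h : p ≠ q) :
    ∃ v : K, v ≠ 0 ∧ 0 < ordAt p.1 v ∧ ordAt q.1 v < 0 := by
  have h1 : ¬ p.1 ≤ q.1 := fun hl => h (place_eq_of_le hl)
  have h2 : ¬ q.1 ≤ p.1 := fun hl => h (place_eq_of_le hl).symm
  obtain ⟨a, hap, haq⟩ := Set.not_subset.1 h1
  obtain ⟨b, hbq, hbp⟩ := Set.not_subset.1 h2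
  have ha : a ≠ 0 := fun h => haq (h ▸ q.1.zero_mem)
  have hb : b ≠ 0 := fun h => hbp (h ▸ p.1.zero_mem)
  have e1 := (mem_place_iff p ha).1 hap
  have e2 := (mem_place_iff q hb).1 hbq
  have e3 := (mem_place_iff p hb).not.1 hbp
  have e4 := (mem_place_iff q ha).not.1 haq
  refine ⟨a * b⁻¹, mul_ne_zero ha (inv_ne_zero hb), ?_, ?_⟩ <;>
  · rw [ordAt_mul _ ha (inv_ne_zero hb), ordAt_inv]; omega

theorem exists_sep (p : Place F K) (s : Finset (Place F K)) (hp : p ∉ s) :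
    ∃ u : K, u ≠ 0 ∧ 0 < ordAt p.1 u ∧ ∀ q ∈ s, ordAt q.1 u < 0 := by
  induction s using Finset.induction_on with
  | empty => exact ⟨unif p, unif_ne_zero p, by simp, by simp⟩
  | insert q s hq ih =>
    obtain ⟨u, hu0, hup, hus⟩ := ih (fun h => hp (Finset.mem_insert_of_mem h))
    obtain ⟨v, hv0, hvp, hvq⟩ := exists_sep_pair (p := p) (q := q)
      (fun h => hp (h ▸ Finset.mem_insert_self _ _))
    by_cases huq : ordAt q.1 u < 0
    · exact ⟨u, hu0, hup, by simpa using ⟨huq, hus⟩⟩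
    obtain ⟨r, hr⟩ : ∃ r : ℕ, ∀ t ∈ s, (ordAt t.1 u).natAbs < r := by
      refine ⟨s.sup (fun t => (ordAt t.1 u).natAbs) + 1, fun t ht => Nat.lt_succ_of_le ?_⟩
      exact Finset.le_sup (f := fun t => (ordAt t.1 u).natAbs) ht
    have hvr : v ^ (r + 1) ≠ 0 := pow_ne_zero _ hv0
    have hq' : u + v ^ (r + 1) ≠ 0 ∧ ordAt q.1 (u + v ^ (r + 1)) = ordAt q.1 (v ^ (r + 1)) := by
      have := ordAt_add_of_lt q hvr hu0 (by rw [ordAt_pow q hv0]; push_cast; nlinarith)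
      rwa [add_comm u]
    refine ⟨u + v ^ (r + 1), hq'.1, ?_, ?_⟩
    · refine lt_of_lt_of_le Int.zero_lt_one (ordAt_add_ge p hq'.1 ((mem_lev_iff hu0).2 (by omega))
        ((mem_lev_iff hvr).2 ?_))
      rw [ordAt_pow p hv0]; push_cast; nlinarith
    · intro t ht
      rw [Finset.mem_insert] at ht
      rcases ht with rfl | ht
      · rw [hq'.2, ordAt_pow _ hv0]; push_cast; nlinarith
      · have h1 := hus t ht
        have h2 := hr t ht
        rcases lt_or_ge (ordAt t.1 v) 0 with h3 | h3
        · have := ordAt_add_of_lt t hvr hu0 (by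
            rw [ordAt_pow t hv0]; push_cast
            have : (r : ℤ) > -ordAt t.1 u := by omega
            nlinarith)
          rw [add_comm u, this.2, ordAt_pow t hv0]; push_cast; nlinarith
        · have := ordAt_add_of_lt t hu0 hvr (by
            rw [ordAt_pow t hv0]
            have : (0 : ℤ) ≤ (r + 1 : ℕ) * ordAt t.1 v := by positivity
            omega)
          rw [this.2]; exact h1

theorem exists_idem (p : Place F K) (s : Finset (Place F K)) (hp : p ∉ s) (N : ℕ) :
    ∃ e : K, e - 1 ∈ lev p N ∧ ∀ q ∈ s, e ∈ lev q N := by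
  obtain ⟨u, hu0, hup, hus⟩ := exists_sep p s hp
  have hun : u ^ (N + 1) ≠ 0 := pow_ne_zero _ hu0
  have h1 := ordAt_add_of_lt p (one_ne_zero (α := K)) hun
    (by rw [ordAt_one, ordAt_pow p hu0]; push_cast; nlinarith)
  refine ⟨(1 + u ^ (N + 1))⁻¹, ?_, ?_⟩
  · have : (1 + u ^ (N + 1))⁻¹ - 1 = -(u ^ (N + 1) * (1 + u ^ (N + 1))⁻¹) := by
      field_simp [h1.1]; ring
    rw [this, Submodule.neg_mem_iff, mem_lev_iff (mul_ne_zero hun (inv_ne_zero h1.1)),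
      ordAt_mul p hun (inv_ne_zero h1.1), ordAt_inv, h1.2, ordAt_one, ordAt_pow p hu0]
    push_cast; nlinarith
  · intro q hq
    have hq' := hus q hq
    have h2 := ordAt_add_of_lt q hun (one_ne_zero (α := K))
      (by rw [ordAt_one, ordAt_pow q hu0]; push_cast; nlinarith)
    rw [mem_lev_iff (inv_ne_zero h1.1), ordAt_inv, add_comm, h2.2, ordAt_pow q hu0]
    push_cast; nlinarith

theorem exists_mem_lev (p : Place F K) (y : K) : ∃ N : ℕ, y ∈ lev p (-N) := by
  by_cases hy : y = 0
  · exact ⟨0, by simp [hy]⟩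
  exact ⟨(ordAt p.1 y).natAbs, (mem_lev_iff hy).2 (by omega)⟩

/-- Weak approximation. -/
theorem weak_approx (s : Finset (Place F K)) (y : Place F K → K) (n : ℕ) :
    ∃ f : K, ∀ p ∈ s, f - y p ∈ lev p n := by
  choose N hN using fun (pq : Place F K × Place F K) => exists_mem_lev pq.1 (y pq.2)
  set M := n + (s ×ˢ s).sup N with hM
  have hle : ∀ p ∈ s, ∀ q ∈ s, y q ∈ lev p (-((M - n : ℕ) : ℤ)) := by
    intro p hp q hq
    refine lev_anti ?_ (hN (p, q))
    have : N (p, q) ≤ (s ×ˢ s).sup N := Finset.le_sup (f := N) (by simp [hp, hq])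
    omega
  choose e he1 he2 using fun p : Place F K => exists_idem p (s.erase p) (by simp) M
  refine ⟨∑ q ∈ s, e q * y q, fun p hp => ?_⟩
  rw [← Finset.add_sum_erase s _ hp]
  have : e p * y p + ∑ q ∈ s.erase p, e q * y q - y p =
      (e p - 1) * y p + ∑ q ∈ s.erase p, e q * y q := by ring
  rw [this]
  have hMn : (n : ℤ) = M + -((M - n : ℕ) : ℤ) := by omega
  refine Submodule.add_mem _ ?_ (Submodule.sum_mem _ fun q hq => ?_)
  · rw [hMn]; exact mul_mem_lev (he1 p) (hle p hp p hp)
  · rw [hMn]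
    refine mul_mem_lev (he2 q p ?_) (hle p hp q (Finset.mem_of_mem_erase hq))
    simp only [Finset.mem_erase] at hq ⊢
    exact ⟨Ne.symm hq.1, hp⟩

end Approximation

end CFF

namespace CFF

section Zeros

variable {F K : Type} [Field F] [Field K] [Algebra F K]

theorem finrank_of_length {V : Type*} [AddCommGroup V] [Module F V] {n : ℕ}
    (h : Module.length F V = n) : FiniteDimensional F V ∧ Module.finrank F V = n := by
  have h1 : IsFiniteLength F V := by
    rw [← Module.length_ne_top_iff, h]; exact ENat.natCast_ne_top n
  have h2 := (isFiniteLength_iff_isNoetherian_isArtinian.1 h1).1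
  have h3 : FiniteDimensional F V := inferInstance
  refine ⟨h3, ?_⟩
  rw [Module.length_eq_finrank] at h
  exact_mod_cast h

theorem length_of_finrank {V : Type*} [AddCommGroup V] [Module F V] [FiniteDimensional F V] :
    Module.length F V = Module.finrank F V := Module.length_eq_finrank F V

variable [IsCF F K]

/-- Functions regular at `p` modulo those of order at least `n`. -/
def LevQuot (p : Place F K) (n : ℤ) : Type := lev p 0 ⧸ (lev p n).submoduleOf (lev p 0)

instance (p : Place F K) (n : ℤ) : AddCommGroup (LevQuot p n) :=
  inferInstanceAs (AddCommGroup (lev p 0 ⧸ (lev p n).submoduleOf (lev p 0)))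

instance (p : Place F K) (n : ℤ) : Module F (LevQuot p n) :=
  inferInstanceAs (Module F (lev p 0 ⧸ (lev p n).submoduleOf (lev p 0)))

/-- The quotient map. -/
def LevQuot.mk (p : Place F K) (n : ℤ) : lev p 0 →ₗ[F] LevQuot p n := Submodule.mkQ _

/-- The zeros of a non-constant function have total degree at most its field degree. -/
theorem sum_zeros_le {x : K} (hx : Transcendental F x) (s : Finset (Place F K))
    (hs : ∀ p ∈ s, 0 < ordAt p.1 x) :
    ∑ p ∈ s, ordAt p.1 x * placeDegree F p ≤ (fdeg F x : ℤ) := by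
  have hx0 : x ≠ 0 := fun h => hx (h ▸ isAlgebraic_zero)
  have hV (p : s) : FiniteDimensional F (LevQuot p.1 (ordAt p.1.1 x)) ∧
      Module.finrank F (LevQuot p.1 (ordAt p.1.1 x)) = (ordAt p.1.1 x).toNat * placeDegree F p.1 := by
    refine finrank_of_length ?_
    have := rlen_lev p.1 0 (ordAt p.1.1 x).toNat
    rw [zero_add, Int.toNat_of_nonneg (hs p.1 p.2).le] at this
    exact this
  let S : Submodule F K := ⨅ p : s, lev p.1 0
  have hS (f : K) : f ∈ S ↔ ∀ p : s, f ∈ lev p.1 0 := Submodule.mem_iInf _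
  let φ : S →ₗ[F] (∀ p : s, LevQuot p.1 (ordAt p.1.1 x)) := LinearMap.pi fun p =>
    LevQuot.mk p.1 _ ∘ₗ Submodule.inclusion (iInf_le _ p)
  have hker (a : S) (h : ∀ p : s, (a : K) ∈ lev p.1 (ordAt p.1.1 x)) : φ a = 0 := by
    funext p
    exact (Submodule.Quotient.mk_eq_zero _).2 (h p)
  have key := finrank_mod_le hx S (fun f hf => ?_) (∀ p : s, LevQuot p.1 (ordAt p.1.1 x)) φ ?_ ?_
  · have hfd := fun p => (hV p).1
    rw [Module.finrank_pi_fintype, Finset.sum_congr rfl (fun p _ => (hV p).2)] at key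
    have h2 := key.2
    rw [Finset.sum_coe_sort s (fun p => (ordAt p.1 x).toNat * placeDegree F p)] at h2
    calc _ = ((∑ p ∈ s, (ordAt p.1 x).toNat * placeDegree F p : ℕ) : ℤ) := by
          push_cast
          refine Finset.sum_congr rfl fun p hp => ?_
          rw [Int.toNat_of_nonneg (hs p hp).le]
      _ ≤ _ := by exact_mod_cast h2
  · rw [hS] at *
    intro p
    rw [mul_mem_lev_iff hx0]
    exact lev_anti (by have := hs p.1 p.2; omega) (hf p)
  · intro v
    choose y hy using fun p : s => Submodule.mkQ_surjective _ (v p)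
    obtain ⟨f, hf⟩ := weak_approx s (fun p => if h : p ∈ s then (y ⟨p, h⟩ : K) else 0)
      (s.sup fun p => (ordAt p.1 x).toNat)
    have hf' (p : s) : f - y p ∈ lev p.1 (ordAt p.1.1 x) := by
      have := hf p.1 p.2
      rw [dif_pos p.2] at this
      refine lev_anti ?_ this
      have h1 : (ordAt p.1.1 x).toNat ≤ s.sup fun p => (ordAt p.1 x).toNat :=
        Finset.le_sup (f := fun p : Place F K => (ordAt p.1 x).toNat) p.2
      omega
    have hfS : f ∈ S := by
      rw [hS]
      intro p
      have := Submodule.add_mem _ (lev_anti (hs p.1 p.2).le (hf' p)) (y p).2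
      rwa [sub_add_cancel] at this
    refine ⟨⟨f, hfS⟩, ?_⟩
    funext p
    rw [← hy p]
    exact (Submodule.Quotient.eq _).2 (hf' p)
  · intro a r hr h
    refine hker a fun p => ?_
    rw [h, mul_mem_lev_iff hx0, sub_self]
    exact (hS r).1 hr p

theorem card_zeros_le {x : K} (hx : Transcendental F x) (s : Finset (Place F K))
    (hs : ∀ p ∈ s, 0 < ordAt p.1 x) : s.card ≤ fdeg F x := by
  have := sum_zeros_le hx s hs
  have h2 : ∑ p ∈ s, (1 : ℤ) ≤ ∑ p ∈ s, ordAt p.1 x * placeDegree F p := by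
    refine Finset.sum_le_sum fun p hp => ?_
    have h3 := hs p hp
    have h4 := placeDegree_pos p
    have : (1 : ℤ) ≤ placeDegree F p := by exact_mod_cast h4
    nlinarith
  rw [Finset.sum_const, nsmul_eq_mul, mul_one] at h2
  exact_mod_cast h2.trans this

theorem finite_zeros (x : K) : {p : Place F K | 0 < ordAt p.1 x}.Finite := by
  by_cases hx : x ∈ (algebraMap F K).range
  · obtain ⟨c, rfl⟩ := hx
    simp [ordAt_const]
  by_contra hinf
  obtain ⟨s, hs, hc⟩ := Set.Infinite.exists_subset_card_eq hinf (fdeg F x + 1)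
  have := card_zeros_le (transcendental_of_not_mem hx) s (fun p hp => hs hp)
  omega

theorem finite_support_ordAt (x : K) : (Function.support fun p : Place F K => ordAt p.1 x).Finite := by
  refine ((finite_zeros x).union (finite_zeros x⁻¹)).subset fun p hp => ?_
  rw [Function.mem_support] at hp
  rw [Set.mem_union, Set.mem_ofPred_eq, Set.mem_ofPred_eq, ordAt_inv]
  omega

/-- The divisor of a function. -/
def dv (F : Type) {K : Type} [Field F] [Field K] [Algebra F K] [IsCF F K] (x : K) : Divisor F K :=
  Finsupp.ofSupportFinite (fun p : Place F K => ordAt p.1 x) (finite_support_ordAt x)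

@[simp] theorem dv_apply (x : K) (p : Place F K) : dv F x p = ordAt p.1 x := rfl

theorem dv_mul {x y : K} (hx : x ≠ 0) (hy : y ≠ 0) : dv F (x * y) = dv F x + dv F y := by
  ext p; simp [ordAt_mul p hx hy]

theorem dv_inv (x : K) : dv F x⁻¹ = - dv F x := by
  ext p; simp [ordAt_inv]

theorem degHom_single (p : Place F K) (n : ℤ) :
    degHom F K (Finsupp.single p n) = n * placeDegree F p := by
  simp [degHom]

theorem degHom_apply (D : Divisor F K) : degHom F K D = D.sum fun p n => n * placeDegree F p := by
  simp [degHom]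

theorem degHom_mono {D E : Divisor F K} (h : D ≤ E) : degHom F K D ≤ degHom F K E := by
  rw [← sub_nonneg, ← map_sub, degHom_apply]
  refine Finset.sum_nonneg fun p _ => mul_nonneg ?_ (by positivity)
  have := h p
  rw [Finsupp.sub_apply]; omega

theorem Divisor.le_induction {D : Divisor F K} {P : Divisor F K → Prop} (h0 : P D)
    (hs : ∀ E p, D ≤ E → P E → P (E + Finsupp.single p 1)) {E : Divisor F K} (h : D ≤ E) : P E := by
  obtain ⟨N, hN⟩ : ∃ N : ℕ, degHom F K E - degHom F K D = N :=
    ⟨_, (Int.toNat_of_nonneg (sub_nonneg.2 (degHom_mono h))).symm⟩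
  induction N using Nat.strong_induction_on generalizing E with | _ N ih => ?_
  by_cases hDE : D = E
  · exact hDE ▸ h0
  obtain ⟨p, hp⟩ : ∃ p, D p ≠ E p := by
    by_contra! hne; exact hDE (Finsupp.ext hne)
  have hp' : D p < E p := lt_of_le_of_ne (h p) hp
  have hle : D ≤ E - Finsupp.single p 1 := by
    intro q
    rw [Finsupp.sub_apply, Finsupp.single_apply]
    split_ifs with hq
    · subst hq; omega
    · simpa using h q
  have hd := degHom_single p 1
  have hpos := placeDegree_pos p
  have h2 := degHom_mono hle
  have h3 : degHom F K (E - Finsupp.single p 1) = degHom F K E - placeDegree F p := by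
    rw [map_sub, hd, one_mul]
  have := hs _ p hle (ih (N - placeDegree F p) (by omega) hle (by omega))
  rwa [sub_add_cancel] at this

end Zeros

section Adeles

variable {F K : Type} [Field F] [Field K] [Algebra F K] [IsCF F K]

/-- Adeles bounded by `D`. -/
def Ad (D : Divisor F K) : Submodule F (Place F K → K) :=
  Submodule.pi Set.univ fun p => lev p (-D p)

theorem mem_Ad {D : Divisor F K} {a : Place F K → K} : a ∈ Ad D ↔ ∀ p, a p ∈ lev p (-D p) := by
  simp [Ad]

theorem Ad_mono {D E : Divisor F K} (h : D ≤ E) : Ad D ≤ Ad E := by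
  intro a ha
  rw [mem_Ad] at *
  exact fun p => lev_anti (by have := h p; omega) (ha p)

theorem Ad_sup (D E : Divisor F K) : Ad (D ⊔ E) = Ad D ⊔ Ad E := by
  refine le_antisymm ?_ (sup_le (Ad_mono le_sup_left) (Ad_mono le_sup_right))
  intro a ha
  rw [mem_Ad] at ha
  rw [Submodule.mem_sup]
  refine ⟨fun p => if E p ≤ D p then a p else 0, ?_, fun p => if E p ≤ D p then 0 else a p, ?_, ?_⟩
  · rw [mem_Ad]; intro p
    have := ha p
    rw [Finsupp.sup_apply] at this
    split_ifs with h
    · rwa [sup_eq_left.2 h] at this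
    · exact Submodule.zero_mem _
  · rw [mem_Ad]; intro p
    have := ha p
    rw [Finsupp.sup_apply] at this
    split_ifs with h
    · exact Submodule.zero_mem _
    · rwa [sup_eq_right.2 (by omega)] at this
  · funext p
    simp only [Pi.add_apply]
    split_ifs <;> simp

theorem rlen_Ad_single (D : Divisor F K) (p : Place F K) :
    rlen (Ad D) (Ad (D + Finsupp.single p 1)) = placeDegree F p := by
  rw [← rlen_lev_succ p (-D p - 1)]
  have hmem (a : Ad (D + Finsupp.single p 1)) : a.1 p ∈ lev p (-D p - 1) := by
    have := mem_Ad.1 a.2 p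
    rwa [Finsupp.add_apply, Finsupp.single_eq_same, neg_add, ← sub_eq_add_neg] at this
  let φ : Ad (D + Finsupp.single p 1) →ₗ[F]
      (lev p (-D p - 1) ⧸ (lev p (-D p - 1 + 1)).submoduleOf (lev p (-D p - 1))) :=
    Submodule.mkQ _ ∘ₗ (LinearMap.codRestrict _ (LinearMap.proj p ∘ₗ Submodule.subtype _) hmem)
  refine rlen_eq_of_surjective φ ?_ ?_
  · intro v
    obtain ⟨y, rfl⟩ := Submodule.mkQ_surjective _ v
    refine ⟨⟨Pi.single p y.1, ?_⟩, ?_⟩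
    · rw [mem_Ad]
      intro q
      by_cases hq : q = p
      · subst hq
        rw [Finsupp.add_apply, Finsupp.single_eq_same, neg_add, ← sub_eq_add_neg, Pi.single_eq_same]
        exact y.2
      · rw [Pi.single_eq_of_ne hq]; exact Submodule.zero_mem _
    · refine congrArg (Submodule.mkQ _) (Subtype.ext ?_)
      exact Pi.single_eq_same (M := fun _ => K) p y.1
  · intro a
    have h1 : φ a = 0 ↔ a.1 p ∈ lev p (-D p - 1 + 1) :=
      (Submodule.Quotient.mk_eq_zero _)
    rw [h1, sub_add_cancel, mem_Ad]
    refine ⟨fun h q => ?_, fun h => h p⟩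
    by_cases hq : q = p
    · subst hq; exact h
    · have := mem_Ad.1 a.2 q
      rwa [Finsupp.add_apply, Finsupp.single_eq_of_ne hq, add_zero] at this

theorem rlen_Ad {D E : Divisor F K} (h : D ≤ E) :
    rlen (Ad D) (Ad E) = ((degHom F K E - degHom F K D).toNat : ℕ) := by
  refine Divisor.le_induction (P := fun E => rlen (Ad D) (Ad E) =
    ((degHom F K E - degHom F K D).toNat : ℕ)) ?_ ?_ h
  · simp [rlen_self]
  · intro E p hDE ih
    have h1 : E ≤ E + Finsupp.single p 1 := le_add_of_nonneg_right (by
      intro q; rw [Finsupp.single_apply]; split_ifs <;> simp)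
    rw [← rlen_add (Ad_mono hDE) (Ad_mono h1), ih, rlen_Ad_single, map_add, degHom_single]
    have := degHom_mono hDE
    norm_cast
    omega

/-- The diagonal copy of `K` inside the adeles. -/
def diag (F K : Type) [Field F] [Field K] [Algebra F K] : K →ₗ[F] (Place F K → K) :=
  LinearMap.pi fun _ => LinearMap.id

def dK (F K : Type) [Field F] [Field K] [Algebra F K] : Submodule F (Place F K → K) :=
  LinearMap.range (diag F K)

theorem mem_RRspace {D : Divisor F K} {f : K} : f ∈ RRspace F D ↔ ∀ p, f ∈ lev p (-D p) := by
  have hsub : RRspace F D ≤ ⨅ p : Place F K, lev p (-D p) := by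
    rw [RRspace, Submodule.span_le]
    intro g hg
    rw [SetLike.mem_coe, Submodule.mem_iInf]
    intro p
    by_cases hg0 : g = 0
    · rw [hg0]; exact Submodule.zero_mem _
    rw [mem_lev_iff hg0]
    have := hg p
    omega
  constructor
  · intro h
    have := hsub h
    rwa [Submodule.mem_iInf] at this
  · intro h
    by_cases hf0 : f = 0
    · rw [hf0]; exact Submodule.zero_mem _
    · refine Submodule.subset_span fun p => ?_
      have := (mem_lev_iff hf0).1 (h p)
      omega

theorem mem_RRspace_iff {D : Divisor F K} {f : K} (hf : f ≠ 0) :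
    f ∈ RRspace F D ↔ 0 ≤ D + dv F f := by
  rw [mem_RRspace]
  refine forall_congr' fun p => ?_
  rw [mem_lev_iff hf]
  simp only [Finsupp.coe_zero, Pi.zero_apply, Finsupp.add_apply, dv_apply]
  omega

theorem RRspace_mono {D E : Divisor F K} (h : D ≤ E) : RRspace F D ≤ RRspace F E := by
  intro f hf
  rw [mem_RRspace] at *
  exact fun p => lev_anti (by have := h p; omega) (hf p)

theorem mul_mem_RRspace {D E : Divisor F K} {f g : K} (hf : f ∈ RRspace F D)
    (hg : g ∈ RRspace F E) : f * g ∈ RRspace F (D + E) := by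
  rw [mem_RRspace] at *
  intro p
  rw [Finsupp.add_apply, neg_add]
  exact mul_mem_lev (hf p) (hg p)

theorem diag_mem_Ad {D : Divisor F K} {f : K} : diag F K f ∈ Ad D ↔ f ∈ RRspace F D := by
  rw [mem_Ad, mem_RRspace]; rfl

theorem rlen_RR (D E : Divisor F K) :
    rlen (RRspace F D) (RRspace F E) = rlen (Ad D) (Ad E ⊓ dK F K) := by
  have hmem (f : RRspace F E) : diag F K f ∈ Ad E ⊓ dK F K :=
    ⟨diag_mem_Ad.2 f.2, ⟨f.1, rfl⟩⟩
  let φ : RRspace F E →ₗ[F] (Ad E ⊓ dK F K : Submodule F (Place F K → K)) ⧸ _ :=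
    Submodule.mkQ ((Ad D).submoduleOf (Ad E ⊓ dK F K)) ∘ₗ
      LinearMap.codRestrict _ (diag F K ∘ₗ Submodule.subtype _) hmem
  refine rlen_eq_of_surjective φ ?_ ?_
  · intro v
    obtain ⟨⟨y, hy, z, rfl⟩, rfl⟩ := Submodule.mkQ_surjective _ v
    exact ⟨⟨z, diag_mem_Ad.1 hy⟩, rfl⟩
  · intro f
    rw [← diag_mem_Ad]
    exact Submodule.Quotient.mk_eq_zero _

theorem rlen_RR_add {D E : Divisor F K} (h : D ≤ E) :
    rlen (RRspace F D) (RRspace F E) + rlen (Ad D ⊔ dK F K) (Ad E ⊔ dK F K) =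
      ((degHom F K E - degHom F K D).toNat : ℕ) := by
  have h1 := Ad_mono h
  rw [← rlen_Ad h, rlen_RR, ← rlen_sup (Ad D) (Ad E ⊓ dK F K)]
  have h2 : (Ad E ⊓ dK F K) ⊔ Ad D = Ad E ⊓ (Ad D ⊔ dK F K) := by
    rw [sup_comm, inf_comm, ← sup_inf_assoc_of_le _ h1, inf_comm]
  have h3 : rlen (Ad D ⊔ dK F K) (Ad E ⊔ dK F K) = rlen (Ad E ⊓ (Ad D ⊔ dK F K)) (Ad E) := by
    rw [rlen_inf, ← rlen_sup (Ad D ⊔ dK F K) (Ad E), ← sup_assoc, sup_eq_left.2 h1]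
  rw [h3, h2]
  exact rlen_add (by rw [← h2]; exact le_sup_right) inf_le_left

end Adeles

section Degree

variable {F K : Type} [Field F] [Field K] [Algebra F K] [IsCF F K]

open IntermediateField Polynomial

/-- Every non-constant function has a pole. -/
theorem exists_pole {f : K} (hf : f ∉ (algebraMap F K).range) : ∃ p : Place F K, f ∉ p.1 := by
  have htr := transcendental_inv (transcendental_of_not_mem hf)
  set x := f⁻¹ with hxdef
  let A : Subring K := (Algebra.adjoin F {x}).toSubring
  have hxA : x ∈ A := Algebra.subset_adjoin rfl
  let I : Ideal A := Ideal.span {⟨x, hxA⟩}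
  have hI : I ≠ ⊤ := by
    rw [Ne, Ideal.eq_top_iff_one, Ideal.mem_span_singleton]
    rintro ⟨⟨c, hc⟩, h⟩
    obtain ⟨q, rfl⟩ : ∃ q : F[X], aeval x q = c := by
      have : c ∈ Algebra.adjoin F {x} := hc
      rwa [Algebra.adjoin_singleton_eq_range_aeval] at this
    have h1 : (1 : K) = x * aeval x q := congrArg Subtype.val h
    have h2 : aeval x (X * q - 1 : F[X]) = 0 := by simp [← h1]
    have h3 := (transcendental_iff.1 htr) _ h2
    have := congrArg (fun r : F[X] => r.coeff 0) h3
    simp at this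
  obtain ⟨B, hAB, hIB⟩ := Ideal.image_subset_nonunits_valuationSubring I hI
  have hxB : x ∈ B.nonunits := hIB ⟨⟨x, hxA⟩, Ideal.mem_span_singleton_self _, rfl⟩
  have hx0 : x ≠ 0 := fun h => htr (h ▸ isAlgebraic_zero)
  have hfB : f ∉ B := by
    intro h
    rw [ValuationSubring.mem_nonunits_iff_exists_mem_maximalIdeal] at hxB
    obtain ⟨hxB, hm⟩ := hxB
    rw [IsLocalRing.mem_maximalIdeal] at hm
    refine hm (IsUnit.of_mul_eq_one ⟨f, h⟩ (Subtype.ext ?_))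
    change x * f = 1
    rw [hxdef, inv_mul_cancel₀]
    rintro rfl
    simp [hxdef] at hx0
  refine ⟨⟨B, ⟨?_, fun c => hAB ?_⟩⟩, hfB⟩
  · rintro rfl; exact hfB trivial
  · exact (Algebra.adjoin F {x}).algebraMap_mem c

theorem RRspace_zero : RRspace F (0 : Divisor F K) = Submodule.span F {(1 : K)} := by
  ext f
  rw [mem_RRspace, Submodule.mem_span_singleton]
  constructor
  · intro h
    by_contra hc
    have : f ∉ (algebraMap F K).range := by
      rintro ⟨c, rfl⟩; exact hc ⟨c, by rw [Algebra.smul_def, mul_one]⟩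
    obtain ⟨p, hp⟩ := exists_pole (F := F) this
    have := h p
    rw [Finsupp.coe_zero, Pi.zero_apply, neg_zero, mem_lev_zero] at this
    exact hp this
  · rintro ⟨c, rfl⟩ p
    rw [Finsupp.coe_zero, Pi.zero_apply, neg_zero, mem_lev_zero, Algebra.smul_def, mul_one]
    exact p.const_mem c

theorem rlen_RR_le {D E : Divisor F K} (h : D ≤ E) :
    rlen (RRspace F D) (RRspace F E) ≤ ((degHom F K E - degHom F K D).toNat : ℕ) := by
  rw [← rlen_RR_add h]; exact le_self_add

theorem ell_zero : ell F (0 : Divisor F K) = 1 := by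
  rw [ell, RRspace_zero]; exact finrank_span_singleton one_ne_zero

theorem length_RR_le {D : Divisor F K} (h : 0 ≤ D) :
    Module.length F (RRspace F D) ≤ ((degHom F K D).toNat + 1 : ℕ) := by
  have h1 := rlen_RR_le h
  have h2 := rlen_add (bot_le (a := RRspace F (0 : Divisor F K))) (RRspace_mono h)
  rw [rlen_bot, rlen_bot, RRspace_zero, length_of_finrank, finrank_span_singleton one_ne_zero,
    ← RRspace_zero] at h2
  rw [← h2, add_comm]
  rw [map_zero, sub_zero] at h1
  push_cast
  gcongr

instance finiteDimensional_RR (D : Divisor F K) : FiniteDimensional F (RRspace F D) := by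
  have h : ∀ E : Divisor F K, 0 ≤ E → FiniteDimensional F (RRspace F E) := by
    intro E hE
    have := length_RR_le hE
    obtain ⟨n, hn⟩ := ENat.ne_top_iff_exists.1 (ne_top_of_le_ne_top (ENat.natCast_ne_top _) this)
    exact (finrank_of_length hn.symm).1
  have := h (D ⊔ 0) le_sup_right
  exact Submodule.finiteDimensional_of_le (RRspace_mono (le_sup_left : D ≤ D ⊔ 0))

theorem length_RR (D : Divisor F K) : Module.length F (RRspace F D) = ell F D :=
  length_of_finrank

theorem ell_mono {D E : Divisor F K} (h : D ≤ E) : ell F D ≤ ell F E :=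
  Submodule.finrank_mono (RRspace_mono h)

theorem rlen_RR_eq {D E : Divisor F K} (h : D ≤ E) :
    rlen (RRspace F D) (RRspace F E) = (ell F E - ell F D : ℕ) := by
  have h2 := rlen_add (bot_le (a := RRspace F D)) (RRspace_mono h)
  rw [rlen_bot, rlen_bot, length_RR, length_RR] at h2
  obtain ⟨n, hn⟩ := ENat.ne_top_iff_exists.1 (ne_top_of_le_ne_top (ENat.natCast_ne_top _) (rlen_RR_le h))
  rw [← hn] at h2 ⊢
  norm_cast at h2 ⊢
  omega

theorem ell_le_of_le {D E : Divisor F K} (h : D ≤ E) :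
    (ell F E : ℤ) - ell F D ≤ degHom F K E - degHom F K D := by
  have := rlen_RR_le h
  rw [rlen_RR_eq h] at this
  have h1 : ell F E - ell F D ≤ (degHom F K E - degHom F K D).toNat := by exact_mod_cast this
  have h2 := degHom_mono h
  have h3 := ell_mono h
  omega

theorem deg_zeros_le {x : K} (hx : Transcendental F x) :
    degHom F K (dv F x ⊔ 0) ≤ fdeg F x := by
  refine le_trans (le_of_eq ?_) (sum_zeros_le hx ((dv F x).support.filter fun p => 0 < ordAt p.1 x)
    (fun p hp => (Finset.mem_filter.1 hp).2))
  have hval (p : Place F K) (hp : 0 < ordAt p.1 x) : (dv F x ⊔ 0) p = ordAt p.1 x := by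
    rw [Finsupp.sup_apply, dv_apply]; exact sup_eq_left.2 hp.le
  have hsupp : (dv F x ⊔ 0).support = (dv F x).support.filter fun p => 0 < ordAt p.1 x := by
    ext p
    rw [Finset.mem_filter, Finsupp.mem_support_iff, Finsupp.mem_support_iff, dv_apply]
    constructor
    · intro h
      have : ¬ ordAt p.1 x ≤ 0 := fun h' => h (by
        rw [Finsupp.sup_apply, dv_apply]; exact sup_eq_right.2 h')
      omega
    · rintro ⟨h1, h2⟩
      rwa [hval p h2]
  rw [degHom_apply, Finsupp.sum, hsupp]
  exact Finset.sum_congr rfl fun p hp => by rw [hval p (Finset.mem_filter.1 hp).2]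

/-- The pole divisor. -/
def pdiv (F : Type) {K : Type} [Field F] [Field K] [Algebra F K] [IsCF F K] (x : K) : Divisor F K :=
  dv F x⁻¹ ⊔ 0

theorem pdiv_nonneg (x : K) : 0 ≤ pdiv F x := le_sup_right

theorem mem_RR_pdiv (x : K) : x ∈ RRspace F (pdiv F x) := by
  by_cases hx : x = 0
  · rw [hx]; exact Submodule.zero_mem _
  rw [mem_RRspace_iff hx, pdiv, dv_inv]
  intro p
  have : -dv F x p ≤ (-dv F x ⊔ 0) p := le_sup_left
  simp only [Finsupp.coe_zero, Pi.zero_apply, Finsupp.add_apply]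
  omega

theorem pow_mem_RR {D : Divisor F K} {x : K} (hx : x ∈ RRspace F D) (n : ℕ) :
    x ^ n ∈ RRspace F (n • D) := by
  induction n with
  | zero => rw [pow_zero, zero_smul, RRspace_zero]; exact Submodule.mem_span_singleton_self _
  | succ n ih => rw [pow_succ, succ_nsmul]; exact mul_mem_RRspace ih hx

theorem pow_mem_RR_le {D : Divisor F K} {x : K} (hx : x ∈ RRspace F D) (hD : 0 ≤ D) {n m : ℕ}
    (h : n ≤ m) : x ^ n ∈ RRspace F (m • D) :=
  RRspace_mono (nsmul_le_nsmul_left hD h) (pow_mem_RR hx n)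

theorem fdeg_le_of_mem {D : Divisor F K} (hD : 0 ≤ D) {x : K} (hx : Transcendental F x)
    (hxD : x ∈ RRspace F D) : (fdeg F x : ℤ) ≤ degHom F K D := by
  have hfin := finiteDimensional_adjoin hx
  let b := Module.finBasis (adjoin F {x}) K
  let B : Divisor F K := ∑ i, pdiv F (b i)
  have hB0 : 0 ≤ B := Finset.sum_nonneg fun i _ => pdiv_nonneg _
  have hbB (i) : b i ∈ RRspace F B :=
    RRspace_mono (Finset.single_le_sum (f := fun i => pdiv F (b i)) (fun i _ => pdiv_nonneg _)
      (Finset.mem_univ i)) (mem_RR_pdiv _)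
  have key (m : ℕ) : (fdeg F x : ℤ) * (m + 1) ≤ m * degHom F K D + degHom F K B + 1 := by
    let v : (Fin (fdeg F x) × Fin (m + 1)) → RRspace F (m • D + B) := fun ij =>
      ⟨x ^ (ij.2 : ℕ) * b ij.1, mul_mem_RRspace (pow_mem_RR_le hxD hD (by omega)) (hbB _)⟩
    have hv : LinearIndependent F v := by
      refine LinearIndependent.of_comp (Submodule.subtype _) ?_
      rw [Fintype.linearIndependent_iff]
      intro c hc
      have hlin := (linearIndependent_adjoin_iff hx _).1 b.linearIndependent Finset.univ
        (fun i => ∑ j : Fin (m + 1), Polynomial.C (c (i, j)) * Polynomial.X ^ (j : ℕ)) (by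
          rw [← hc, Fintype.sum_prod_type]
          refine Finset.sum_congr rfl fun i _ => ?_
          rw [map_sum, Finset.sum_mul]
          refine Finset.sum_congr rfl fun j _ => ?_
          simp [v, Algebra.smul_def, mul_assoc])
      rintro ⟨i, j⟩
      have := congrArg (fun q : F[X] => q.coeff (j : ℕ)) (hlin i (Finset.mem_univ _))
      simp only [Polynomial.finsetSum_coeff, Polynomial.coeff_C_mul, Polynomial.coeff_X_pow,
        Polynomial.coeff_zero] at this
      rw [Finset.sum_eq_single j] at this
      · simpa using this
      · intro j' _ hj'
        rw [if_neg (fun h => hj' (Fin.ext h.symm)), mul_zero]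
      · simp
    have h1 := hv.fintype_card_le_finrank
    rw [Fintype.card_prod, Fintype.card_fin, Fintype.card_fin] at h1
    have h2 := ell_le_of_le (D := (0 : Divisor F K)) (E := m • D + B)
      (add_nonneg (nsmul_nonneg hD m) hB0)
    rw [ell_zero, map_add, map_nsmul, map_zero, nsmul_eq_mul] at h2
    have h3 : (fdeg F x * (m + 1) : ℕ) ≤ (ell F (m • D + B) : ℤ) := by exact_mod_cast h1
    push_cast at h3 h2
    linarith
  by_contra! hlt
  have h1 := key (degHom F K B + 1).toNat
  have h2 : (0 : ℤ) ≤ degHom F K B := by simpa using degHom_mono hB0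
  rw [Int.toNat_of_nonneg (by omega)] at h1
  have h3 : (0 : ℤ) ≤ degHom F K D := by simpa using degHom_mono hD
  nlinarith

theorem deg_pdiv {x : K} (hx : Transcendental F x) : degHom F K (pdiv F x) = fdeg F x := by
  refine le_antisymm ?_ (fdeg_le_of_mem (pdiv_nonneg x) hx (mem_RR_pdiv x))
  rw [← fdeg_inv]
  exact deg_zeros_le (transcendental_inv hx)

/-- The product formula. -/
theorem degHom_dv (x : K) : degHom F K (dv F x) = 0 := by
  by_cases hx : x ∈ (algebraMap F K).range
  · obtain ⟨c, rfl⟩ := hx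
    have : dv F (algebraMap F K c) = 0 := by ext p; simp [ordAt_const]
    rw [this, map_zero]
  have h := transcendental_of_not_mem hx
  have h1 := deg_pdiv h
  have h2 := deg_pdiv (transcendental_inv h)
  rw [fdeg_inv] at h2
  have h3 : dv F x = pdiv F x⁻¹ - pdiv F x := by
    ext p
    simp only [pdiv, inv_inv, dv_inv, Finsupp.sub_apply, Finsupp.sup_apply, Finsupp.neg_apply,
      Finsupp.coe_zero, Pi.zero_apply]
    rcases le_total 0 (dv F x p) with h | h
    · rw [sup_eq_left.2 h, sup_eq_right.2 (by omega)]; omega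
    · rw [sup_eq_right.2 h, sup_eq_left.2 (by omega)]; omega
  rw [h3, map_sub, h1, h2, sub_self]

theorem ell_eq_zero_of_neg {D : Divisor F K} (h : degHom F K D < 0) : ell F D = 0 := by
  have : RRspace F D = ⊥ := by
    rw [Submodule.eq_bot_iff]
    intro f hf
    by_contra hf0
    have := degHom_mono ((mem_RRspace_iff hf0).1 hf)
    rw [map_zero, map_add, degHom_dv] at this
    omega
  rw [ell, this, finrank_bot]

end Degree

end CFF

namespace CFF

section Duality

variable {F K : Type} [Field F] [Field K] [Algebra F K] [IsCF F K]

/-- `g` is the genus: Riemann's inequality holds with constant `g` and is attained. -/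
structure IsGenus (F K : Type) [Field F] [Field K] [Algebra F K] (g : ℤ) : Prop where
  le : ∀ D : Divisor F K, degHom F K D + 1 - ell F D ≤ g
  attained : ∃ D : Divisor F K, degHom F K D + 1 - ell F D = g

theorem isGenus_of_genus {g : ℕ} (hg0 : g ≠ 0) (h : genus F K = g) : IsGenus F K g := by
  set S := {g : ℕ | ∃ D : Divisor F K, (g : ℤ) = degHom F K D + 1 - ell F D} with hS
  have hb : BddAbove S := by
    by_contra hb
    have : genus F K = 0 := Nat.sSup_of_not_bddAbove hb
    omega
  have hne : S.Nonempty := by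
    by_contra hne
    rw [Set.not_nonempty_iff_eq_empty] at hne
    have : genus F K = 0 := by rw [genus, ← hS, hne]; simp
    omega
  constructor
  · intro D
    rcases lt_or_ge (degHom F K D + 1 - ell F D) 0 with h1 | h1
    · omega
    · obtain ⟨m, hm⟩ := Int.eq_ofNat_of_zero_le h1
      have : m ≤ sSup S := le_csSup hb ⟨D, hm.symm⟩
      have h2 : sSup S = g := h
      omega
  · have : sSup S ∈ S := Nat.sSup_mem hne hb
    obtain ⟨D, hD⟩ := this
    exact ⟨D, by rw [← hD]; exact_mod_cast h⟩

theorem IsGenus.attained_of_le {g : ℤ} (hg : IsGenus F K g) {D E : Divisor F K} (h : D ≤ E)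
    (hD : degHom F K D + 1 - ell F D = g) : degHom F K E + 1 - ell F E = g := by
  have h1 := hg.le E
  have h2 := ell_le_of_le h
  omega

/-- The adele space. -/
def AA (F K : Type) [Field F] [Field K] [Algebra F K] [IsCF F K] : Submodule F (Place F K → K) :=
  ⨆ D : Divisor F K, Ad D

theorem mem_AA {a : Place F K → K} : a ∈ AA F K ↔ ∃ D : Divisor F K, a ∈ Ad D := by
  refine Submodule.mem_iSup_of_directed _ ?_
  intro D E
  exact ⟨D ⊔ E, Ad_mono le_sup_left, Ad_mono le_sup_right⟩

theorem Ad_le_AA (D : Divisor F K) : Ad D ≤ AA F K := le_iSup _ D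

theorem dK_le_AA : dK F K ≤ AA F K := by
  rintro _ ⟨f, rfl⟩
  exact Ad_le_AA _ (diag_mem_Ad.2 (mem_RR_pdiv f))

theorem AA_eq {g : ℤ} (hg : IsGenus F K g) {D : Divisor F K}
    (hD : degHom F K D + 1 - ell F D = g) : AA F K = Ad D ⊔ dK F K := by
  refine le_antisymm ?_ (sup_le (Ad_le_AA D) dK_le_AA)
  refine iSup_le fun D' => ?_
  have hle : D ≤ D ⊔ D' := le_sup_left
  have h1 := rlen_RR_add hle
  have h2 := hg.attained_of_le hle hD
  rw [rlen_RR_eq hle] at h1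
  have h3 : ell F (D ⊔ D') - ell F D = (degHom F K (D ⊔ D') - degHom F K D).toNat := by
    have := ell_mono hle; omega
  rw [h3] at h1
  have h4 : rlen (Ad D ⊔ dK F K) (Ad (D ⊔ D') ⊔ dK F K) = 0 := by
    exact (ENat.addLECancellable_natCast _).inj.1 (h1.trans (add_zero _).symm)
  exact (Ad_mono le_sup_right).trans (le_sup_left.trans (rlen_eq_zero h4))

theorem rlen_AA {g : ℤ} (hg : IsGenus F K g) (D : Divisor F K) :
    rlen (Ad D ⊔ dK F K) (AA F K) = ((ell F D - degHom F K D - 1 + g).toNat : ℕ) := by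
  obtain ⟨D0, hD0⟩ := hg.attained
  have hle : D ≤ D ⊔ D0 := le_sup_left
  have h2 := hg.attained_of_le (le_sup_right : D0 ≤ D ⊔ D0) hD0
  have h1 := rlen_RR_add hle
  rw [rlen_RR_eq hle, ← AA_eq hg h2] at h1
  have h3 := hg.le D
  have h4 := ell_mono hle
  have h5 := degHom_mono hle
  obtain ⟨n, hn⟩ := ENat.ne_top_iff_exists.1
    (ne_top_of_le_ne_top (ENat.natCast_ne_top _) (h1 ▸ le_add_self))
  rw [← hn] at h1 ⊢
  norm_cast at h1 ⊢
  omega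

/-- Multiplication of adeles by a function. -/
def mulA (x : K) : AA F K →ₗ[F] AA F K :=
  ((LinearMap.pi fun p => LinearMap.mulLeft F x ∘ₗ LinearMap.proj p :
      (Place F K → K) →ₗ[F] (Place F K → K)) ∘ₗ Submodule.subtype _).codRestrict _ <| by
    intro a
    obtain ⟨D, hD⟩ := mem_AA.1 a.2
    refine mem_AA.2 ⟨pdiv F x + D, mem_Ad.2 fun p => ?_⟩
    rw [Finsupp.add_apply, neg_add]
    exact mul_mem_lev (mem_RRspace.1 (mem_RR_pdiv x) p) (mem_Ad.1 hD p)

@[simp] theorem mulA_apply (x : K) (a : AA F K) (p : Place F K) :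
    (mulA x a).1 p = x * a.1 p := rfl

/-- Weil differentials vanishing on the adeles bounded by `D`. -/
def Om (D : Divisor F K) : Submodule F (Module.Dual F (AA F K)) :=
  ((Ad D ⊔ dK F K).submoduleOf (AA F K)).dualAnnihilator

theorem mem_Om {D : Divisor F K} {ω : Module.Dual F (AA F K)} :
    ω ∈ Om D ↔ (∀ a : AA F K, a.1 ∈ Ad D → ω a = 0) ∧ ∀ a : AA F K, a.1 ∈ dK F K → ω a = 0 := by
  rw [Om, Submodule.mem_dualAnnihilator]
  constructor
  · intro h
    exact ⟨fun a ha => h a (Submodule.mem_sup_left ha), fun a ha => h a (Submodule.mem_sup_right ha)⟩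
  · rintro ⟨h1, h2⟩ a ha
    obtain ⟨b, hb, c, hc, hbc⟩ := Submodule.mem_sup.1 ha
    have : a = ⟨b, Ad_le_AA _ hb⟩ + ⟨c, dK_le_AA hc⟩ := Subtype.ext hbc.symm
    rw [this, map_add, h1 _ hb, h2 _ hc, add_zero]

theorem finrank_Om {g : ℤ} (hg : IsGenus F K g) (D : Divisor F K) :
    FiniteDimensional F (Om D) ∧
      (Module.finrank F (Om D) : ℤ) = ell F D - degHom F K D - 1 + g := by
  obtain ⟨h1, h2⟩ := finrank_of_length (rlen_AA hg D)
  have e := Submodule.dualQuotEquivDualAnnihilator ((Ad D ⊔ dK F K).submoduleOf (AA F K))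
  refine ⟨Module.Finite.equiv e, ?_⟩
  have h3 : Module.finrank F (Om D) = _ := e.finrank_eq.symm
  rw [h3, Subspace.dual_finrank_eq, h2]
  have := hg.le D
  omega

/-- The action of functions on Weil differentials, as a linear map. -/
def actOm (ω : Module.Dual F (AA F K)) : K →ₗ[F] Module.Dual F (AA F K) where
  toFun x := ω ∘ₗ mulA x
  map_add' x y := by
    ext a
    rw [LinearMap.add_apply, LinearMap.comp_apply, LinearMap.comp_apply, LinearMap.comp_apply,
      ← map_add]
    congr 1
    exact Subtype.ext (funext fun p => add_mul _ _ _)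
  map_smul' c x := by
    ext a
    rw [LinearMap.smul_apply, LinearMap.comp_apply, LinearMap.comp_apply, RingHom.id_apply,
      ← map_smul]
    congr 1
    exact Subtype.ext (funext fun p => smul_mul_assoc _ _ _)

theorem actOm_apply (ω : Module.Dual F (AA F K)) (x : K) (a : AA F K) :
    actOm ω x a = ω (mulA x a) := rfl

theorem mulA_mulA (x y : K) (a : AA F K) : mulA x (mulA y a) = mulA (x * y) a :=
  Subtype.ext (funext fun _ => (mul_assoc _ _ _).symm)

theorem mulA_one (a : AA F K) : mulA (1 : K) a = a :=
  Subtype.ext (funext fun _ => one_mul _)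

theorem actOm_injective {ω : Module.Dual F (AA F K)} (hω : ω ≠ 0) :
    Function.Injective (actOm ω) := by
  rw [injective_iff_map_eq_zero]
  intro x hx
  by_contra hx0
  apply hω
  ext a
  have : mulA x (mulA x⁻¹ a) = a := by rw [mulA_mulA, mul_inv_cancel₀ hx0, mulA_one]
  rw [← this, ← actOm_apply, hx]; rfl

theorem mulA_mem_dK {x : K} {a : AA F K} (ha : a.1 ∈ dK F K) : (mulA x a).1 ∈ dK F K := by
  obtain ⟨f, hf⟩ := ha
  exact ⟨x * f, funext fun p => by rw [mulA_apply, ← hf]; rfl⟩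

theorem mulA_mem_Ad {x : K} {a : AA F K} {B D : Divisor F K} (hx : x ∈ RRspace F B)
    (ha : a.1 ∈ Ad D) : (mulA x a).1 ∈ Ad (B + D) := by
  rw [mem_Ad] at *
  intro p
  rw [Finsupp.add_apply, neg_add]
  exact mul_mem_lev (mem_RRspace.1 hx p) (ha p)

theorem actOm_mem {ω : Module.Dual F (AA F K)} {D B E : Divisor F K} (hω : ω ∈ Om D) {x : K}
    (hx : x ∈ RRspace F B) (h : B + E = D) : actOm ω x ∈ Om E := by
  rw [mem_Om] at *
  exact ⟨fun a ha => hω.1 _ (h ▸ mulA_mem_Ad hx ha), fun a ha => hω.2 _ (mulA_mem_dK ha)⟩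

/-- Multiplication embeds `L(B)` into differentials. -/
theorem finrank_map_actOm {ω : Module.Dual F (AA F K)} (hω : ω ≠ 0) (B : Divisor F K) :
    Module.finrank F ((RRspace F B).map (actOm ω)) = ell F B :=
  (Submodule.equivMapOfInjective _ (actOm_injective hω) _).finrank_eq.symm

theorem ell_le_of_Om {g : ℤ} (hg : IsGenus F K g) {ω : Module.Dual F (AA F K)} (hω : ω ≠ 0)
    {D : Divisor F K} (h : ω ∈ Om D) (E : Divisor F K) :
    (ell F (D - E) : ℤ) ≤ ell F E - degHom F K E - 1 + g := by
  obtain ⟨h1, h2⟩ := finrank_Om hg E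
  rw [← h2, ← finrank_map_actOm hω]
  norm_cast
  refine Submodule.finrank_mono ?_
  rintro _ ⟨x, hx, rfl⟩
  exact actOm_mem h hx (by abel)

/-- Two non-zero Weil differentials are proportional. -/
theorem exists_actOm_eq {g : ℤ} (hg : IsGenus F K g) {ω η : Module.Dual F (AA F K)} (hω : ω ≠ 0)
    (hη : η ≠ 0) {D E : Divisor F K} (hD : ω ∈ Om D) (hE : η ∈ Om E) :
    ∃ z : K, z ≠ 0 ∧ η = actOm ω z := by
  obtain ⟨p, hp⟩ : ∃ D : Divisor F K, 0 < degHom F K D := by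
    obtain ⟨x, hx⟩ := IsCF.ff (F := F) (K := K)
    have hp : x ∉ (algebraMap F K).range := by
      rintro ⟨c, rfl⟩; exact hx.1 (isAlgebraic_algebraMap c)
    obtain ⟨p, -⟩ := exists_pole hp
    refine ⟨Finsupp.single p 1, ?_⟩
    rw [degHom_single]
    have := placeDegree_pos p
    omega
  set m : ℕ := (3 * g - degHom F K D - degHom F K E).toNat with hm
  set N := m • p with hN
  have hNdeg : 3 * g - degHom F K D - degHom F K E ≤ degHom F K N ∧ 0 ≤ degHom F K N := by
    rw [hN, map_nsmul, nsmul_eq_mul]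
    constructor
    · have : (m : ℤ) ≤ m * degHom F K p := le_mul_of_one_le_right (by positivity) (by omega)
      omega
    · positivity
  obtain ⟨hfin, hdim⟩ := finrank_Om hg (-N)
  have hneg : ell F (-N) ≤ 1 := by
    have := ell_le_of_le (D := -N ⊓ 0) (E := 0) inf_le_right
    rcases hNdeg.2.lt_or_eq with h | h
    · rw [ell_eq_zero_of_neg (by rw [map_neg]; omega)]; exact zero_le_one
    · by_cases hm0 : m = 0
      · rw [hN, hm0, zero_smul, neg_zero, ell_zero]
      · exfalso
        rw [hN, map_nsmul, nsmul_eq_mul] at h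
        have : 0 < (m : ℤ) * degHom F K p := by positivity
        omega
  let A := (RRspace F (D + N)).map (actOm ω)
  let B := (RRspace F (E + N)).map (actOm η)
  have hA : A ≤ Om (-N) := by
    rintro _ ⟨x, hx, rfl⟩; exact actOm_mem hD hx (by abel)
  have hB : B ≤ Om (-N) := by
    rintro _ ⟨x, hx, rfl⟩; exact actOm_mem hE hx (by abel)
  have hAB : A ⊓ B ≠ ⊥ := by
    intro h
    have hfA := Submodule.finiteDimensional_of_le hA
    have hfB := Submodule.finiteDimensional_of_le hB
    have h1 := Submodule.finrank_sup_add_finrank_inf_eq A B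
    rw [h, finrank_bot, finrank_map_actOm hω, finrank_map_actOm hη] at h1
    have h2 := Submodule.finrank_mono (sup_le hA hB)
    have h3 := hg.le (D + N)
    have h4 := hg.le (E + N)
    rw [map_add] at h3 h4
    rw [map_neg] at hdim
    omega
  obtain ⟨θ, ⟨⟨x, hx, hxθ⟩, ⟨y, hy, hyθ⟩⟩, hθ⟩ := Submodule.exists_mem_ne_zero_of_ne_bot hAB
  have hy0 : y ≠ 0 := by rintro rfl; exact hθ (by rw [← hyθ, map_zero])
  have hx0 : x ≠ 0 := by rintro rfl; exact hθ (by rw [← hxθ, map_zero])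
  refine ⟨x * y⁻¹, mul_ne_zero hx0 (inv_ne_zero hy0), ?_⟩
  ext a
  have h1 : actOm η y (mulA y⁻¹ a) = actOm ω x (mulA y⁻¹ a) := by rw [hyθ, hxθ]
  rwa [actOm_apply, actOm_apply, mulA_mulA, mulA_mulA, mul_inv_cancel₀ hy0, mulA_one] at h1

/-- The Riemann-Roch theorem. -/
theorem riemann_roch {g : ℤ} (hg : IsGenus F K g) (hg0 : 0 < g) :
    ∃ W : Divisor F K, ∀ D : Divisor F K,
      (ell F D : ℤ) - degHom F K D - 1 + g = ell F (W - D) := by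
  have hne : ∃ n : ℕ, ∃ (D : Divisor F K) (ω : Module.Dual F (AA F K)), ω ≠ 0 ∧ ω ∈ Om D ∧
      2 * g - degHom F K D = n := by
    obtain ⟨h1, h2⟩ := finrank_Om hg (0 : Divisor F K)
    rw [ell_zero, map_zero] at h2
    have : Om (0 : Divisor F K) ≠ ⊥ := by
      intro h
      rw [h, finrank_bot] at h2
      push_cast at h2
      omega
    obtain ⟨ω, hω, hω0⟩ := Submodule.exists_mem_ne_zero_of_ne_bot this
    exact ⟨(2 * g).toNat, 0, ω, hω0, hω, by rw [map_zero]; omega⟩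
  obtain ⟨W, ω, hω, hωW, hW⟩ := Nat.find_spec hne
  have hmax : ∀ E : Divisor F K, ω ∈ Om E → degHom F K E ≤ degHom F K W := by
    intro E hE
    by_contra! hlt
    have h1 := ell_le_of_Om hg hω hE 0
    rw [sub_zero, ell_zero, map_zero] at h1
    have h2 := hg.le E
    refine Nat.find_min hne (m := (2 * g - degHom F K E).toNat) ?_ ⟨E, ω, hω, hE, ?_⟩ <;> omega
  refine ⟨W, fun D => ?_⟩
  obtain ⟨h1, h2⟩ := finrank_Om hg D
  rw [← h2, ← finrank_map_actOm hω]
  norm_cast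
  have : Om D = (RRspace F (W - D)).map (actOm ω) := by
    refine le_antisymm ?_ ?_
    · intro η hη
      by_cases hη0 : η = 0
      · rw [hη0]; exact Submodule.zero_mem _
      obtain ⟨z, hz0, rfl⟩ := exists_actOm_eq hg hω hη0 hωW hη
      refine ⟨z, (mem_RRspace_iff hz0).2 ?_, rfl⟩
      have hE : ω ∈ Om (W ⊔ (D - dv F z)) := by
        rw [mem_Om]
        refine ⟨fun a ha => ?_, (mem_Om.1 hωW).2⟩
        rw [Ad_sup] at ha
        obtain ⟨b, hb, c, hc, hbc⟩ := Submodule.mem_sup.1 ha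
        have : a = ⟨b, Ad_le_AA _ hb⟩ + ⟨c, Ad_le_AA _ hc⟩ := Subtype.ext hbc.symm
        rw [this, map_add, (mem_Om.1 hωW).1 _ hb, zero_add]
        have h3 : (⟨c, Ad_le_AA _ hc⟩ : AA F K) = mulA z (mulA z⁻¹ ⟨c, Ad_le_AA _ hc⟩) := by
          rw [mulA_mulA, mul_inv_cancel₀ hz0, mulA_one]
        rw [h3]
        refine (mem_Om.1 hη).1 _ ?_
        have hz' : z⁻¹ ∈ RRspace F (dv F z) := by
          rw [mem_RRspace_iff (inv_ne_zero hz0), dv_inv, add_neg_cancel]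
        have := mulA_mem_Ad (a := ⟨c, Ad_le_AA _ hc⟩) hz' hc
        rwa [add_sub_cancel] at this
      have h4 := hmax _ hE
      have h5 : W ⊔ (D - dv F z) ≤ W := by
        intro p
        by_contra hlt
        have hle : W + Finsupp.single p 1 ≤ W ⊔ (D - dv F z) := by
          intro q
          rw [Finsupp.add_apply, Finsupp.single_apply]
          split_ifs with hq
          · subst hq; omega
          · rw [add_zero]; exact (le_sup_left : W ≤ W ⊔ (D - dv F z)) q
        have h6 := degHom_mono hle
        rw [map_add, degHom_single] at h6
        have := placeDegree_pos p
        omega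
      have h6 : D - dv F z ≤ W := le_sup_right.trans h5
      intro p
      have := h6 p
      simp only [Finsupp.sub_apply, Finsupp.add_apply, Finsupp.coe_zero, Pi.zero_apply] at *
      omega
    · rintro _ ⟨x, hx, rfl⟩
      exact actOm_mem hωW hx (by abel)
  rw [this]

end Duality

section ClassNumberOne

variable {F K : Type} [Field F] [Field K] [Algebra F K] [IsCF F K]

theorem mem_principalDivisors {D : Divisor F K} (hD : D ∈ principalDivisors F K) :
    ∃ f : K, f ≠ 0 ∧ D = dv F f := by
  induction hD using AddSubgroup.closure_induction with
  | mem D h =>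
    obtain ⟨f, hf, hD⟩ := h
    exact ⟨f, hf, Finsupp.ext hD⟩
  | zero => exact ⟨1, one_ne_zero, by ext p; simp [ordAt_one]⟩
  | add D E hD hE h1 h2 =>
    obtain ⟨f, hf, rfl⟩ := h1
    obtain ⟨g, hg, rfl⟩ := h2
    exact ⟨f * g, mul_ne_zero hf hg, (dv_mul hf hg).symm⟩
  | neg D h1 h2 =>
    obtain ⟨f, hf, rfl⟩ := h2
    exact ⟨f⁻¹, inv_ne_zero hf, (dv_inv f).symm⟩

theorem exists_dv_of_classNumber (h : classNumber F K = 1) {D : Divisor F K}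
    (hD : degHom F K D = 0) : ∃ f : K, f ≠ 0 ∧ D = dv F f := by
  refine mem_principalDivisors ?_
  have h1 : Subsingleton (ClassGroup0 F K) := (Nat.card_eq_one_iff_unique.1 h).1
  have h2 : (QuotientAddGroup.mk (⟨D, hD⟩ : zeroDivisors F K) :
      zeroDivisors F K ⧸ (principalDivisors F K).addSubgroupOf (zeroDivisors F K)) =
      QuotientAddGroup.mk 0 := h1.elim _ _
  rw [QuotientAddGroup.eq, add_zero] at h2
  have h3 : -D ∈ principalDivisors F K := h2
  exact neg_mem_iff.1 h3

theorem exists_dv_eq_sub (h : classNumber F K = 1) {D E : Divisor F K}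
    (hDE : degHom F K D = degHom F K E) : ∃ f : K, f ≠ 0 ∧ E + dv F f = D := by
  obtain ⟨f, hf, hD⟩ := exists_dv_of_classNumber h (D := D - E) (by rw [map_sub, hDE, sub_self])
  exact ⟨f, hf, by rw [← hD]; abel⟩

theorem ell_eq_of_deg (h : classNumber F K = 1) {D E : Divisor F K}
    (hDE : degHom F K D = degHom F K E) : ell F D = ell F E := by
  have key : ∀ {D E : Divisor F K}, degHom F K D = degHom F K E → ell F D ≤ ell F E := by
    intro D E hDE
    obtain ⟨f, hf, hE⟩ := exists_dv_eq_sub h hDE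
    have hinj : Function.Injective (LinearMap.mulLeft F f) := mul_right_injective₀ hf
    have h1 : ell F D = Module.finrank F ((RRspace F D).map (LinearMap.mulLeft F f)) :=
      (Submodule.equivMapOfInjective _ hinj _).finrank_eq
    rw [h1]
    refine Submodule.finrank_mono ?_
    rintro _ ⟨x, hx, rfl⟩
    have hf' : f ∈ RRspace F (-dv F f) := by
      rw [mem_RRspace_iff hf, neg_add_cancel]
    have := mul_mem_RRspace hf' hx
    rwa [← hE, neg_add_cancel_comm_assoc] at this
  exact le_antisymm (key hDE) (key hDE.symm)

/-- With class number one and a divisor of degree one, `ℓ` depends only on the degree. -/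
theorem exists_ell_fun {g : ℕ} (hg0 : g ≠ 0) (hg : genus F K = g) (hh : classNumber F K = 1)
    {D₁ : Divisor F K} (h1 : degHom F K D₁ = 1) :
    ∃ l : ℤ → ℕ, (∀ D : Divisor F K, ell F D = l (degHom F K D)) ∧ l 0 = 1 ∧ (∀ n < 0, l n = 0) ∧
      ∀ n, (l n : ℤ) - l (2 * g - 2 - n) = n + 1 - g := by
  obtain ⟨W, hW⟩ := riemann_roch (isGenus_of_genus hg0 hg) (by omega)
  have hl (D : Divisor F K) : ell F D = ell F (degHom F K D • D₁) :=
    ell_eq_of_deg hh (by rw [map_zsmul, h1, zsmul_eq_mul, mul_one]; rfl)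
  have hdeg (n : ℤ) : degHom F K (n • D₁) = n := by rw [map_zsmul, h1]; simp
  have hWd : degHom F K W = 2 * g - 2 := by
    have e1 := hW 0
    have e2 := hW W
    rw [sub_self] at e2
    rw [sub_zero, map_zero] at e1
    rw [ell_zero] at e1 e2
    push_cast at *
    omega
  refine ⟨fun n => ell F (n • D₁), hl, by simp [ell_zero], fun n hn => ?_, fun n => ?_⟩
  · exact ell_eq_zero_of_neg (by rw [hdeg]; exact hn)
  · have := hW (n • D₁)
    rw [hdeg, hl (W - _), map_sub, hdeg, hWd] at this
    dsimp only
    omega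

end ClassNumberOne

end CFF

namespace CFF

section GenusFour

/-- A function field over `𝔽₂` of genus `4` with class number `1` and a function of degree `5`. -/
class IsG4 (K : Type) [Field K] [Algebra (ZMod 2) K] : Prop extends IsCF (ZMod 2) K where
  exists_T : ∃ T : K, Transcendental (ZMod 2) T ∧ fdeg (ZMod 2) T = 5
  equiv : ∀ D E : Divisor (ZMod 2) K, degHom (ZMod 2) K D = degHom (ZMod 2) K E →
    ∃ f : K, f ≠ 0 ∧ E + dv (ZMod 2) f = D
  exists_ell : ∃ l : ℤ → ℕ, (∀ D : Divisor (ZMod 2) K, ell (ZMod 2) D = l (degHom (ZMod 2) K D)) ∧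
    l 0 = 1 ∧ (∀ n < 0, l n = 0) ∧ ∀ n, (l n : ℤ) - l (6 - n) = n - 3
  exists_deg_one : ∃ D : Divisor (ZMod 2) K, degHom (ZMod 2) K D = 1

variable (K : Type) [Field K] [Algebra (ZMod 2) K]

theorem isG4_of [IsCF (ZMod 2) K] (hg : genus (ZMod 2) K = 4) (hh : classNumber (ZMod 2) K = 1)
    {T : K} (hT : Transcendental (ZMod 2) T) (hT5 : fdeg (ZMod 2) T = 5) : IsG4 K := by
  have h1 : ∃ D : Divisor (ZMod 2) K, degHom (ZMod 2) K D = 1 := by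
    obtain ⟨W, hW⟩ := riemann_roch (isGenus_of_genus (by norm_num) hg) (by norm_num)
    refine ⟨W - pdiv (ZMod 2) T, ?_⟩
    have e1 := hW 0
    have e2 := hW W
    rw [sub_self] at e2
    rw [sub_zero, map_zero] at e1
    rw [ell_zero] at e1 e2
    rw [map_sub, deg_pdiv hT, hT5]
    push_cast at *
    omega
  refine ⟨⟨T, hT, hT5⟩, fun D E => exists_dv_eq_sub hh, ?_, h1⟩
  obtain ⟨D₁, h1⟩ := h1
  obtain ⟨l, h⟩ := exists_ell_fun (by norm_num) hg hh h1
  refine ⟨l, h.1, h.2.1, h.2.2.1, fun n => ?_⟩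
  have := h.2.2.2 n
  rw [show 2 * ((4 : ℕ) : ℤ) - 2 - n = 6 - n by push_cast; ring] at this
  push_cast at this
  linarith

variable [IsG4 K]

/-- `ℓ(D)` as a function of the degree of `D`. -/
def lf : ℤ → ℕ := (IsG4.exists_ell (K := K)).choose

variable {K}

theorem ell_eq (D : Divisor (ZMod 2) K) : ell (ZMod 2) D = lf K (degHom (ZMod 2) K D) :=
  (IsG4.exists_ell (K := K)).choose_spec.1 D

variable (K)

theorem lf_zero : lf K 0 = 1 := (IsG4.exists_ell (K := K)).choose_spec.2.1

theorem lf_neg {n : ℤ} (hn : n < 0) : lf K n = 0 := (IsG4.exists_ell (K := K)).choose_spec.2.2.1 n hn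

theorem lf_sub (n : ℤ) : (lf K n : ℤ) - lf K (6 - n) = n - 3 :=
  (IsG4.exists_ell (K := K)).choose_spec.2.2.2 n

theorem lf_four : lf K 4 = 1 + lf K 2 := by have := lf_sub K 4; norm_num at this; omega

theorem lf_five : lf K 5 = 2 + lf K 1 := by have := lf_sub K 5; norm_num at this; omega

theorem lf_six : lf K 6 = 4 := by
  have := lf_sub K 6; norm_num at this; rw [lf_zero] at this; omega

theorem lf_large {n : ℤ} (hn : 7 ≤ n) : (lf K n : ℤ) = n - 3 := by
  have := lf_sub K n; rw [lf_neg K (n := 6 - n) (by omega)] at this; omega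

/-- A divisor of given degree. -/
def dvs (n : ℤ) : Divisor (ZMod 2) K := n • (IsG4.exists_deg_one (K := K)).choose

theorem deg_dvs (n : ℤ) : degHom (ZMod 2) K (dvs K n) = n := by
  rw [dvs, map_zsmul, (IsG4.exists_deg_one (K := K)).choose_spec]; simp

/-- The effective divisors of degree `n`. -/
def effs (n : ℤ) : Set (Divisor (ZMod 2) K) := {D | 0 ≤ D ∧ degHom (ZMod 2) K D = n}

variable {K}

theorem mem_effs {n : ℤ} {D : Divisor (ZMod 2) K} :
    D ∈ effs K n ↔ 0 ≤ D ∧ degHom (ZMod 2) K D = n := Iff.rfl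

theorem algebraMap_eq_zero_or_one (c : ZMod 2) :
    algebraMap (ZMod 2) K c = 0 ∨ algebraMap (ZMod 2) K c = 1 := by
  obtain rfl | rfl : c = 0 ∨ c = 1 := by revert c; decide
  · left; simp
  · right; simp

theorem eq_one_of_dv_eq_zero {f : K} (hf : f ≠ 0) (h : dv (ZMod 2) f = 0) : f = 1 := by
  have : f ∈ RRspace (ZMod 2) (0 : Divisor (ZMod 2) K) := by
    rw [mem_RRspace_iff hf, h]; simp
  rw [RRspace_zero, Submodule.mem_span_singleton] at this
  obtain ⟨c, hc⟩ := this
  rw [← Algebra.algebraMap_eq_smul_one] at hc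
  rcases algebraMap_eq_zero_or_one (K := K) c with h | h
  · exact absurd (hc ▸ h) hf
  · rw [← hc, h]

theorem dv_injOn {f g : K} (hf : f ≠ 0) (hg : g ≠ 0) (h : dv (ZMod 2) f = dv (ZMod 2) g) :
    f = g := by
  have : f * g⁻¹ = 1 := by
    refine eq_one_of_dv_eq_zero (mul_ne_zero hf (inv_ne_zero hg)) ?_
    rw [dv_mul hf (inv_ne_zero hg), dv_inv, h, add_neg_cancel]
  field_simp at this
  exact this

theorem image_eq_effs (D : Divisor (ZMod 2) K) :
    (fun f => D + dv (ZMod 2) f) '' ((RRspace (ZMod 2) D : Set K) \ {0}) =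
      effs K (degHom (ZMod 2) K D) := by
  ext E
  constructor
  · rintro ⟨f, ⟨hf, hf0⟩, rfl⟩
    have hf0 : f ≠ 0 := hf0
    exact ⟨(mem_RRspace_iff hf0).1 hf, by rw [map_add, degHom_dv, add_zero]⟩
  · rintro ⟨hE, hd⟩
    obtain ⟨f, hf, hfE⟩ := IsG4.equiv E D hd
    exact ⟨f, ⟨(mem_RRspace_iff hf).2 (hfE ▸ hE), hf⟩, hfE⟩

theorem finite_RR (D : Divisor (ZMod 2) K) : (RRspace (ZMod 2) D : Set K).Finite :=
  (Module.finite_of_finite (ZMod 2) : Finite (RRspace (ZMod 2) D))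

theorem ncard_RR (D : Divisor (ZMod 2) K) :
    (RRspace (ZMod 2) D : Set K).ncard = 2 ^ lf K (degHom (ZMod 2) K D) := by
  rw [← ell_eq, ell]
  have := Module.natCard_eq_pow_finrank (K := ZMod 2) (V := RRspace (ZMod 2) D)
  rw [Nat.card_zmod] at this
  rw [← this]; rfl

variable (K) in
theorem finite_effs (n : ℤ) : (effs K n).Finite := by
  rw [← deg_dvs K n, ← image_eq_effs]
  exact ((finite_RR _).sdiff).image _

variable (K) in
theorem ncard_effs (n : ℤ) : (effs K n).ncard = 2 ^ lf K n - 1 := by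
  conv_lhs => rw [← deg_dvs K n, ← image_eq_effs]
  rw [Set.InjOn.ncard_image, Set.ncard_sdiff_singleton_of_mem (Submodule.zero_mem _), ncard_RR,
    deg_dvs]
  intro f hf g hg h
  exact dv_injOn hf.2 hg.2 (add_left_cancel h)

theorem card_le_of_effs {n : ℤ} (s : Finset (Divisor (ZMod 2) K)) (h : ∀ D ∈ s, D ∈ effs K n) :
    s.card ≤ 2 ^ lf K n - 1 := by
  rw [← ncard_effs, ← Set.ncard_coe_finset]
  exact Set.ncard_le_ncard h (finite_effs K n)

theorem single_mem_effs (p : Place (ZMod 2) K) :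
    Finsupp.single p 1 ∈ effs K (placeDegree (ZMod 2) p) :=
  ⟨by simp, by rw [degHom_single, one_mul]⟩

theorem add_mem_effs {m n : ℤ} {D E : Divisor (ZMod 2) K} (hD : D ∈ effs K m) (hE : E ∈ effs K n) :
    D + E ∈ effs K (m + n) :=
  ⟨add_nonneg hD.1 hE.1, by rw [map_add, hD.2, hE.2]⟩

theorem exists_mem_effs {n : ℤ} (h : 1 ≤ lf K n) : ∃ D, D ∈ effs K n := by
  have : (effs K n).ncard ≠ 0 := by
    rw [ncard_effs]
    have := Nat.pow_le_pow_right (n := 2) (by norm_num) h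
    omega
  exact (Set.nonempty_of_ncard_ne_zero this)

theorem lf_pos_of_mem {n : ℤ} {D : Divisor (ZMod 2) K} (h : D ∈ effs K n) : 1 ≤ lf K n := by
  have := card_le_of_effs {D} (by simpa using h)
  rw [Finset.card_singleton] at this
  by_contra h0
  rw [show lf K n = 0 by omega] at this
  simp at this

theorem lf_pos (p : Place (ZMod 2) K) : 1 ≤ lf K (placeDegree (ZMod 2) p) :=
  lf_pos_of_mem (single_mem_effs p)

/-- A nonzero effective divisor is the sum of a place and an effective divisor. -/
theorem exists_place_add {n : ℤ} (hn : n ≠ 0) {D : Divisor (ZMod 2) K} (hD : D ∈ effs K n) :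
    ∃ p : Place (ZMod 2) K, ∃ E ∈ effs K (n - placeDegree (ZMod 2) p),
      D = Finsupp.single p 1 + E := by
  obtain ⟨p, hp⟩ : ∃ p, D p ≠ 0 := by
    by_contra! h
    have : D = 0 := Finsupp.ext h
    rw [this] at hD
    exact hn (by rw [← hD.2, map_zero])
  refine ⟨p, D - Finsupp.single p 1, ⟨?_, ?_⟩, by abel⟩
  · intro q
    have hq := hD.1 q
    have hp' := hD.1 p
    simp only [Finsupp.coe_zero, Pi.zero_apply] at hq hp' ⊢
    rw [Finsupp.sub_apply, Finsupp.single_apply]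
    split_ifs with h
    · subst h; omega
    · omega
  · rw [map_sub, hD.2, degHom_single, one_mul]

theorem single_add_single_inj {p q p' q' : Place (ZMod 2) K}
    (h : (Finsupp.single p 1 + Finsupp.single q 1 : Divisor (ZMod 2) K) =
      Finsupp.single p' 1 + Finsupp.single q' 1) : s(p, q) = s(p', q') := by
  have h1 := DFunLike.congr_fun h p
  have h2 := DFunLike.congr_fun h q
  have h3 := DFunLike.congr_fun h p'
  have h4 := DFunLike.congr_fun h q'
  simp only [Finsupp.add_apply, Finsupp.single_apply] at h1 h2 h3 h4
  rw [Sym2.eq_iff]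
  by_cases a : p = p' <;> by_cases b : p = q' <;> by_cases c : q = p' <;> by_cases d : q = q' <;>
    by_cases e : p = q <;> by_cases f : p' = q' <;> simp_all [eq_comm]

/-- Sums of two places of degree `d` and places of degree `2 * d` are distinct divisors. -/
theorem card_pairs_add (d : ℕ) (hd : 0 < d) (S R : Finset (Place (ZMod 2) K))
    (hS : ∀ p ∈ S, placeDegree (ZMod 2) p = d) (hR : ∀ p ∈ R, placeDegree (ZMod 2) p = d + d) :
    (S.card + 1).choose 2 + R.card ≤ 2 ^ lf K (d + d) - 1 := by
  let φ : Sym2 (Place (ZMod 2) K) → Divisor (ZMod 2) K :=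
    Sym2.lift ⟨fun p q => Finsupp.single p 1 + Finsupp.single q 1, fun _ _ => add_comm _ _⟩
  have hφ : Function.Injective φ := by
    intro a b h
    induction a with | _ p q
    induction b with | _ p' q'
    exact single_add_single_inj h
  have hψ : Function.Injective (fun p : Place (ZMod 2) K => (Finsupp.single p 1 : Divisor (ZMod 2) K)) :=
    Finsupp.single_left_injective one_ne_zero
  have := card_le_of_effs (n := (d : ℤ) + d) (S.sym2.image φ ∪ R.image fun p => Finsupp.single p 1) (by
    intro D hD
    rw [Finset.mem_union, Finset.mem_image, Finset.mem_image] at hD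
    rcases hD with ⟨z, hz, rfl⟩ | ⟨p, hp, rfl⟩
    · induction z with | _ p q
      rw [Finset.mk_mem_sym2_iff] at hz
      have h1 := single_mem_effs p
      have h2 := single_mem_effs q
      rw [hS p hz.1] at h1
      rw [hS q hz.2] at h2
      exact add_mem_effs h1 h2
    · have h1 := single_mem_effs p
      rw [hR p hp] at h1
      exact_mod_cast h1)
  rw [Finset.card_union_of_disjoint, Finset.card_image_of_injective _ hφ,
    Finset.card_image_of_injective _ hψ, Finset.card_sym2] at this
  · exact this
  · rw [Finset.disjoint_left]
    intro D hD hD'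
    rw [Finset.mem_image] at hD hD'
    obtain ⟨z, hz, rfl⟩ := hD
    obtain ⟨r, hr, h⟩ := hD'
    induction z with | _ p q
    rw [Finset.mk_mem_sym2_iff] at hz
    have h1 := DFunLike.congr_fun h p
    change _ = (Finsupp.single p 1 + Finsupp.single q 1 : Divisor (ZMod 2) K) p at h1
    simp only [Finsupp.add_apply, Finsupp.single_apply] at h1
    by_cases hrp : r = p
    · have := hR r hr
      have := hS p hz.1
      subst hrp
      omega
    · rw [if_neg hrp] at h1
      split_ifs at h1 <;> norm_num at h1

/-- Divisors containing a place `P` are counted by the divisors of smaller degree. -/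
theorem card_add_effs (P : Place (ZMod 2) K) (n : ℤ) (R : Finset (Place (ZMod 2) K))
    (hR : ∀ p ∈ R, p ≠ P ∧ placeDegree (ZMod 2) p = n) :
    R.card + (2 ^ lf K (n - placeDegree (ZMod 2) P) - 1) ≤ 2 ^ lf K n - 1 := by
  have hψ : Function.Injective (fun p : Place (ZMod 2) K => (Finsupp.single p 1 : Divisor (ZMod 2) K)) :=
    Finsupp.single_left_injective one_ne_zero
  set A := (finite_effs K (n - placeDegree (ZMod 2) P)).toFinset with hA
  have hAc : A.card = 2 ^ lf K (n - placeDegree (ZMod 2) P) - 1 := by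
    rw [← ncard_effs, Set.ncard_eq_toFinset_card _ (finite_effs K _)]
  rw [← hAc]
  have := card_le_of_effs (n := n) (R.image (fun p => Finsupp.single p 1) ∪
    A.image fun D => D + Finsupp.single P 1) (by
    intro D hD
    rw [Finset.mem_union, Finset.mem_image, Finset.mem_image] at hD
    rcases hD with ⟨p, hp, rfl⟩ | ⟨E, hE, rfl⟩
    · rw [← (hR p hp).2]
      exact single_mem_effs p
    · rw [hA, Set.Finite.mem_toFinset] at hE
      have := add_mem_effs hE (single_mem_effs P)
      rwa [sub_add_cancel] at this)
  rw [Finset.card_union_of_disjoint, Finset.card_image_of_injective _ hψ,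
    Finset.card_image_of_injective _ (add_left_injective _)] at this
  · exact this
  · rw [Finset.disjoint_left]
    intro D hD hD'
    rw [Finset.mem_image] at hD hD'
    obtain ⟨p, hp, rfl⟩ := hD
    obtain ⟨E, hE, h⟩ := hD'
    rw [hA, Set.Finite.mem_toFinset] at hE
    have h1 := DFunLike.congr_fun h P
    have h2 := hE.1 P
    simp only [Finsupp.coe_zero, Pi.zero_apply] at h2
    rw [Finsupp.add_apply, Finsupp.single_apply, Finsupp.single_apply, if_pos rfl,
      if_neg (hR p hp).1] at h1
    omega

theorem card_le_effs (n : ℤ) (R : Finset (Place (ZMod 2) K))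
    (hR : ∀ p ∈ R, placeDegree (ZMod 2) p = n) : R.card ≤ 2 ^ lf K n - 1 := by
  have hψ : Function.Injective (fun p : Place (ZMod 2) K => (Finsupp.single p 1 : Divisor (ZMod 2) K)) :=
    Finsupp.single_left_injective one_ne_zero
  rw [← Finset.card_image_of_injective R hψ]
  refine card_le_of_effs _ fun D hD => ?_
  rw [Finset.mem_image] at hD
  obtain ⟨p, hp, rfl⟩ := hD
  rw [← hR p hp]
  exact single_mem_effs p

end GenusFour

end CFF

namespace CFF

open IntermediateField Polynomial

section Independence

variable {F K : Type} [Field F] [Field K] [Algebra F K] [IsCF F K]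

theorem linearIndependent_pow_of_adjoin_eq_top {x y : K} (hx : Transcendental F x)
    (h : adjoin (adjoin F {x}) {y} = ⊤) :
    LinearIndependent (adjoin F {x}) (fun i : Fin (fdeg F x) => y ^ (i : ℕ)) := by
  have hfin := finiteDimensional_adjoin hx
  have hyint : IsIntegral (adjoin F {x}) y := Algebra.IsIntegral.isIntegral y
  have hd : (minpoly (adjoin F {x}) y).natDegree = fdeg F x := by
    rw [← adjoin.finrank hyint, h, finrank_top', fdeg]
  have := linearIndependent_pow (K := adjoin F {x}) y
  rw [hd] at this
  exact this

theorem adjoin_eq_top_of_prime {x y : K} (hp : (fdeg F x).Prime) (hy : y ∉ adjoin F {x}) :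
    adjoin (adjoin F {x}) {y} = ⊤ := by
  have h1 : Module.finrank (adjoin F {x}) (adjoin (adjoin F {x}) {y}) ∣ fdeg F x :=
    ⟨_, (Module.finrank_mul_finrank _ _ _).symm⟩
  rcases (Nat.dvd_prime hp).1 h1 with h | h
  · rw [finrank_adjoin_simple_eq_one_iff, mem_bot] at h
    obtain ⟨c, rfl⟩ := h
    exact absurd c.2 hy
  · have : FiniteDimensional (adjoin F {x}) K := Module.finite_of_finrank_pos hp.pos
    exact eq_of_le_of_finrank_eq le_top (by rw [h, finrank_top']; rfl)

theorem fdeg_dvd_of_mem {x y : K} (hy : y ∈ adjoin F {x}) : fdeg F x ∣ fdeg F y := by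
  have hle : adjoin F {y} ≤ adjoin F {x} := adjoin_simple_le_iff.2 hy
  exact ⟨_, ((mul_comm _ _).trans (relfinrank_mul_finrank_top hle)).symm⟩

/-- Independence over `F(x)` gives independence over `F` of the products with powers of `x`. -/
theorem linearIndependent_pow_mul {x : K} (hx : Transcendental F x) {ι : Type} {u : ι → K}
    (hu : LinearIndependent (adjoin F {x}) u) :
    LinearIndependent F (fun s : ℕ × ι => x ^ s.1 * u s.2) := by
  rw [linearIndependent_adjoin_iff hx] at hu
  rw [linearIndependent_iff']
  intro s c hc
  have h := hu (s.image Prod.snd)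
    (fun j => ∑ t ∈ s with t.2 = j, C (c t) * X ^ t.1) (by
      rw [← hc]
      simp only [map_sum, map_mul, map_pow, aeval_X, aeval_C]
      rw [← Finset.sum_fiberwise_of_maps_to (g := Prod.snd) (t := s.image Prod.snd)
        (fun t ht => Finset.mem_image_of_mem _ ht) (fun t => c t • (x ^ t.1 * u t.2))]
      refine Finset.sum_congr rfl fun j _ => ?_
      rw [Finset.sum_mul]
      refine Finset.sum_congr rfl fun t ht => ?_
      rw [Finset.mem_filter] at ht
      rw [ht.2, Algebra.smul_def, mul_assoc])
  intro t ht
  have h1 := congrArg (fun p => coeff p t.1) (h t.2 (Finset.mem_image_of_mem _ ht))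
  simp only [Polynomial.finsetSum_coeff, coeff_C_mul_X_pow, coeff_zero] at h1
  rw [Finset.sum_eq_single t] at h1
  · simpa using h1
  · intro b hb hbt
    rw [Finset.mem_filter] at hb
    rw [if_neg]
    intro h2
    exact hbt (Prod.ext h2.symm hb.2)
  · intro h2
    exact absurd (Finset.mem_filter.2 ⟨ht, rfl⟩ : t ∈ s.filter fun b => b.2 = t.2) h2

theorem span_eq_RRspace {D : Divisor F K} {ι : Type} [Fintype ι] {v : ι → K}
    (hv : LinearIndependent F v) (hm : ∀ i, v i ∈ RRspace F D) (hc : ell F D ≤ Fintype.card ι) :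
    Submodule.span F (Set.range v) = RRspace F D := by
  refine Submodule.eq_of_le_of_finrank_le ?_ ?_
  · rw [Submodule.span_le]; rintro _ ⟨i, rfl⟩; exact hm i
  · rw [finrank_span_eq_card hv]; exact hc

theorem card_le_ell {D : Divisor F K} {ι : Type} [Fintype ι] {v : ι → K}
    (hv : LinearIndependent F v) (hm : ∀ i, v i ∈ RRspace F D) : Fintype.card ι ≤ ell F D := by
  rw [← finrank_span_eq_card hv]
  refine Submodule.finrank_mono ?_
  rw [Submodule.span_le]; rintro _ ⟨i, rfl⟩; exact hm i

theorem linearIndependent_pow_self {x : K} (hx : Transcendental F x) :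
    LinearIndependent F (fun i : ℕ => x ^ i) := by
  rw [linearIndependent_iff']
  intro s c hc
  have h := (transcendental_iff.1 hx) (∑ i ∈ s, C (c i) * X ^ i) (by
    rw [← hc]; simp [Algebra.smul_def])
  intro i hi
  have := congrArg (fun p => coeff p i) h
  simpa [Polynomial.finsetSum_coeff, coeff_C_mul_X_pow, hi] using this

theorem succ_le_ell {D : Divisor F K} (hD : 0 ≤ D) {x : K} (hx : Transcendental F x)
    (hxD : x ∈ RRspace F D) (n : ℕ) : n + 1 ≤ ell F (n • D) := by
  have h := (linearIndependent_pow_self hx).comp (fun i : Fin (n + 1) => (i : ℕ))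
    Fin.val_injective
  have := card_le_ell (D := n • D) h (fun i => pow_mem_RR_le hxD hD (Nat.lt_succ_iff.1 i.2))
  simpa using this

theorem exists_transcendental {D : Divisor F K} (h : 2 ≤ ell F D) :
    ∃ x ∈ RRspace F D, Transcendental F x := by
  by_contra! hc
  have hle : RRspace F D ≤ Submodule.span F {(1 : K)} := by
    intro x hx
    have h1 : x ∈ (algebraMap F K).range := by
      by_contra h2
      exact hc x hx (transcendental_of_not_mem h2)
    obtain ⟨c, rfl⟩ := h1
    exact Submodule.mem_span_singleton.2 ⟨c, (Algebra.algebraMap_eq_smul_one c).symm⟩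
  have := Submodule.finrank_mono hle
  rw [finrank_span_singleton one_ne_zero] at this
  have h' : ell F D = Module.finrank F (RRspace F D) := rfl
  omega

theorem pdiv_le {D : Divisor F K} (hD : 0 ≤ D) {x : K} (hx : x ≠ 0) (h : x ∈ RRspace F D) :
    pdiv F x ≤ D := by
  rw [mem_RRspace_iff hx] at h
  refine sup_le ?_ hD
  rw [dv_inv]
  intro p
  have := h p
  simp only [Finsupp.coe_zero, Pi.zero_apply, Finsupp.add_apply, Finsupp.neg_apply] at this ⊢
  omega

theorem eq_of_le_of_deg {D E : Divisor F K} (h : D ≤ E) (hd : degHom F K E ≤ degHom F K D) :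
    D = E := by
  by_contra hne
  obtain ⟨p, hp⟩ : ∃ p, D p ≠ E p := by
    by_contra! h'; exact hne (Finsupp.ext h')
  have h1 : D + Finsupp.single p 1 ≤ E := by
    intro q
    have hq := h q
    have hp' := h p
    rw [Finsupp.add_apply, Finsupp.single_apply]
    split_ifs with hh
    · subst hh; omega
    · omega
  have := degHom_mono h1
  rw [map_add, degHom_single] at this
  have := placeDegree_pos p
  omega

theorem ne_zero_of_transcendental {x : K} (hx : Transcendental F x) : x ≠ 0 := by
  rintro rfl
  exact hx isAlgebraic_zero

theorem pdiv_eq {D : Divisor F K} (hD : 0 ≤ D) {x : K} (hx : Transcendental F x)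
    (h : x ∈ RRspace F D) (hd : degHom F K D ≤ fdeg F x) : pdiv F x = D :=
  eq_of_le_of_deg (pdiv_le hD (ne_zero_of_transcendental hx) h) (by rw [deg_pdiv hx]; exact hd)

theorem mem_of_pdiv_eq_zero {x : K} {p : Place F K} : x ∈ p.1 ↔ pdiv F x p = 0 := by
  by_cases hx : x = 0
  · subst hx
    simp only [pdiv, inv_zero, Finsupp.sup_apply, dv_apply, Finsupp.coe_zero, Pi.zero_apply]
    have := ordAt_const p (c := (0 : F))
    rw [map_zero] at this
    simp [this, p.1.zero_mem]
  · rw [mem_place_iff p hx]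
    simp only [pdiv, dv_inv, Finsupp.sup_apply, dv_apply, Finsupp.neg_apply, Finsupp.coe_zero,
      Pi.zero_apply]
    omega

theorem aeval_mem {y : K} {p : Place F K} (hy : y ∈ p.1) (b : F[X]) : aeval y b ∈ p.1 := by
  rw [aeval_eq_sum_range]
  refine sum_mem fun i _ => ?_
  rw [Algebra.smul_def]
  exact p.1.mul_mem _ _ (p.const_mem _) (pow_mem hy _)

theorem inv_aeval_mem {y : K} {p : Place F K} (hy : y ∉ p.1) {b : F[X]} (hb : b ≠ 0) :
    (aeval y b)⁻¹ ∈ p.1 := by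
  rcases p.1.mem_or_inv_mem (aeval y b) with h | h
  · by_cases hd : b.natDegree = 0
    · rw [natDegree_eq_zero] at hd
      obtain ⟨c, rfl⟩ := hd
      rw [aeval_C, ← map_inv₀]
      exact p.const_mem _
    exfalso
    apply hy
    have hi : IsIntegral p.1 y := by
      let f : F →+* p.1 := constHom F p
      have hf : (algebraMap p.1 K).comp f = algebraMap F K := by ext; rfl
      have hlc : b.leadingCoeff ≠ 0 := leadingCoeff_ne_zero.2 hb
      let q : p.1[X] := (C b.leadingCoeff⁻¹ * b).map f - C (f b.leadingCoeff⁻¹ * ⟨aeval y b, h⟩)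
      refine ⟨q, ?_, ?_⟩
      · have hm : (C b.leadingCoeff⁻¹ * b).Monic := by
          rw [mul_comm]; exact monic_mul_leadingCoeff_inv hb
        refine (hm.map f).sub_of_left ?_
        refine degree_C_le.trans_lt ?_
        rw [hm.degree_map, degree_mul, degree_C (inv_ne_zero hlc), zero_add]
        exact natDegree_pos_iff_degree_pos.1 (Nat.pos_of_ne_zero hd)
      · have h1 : eval₂ (algebraMap p.1 K) y ((C b.leadingCoeff⁻¹ * b).map f) =
            algebraMap F K b.leadingCoeff⁻¹ * aeval y b := by
          rw [eval₂_map, hf, eval₂_mul, eval₂_C]; rfl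
        rw [eval₂_sub, eval₂_C, h1, map_mul]
        exact sub_self _
    obtain ⟨z, hz⟩ := IsIntegrallyClosed.isIntegral_iff.1 hi
    rw [← hz]; exact z.2
  · exact h

theorem ordAt_aeval {y : K} {p : Place F K} (hy : y ∉ p.1) {b : F[X]} (hb : b ≠ 0) :
    ordAt p.1 (aeval y b) = b.natDegree * ordAt p.1 y := by
  have hyne : y ≠ 0 := by rintro rfl; exact hy p.1.zero_mem
  have hneg : ordAt p.1 y < 0 := by
    by_contra! h; exact hy ((mem_place_iff p hyne).2 h)
  induction hn : b.natDegree using Nat.strong_induction_on generalizing b with | _ n ih => ?_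
  by_cases hn0 : n = 0
  · subst hn0
    obtain ⟨c, rfl⟩ := natDegree_eq_zero.1 hn
    rw [aeval_C, ordAt_const]; simp
  have hlead : ordAt p.1 (algebraMap F K b.leadingCoeff * y ^ n) = n * ordAt p.1 y := by
    rw [ordAt_mul p ((_root_.map_ne_zero _).2 (leadingCoeff_ne_zero.2 hb)) (pow_ne_zero _ hyne),
      ordAt_const, ordAt_pow p hyne, zero_add]
  have hb' : aeval y b = algebraMap F K b.leadingCoeff * y ^ n + aeval y b.eraseLead := by
    conv_lhs => rw [← eraseLead_add_C_mul_X_pow b]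
    rw [map_add, map_mul, aeval_C, map_pow, aeval_X, hn, add_comm]
  by_cases he : aeval y b.eraseLead = 0
  · rw [hb', he, add_zero, hlead]
  have he0 : b.eraseLead ≠ 0 := by rintro h; rw [h, map_zero] at he; exact he rfl
  have hlt : b.eraseLead.natDegree < n := by
    have := eraseLead_natDegree_le b
    omega
  have h2 := ih _ hlt he0 rfl
  rw [hb', (ordAt_add_of_lt p ?_ ?_ ?_).2, hlead]
  · exact mul_ne_zero ((_root_.map_ne_zero _).2 (leadingCoeff_ne_zero.2 hb)) (pow_ne_zero _ hyne)
  · exact he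
  · rw [hlead, h2]
    have : (b.eraseLead.natDegree : ℤ) < n := by exact_mod_cast hlt
    nlinarith

/-- Elements of `F(y)` with poles bounded by `n` times the poles of `y` are polynomials in `y`. -/
theorem exists_aeval_eq {y w : K} (hy : Transcendental F y) {n : ℕ}
    (hw : w ∈ RRspace F (n • pdiv F y)) (hwy : w ∈ adjoin F {y}) :
    ∃ p : F[X], p.natDegree ≤ n ∧ aeval y p = w := by
  obtain ⟨r, s, rfl⟩ := (mem_adjoin_simple_iff F w).1 hwy
  by_cases hs : s = 0
  · refine ⟨0, by simp, by simp [hs]⟩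
  by_cases hr : r = 0
  · refine ⟨0, by simp, by simp [hr]⟩
  have hinj := transcendental_iff_injective.1 hy
  have h0 {b : F[X]} (hb : b ≠ 0) : aeval y b ≠ 0 := fun h => hb (hinj (by rw [h, map_zero]))
  obtain ⟨r', hr'⟩ := EuclideanDomain.gcd_dvd_left r s
  obtain ⟨s', hs'⟩ := EuclideanDomain.gcd_dvd_right r s
  have hd0 : EuclideanDomain.gcd r s ≠ 0 := fun h => hs (by rw [hs', h, zero_mul])
  have hs'0 : s' ≠ 0 := fun h => hs (by rw [hs', h, mul_zero])
  have hbez : r' * EuclideanDomain.gcdA r s + s' * EuclideanDomain.gcdB r s = 1 := by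
    have := EuclideanDomain.gcd_eq_gcd_ab r s
    refine mul_left_cancel₀ hd0 ?_
    linear_combination (-1 : F[X]) * this + (-EuclideanDomain.gcdA r s) * hr' +
      (-EuclideanDomain.gcdB r s) * hs'
  have hq : aeval y r / aeval y s = aeval y r' / aeval y s' := by
    have e1 := congrArg (aeval y) hr'
    have e2 := congrArg (aeval y) hs'
    rw [map_mul] at e1 e2
    rw [e1, e2, mul_div_mul_left _ _ (h0 hd0)]
  rw [hq] at hw ⊢
  have hunit : s'.natDegree = 0 := by
    by_contra hdeg
    have hnr : (aeval y s') ∉ (algebraMap F K).range := by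
      rintro ⟨c, hc⟩
      have : s' = C c := hinj (by rw [aeval_C, hc])
      rw [this, natDegree_C] at hdeg
      exact hdeg rfl
    have hnr' : (aeval y s')⁻¹ ∉ (algebraMap F K).range := by
      rintro ⟨c, hc⟩
      exact hnr ⟨c⁻¹, by rw [map_inv₀, hc, inv_inv]⟩
    obtain ⟨p, hp⟩ := exists_pole hnr'
    have hyp : y ∈ p.1 := by
      by_contra hyp
      exact hp (inv_aeval_mem hyp hs'0)
    apply hp
    have hwp : aeval y r' / aeval y s' ∈ p.1 := by
      have := mem_RRspace.1 hw p
      rw [Finsupp.smul_apply, mem_of_pdiv_eq_zero.1 hyp, smul_zero, neg_zero] at this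
      exact mem_lev_zero.1 this
    have h1 := congrArg (aeval y) hbez
    rw [map_add, map_mul, map_mul, map_one] at h1
    have h2 : (aeval y s')⁻¹ = aeval y r' / aeval y s' * aeval y (EuclideanDomain.gcdA r s) +
        aeval y (EuclideanDomain.gcdB r s) := by
      field_simp [h0 hs'0]
      linear_combination -h1
    rw [h2]
    exact p.1.add_mem _ _ (p.1.mul_mem _ _ hwp (aeval_mem hyp _)) (aeval_mem hyp _)
  obtain ⟨c, rfl⟩ := natDegree_eq_zero.1 hunit
  have hc : c ≠ 0 := fun h => hs'0 (by rw [h, C_0])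
  have hw' : aeval y r' / aeval y (C c) = aeval y (C c⁻¹ * r') := by
    rw [map_mul, aeval_C, aeval_C, map_inv₀]; field_simp
  rw [hw'] at hw ⊢
  refine ⟨_, ?_, rfl⟩
  set b := C c⁻¹ * r'
  have hb : b ≠ 0 := by
    refine mul_ne_zero (C_ne_zero.2 (inv_ne_zero hc)) ?_
    rintro rfl
    exact hr (by rw [hr', mul_zero])
  have hnr : y ∉ (algebraMap F K).range := by
    rintro ⟨c, rfl⟩
    exact hy (isAlgebraic_algebraMap c)
  obtain ⟨p, hp⟩ := exists_pole hnr
  have h1 := (mem_RRspace_iff (h0 hb)).1 hw p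
  have hyne := ne_zero_of_transcendental hy
  have hneg : ordAt p.1 y < 0 := by
    by_contra! h; exact hp ((mem_place_iff p hyne).2 h)
  rw [Finsupp.add_apply, dv_apply, ordAt_aeval hp hb, Finsupp.smul_apply, pdiv, dv_inv,
    Finsupp.sup_apply, Finsupp.neg_apply, dv_apply, Finsupp.coe_zero, Pi.zero_apply,
    sup_of_le_left (by omega : (0 : ℤ) ≤ - ordAt p.1 y), nsmul_eq_mul] at h1
  by_contra! hlt
  have : (n : ℤ) < b.natDegree := by exact_mod_cast hlt
  nlinarith

end Independence

end CFF

namespace CFF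

open IntermediateField Polynomial

section Points

variable {F K : Type} [Field F] [Field K] [Algebra F K]

theorem aevalAeval_map {A B : Type} [CommRing A] [CommRing B] [Algebra F A] [Algebra F B]
    (φ : A →ₐ[F] B) (x y : A) (p : F[X][X]) :
    φ (aevalAeval x y p) = aevalAeval (φ x) (φ y) p := by
  have : φ.comp (aevalAeval x y) = aevalAeval (φ x) (φ y) := by
    apply algHom_ext'
    · ext; simp
    · simp
  exact DFunLike.congr_fun this p

theorem aevalAeval_mem {A : Type} [CommRing A] [Algebra F A] {x y : A} (S : Subalgebra F A)
    (hx : x ∈ S) (hy : y ∈ S) (p : F[X][X]) : aevalAeval x y p ∈ S := by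
  have := aevalAeval_map S.val ⟨x, hx⟩ ⟨y, hy⟩ p
  change _ = aevalAeval x y p at this
  rw [← this]
  exact Subtype.coe_prop _

theorem mem_of_aevalAeval (P : Place F K) {x y : K} (hx : x ∈ P.1) (hy : y ∈ P.1) (p : F[X][X]) :
    aevalAeval x y p ∈ P.1 :=
  aevalAeval_mem ({ P.1.toSubring with algebraMap_mem' := P.const_mem } : Subalgebra F K) hx hy p

/-- Reduction modulo a place, on a subalgebra of its valuation ring. -/
def resHom (P : Place F K) (A : Subalgebra F K) (hA : ∀ a ∈ A, a ∈ P.1) : A →ₐ[F] Res P where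
  toFun a := IsLocalRing.residue P.1 ⟨a, hA a a.2⟩
  map_one' := map_one (IsLocalRing.residue P.1)
  map_mul' a b := map_mul (IsLocalRing.residue P.1) ⟨a, hA a a.2⟩ ⟨b, hA b b.2⟩
  map_zero' := map_zero (IsLocalRing.residue P.1)
  map_add' a b := map_add (IsLocalRing.residue P.1) ⟨a, hA a a.2⟩ ⟨b, hA b b.2⟩
  commutes' _ := rfl

theorem resHom_apply (P : Place F K) (A : Subalgebra F K) (hA : ∀ a ∈ A, a ∈ P.1) {a : K}
    (ha : a ∈ A) : resHom P A hA ⟨a, ha⟩ = IsLocalRing.residue P.1 ⟨a, hA a ha⟩ := rfl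

variable [IsCF F K]

theorem exists_place_of_point {x y : K} (hx : Transcendental F x) {κ : Type} [Field κ] [Algebra F κ]
    [Finite κ] {a b : κ} (hs : Function.Surjective (aevalAeval (R := F) a b))
    (H : ∀ p : F[X][X], aevalAeval x y p = 0 → aevalAeval a b p = 0) :
    ∃ (P : Place F K) (hxP : x ∈ P.1) (hyP : y ∈ P.1) (ι : κ →ₐ[F] Res P),
      ι a = IsLocalRing.residue P.1 ⟨x, hxP⟩ ∧ ι b = IsLocalRing.residue P.1 ⟨y, hyP⟩ := by
  set A : Subalgebra F K := (aevalAeval (R := F) x y).range with hA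
  let g : F[X][X] →ₐ[F] A := (aevalAeval (R := F) x y).rangeRestrict
  have hg : Function.Surjective g := (aevalAeval (R := F) x y).rangeRestrict_surjective
  let φ : A →ₐ[F] κ := AlgHom.liftOfSurjective g hg (aevalAeval a b) (fun p hp => by
    rw [RingHom.mem_ker] at hp ⊢
    exact H p (congrArg Subtype.val hp))
  have hφ : ∀ p, φ (g p) = aevalAeval a b p := fun p =>
    AlgHom.liftOfSurjective_apply _ _ _ _ _
  have hφs : Function.Surjective φ := fun c => by
    obtain ⟨p, rfl⟩ := hs c; exact ⟨g p, hφ p⟩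
  let I : Ideal A := RingHom.ker φ
  have hI : I ≠ ⊤ := RingHom.ker_ne_top φ
  obtain ⟨B, hAB, hIB⟩ := Ideal.image_subset_nonunits_valuationSubring (A := A.toSubring) I hI
  have hgx : ((g (C X) : A) : K) = x := by change aevalAeval x y (C X) = x; simp
  have hgy : ((g X : A) : K) = y := by change aevalAeval x y X = y; simp
  have hB : B ≠ ⊤ := by
    rintro rfl
    have _ := Fintype.ofFinite κ
    have h1 : g (C X) ^ Fintype.card κ - g (C X) ∈ I := by
      change φ _ = 0
      rw [map_sub, map_pow, FiniteField.pow_card, sub_self]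
    have h2 : x ^ Fintype.card κ - x ∈ (⊤ : ValuationSubring K).nonunits := by
      refine hIB ⟨_, h1, ?_⟩
      change ((g (C X) : A) : K) ^ Fintype.card κ - ((g (C X) : A) : K) = _
      rw [hgx]
    rw [ValuationSubring.mem_nonunits_iff_exists_mem_maximalIdeal] at h2
    obtain ⟨_, h3⟩ := h2
    rw [IsLocalRing.mem_maximalIdeal, mem_nonunits_iff, isUnit_iff_exists_inv] at h3
    have h4 : x ^ Fintype.card κ - x = 0 := by
      by_contra h0
      exact h3 ⟨⟨(x ^ Fintype.card κ - x)⁻¹, trivial⟩, Subtype.ext (mul_inv_cancel₀ h0)⟩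
    refine hx ⟨X ^ Fintype.card κ - X, ?_, by simpa using h4⟩
    exact FiniteField.X_pow_card_sub_X_ne_zero F Fintype.one_lt_card
  obtain ⟨P, rfl⟩ : ∃ P : Place F K, P.1 = B := ⟨⟨B, hB, fun c => hAB (A.algebraMap_mem c)⟩, rfl⟩
  have hAP : ∀ a ∈ A, a ∈ P.1 := fun a ha => hAB ha
  let r := resHom P A hAP
  let ι : κ →ₐ[F] Res P := AlgHom.liftOfSurjective φ hφs r (fun c hc => by
    obtain ⟨c, hcA⟩ := c
    change resHom P A hAP ⟨c, hcA⟩ = 0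
    rw [resHom_apply]
    have h2 : (c : K) ∈ P.1.nonunits := hIB ⟨⟨c, hcA⟩, hc, rfl⟩
    rw [ValuationSubring.mem_nonunits_iff_exists_mem_maximalIdeal] at h2
    exact (IsLocalRing.residue_eq_zero_iff _).2 h2.2)
  have hι : ∀ c, ι (φ c) = r c := fun c => AlgHom.liftOfSurjective_apply _ _ _ _ _
  have hxP : x ∈ P.1 := hgx ▸ hAP _ (g (C X)).2
  have hyP : y ∈ P.1 := hgy ▸ hAP _ (g X).2
  refine ⟨P, hxP, hyP, ι, ?_, ?_⟩
  · have h : φ (g (C X)) = a := by rw [hφ]; simp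
    rw [← h, hι]
    exact congrArg (IsLocalRing.residue P.1) (Subtype.ext (a2 := ⟨x, hxP⟩) hgx)
  · have h : φ (g X) = b := by rw [hφ]; simp
    rw [← h, hι]
    exact congrArg (IsLocalRing.residue P.1) (Subtype.ext (a2 := ⟨y, hyP⟩) hgy)

theorem residue_aevalAeval (P : Place F K) {x y : K} (hxP : x ∈ P.1) (hyP : y ∈ P.1) (p : F[X][X]) :
    IsLocalRing.residue P.1 ⟨aevalAeval x y p, mem_of_aevalAeval P hxP hyP p⟩ =
      aevalAeval (IsLocalRing.residue P.1 ⟨x, hxP⟩) (IsLocalRing.residue P.1 ⟨y, hyP⟩) p := by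
  let A := (aevalAeval (R := F) x y).range
  have hA : ∀ a ∈ A, a ∈ P.1 := by rintro _ ⟨p, rfl⟩; exact mem_of_aevalAeval P hxP hyP p
  have hxA : x ∈ A := ⟨C X, by simp⟩
  have hyA : y ∈ A := ⟨X, by simp⟩
  have h := aevalAeval_map (resHom P A hA) ⟨x, hxA⟩ ⟨y, hyA⟩ p
  have h2 : aevalAeval (⟨x, hxA⟩ : A) ⟨y, hyA⟩ p = ⟨aevalAeval x y p, p, rfl⟩ :=
    Subtype.ext (aevalAeval_map A.val _ _ p)
  rw [h2] at h
  exact h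

theorem ell_le_add_sub_single {P : Place F K} {D : Divisor F K} (hD : D P = 0) {κ : Type} [Field κ]
    [Algebra F κ] [FiniteDimensional F κ] (ι : κ →ₐ[F] Res P)
    (h : ∀ f ∈ RRspace F D, ∃ (hf : f ∈ P.1) (c : κ), IsLocalRing.residue P.1 ⟨f, hf⟩ = ι c) :
    ell F D ≤ Module.finrank F κ + ell F (D - Finsupp.single P 1) := by
  have hO : RRspace F D ≤ Osub P := fun f hf => (h f hf).1
  let r : RRspace F D →ₗ[F] Res P := (resMap P).comp (Submodule.inclusion hO)
  have hr : LinearMap.range r ≤ LinearMap.range ι.toLinearMap := by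
    rintro _ ⟨f, rfl⟩
    obtain ⟨_, c, hc⟩ := h f f.2
    exact ⟨c, hc.symm⟩
  have h1 : Module.finrank F (LinearMap.range r) ≤ Module.finrank F κ :=
    (Submodule.finrank_mono hr).trans (LinearMap.finrank_range_le _)
  have h2 : Module.finrank F (LinearMap.ker r) ≤ ell F (D - Finsupp.single P 1) := by
    have hm : ∀ f : LinearMap.ker r, ((f : RRspace F D) : K) ∈
        RRspace F (D - Finsupp.single P 1) := by
      intro f
      rw [mem_RRspace]
      intro q
      by_cases hq : q = P
      · subst hq
        have h3 : r f = 0 := f.2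
        have h4 := (residue_eq_zero_iff q (h _ (f : RRspace F D).2).1).1 h3
        rw [Finsupp.sub_apply, hD, Finsupp.single_eq_same]
        simpa using h4
      · rw [Finsupp.sub_apply, Finsupp.single_eq_of_ne (by tauto), sub_zero]
        exact mem_RRspace.1 (f : RRspace F D).2 q
    exact LinearMap.finrank_le_finrank_of_injective
      (f := (((RRspace F D).subtype.comp (LinearMap.ker r).subtype).codRestrict _ hm))
      (fun f g hfg => Subtype.ext (Subtype.ext (congrArg (fun u : RRspace F (D - Finsupp.single P 1) => (u : K)) hfg)))
  have h3 := LinearMap.finrank_range_add_finrank_ker r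
  have h4 : ell F D = Module.finrank F (RRspace F D) := rfl
  omega

end Points

section Count

variable {K : Type} [Field K] [Algebra (ZMod 2) K] [IsG4 K]

theorem exists_place_of_point_deg {x y : K} (hx : Transcendental (ZMod 2) x) {κ : Type} [Field κ]
    [Algebra (ZMod 2) κ] [Finite κ] {a b : κ} {e : ℕ} (he : Module.finrank (ZMod 2) κ = e)
    (hs : Function.Surjective (aevalAeval (R := ZMod 2) a b))
    (H : ∀ p : (ZMod 2)[X][X], aevalAeval x y p = 0 → aevalAeval a b p = 0)
    {D : Divisor (ZMod 2) K} (hxy : ∀ f ∈ RRspace (ZMod 2) D, ∃ p : (ZMod 2)[X][X], aevalAeval x y p = f)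
    (hD : ∀ P : Place (ZMod 2) K, x ∈ P.1 → y ∈ P.1 → D P = 0)
    (hm : ∀ m : ℕ, 2 ≤ m → e + lf K (degHom (ZMod 2) K D - e * m) < lf K (degHom (ZMod 2) K D)) :
    ∃ P : Place (ZMod 2) K, ∃ (_ : placeDegree (ZMod 2) P = e) (_ : D P = 0)
      (hxP : x ∈ P.1) (hyP : y ∈ P.1) (θ : Res P →ₐ[ZMod 2] κ),
      θ (IsLocalRing.residue P.1 ⟨x, hxP⟩) = a ∧ θ (IsLocalRing.residue P.1 ⟨y, hyP⟩) = b := by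
  obtain ⟨P, hxP, hyP, ι, h1, h2⟩ := exists_place_of_point hx hs H
  have hDP := hD P hxP hyP
  have _ : FiniteDimensional (ZMod 2) κ := Module.Finite.of_finite
  have hl := ell_le_add_sub_single hDP ι (fun f hf => by
    obtain ⟨p, rfl⟩ := hxy f hf
    refine ⟨mem_of_aevalAeval P hxP hyP p, aevalAeval a b p, ?_⟩
    rw [residue_aevalAeval P hxP hyP, aevalAeval_map, h1, h2])
  let _ : Algebra κ (Res P) := ι.toRingHom.toAlgebra
  have _ : IsScalarTower (ZMod 2) κ (Res P) := IsScalarTower.of_algebraMap_eq' ι.comp_algebraMap.symm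
  have htower := Module.finrank_mul_finrank (ZMod 2) κ (Res P)
  rw [← placeDegree_eq, he] at htower
  set m := Module.finrank κ (Res P)
  have hpos := placeDegree_pos (F := ZMod 2) P
  have hm1 : m = 1 := by
    rcases Nat.lt_or_ge m 2 with h | h
    · have : m ≠ 0 := by rintro h0; rw [h0] at htower; omega
      omega
    · have := hm m h
      rw [ell_eq, ell_eq, map_sub, degHom_single, he, ← htower] at hl
      push_cast at hl
      rw [one_mul] at hl
      omega
  have hdeg : placeDegree (ZMod 2) P = e := by rw [← htower, hm1, mul_one]
  have hbij : Function.Bijective ι := by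
    refine ⟨ι.toRingHom.injective, ?_⟩
    refine (LinearMap.injective_iff_surjective_of_finrank_eq_finrank
      (f := ι.toLinearMap) ?_).1 ι.toRingHom.injective
    rw [he, ← placeDegree_eq, hdeg]
  let θ := (AlgEquiv.ofBijective ι hbij).symm
  refine ⟨P, hdeg, hDP, hxP, hyP, θ.toAlgHom, ?_, ?_⟩
  · rw [← h1]; exact (AlgEquiv.ofBijective ι hbij).symm_apply_apply a
  · rw [← h2]; exact (AlgEquiv.ofBijective ι hbij).symm_apply_apply b

/-- Points of degree `e` on a plane model are bounded by the places of degree `e`. -/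
theorem card_points_le {x y : K} (hx : Transcendental (ZMod 2) x) {κ : Type} [Field κ]
    [Algebra (ZMod 2) κ] [Finite κ] {e : ℕ} (he : Module.finrank (ZMod 2) κ = e)
    {D : Divisor (ZMod 2) K} (hxy : ∀ f ∈ RRspace (ZMod 2) D, ∃ p : (ZMod 2)[X][X], aevalAeval x y p = f)
    (hD : ∀ P : Place (ZMod 2) K, x ∈ P.1 → y ∈ P.1 → D P = 0)
    (hm : ∀ m : ℕ, 2 ≤ m → e + lf K (degHom (ZMod 2) K D - e * m) < lf K (degHom (ZMod 2) K D))
    (s : Finset (κ × κ))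
    (hs : ∀ q ∈ s, Function.Surjective (aevalAeval (R := ZMod 2) q.1 q.2) ∧
      ∀ p : (ZMod 2)[X][X], aevalAeval x y p = 0 → aevalAeval q.1 q.2 p = 0) {N : ℕ}
    (hN : ∀ R : Finset (Place (ZMod 2) K), (∀ P ∈ R, placeDegree (ZMod 2) P = e ∧ D P = 0) →
      R.card ≤ N) : s.card ≤ N * e := by
  have h : ∀ q : κ × κ, ∃ P : Place (ZMod 2) K, q ∈ s →
      ∃ (_ : placeDegree (ZMod 2) P = e) (_ : D P = 0)
      (hxP : x ∈ P.1) (hyP : y ∈ P.1) (θ : Res P →ₐ[ZMod 2] κ),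
      θ (IsLocalRing.residue P.1 ⟨x, hxP⟩) = q.1 ∧ θ (IsLocalRing.residue P.1 ⟨y, hyP⟩) = q.2 := by
    intro q
    by_cases hq : q ∈ s
    · obtain ⟨P, h⟩ := exists_place_of_point_deg hx he (hs q hq).1 (hs q hq).2 hxy hD hm
      exact ⟨P, fun _ => h⟩
    · obtain ⟨P, _⟩ := exists_pole (F := ZMod 2) (K := K) (f := x) (by
        rintro ⟨c, rfl⟩; exact hx (isAlgebraic_algebraMap c))
      exact ⟨P, fun h => absurd h hq⟩
  choose f hf using h
  have hR := hN (s.image f) (by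
    intro P hP
    obtain ⟨q, hq, rfl⟩ := Finset.mem_image.1 hP
    obtain ⟨h1, h2, _⟩ := hf q hq
    exact ⟨h1, h2⟩)
  refine (Finset.card_le_mul_card_image (f := f) s e ?_).trans ?_
  · intro P hP
    have _ : Finite (Res P →ₐ[ZMod 2] κ) := inferInstance
    have hdeg : placeDegree (ZMod 2) P = e := by
      obtain ⟨q, hq, rfl⟩ := Finset.mem_image.1 hP
      exact (hf q hq).1
    have h1 := card_algHom_le_finrank (ZMod 2) (Res P) κ
    rw [← placeDegree_eq, hdeg] at h1
    refine le_trans ?_ h1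
    have hg : ∀ q : κ × κ, ∃ θ : Res P →ₐ[ZMod 2] κ, q ∈ s.filter (fun q => f q = P) →
        ∃ (hxP : x ∈ P.1) (hyP : y ∈ P.1), θ (IsLocalRing.residue P.1 ⟨x, hxP⟩) = q.1 ∧
          θ (IsLocalRing.residue P.1 ⟨y, hyP⟩) = q.2 := by
      obtain ⟨q₀, hq₀, rfl⟩ := Finset.mem_image.1 hP
      intro q
      by_cases hq : q ∈ s.filter (fun q => f q = f q₀)
      · obtain ⟨hq1, hq2⟩ := Finset.mem_filter.1 hq
        obtain ⟨_, _, hxP, hyP, θ, h⟩ := hf q hq1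
        rw [← hq2]
        exact ⟨θ, fun _ => ⟨hxP, hyP, h⟩⟩
      · obtain ⟨_, _, _, _, θ, _⟩ := hf q₀ hq₀
        exact ⟨θ, fun h => absurd h hq⟩
    choose g hg using hg
    have _ := Fintype.ofFinite (Res P →ₐ[ZMod 2] κ)
    rw [Nat.card_eq_fintype_card]
    refine Finset.card_le_card_of_injOn g (fun _ _ => Finset.mem_univ _) ?_
    intro q hq q' hq' h
    obtain ⟨_, _, h1, h2⟩ := hg q hq
    obtain ⟨_, _, h3, h4⟩ := hg q' hq'
    exact Prod.ext (by rw [← h1, ← h3, h]) (by rw [← h2, ← h4, h])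
  · rw [mul_comm]; exact Nat.mul_le_mul_right _ hR

end Count

end CFF

namespace CFF

open Polynomial

section FiniteFields

/-- The `e`-bit digit of `v` at bit offset `o`. -/
def nib (o e v : ℕ) : ℕ := (v >>> o) % 2 ^ e

theorem nib_xor (o e v w : ℕ) : nib o e (v ^^^ w) = nib o e v ^^^ nib o e w := by
  rw [nib, Nat.shiftRight_xor_distrib, Nat.xor_mod_two_pow]; rfl

theorem nib_lt (o e v : ℕ) : nib o e v < 2 ^ e := Nat.mod_lt _ (by positivity)

theorem nib_zero (o e : ℕ) : nib o e 0 = 0 := by simp [nib]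

/-- Multiplication read off a packed multiplication table. -/
def tmul (e t a b : ℕ) : ℕ := nib (e * (a * 2 ^ e + b)) e t

def allLt (n : ℕ) (f : ℕ → Bool) : Bool :=
  Nat.rec true (fun k ih => and (f k) ih) n

theorem of_allLt {n : ℕ} {f : ℕ → Bool} (h : allLt n f = true) : ∀ k < n, f k = true := by
  induction n with
  | zero => intro k hk; omega
  | succ n ih =>
    change (f n && allLt n f) = true at h
    rw [Bool.and_eq_true] at h
    intro k hk
    rcases Nat.lt_succ_iff_lt_or_eq.1 hk with h1 | rfl
    · exact ih h.2 k h1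
    · exact h.1

/-- The multiplication table `t` defines a field on the `e`-bit numbers under bitwise addition. -/
def isTable (e t : ℕ) : Bool :=
  and (Nat.blt 0 e) <| allLt (2 ^ e) fun a => and (Nat.beq (tmul e t a 1) a) <|
    allLt (2 ^ e) fun b =>
      and (Nat.beq (tmul e t a b) (tmul e t b a)) <|
      and (or (or (Nat.beq a 0) (Nat.beq b 0)) (not (Nat.beq (tmul e t a b) 0))) <|
      allLt (2 ^ e) fun c =>
        and (Nat.beq (tmul e t (tmul e t a b) c) (tmul e t a (tmul e t b c)))
          (Nat.beq (tmul e t a (Nat.xor b c)) (Nat.xor (tmul e t a b) (tmul e t a c)))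

class TableField (e t : ℕ) : Prop where
  check : isTable e t = true

def tbl1 : ℕ :=
  8

def tbl2 : ℕ :=
  2625168384

def tbl3 : ℕ :=
  2821848294356612419217921029917578219971947684264937521152

def tbl4 : ℕ :=
  116196760129267793630862849262464326346044543732748708940920453221664288556434379745879494961270582141731748813355742142288220638766218855867759359510984593843506004200114943278699875244065120512813025380665946106619127097398772031257643617143689515450995722003729973585221105779229319991106539050771048038400

def tbl5 : ℕ :=
  1080479032087761823018211772211032424761431165939550601302933045899793796247925151534488420485575080629440461244062296952960669259146067625816894610020857784948699212533089932998718160929854919760451690175594109156412503671374870774742677624751658461920525921680254615955760716646561685513908120302828105471422735757076859920719516304396071967631600039836959861425527618571370028614410915388542898250632461069961115855226122705943878937926046776438062784208660952004294988348751642784539093188588739283613504515420753593895853508468960326372810382131677984103574141907468855912386723965552863149272251044902760042818022756121863105388970128213094669520714740625672915107248442403282317945071789690649976695816752608901715796618618047812879471798683462792169253693727925707698786900618952516336901879347668532495254749529308343318095737259423229421288596145768568961072089644576761104042901235498303619151778334753211433384193708447029558436876823354967287042465404199062217536206763855083419372561568400965447121121632143448874315638466207921432990572941295626897295006585357910136004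37345014523103774325441249963724119162034606046898190840942821086017654297642452944418259132037807734164211605724739782819781353435761009390836216362900777584713462606884327330779408941635095127726452318274311602862610838031905185084111375203469849716078223880040803555184033898903431904408499901976387979014468435507345745772488651003084902781458751948967454175797339287002946443741078296424767125593778879332774650111994871979244289813779477452088152162304

instance : TableField 1 tbl1 := ⟨by decide +kernel⟩
instance : TableField 2 tbl2 := ⟨by decide +kernel⟩
instance : TableField 3 tbl3 := ⟨by decide +kernel⟩
instance : TableField 4 tbl4 := ⟨by decide +kernel⟩
instance : TableField 5 tbl5 := ⟨by decide +kernel⟩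

theorem TableField.spec (e t : ℕ) [h : TableField e t] : 0 < e ∧ ∀ a < 2 ^ e, tmul e t a 1 = a ∧
    ∀ b < 2 ^ e, tmul e t a b = tmul e t b a ∧ (tmul e t a b = 0 → a = 0 ∨ b = 0) ∧
      ∀ c < 2 ^ e, tmul e t (tmul e t a b) c = tmul e t a (tmul e t b c) ∧
        tmul e t a (b ^^^ c) = tmul e t a b ^^^ tmul e t a c := by
  have h := h.check
  rw [isTable, Bool.and_eq_true] at h
  refine ⟨Nat.le_of_ble_eq_true h.1, fun a ha => ?_⟩
  have h1 := of_allLt h.2 a ha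
  rw [Bool.and_eq_true] at h1
  refine ⟨Nat.eq_of_beq_eq_true h1.1, fun b hb => ?_⟩
  have h2 := of_allLt h1.2 b hb
  rw [Bool.and_eq_true, Bool.and_eq_true] at h2
  refine ⟨Nat.eq_of_beq_eq_true h2.1, ?_, fun c hc => ?_⟩
  · intro h0
    have h3 := h2.2.1
    rw [h0, Bool.or_eq_true, Bool.or_eq_true] at h3
    exact (h3.resolve_right (by decide)).imp Nat.eq_of_beq_eq_true Nat.eq_of_beq_eq_true
  · have h3 := of_allLt h2.2.2 c hc
    rw [Bool.and_eq_true] at h3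
    exact ⟨Nat.eq_of_beq_eq_true h3.1, Nat.eq_of_beq_eq_true h3.2⟩

/-- The finite field with a given multiplication table. -/
structure TF (e t : ℕ) where
  val : ℕ
  lt : val < 2 ^ e

namespace TF

variable {e t : ℕ}

@[ext] theorem ext {a b : TF e t} (h : a.val = b.val) : a = b := by
  cases a; cases b; cases h; rfl

theorem val_injective : Function.Injective (TF.val : TF e t → ℕ) := fun _ _ => TF.ext

/-- The element with code `n mod 2 ^ e`. -/
def mk' (e t n : ℕ) : TF e t := ⟨n % 2 ^ e, Nat.mod_lt _ (by positivity)⟩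

theorem val_mk' {n : ℕ} (h : n < 2 ^ e) : (mk' e t n).val = n := Nat.mod_eq_of_lt h

variable [TableField e t]

instance : Zero (TF e t) := ⟨⟨0, by positivity⟩⟩
instance : One (TF e t) := ⟨⟨1, Nat.one_lt_two_pow (TableField.spec e t).1.ne'⟩⟩
instance : Add (TF e t) := ⟨fun a b => ⟨a.val ^^^ b.val, Nat.xor_lt_two_pow a.lt b.lt⟩⟩
instance : Neg (TF e t) := ⟨fun a => a⟩
instance : Mul (TF e t) := ⟨fun a b => ⟨tmul e t a.val b.val, nib_lt _ _ _⟩⟩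

theorem val_zero : (0 : TF e t).val = 0 := rfl
theorem val_one : (1 : TF e t).val = 1 := rfl
theorem val_add (a b : TF e t) : (a + b).val = a.val ^^^ b.val := rfl
theorem val_mul (a b : TF e t) : (a * b).val = tmul e t a.val b.val := rfl

theorem mul_comm' (a b : TF e t) : a * b = b * a :=
  TF.ext (((TableField.spec e t).2 _ a.lt).2 _ b.lt).1

theorem mul_add' (a b c : TF e t) : a * (b + c) = a * b + a * c :=
  TF.ext ((((TableField.spec e t).2 _ a.lt).2 _ b.lt).2.2 _ c.lt).2

theorem mul_one' (a : TF e t) : a * 1 = a := TF.ext ((TableField.spec e t).2 _ a.lt).1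

theorem add_self' (a : TF e t) : a + a = 0 := TF.ext (Nat.xor_self _)

theorem mul_zero' (a : TF e t) : a * 0 = 0 := by
  have := mul_add' a 0 0
  rwa [add_self', add_self'] at this

instance : CommRing (TF e t) where
  add_assoc a b c := TF.ext (Nat.xor_assoc _ _ _)
  zero_add a := TF.ext (Nat.zero_xor _)
  add_zero a := TF.ext (Nat.xor_zero _)
  add_comm a b := TF.ext (Nat.xor_comm _ _)
  nsmul := nsmulRec
  zsmul := zsmulRec
  neg_add_cancel a := add_self' a
  mul_assoc a b c := TF.ext ((((TableField.spec e t).2 _ a.lt).2 _ b.lt).2.2 _ c.lt).1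
  mul_comm := mul_comm'
  one_mul a := (mul_comm' _ _).trans (mul_one' a)
  mul_one := mul_one'
  left_distrib := mul_add'
  right_distrib a b c := by
    rw [mul_comm' (a + b) c, mul_add', mul_comm' c, mul_comm' c]
  zero_mul a := (mul_comm' _ _).trans (mul_zero' a)
  mul_zero := mul_zero'

instance : Nontrivial (TF e t) := ⟨0, 1, fun h => Nat.zero_ne_one (congrArg TF.val h)⟩

instance : NoZeroDivisors (TF e t) where
  eq_zero_or_eq_zero_of_mul_eq_zero {a b} h := by
    rcases (((TableField.spec e t).2 _ a.lt).2 _ b.lt).2.1 (congrArg TF.val h) with h | h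
    · exact Or.inl (TF.ext h)
    · exact Or.inr (TF.ext h)

instance : IsDomain (TF e t) := NoZeroDivisors.to_isDomain _

/-- Numbers below `2 ^ e` as field elements. -/
def equivFin : TF e t ≃ Fin (2 ^ e) where
  toFun a := ⟨a.val, a.lt⟩
  invFun a := ⟨a.1, a.2⟩
  left_inv _ := rfl
  right_inv _ := rfl

instance : Fintype (TF e t) := Fintype.ofEquiv _ equivFin.symm

instance : Field (TF e t) := (Finite.isField_of_domain (TF e t)).toField

instance : CharP (TF e t) 2 :=
  CharTwo.of_one_ne_zero_of_two_eq_zero one_ne_zero (by rw [← one_add_one_eq_two, add_self'])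

instance : Algebra (ZMod 2) (TF e t) := ZMod.algebra _ 2

theorem finrank_eq : Module.finrank (ZMod 2) (TF e t) = e := by
  have h := Module.card_eq_pow_finrank (K := ZMod 2) (V := TF e t)
  rw [ZMod.card, Fintype.card_congr equivFin, Fintype.card_fin] at h
  exact (Nat.pow_right_injective le_rfl h).symm

end TF

/-- Non-membership in a maximal subfield forces generation. -/
theorem surjective_aevalAeval {κ : Type} [Field κ] [Algebra (ZMod 2) κ] [Finite κ] {e e' : ℕ}
    (he : Module.finrank (ZMod 2) κ = e) {a b : κ}
    (h : ∀ d, d ∣ e → d ≠ e → d ∣ e' ∧ ¬ (a ^ 2 ^ e' = a ∧ b ^ 2 ^ e' = b)) :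
    Function.Surjective (aevalAeval (R := ZMod 2) a b) := by
  let A := (aevalAeval (R := ZMod 2) a b).range
  have _ : FiniteDimensional (ZMod 2) κ := Module.Finite.of_finite
  let L : IntermediateField (ZMod 2) κ := A.toIntermediateField (fun x hx =>
    A.inv_mem_of_algebraic (x := ⟨x, hx⟩) (Algebra.IsAlgebraic.isAlgebraic x))
  have haL : a ∈ L := ⟨C X, by simp⟩
  have hbL : b ∈ L := ⟨X, by simp⟩
  by_cases hL : Module.finrank (ZMod 2) L = e
  · have h1 : L = ⊤ := by
      refine IntermediateField.eq_of_le_of_finrank_eq le_top ?_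
      rw [hL, IntermediateField.finrank_top', he]
    intro c
    have : c ∈ L := h1 ▸ IntermediateField.mem_top
    exact this
  · have hdvd : Module.finrank (ZMod 2) L ∣ e := ⟨_, he ▸ (Module.finrank_mul_finrank _ L _).symm⟩
    obtain ⟨⟨m, rfl⟩, h2⟩ := h _ hdvd hL
    have hp : ∀ c ∈ L, c ^ 2 ^ (Module.finrank (ZMod 2) L * m) = c := by
      intro c hc
      have _ := Fintype.ofFinite L
      have h3 := FiniteField.pow_card_pow m (⟨c, hc⟩ : L)
      rw [Module.card_eq_pow_finrank (K := ZMod 2), ZMod.card, ← pow_mul] at h3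
      exact congrArg Subtype.val h3
    exact absurd ⟨hp a haL, hp b hbL⟩ h2

end FiniteFields

end CFF

namespace CFF

open Polynomial

section Enumeration

def tfrob (e t n a : ℕ) : ℕ := Nat.rec a (fun _ ih => tmul e t ih ih) n

def tpow (e t a n : ℕ) : ℕ := Nat.rec 1 (fun _ ih => tmul e t ih a) n

/-- The monomial `X ^ i * Y ^ j * (X ^ 2 + X * Y + Y ^ 2) ^ k`. -/
def mono (m : ℕ × ℕ × ℕ) : (ZMod 2)[X][X] :=
  C X ^ m.1 * X ^ m.2.1 * (C X ^ 2 + C X * X + X ^ 2) ^ m.2.2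

def tmono (e t : ℕ) (m : ℕ × ℕ × ℕ) (a b : ℕ) : ℕ :=
  tmul e t (tmul e t (tpow e t a m.1) (tpow e t b m.2.1))
    (tpow e t (Nat.xor (Nat.xor (tmul e t a a) (tmul e t a b)) (tmul e t b b)) m.2.2)

def polyOf : List Bool → List (ℕ × ℕ × ℕ) → (ZMod 2)[X][X]
  | b :: c, m :: ms => (if b then mono m else 0) + polyOf c ms
  | _, _ => 0

def xorOf : List Bool → List ℕ → ℕ
  | b :: c, v :: vs => (if b then v else 0) ^^^ xorOf c vs
  | _, _ => 0

/-- The number of zero digits among the first `n`, plus `acc`. -/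
def cz (e n v acc : ℕ) : ℕ :=
  Nat.rec (fun _ acc => acc)
    (fun _ ih v acc => ih (v >>> e) (cond (Nat.beq (v % 2 ^ e) 0) (acc + 1) acc)) n v acc

theorem cz_eq (e n v acc : ℕ) :
    cz e n v acc = ((Finset.range n).filter fun i => nib (e * i) e v = 0).card + acc := by
  have h : ∀ n v acc, cz e n v acc = Nat.count (fun i => nib (e * i) e v = 0) n + acc := by
    intro n
    induction n with
    | zero => intro v acc; simp [cz]
    | succ n ih =>
      intro v acc
      change cz e n (v >>> e) _ = _
      have h1 : ∀ i, nib (e * (i + 1)) e v = nib (e * i) e (v >>> e) := by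
        intro i; rw [nib, nib, ← Nat.shiftRight_add, mul_add, mul_one, add_comm]
      rw [ih, Nat.count_succ']
      simp only [h1]
      have h2 : nib (e * 0) e v = v % 2 ^ e := by rw [nib, mul_zero, Nat.shiftRight_zero]
      rw [h2]
      by_cases h3 : v % 2 ^ e = 0
      · rw [h3, if_pos rfl]; change _ + (acc + 1) = _; ring
      · rw [if_neg h3, Bool.eq_false_iff.2 fun h4 => h3 (Nat.eq_of_beq_eq_true h4)]; rfl
  rw [h, Nat.count_eq_card_filter_range]

section

variable {e t : ℕ} [TableField e t]

theorem TF.val_frob (a : TF e t) (n : ℕ) : (a ^ 2 ^ n).val = tfrob e t n a.val := by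
  induction n with
  | zero => simp [tfrob]
  | succ n ih =>
    rw [pow_succ, pow_mul, pow_two, TF.val_mul, ih]; rfl

theorem TF.val_pow (a : TF e t) (n : ℕ) : (a ^ n).val = tpow e t a.val n := by
  induction n with
  | zero => rw [pow_zero]; rfl
  | succ n ih => rw [pow_succ, TF.val_mul, ih]; rfl

theorem TF.val_mono (a b : TF e t) (m : ℕ × ℕ × ℕ) :
    (aevalAeval a b (mono m)).val = tmono e t m a.val b.val := by
  have : aevalAeval a b (mono m) = a ^ m.1 * b ^ m.2.1 * (a * a + a * b + b * b) ^ m.2.2 := by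
    simp [mono, pow_two, mul_comm b a]
  rw [this, TF.val_mul, TF.val_mul, TF.val_pow, TF.val_pow, TF.val_pow, TF.val_add, TF.val_add,
    TF.val_mul, TF.val_mul, TF.val_mul]
  rfl

def matchVals (e t o a b : ℕ) : List (ℕ × ℕ × ℕ) → List ℕ → Bool
  | m :: ms, v :: vs =>
    and (Nat.beq (tmono e t m a b) (nib (o + e * (a * 2 ^ e + b)) e v)) (matchVals e t o a b ms vs)
  | _, _ => true

/-- The digits of `vs` are the values of the monomials `ms` at all points over the table field. -/
def isVals (e t o : ℕ) (ms : List (ℕ × ℕ × ℕ)) (vs : List ℕ) : Bool :=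
  allLt (2 ^ e) fun a => allLt (2 ^ e) fun b => matchVals e t o a b ms vs

theorem val_polyOf {o : ℕ} {a b : TF e t} : ∀ {ms : List (ℕ × ℕ × ℕ)} {vs : List ℕ}
    (_ : ms.length = vs.length) (_ : matchVals e t o a.val b.val ms vs = true) (c : List Bool),
    (aevalAeval a b (polyOf c ms)).val = nib (o + e * (a.val * 2 ^ e + b.val)) e (xorOf c vs)
  | [], [], _, _, c => by
    cases c <;> simp only [polyOf, xorOf, map_zero, nib_zero] <;> rfl
  | m :: ms, v :: vs, hl, h, [] => by
    simp only [polyOf, xorOf, map_zero, nib_zero]; rfl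
  | m :: ms, v :: vs, hl, h, d :: c => by
    rw [matchVals, Bool.and_eq_true] at h
    rw [polyOf, xorOf, map_add, TF.val_add, nib_xor,
      val_polyOf (by simpa using hl) h.2 c]
    congr 1
    cases d
    · simp only [Bool.false_eq_true, if_false, map_zero, nib_zero]; rfl
    · simp only [if_true]
      rw [TF.val_mono]
      exact Nat.eq_of_beq_eq_true h.1

/-- The nonzero digits of `G` cover all points over the maximal subfield. -/
def isMask (e t e' G : ℕ) : Bool :=
  allLt (2 ^ e) fun a => allLt (2 ^ e) fun b => or (Nat.beq e 1) <|
    or (not (Nat.beq (nib (e * (a * 2 ^ e + b)) e G) 0)) <|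
      not (and (Nat.beq (tfrob e t e' a) a) (Nat.beq (tfrob e t e' b) b))

theorem exists_points {e' o G : ℕ} {ms : List (ℕ × ℕ × ℕ)} {vs : List ℕ}
    (hl : ms.length = vs.length) (hv : isVals e t o ms vs = true) (hG : isMask e t e' G = true)
    (he' : ∀ d, d ∣ e → d ≠ e → d ∣ e') (c : List Bool) :
    ∃ s : Finset (TF e t × TF e t), s.card = cz e (4 ^ e) ((xorOf c vs >>> o) ||| G) 0 ∧
      ∀ q ∈ s, Function.Surjective (aevalAeval (R := ZMod 2) q.1 q.2) ∧
        aevalAeval q.1 q.2 (polyOf c ms) = 0 := by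
  set V := xorOf c vs with hV
  set T := (Finset.range (4 ^ e)).filter fun i => nib (e * i) e ((V >>> o) ||| G) = 0 with hT
  have h4 : 4 ^ e = 2 ^ e * 2 ^ e := by rw [← mul_pow]; norm_num
  have hdm : ∀ i, i / 2 ^ e * 2 ^ e + i % 2 ^ e = i := fun i => by
    rw [mul_comm]; exact Nat.div_add_mod i (2 ^ e)
  have hlt : ∀ i ∈ T, i / 2 ^ e < 2 ^ e ∧ i % 2 ^ e < 2 ^ e := fun i hi => by
    have := Finset.mem_range.1 (Finset.mem_filter.1 hi).1
    exact ⟨Nat.div_lt_of_lt_mul (h4 ▸ this), Nat.mod_lt _ (by positivity)⟩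
  refine ⟨T.image fun i => (TF.mk' e t (i / 2 ^ e), TF.mk' e t (i % 2 ^ e)), ?_, ?_⟩
  · rw [Finset.card_image_of_injOn, cz_eq, add_zero]
    intro i hi j hj hij
    have h1 := congrArg (fun q : TF e t × TF e t => q.1.val * 2 ^ e + q.2.val) hij
    simp only [TF.val_mk' (hlt i hi).1, TF.val_mk' (hlt i hi).2, TF.val_mk' (hlt j hj).1,
      TF.val_mk' (hlt j hj).2, hdm] at h1
    exact h1
  · intro q hq
    obtain ⟨i, hi, rfl⟩ := Finset.mem_image.1 hq
    obtain ⟨ha, hb⟩ := hlt i hi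
    have hz := (Finset.mem_filter.1 hi).2
    have hor : nib (e * i) e ((V >>> o) ||| G) = nib (e * i) e (V >>> o) ||| nib (e * i) e G := by
      rw [nib, Nat.shiftRight_or_distrib, Nat.or_mod_two_pow]; rfl
    rw [hor, Nat.or_eq_zero_iff] at hz
    constructor
    · refine surjective_aevalAeval TF.finrank_eq (fun d hd hde => ⟨he' d hd hde, fun hf => ?_⟩)
      have h1 := of_allLt (of_allLt hG _ ha) _ hb
      rw [hdm, hz.2, Bool.or_eq_true, Bool.or_eq_true] at h1
      rcases h1 with h1 | h1 | h1
      · have h2 := Nat.eq_of_beq_eq_true h1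
        rw [h2, Nat.dvd_one] at hd
        omega
      · exact absurd h1 (by decide)
      · have h2 := congrArg TF.val hf.1
        have h3 := congrArg TF.val hf.2
        rw [TF.val_frob, TF.val_mk' ha] at h2
        rw [TF.val_frob, TF.val_mk' hb] at h3
        rw [h2, h3, Nat.beq_refl, Nat.beq_refl] at h1
        exact absurd h1 (by decide)
    · refine TF.ext ?_
      have h1 := of_allLt (of_allLt hv _ ha) _ hb
      rw [val_polyOf hl (o := o) (by rw [TF.val_mk' ha, TF.val_mk' hb]; exact h1), TF.val_mk' ha,
        TF.val_mk' hb, hdm, TF.val_zero]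
      rw [nib, ← Nat.shiftRight_add] at hz
      exact hz.1

theorem cz_pos_of_point {o : ℕ} {ms : List (ℕ × ℕ × ℕ)} {vs : List ℕ}
    (hl : ms.length = vs.length) (hv : isVals e t o ms vs = true) (c : List Bool) {a b : TF e t}
    (h : aevalAeval a b (polyOf c ms) = 0) : 0 < cz e (4 ^ e) (xorOf c vs >>> o) 0 := by
  rw [cz_eq, add_zero, Finset.card_pos]
  refine ⟨a.val * 2 ^ e + b.val, Finset.mem_filter.2 ⟨Finset.mem_range.2 ?_, ?_⟩⟩
  · have h4 : 4 ^ e = 2 ^ e * 2 ^ e := by rw [← mul_pow]; norm_num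
    have := a.lt; have := b.lt
    rw [h4]; nlinarith
  · have h1 := of_allLt (of_allLt hv _ a.lt) _ b.lt
    have h2 := val_polyOf hl h1 c
    rw [h, TF.val_zero, nib, Nat.shiftRight_add] at h2
    exact h2.symm

end

/-- Depth-first search through all subsets of `vs`, with running bitwise sum. -/
def tree (leaf : ℕ → List Bool → Bool) (vs : List ℕ) (acc : ℕ) (c : List Bool) : Bool :=
  List.rec (fun acc c => leaf acc c)
    (fun v _ ih acc c => and (ih acc (false :: c)) (ih (acc ^^^ v) (true :: c))) vs acc c

theorem of_tree {leaf : ℕ → List Bool → Bool} : ∀ {vs : List ℕ} {acc : ℕ} {c : List Bool}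
    (_ : tree leaf vs acc c = true) {d : List Bool} (_ : d.length = vs.length),
    leaf (acc ^^^ xorOf d vs) (d.reverseAux c) = true
  | [], acc, c, h, [], _ => by simpa [xorOf] using (show leaf acc c = true from h)
  | v :: vs, acc, c, h, b :: d, hd => by
    have h : and (tree leaf vs acc (false :: c)) (tree leaf vs (acc ^^^ v) (true :: c)) = true := h
    rw [Bool.and_eq_true] at h
    have hd' : d.length = vs.length := by simpa using hd
    cases b
    · have := of_tree h.1 hd'
      simpa [xorOf] using this
    · have := of_tree h.2 hd'
      simpa [xorOf, Nat.xor_assoc] using this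

theorem exists_polyOf {M : Type} [AddCommGroup M] [Module (ZMod 2) M]
    (φ : (ZMod 2)[X][X] →ₗ[ZMod 2] M) : ∀ (ms : List (ℕ × ℕ × ℕ)) {w : M}
    (_ : w ∈ Submodule.span (ZMod 2) {u | ∃ m ∈ ms, φ (mono m) = u}),
    ∃ c : List Bool, c.length = ms.length ∧ φ (polyOf c ms) = w
  | [], w, hw => ⟨[], rfl, by simpa [polyOf, eq_comm] using hw⟩
  | m :: ms, w, hw => by
    have h1 : {u | ∃ m' ∈ m :: ms, φ (mono m') = u} =
        insert (φ (mono m)) {u | ∃ m' ∈ ms, φ (mono m') = u} := by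
      ext u; simp [eq_comm]
    rw [h1, Submodule.mem_span_insert] at hw
    obtain ⟨a, z, hz, rfl⟩ := hw
    obtain ⟨c, hc, rfl⟩ := exists_polyOf φ ms hz
    obtain rfl | rfl : a = 0 ∨ a = 1 := by revert a; decide
    · exact ⟨false :: c, by simp [hc], by simp [polyOf]⟩
    · exact ⟨true :: c, by simp [hc], by simp [polyOf]⟩

end Enumeration

end CFF

namespace CFF

section SmallDegree

variable {K : Type} [Field K] [Algebra (ZMod 2) K] [IsG4 K]

theorem eq_zero_of_mem_effs {D : Divisor (ZMod 2) K} (h : D ∈ effs K 0) : D = 0 :=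
  (eq_of_le_of_deg h.1 (by rw [h.2, map_zero])).symm

theorem eq_single_of_mem_effs {n : ℤ} (hn : 0 < n)
    (h : ∀ m, 0 < m → m < n → lf K m = 0 ∨ lf K (n - m) = 0) {D : Divisor (ZMod 2) K}
    (hD : D ∈ effs K n) :
    ∃ P : Place (ZMod 2) K, placeDegree (ZMod 2) P = n ∧ D = Finsupp.single P 1 := by
  obtain ⟨P, E, hE, rfl⟩ := exists_place_add hn.ne' hD
  have h1 := placeDegree_pos (F := ZMod 2) P
  have h2 := lf_pos_of_mem hE
  have h3 := lf_pos P
  have h4 : (placeDegree (ZMod 2) P : ℤ) = n := by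
    by_contra hne
    rcases lt_or_gt_of_ne hne with h5 | h5
    · rcases h _ (by omega) h5 with h6 | h6 <;> omega
    · rw [lf_neg K (by omega)] at h2; omega
  rw [h4, sub_self] at hE
  exact ⟨P, h4, by rw [eq_zero_of_mem_effs hE, add_zero]⟩

theorem exists_place_of_lf {n : ℤ} (hn : 0 < n)
    (h : ∀ m, 0 < m → m < n → lf K m = 0 ∨ lf K (n - m) = 0) (h1 : 1 ≤ lf K n) :
    ∃ P : Place (ZMod 2) K, placeDegree (ZMod 2) P = n := by
  obtain ⟨D, hD⟩ := exists_mem_effs h1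
  obtain ⟨P, hP, _⟩ := eq_single_of_mem_effs hn h hD
  exact ⟨P, hP⟩

theorem lf_le_add_place (P : Place (ZMod 2) K) (n : ℤ) :
    lf K n ≤ lf K (n - placeDegree (ZMod 2) P) + placeDegree (ZMod 2) P := by
  have h := ell_le_of_le (D := dvs K n - Finsupp.single P 1) (E := dvs K n) (by simp)
  rw [ell_eq, ell_eq, map_sub, deg_dvs, degHom_single, one_mul] at h
  omega

variable (K)

theorem lf_le {n : ℕ} : lf K n ≤ n + 1 := by
  rcases Nat.eq_zero_or_pos (lf K n) with h | h
  · omega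
  · obtain ⟨D, hD, hd⟩ := exists_mem_effs h
    have := ell_le_of_le hD
    rw [ell_zero, ell_eq, hd, map_zero] at this
    omega

theorem lf_one_le : lf K 1 ≤ 1 := by
  by_contra! h
  obtain ⟨D, hD, hd⟩ := exists_mem_effs (K := K) (n := 1) (by omega)
  obtain ⟨x, hx, htr⟩ := exists_transcendental (D := D) (by rw [ell_eq, hd]; omega)
  have := succ_le_ell hD htr hx 6
  rw [ell_eq, map_nsmul, hd] at this
  norm_num [lf_six] at this

theorem exists_finset_places {n : ℤ} (hn : 0 < n)
    (h : ∀ m, 0 < m → m < n → lf K m = 0 ∨ lf K (n - m) = 0) :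
    ∃ S : Finset (Place (ZMod 2) K), (∀ P ∈ S, (placeDegree (ZMod 2) P : ℤ) = n) ∧
      S.card = 2 ^ lf K n - 1 := by
  have h1 : ∀ D : Divisor (ZMod 2) K, D ∈ effs K n → ∃ P : Place (ZMod 2) K,
      placeDegree (ZMod 2) P = n ∧ D = Finsupp.single P 1 := fun D hD =>
    eq_single_of_mem_effs hn h hD
  have hinj : Function.Injective fun P : Place (ZMod 2) K => (Finsupp.single P 1 : Divisor _ K) :=
    Finsupp.single_left_injective one_ne_zero
  have h2 : ((fun P : Place (ZMod 2) K => (Finsupp.single P 1 : Divisor _ K)) ⁻¹'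
      effs K n).Finite := (finite_effs K n).preimage hinj.injOn
  refine ⟨h2.toFinset, fun P hP => ?_, ?_⟩
  · rw [Set.Finite.mem_toFinset] at hP
    obtain ⟨Q, hQ, h3⟩ := h1 _ hP
    rw [hinj h3, hQ]
  · rw [← ncard_effs, ← Set.ncard_eq_toFinset_card _ h2, ← Set.ncard_image_of_injective _ hinj,
      Set.image_preimage_eq_of_subset]
    intro D hD
    obtain ⟨P, _, rfl⟩ := h1 D hD
    exact ⟨P, rfl⟩

theorem lf_two_le : lf K 2 ≤ 2 := by
  have h1 := lf_one_le K
  rcases Nat.eq_zero_or_pos (lf K 1) with h | h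
  · by_contra! hc
    have h3 := lf_le K (n := 2)
    obtain ⟨S, hS, hc'⟩ := exists_finset_places K (n := 2) (by norm_num) (fun m hm hm2 => by
      obtain rfl : m = 1 := by omega
      exact Or.inl h)
    have h4 := card_pairs_add 2 (by norm_num) S ∅ (fun p hp => by exact_mod_cast hS p hp) (by simp)
    push_cast at h3 h4
    have h5 : lf K 2 = 3 := by omega
    have h6 := lf_four K
    rw [hc', h6, h5] at h4
    norm_num [Nat.choose] at h4
  · obtain ⟨P, hP⟩ := exists_place_of_lf (K := K) (n := 1) (by norm_num) (by intros; omega) h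
    have := lf_le_add_place P 2
    rw [hP] at this
    norm_num at this
    have : placeDegree (ZMod 2) P = 1 := by exact_mod_cast hP
    omega

theorem lf_three_le (h2 : lf K 2 ≤ 1) : lf K 3 ≤ 2 := by
  have h1 := lf_one_le K
  rcases Nat.eq_zero_or_pos (lf K 1) with h | h
  · rcases Nat.eq_zero_or_pos (lf K 2) with h' | h'
    · by_contra! hc
      have hm : ∀ m : ℤ, 0 < m → m < 3 → lf K m = 0 ∨ lf K (3 - m) = 0 := by
        intro m hm hm2
        obtain rfl | rfl : m = 1 ∨ m = 2 := by omega
        · exact Or.inl h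
        · exact Or.inl h'
      have h3 := lf_le K (n := 3)
      obtain ⟨S, hS, hc'⟩ := exists_finset_places K (n := 3) (by norm_num) hm
      have h4 := card_pairs_add 3 (by norm_num) S ∅ (fun p hp => by exact_mod_cast hS p hp)
        (by simp)
      push_cast at h3 h4
      have h6 := lf_six K
      rw [hc', h6] at h4
      have : lf K 3 = 3 ∨ lf K 3 = 4 := by omega
      rcases this with h5 | h5 <;> rw [h5] at h4 <;> norm_num [Nat.choose] at h4
    · obtain ⟨P, hP⟩ := exists_place_of_lf (K := K) (n := 2) (by norm_num) (fun m hm hm2 => by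
        obtain rfl : m = 1 := by omega
        exact Or.inl h) h'
      have := lf_le_add_place P 3
      rw [hP] at this
      norm_num at this
      have : placeDegree (ZMod 2) P = 2 := by exact_mod_cast hP
      omega
  · obtain ⟨P, hP⟩ := exists_place_of_lf (K := K) (n := 1) (by norm_num) (by intros; omega) h
    have := lf_le_add_place P 3
    rw [hP] at this
    norm_num at this
    have : placeDegree (ZMod 2) P = 1 := by exact_mod_cast hP
    omega

theorem lf_le_of_le_two {n : ℤ} (hn : n ≤ 2) : lf K n ≤ 2 := by
  rcases lt_or_ge n 0 with h | h
  · rw [lf_neg K h]; omega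
  · have := lf_zero K
    have := lf_one_le K
    have := lf_two_le K
    obtain rfl | rfl | rfl : n = 0 ∨ n = 1 ∨ n = 2 := by omega
    all_goals omega

theorem lf_le_max (n : ℤ) : (lf K n : ℤ) ≤ max 4 (n - 3) := by
  rcases le_or_gt n 2 with h | h
  · have := lf_le_of_le_two K h; omega
  · rcases le_or_gt 7 n with h7 | h7
    · rw [lf_large K h7]; omega
    · have h1 := lf_one_le K
      have h2 := lf_two_le K
      have h3 := lf_le K (n := 3)
      have := lf_four K
      have := lf_five K
      have := lf_six K
      push_cast at h3
      obtain rfl | rfl | rfl | rfl : n = 3 ∨ n = 4 ∨ n = 5 ∨ n = 6 := by omega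
      all_goals omega

end SmallDegree

end CFF

namespace CFF

open Polynomial IntermediateField

section Model

variable {K : Type} [Field K] [Algebra (ZMod 2) K]

theorem monic_mono_natDegree (j k : ℕ) :
    (mono (0, j, k)).Monic ∧ (mono (0, j, k)).natDegree = j + 2 * k := by
  have h1 : (X ^ 2 + (C X * X + C (X ^ 2)) : (ZMod 2)[X][X]).Monic ∧
      (X ^ 2 + (C X * X + C (X ^ 2)) : (ZMod 2)[X][X]).natDegree = 2 := by
    have hd : (C X * X + C (X ^ 2) : (ZMod 2)[X][X]).degree ≤ 1 := degree_linear_le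
    refine ⟨monic_X_pow_add (lt_of_le_of_lt hd (by norm_num)), ?_⟩
    rw [natDegree_add_eq_left_of_degree_lt, natDegree_X_pow]
    rw [degree_X_pow]
    exact lt_of_le_of_lt hd (by norm_num)
  have h2 : mono (0, j, k) = X ^ j * (X ^ 2 + (C X * X + C (X ^ 2)) : (ZMod 2)[X][X]) ^ k := by
    simp only [mono, pow_zero, one_mul, C_pow]
    ring
  rw [h2]
  refine ⟨(monic_X_pow j).mul (h1.1.pow k), ?_⟩
  rw [(monic_X_pow j).natDegree_mul (h1.1.pow k), natDegree_X_pow, h1.1.natDegree_pow, h1.2,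
    mul_comm k]

theorem natDegree_mono_le (m : ℕ × ℕ × ℕ) : (mono m).natDegree ≤ m.2.1 + 2 * m.2.2 := by
  obtain ⟨i, j, k⟩ := m
  have : mono (i, j, k) = C (X ^ i) * mono (0, j, k) := by
    simp only [mono, pow_zero, one_mul, C_pow]
    ring
  rw [this]
  refine (natDegree_C_mul_le _ _).trans ?_
  rw [(monic_mono_natDegree j k).2]

theorem degree_polyOf_lt {n : ℕ} (hn : 0 < n) : ∀ (c : List Bool) (ms : List (ℕ × ℕ × ℕ))
    (_ : ∀ m ∈ ms, m.2.1 + 2 * m.2.2 < n), (polyOf c ms).degree < n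
  | [], ms, _ => by
    cases ms <;> (simp only [polyOf, degree_zero]; exact WithBot.bot_lt_coe n)
  | b :: c, [], _ => by
    simp only [polyOf, degree_zero]; exact WithBot.bot_lt_coe n
  | b :: c, m :: ms, h => by
    rw [polyOf]
    refine lt_of_le_of_lt (degree_add_le _ _) (max_lt ?_
      (degree_polyOf_lt hn c ms fun m' hm' => h m' (by simp [hm'])))
    cases b
    · simp only [Bool.false_eq_true, if_false, degree_zero]; exact WithBot.bot_lt_coe n
    · have := natDegree_mono_le m
      have h2 := h m (by simp)
      simp only [if_true]
      refine lt_of_le_of_lt degree_le_natDegree ?_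
      exact_mod_cast lt_of_le_of_lt this h2

theorem monic_polyOf {j k : ℕ} (hn : 0 < j + 2 * k) (c : List Bool) (ms : List (ℕ × ℕ × ℕ))
    (h : ∀ m ∈ ms, m.2.1 + 2 * m.2.2 < j + 2 * k) :
    (polyOf (true :: c) ((0, j, k) :: ms)).Monic ∧
      (polyOf (true :: c) ((0, j, k) :: ms)).natDegree = j + 2 * k := by
  have h1 := degree_polyOf_lt hn c ms h
  obtain ⟨h2, h3⟩ := monic_mono_natDegree j k
  have h4 : (polyOf c ms).degree < (mono (0, j, k)).degree := by
    rw [degree_eq_natDegree h2.ne_zero, h3]; exact_mod_cast h1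
  simp only [polyOf, if_true]
  exact ⟨h2.add_of_left h4, by rw [natDegree_add_eq_left_of_degree_lt h4, h3]⟩

variable [IsCF (ZMod 2) K]

theorem dvd_of_monic {x y : K} (hx : Transcendental (ZMod 2) x) {n : ℕ}
    (hli : LinearIndependent (adjoin (ZMod 2) {x}) (fun i : Fin n => y ^ (i : ℕ)))
    {g : (ZMod 2)[X][X]} (hg : g.Monic) (hn : g.natDegree = n) (h0 : aevalAeval x y g = 0)
    {p : (ZMod 2)[X][X]} (hp : aevalAeval x y p = 0) : g ∣ p := by
  rw [← modByMonic_eq_zero_iff_dvd hg]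
  have hr : aevalAeval x y (p %ₘ g) = 0 := by
    have := congrArg (aevalAeval x y) (modByMonic_add_div p g)
    rwa [map_add, map_mul, h0, zero_mul, add_zero, hp] at this
  have hd : (p %ₘ g).degree < n := by
    rw [← hn, ← degree_eq_natDegree hg.ne_zero]; exact degree_modByMonic_lt p hg
  generalize p %ₘ g = r at hr hd
  have h := (linearIndependent_adjoin_iff hx _).1 hli Finset.univ (fun i => r.coeff i) (by
    rw [← hr]
    by_cases hr0 : r = 0
    · subst hr0; simp
    conv_rhs => rw [r.as_sum_range' n ((natDegree_lt_iff_degree_lt hr0).2 hd), map_sum]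
    rw [← Fin.sum_univ_eq_sum_range (fun i => aevalAeval x y (monomial i (r.coeff i)))]
    refine Finset.sum_congr rfl fun i _ => ?_
    rw [← C_mul_X_pow_eq_monomial, map_mul, map_pow, aevalAeval_C, aevalAeval_Y])
  ext1 i
  rw [coeff_zero]
  by_cases hi : i < n
  · exact h ⟨i, hi⟩ (Finset.mem_univ _)
  · exact coeff_eq_zero_of_degree_lt (hd.trans_le (by exact_mod_cast not_lt.1 hi))

theorem aevalAeval_mono (x y : K) (m : ℕ × ℕ × ℕ) :
    aevalAeval x y (mono m) = x ^ m.1 * (y ^ m.2.1 * (x ^ 2 + x * y + y ^ 2) ^ m.2.2) := by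
  simp [mono, mul_assoc, mul_comm y x]

theorem mono_mem_RRspace {D : Divisor (ZMod 2) K} (hD : 0 ≤ D) {x y : K} {r r' N : ℕ}
    (hx : x ∈ RRspace (ZMod 2) D) (hy : y ∈ RRspace (ZMod 2) (r • D))
    (hz : x ^ 2 + x * y + y ^ 2 ∈ RRspace (ZMod 2) (r' • D)) {m : ℕ × ℕ × ℕ}
    (hm : m.1 + r * m.2.1 + r' * m.2.2 ≤ N) :
    aevalAeval x y (mono m) ∈ RRspace (ZMod 2) (N • D) := by
  rw [aevalAeval_mono]
  have h1 := mul_mem_RRspace (pow_mem_RR hx m.1) (mul_mem_RRspace (pow_mem_RR hy m.2.1)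
    (pow_mem_RR hz m.2.2))
  refine RRspace_mono ?_ h1
  have : m.1 • D + (m.2.1 • r • D + m.2.2 • r' • D) = (m.1 + r * m.2.1 + r' * m.2.2) • D := by
    rw [add_smul, add_smul, mul_comm r, mul_comm r', mul_smul, mul_smul, add_assoc]
  rw [this]
  exact nsmul_le_nsmul_left hD hm

theorem linearIndependent_mono {x y : K} (hx : Transcendental (ZMod 2) x) {J : Finset (ℕ × ℕ)}
    (hJ : LinearIndependent (adjoin (ZMod 2) {x})
      (fun s : J => y ^ s.1.1 * (x ^ 2 + x * y + y ^ 2) ^ s.1.2))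
    {ms : List (ℕ × ℕ × ℕ)} (hn : ms.Nodup) (hm : ∀ m ∈ ms, m.2 ∈ J) :
    LinearIndependent (ZMod 2) (fun i : Fin ms.length => aevalAeval x y (mono ms[i])) := by
  have h := linearIndependent_pow_mul hx hJ
  have h2 := h.comp (fun i : Fin ms.length =>
    ((ms[i].1, ⟨ms[i].2, hm _ (List.getElem_mem _)⟩) : ℕ × J)) (by
      intro i i' hi
      have h3 : ms[i].1 = ms[i'].1 := congrArg (fun s : ℕ × J => s.1) hi
      have h4 : ms[i].2 = ms[i'].2 := congrArg (fun s : ℕ × J => s.2.1) hi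
      have h5 : ms[i] = ms[i'] := Prod.ext h3 h4
      exact Fin.ext ((List.Nodup.getElem_inj_iff hn).1 h5))
  convert! h2 using 1
  funext i
  rw [aevalAeval_mono]
  rfl

theorem exists_polyOf_of_mem {x y : K} (hx : Transcendental (ZMod 2) x) {J : Finset (ℕ × ℕ)}
    (hJ : LinearIndependent (adjoin (ZMod 2) {x})
      (fun s : J => y ^ s.1.1 * (x ^ 2 + x * y + y ^ 2) ^ s.1.2))
    {ms : List (ℕ × ℕ × ℕ)} (hn : ms.Nodup) (hm : ∀ m ∈ ms, m.2 ∈ J) {E : Divisor (ZMod 2) K}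
    (hE : ∀ m ∈ ms, aevalAeval x y (mono m) ∈ RRspace (ZMod 2) E)
    (hl : ell (ZMod 2) E ≤ ms.length) {f : K} (hf : f ∈ RRspace (ZMod 2) E) :
    ∃ c : List Bool, c.length = ms.length ∧ aevalAeval x y (polyOf c ms) = f := by
  have h1 := span_eq_RRspace (linearIndependent_mono hx hJ hn hm)
    (fun i => hE _ (List.getElem_mem _)) (by rwa [Fintype.card_fin])
  refine exists_polyOf (aevalAeval x y).toLinearMap ms ?_
  rw [← h1] at hf
  refine Submodule.span_mono ?_ hf
  rintro _ ⟨i, rfl⟩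
  exact ⟨ms[i], List.getElem_mem _, rfl⟩

end Model

/-- An affine plane model of `K`, with poles supported on a divisor of degree 12. -/
structure PlaneModel {K : Type} [Field K] [Algebra (ZMod 2) K] (D : Divisor (ZMod 2) K) (x y : K)
    (g : (ZMod 2)[X][X]) : Prop where
  deg : degHom (ZMod 2) K D = 12
  tr : Transcendental (ZMod 2) x
  gen : ∀ f ∈ RRspace (ZMod 2) D, ∃ p : (ZMod 2)[X][X], aevalAeval x y p = f
  pole : ∀ P : Place (ZMod 2) K, D P = 0 ↔ x ∈ P.1 ∧ y ∈ P.1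
  rel : aevalAeval x y g = 0
  dvd : ∀ p : (ZMod 2)[X][X], aevalAeval x y p = 0 → g ∣ p

section Model

variable {K : Type} [Field K] [Algebra (ZMod 2) K] [IsG4 K]

theorem exists_planeModel {x y : K} (hx : Transcendental (ZMod 2) x) {r r' N N' j k : ℕ}
    (hN0 : N ≠ 0) (hdeg : N * fdeg (ZMod 2) x = 12)
    (hy : y ∈ RRspace (ZMod 2) (r • pdiv (ZMod 2) x))
    (hz : x ^ 2 + x * y + y ^ 2 ∈ RRspace (ZMod 2) (r' • pdiv (ZMod 2) x))
    (hli : LinearIndependent (adjoin (ZMod 2) {x}) (fun i : Fin (j + 2 * k) => y ^ (i : ℕ)))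
    {J : Finset (ℕ × ℕ)}
    (hJ : LinearIndependent (adjoin (ZMod 2) {x})
      (fun s : J => y ^ s.1.1 * (x ^ 2 + x * y + y ^ 2) ^ s.1.2))
    {ms ms' : List (ℕ × ℕ × ℕ)}
    (hms : ms.Nodup ∧ ms.length = 9 ∧ ∀ m ∈ ms, m.2 ∈ J ∧ m.1 + r * m.2.1 + r' * m.2.2 ≤ N)
    (hms' : ms'.Nodup ∧ N' * fdeg (ZMod 2) x = ms'.length + 3 ∧ 4 ≤ ms'.length ∧
      ∀ m ∈ ms', m.2 ∈ J ∧ m.1 + r * m.2.1 + r' * m.2.2 ≤ N' ∧ m.2.1 + 2 * m.2.2 < j + 2 * k)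
    (hjk : 0 < j + 2 * k) (hl : r * j + r' * k ≤ N') :
    ∃ c : List Bool, c.length = ms'.length ∧
      PlaneModel (N • pdiv (ZMod 2) x) x y (polyOf (true :: c) ((0, j, k) :: ms')) := by
  have hD := pdiv_nonneg (F := ZMod 2) x
  have hxD := mem_RR_pdiv (F := ZMod 2) x
  have hd : ∀ n : ℕ, degHom (ZMod 2) K (n • pdiv (ZMod 2) x) = (n * fdeg (ZMod 2) x : ℕ) := by
    intro n
    rw [map_nsmul, deg_pdiv hx, nsmul_eq_mul]; push_cast; rfl
  have hE : ∀ m ∈ ms', aevalAeval x y (mono m) ∈ RRspace (ZMod 2) (N' • pdiv (ZMod 2) x) :=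
    fun m hm => mono_mem_RRspace hD hxD hy hz (hms'.2.2.2 m hm).2.1
  obtain ⟨c, hc, hc2⟩ := exists_polyOf_of_mem hx hJ hms'.1 (fun m hm => (hms'.2.2.2 m hm).1) hE (by
    rw [ell_eq, hd, hms'.2.1]
    have := lf_large K (n := (ms'.length + 3 : ℕ)) (by push_cast; have := hms'.2.2.1; omega)
    push_cast at this ⊢; omega)
    (mono_mem_RRspace hD hxD hy hz (m := (0, j, k)) (N := N') (by simpa using hl))
  obtain ⟨hg, hgn⟩ := monic_polyOf hjk c ms' (fun m hm => (hms'.2.2.2 m hm).2.2)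
  have hrel : aevalAeval x y (polyOf (true :: c) ((0, j, k) :: ms')) = 0 := by
    rw [polyOf, map_add, hc2]
    simp only [if_true]
    have := charP_of_injective_algebraMap (algebraMap (ZMod 2) K).injective 2
    exact CharTwo.add_self_eq_zero _
  refine ⟨c, hc, ?_, hx, ?_, ?_, hrel, fun p hp => dvd_of_monic hx hli hg hgn hrel hp⟩
  · rw [hd, hdeg]; rfl
  · intro f hf
    obtain ⟨c', _, h⟩ := exists_polyOf_of_mem hx hJ hms.1 (fun m hm => (hms.2.2 m hm).1)
      (E := N • pdiv (ZMod 2) x)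
      (fun m hm => mono_mem_RRspace hD hxD hy hz (hms.2.2 m hm).2) (by
        rw [ell_eq, hd, hdeg, hms.2.1]
        have := lf_large K (n := 12) (by norm_num)
        push_cast at this ⊢; omega) hf
    exact ⟨_, h⟩
  · intro P
    rw [mem_of_pdiv_eq_zero]
    have h1 : (N • pdiv (ZMod 2) x) P = 0 ↔ pdiv (ZMod 2) x P = 0 := by
      simp [hN0]
    rw [h1]
    refine ⟨fun h => ⟨h, ?_⟩, fun h => h.1⟩
    have := (mem_RRspace.1 hy) P
    rw [← mem_lev_zero]
    simpa [h] using this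

end Model

end CFF

namespace CFF

section Tables

/-- Valid value tables over the fields with at most 32 elements, packed into one number. -/
structure ValTable (ms : List (ℕ × ℕ × ℕ)) (vs : List ℕ) : Prop where
  len : ms.length = vs.length
  v1 : isVals 1 tbl1 0 ms vs = true
  v2 : isVals 2 tbl2 4 ms vs = true
  v3 : isVals 3 tbl3 36 ms vs = true
  v4 : isVals 4 tbl4 228 ms vs = true
  v5 : isVals 5 tbl5 1252 ms vs = true

def vals000 : ℕ :=
  4696460532857572279118979990980842338366335566782111635192108096707316123721837322284196640083835887702023602601643589599013244374201328495473110176345785923021185207205987703754151993170430728359689328149656735119899215892426827875856252898927076521040288751829469076392367249333221212823732909113176806393284699055132661872747432414616820489578339965364299798017929020595660094797264064425190405932429042680469424407956623840279853806319431159041687112267947221602458257841342397364415142807238451903129847357966930027102944966903956277595803374625846012612076549511446772869596253909648187522587085392288050674523771650729491081342836281610222944160873900660857344198705802968605445263341410297614378353297773712614018390772062016488632999537193415461275789210970828440467401426499534228123367449380379677597754091908381937705071915525788107331466381253195952323293548375157070473772898848526952579833627327194426462150016826849857327604708915801532000435719887095592088504840944532938883648324421756110157384808590197633614586721974345718457554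49654970615565290362207632631511543520512767378263121043113775821262230544521849634322639215698850874207797310357534601861476231587790546258051656953868663191539462927995608819840679013399119857959562659306319564288211619378775299355358339823216430694437791981892605998077971380673925600504313822162913668348543162149442691081078543503566430289114489888394725049793486252291486196590364432206847715548156496603590755295058812954603598743381989810526226501198326316006222112817817852443131050744663106623164476739096736250092111113569364453928557650606146225060474696546364090467953844662938170438164235802454233438588169713811047851504290223036543940971267333424553035647353982938458753680730207964922069817467167308853542957561033160973332789828438008503070366121208607789406498995241254748000079945857066729753105131208461931713928429779299629206985287864285283046751

def vals001 : ℕ :=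
  8366114033459701936618238299859757760901006726332689198369207737881492739255420868459442773456691981636202718111981442031192832424831695093981606003100379641578317755207296697820393282615983342031495095953823034494943846309285308460991433490323642651971051605837868256809710311349803261914831188385305885964011453234111853399070052568199411265627592260144837973870855296198109595106565821819283722528109173092923323436180302357312291351521151163467520897790638172204876628557467403679757777280269224351274602898082028515583336011497129506500070775484188387834134085300545436630603975397726283443880381452847698212234295073183865720757355231129993558713271582321539732943900427288018878017464338027904081735527712846126401053188753864420977106092902088199142990197037220283093527529208190108112999352721569465125522225114166056432296634572029132115905596168504580670731765847045945698118536430322151704769929462459058401826306719574024077630077231039172727500459574050596478903362375125410881895827173747893530388527460238653985009391144234467740857480550276103844555522804774462487237859832589029316819381039040340963088560244651391220713047742827180142437893799965720325081610690885230909844757366966510947433993244023169425975781025932159044824035918544754828608380190168447158848085206954775125801030612704930218390873184388645173905340866074477207028746680781351853627932570009230192840384807270471458947517538368973027587022056814888445656667509943262363750718175465667314433139599475276800262221713911439013742012985170729420631233383259746580907614288581690566782171221414428947853515236790270958985078594000823141975278115376739383598833201461074347262627299965208038938278303858740666199469638387815688831214665190257267551002731394987431726823199839687826504517244438529533572377541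293895970471220813663000085731902871076710236252677849634236249333632076519020884097505904549885589592557657498164575752706894

def vals002 : ℕ :=
  4476502324179041366319065185877820476414624733697953280575261188715196839028324646273620061414279158324815823989138561995631450580968852236388235466715088936418966609369385265317150185242347844864274585054467804317213306887312289756088320724452874457513252224067417862071099717454886931366431364072399870240586227176663234602730464358754400492565565160576958544421088011216284707302987057884333620719404216847180978393963786317475676732951875061140529964633493879575862934447427802971938743082762232688134705462373780731249413816823893280692739291894881130773445440888854703043460659667410255051836637370481751174423403977094389727665617581036341746017491567425135767689243479912021724997419989515228524110300777448960264699524230825164140171258470933375325759502303534850713860607494843296270985419723749577373069740239359396790880708325312819443749517604566898292444979673267428635189161470125407097630375837100442879803634585282678264751416566115780843989904398385256674777156144766522909499851078016540073646720900824522340963423944147486536219986175770439555548005429166501164454378364427675445781100163277093674535971235958957763524645365021367238724677573374105928906299244603672387565469151609893292858953126623533859152228029126814999411021102803420082518193276174212728735362791029418835980034588350497148507897631776887558784941601218990370754967961454267608334358770935559149061627731396689532875483186646418596792926354392260318433894621273197528740831746671674312440662637281581051903978605248519725281335847433744604629266523652742204163116402876280351862362514228236226991969635369955304839821763415698333820439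399866695217757210683237347216845224556625270967725513160929112360602871327486728108092451980690933217993277340473839835249593558782335458683030348487166656939948572649691463142061853404395804148157774814046524092554197317864267372811385207619367394496338168765716420643274512140827887689294

def vals003 : ℕ :=
  1015079560095305217764067721525404971768356767423656286241380432538190052325190785689561909851745844671951146447614784928434236943398888952109638016763202007876797828951469281150743463506947632463382049794882049029773008721763243767980386802584661473568931652004345391827075325700092759284232993113119961696485657658089523930681044754490958549726594343398342271788134549693283728005911636352985060649867804406475111916543924995711413455601351395870589887725690934429056985819870486320852655160138167140939730041896674052934583953446931434899461558333188509390442870942875513878126982487173794851378901419906502632777623309760063869071981258745425169990120330514590674859979241288405189734059133557806598255918344482920266314749489164552160699362183835155353296303489121025049495761427141866756530638647697183136075616762917807699207483971693763426481210296943000664388763303187146747680175857310792209697469029949232558613217870955625936723709758852081334145356207218308252553496114562196455092820525155478449006838087627302999694421619180244223000716172350885426067632557374270175489796263344709021662050493333657590577270844975060874882403001934563872938806798819655128900039107600412076133760449859781609536692707153188318749905213314015114048232422532954558615590611159752854977319258708672604625182994784832175324331579940237296896252976927539649896487610047008640657273717098784950822270192466101304641649609046132166614297514456953914979030132755404295385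3479107577109655601377000139647454578262611550972584674551673545763519304333186462748695661051610562087043013631228875484229406956190352902947738735696128806451871259755418548656467133045057833620319993671829127128156828269828482412870894932680801795807698439040918026619499659344912501190591886749503637066955057261762318441573530378908734502005221443182680104029756461892331923440017289706748647567108367515200069635792511746706594255821453320224284628302

def vals010 : ℕ :=
  1454387777917183673533619610110196337042478111004520938997526409946581127857397333604364819953323235800007962419718838275624140043159560722474707685469594036376267651725814608461768227696945551816778377379526809575331324413761340746265602516316514510164942488467213639063215538041796103907917995731057220090784280550277031104793484071777235529164172005358859816393337854608114059623929546555441405080645121307521987215359215429989618803536727315209250470785218659787993511229494970555208017419614464933483371544792289318681658691970489476434398019291691799116101905149685457058683538661796426278650586165729660433108269136127208929650710093744395284636849502084435165613282802012180709134991716909935717272928568146060507393155769319880710481323115495954792963592398198117305369928118609432433836723271301597498887188236726058127064707576418579189250005895975392222226521691252088090738441164218925519429322523225311549017424999322218710713650070768681602391113898782977730359950867704542348349535760626018550417784991600552563445017478558064241358648961476423690695364076092592499441617655571895267415370044248358581519215007964647556650314886887326787072590577130290946795464327308638516560120139158118484683476623069618257521441999349044271346309307994610803574477949493677620025307909429616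0631300902418818837117708581376997686231367720299698529552443727755049128514613135717669490196996694183225557076293939889378283383201487062374566710748588851356669429933674269130276709578914653327825759974771579171590033146710989533632219917841338400787758672937629802328881432361591339485523512265029279583758372173131782597575129098455826649260168411996582973838802328179729079015120566736368227268940596555772366345574926671161109683732526648668079481766420504843306454001327066346371148141658394299560603409630326669220511223297430748089050352477178326810119356394588047297646053483701161024023767195174048156117099236938

def vals011 : ℕ :=
  1360180758688996458888216214014103798851830951620501903810518095986171993178702995966813989145009876734494948608521209470398821807865676171326323792832766532805344742299644240585883433676044260741628960712675195380372154952072138923110337887053450331501656606843954785714661410840944598685291484511672947395489195640951819196075921347441509421611978214572628291380362505430667602832477995864255801221399509055197099510929270040103025865724231543183073090202374511024498982010074995086214230856182941646540018028875023242427443454081029535726846142004006294373778786804207517972766398946497066217204674734155604014756149581858138627025585522456288290066856133936094753964048508613366805605983542087280479304906564285775281843240388790038564169798243900623065686712182478965047028732742638651043584424384725322402120695429639091670477999715893474372558990582009565199457518086474839051524245753736939036941975557091312612360065705993654557988330154698275583305955825485689173228197908279188865717147886147090634955948090426315932302049587859300992169094725570257231737101823096908460744566835268993262272984631261786586241483942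0346595768682000266616607908497150280707572872325148886467382457982891204513936966294455585257312260482695021254744854700593414426872259036166988620423991889327844910436105417295825541208358439233187028523244610647495492387670014603390245730608988449375644310368101145439238036911038516683397009304211524141838588904314318447295433972419935301914784328563433030413583971378362741986337485259552454537355115332835063899735743212940582374909766205776914224525244115172470352687063570137060340582047426714089866941093015002250425881852470621554465837740010482247962409062015046067532053764432743413332062814461725081911661216537093475007417512107131374174643828486666981441278774631604611885780260000058430356017914038596147819090205915233361708097469432442111380813187978651264596383965124773194

def vals012 : ℕ :=
  1280439537093339750053748336020561214735659957569089715584941601615597307971570119593750648164169013792365292106241177719017589496376865290588008223210661067304305843094787362217111084756003640814421042423742316671403911791589672200546509463529093669661597827465129040051373726699396181883137260252047426375709342546844692047238853153714304480017460743193000702140197134053132730464774071262022427565958795662615096932991695582445349402618056419012927488490503491873289058303706810613771588209150798616819342353459919615357074512387309369647411952488654363853055112468083968834906718143195514563606117918434070472350556102296123421871125278351728808217531991048976095643029648768165552515831813870518449151225198031120773029249462487228688885004591914579878653838677836021450957789908880215470583255656421660878787992487948395267284159285414090693575051612103624094455899054545698779030516241845243749645725088136248076260420115006167647247424653943090303830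2445651178659659329131109548020093710366011128978584456472837818749959114984408651717894616229521588082355037929537627502314326503718199279383374134410048055118617857223585903544414039105693124289827406105287490915403552752416455750136531391916890711572354864201509300764477446016308814479625247351599770827718901911305534054077455408567108854766973540713850562349797884204874245778103216820535862090676000152952173349146262818289274315936276908470691420061085628994874516266030416692840267608835552361512551283365874827537961282957024326854768383148718905869433579624534923821937419808877874892616983678371281390870818140851809978214464431832801102667703822009807673280288678760958785495955628774620276769498297946812210958377716316157936876112529970341418696727870595810760737894456934633266922334926687838591226523684781596104199732726144758511442898689664328651637586580569049703970295376142899262008506666594110707678605421575501063753552610057493350992714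

def vals020 : ℕ :=
  8469686256593376150662224215398847874211959445997114997791868537480168921281899463596540267605962550602537214290039635207299111100259490107358117567442742919809134262605468422548678672398874623171405523435613982610466463762261343704047192951644466225975605816549437463628520304465597323873824070373640403139413605898918193193744175686174893234148727641576098554370904608117004510427700770869104199066747855264511940034045472975080311057066931355254401715373629418837994594645559964177157534694367317496818903734158048634299523793946199988842702892838733442926484155677952417131197428544286736688309047839904739686034386969979528172623259222943549908382255765993649406154035804487318609215242928831726369239232701617355169820758852517012704649327931585224749970932977003070910571922834841543055884571019807809644221988028659942611268139925946292360686003421202029146381553708927360315478303930858815978038064972338583141457641155554166068851154270682512472445637648923887204345180716461745597067725197720454078375254554357595116530924336571845824394951022469268808932448464237060836806614699863814959241244716175367593847714602255536042842962315596314164895555577755109617210019861470177199257742429305450038021089561665359544176578628039568116814834423723110323777736455992296620982651945543695900066144743516510570694812130859302629591121305340480313126285811319748011895112162126597173827926010077095130388139303129267468456477396233846812980459239007558893767507978199337092531828023852228574110233297056608741773933609608924019827275578183426883162304839062803620282243530878560549413638165271836507791984929141377124208954382877746129684972120283065831157335766652764625804270578107305322247430571556560174534931512197451112145216505079089579798319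087609610116438603400555684778507613199736337623345525296755922675634416155611361875690821066948444657583915619072002396058422315067746632921207679723432307652774730

def vals030 : ℕ :=
  1343912046528122259684606654337684069364326055790121635498887767078120837914033263407849584383100756317912804356921805624036476051788122461297423960456094743569960235381894264542242001973411526705735322835318969957256235884204826896490343575568147335801643190631773783563019813938340997400154863399051362879967844628029087170490951780285741836571817204151657745843812647937662900854051044902772255515083258397488465246441011240109640735795758122184909364483427637772689476791068319688822476258794878346151231855354629286057050163432536266437179525440081316991034412514538640750901292035663145841861662955333054431487259010098035470173814648886841878089043128946286723000627493398992134596240952855888360849075644059152991824573049309336698730127895733622217416686719640101165681321420971518503063185229103573189322169309818825037940571511171969050198765665267605645798525900930006312438459611584426856888769585004193246067829836523931902318361197242461002207514412783536323857584637605152953973920317492091009378881785118391365428935567809949140931556513087956077275049153716196252860641548182123261912898270086964758759760258839766770077891864953118769077281694942370108890635781192669915162870491470992609964051689736439990132659023617795855001558784515287738662429726946738939601439987218981318991264378496048765617820844212531847244139819441009574711406617823783019986316493899764958042834669088615383593342986980814728591269041872671804215636469973592264838935384073172011213636823287265153579478184963336494614939056818894567400016169115052587851807550198638122488167566176739930403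0883534560876856231550373833611901899441578362952405780566777274002287967156172970011874149703978788735577364904685506166883901694999025166599789773414911409469397209624050809657113339346239560845412071932542564272355696717145705653386023388729008278735579468953500628905208809154150803448840108549510321518134843122015323682063690

def vals100 : ℕ :=
  1455902765185847406526883797204061124893564025702422472422578629959153300595856586997005170448420379433735360909296301559571302131662075514201327379912518363690336648896837265879235751023792016603936038350860698331035451902197373077477118186796313061025386241771852430135673206077878459465238631320874853851435615995267219525037366694655435294607856691179639211329891307982302614328393713878324292310274091990219034540902287171270029290474172845144972835129102464174540084554971932424386977365951017595345315197852733751326365411747477259054148011656558308212643705969183217181035458005354782270690169706113676569030869075261484611790592972498142788536848787109832248849074412676438061309199682267511556883001012487113187281142951066282835959568768342274678625406470488884480399065120821977839751357990015780077957938297023762382150604754706601453717609516369216977695391016432455098618921377776290837716260987681362763767614073741570540018026349985032962000051370699074449057960366362343514096492975854728909321491094136952058861840454303643392920931278263152163545605187989647864842865022948771365644733317574783539070974921817193840420686555143533424765705945486583068309240138160093245483922185276615967726569618895681979330238493257528751158900722423757729193515998931117160377951433523251861956822911728467174471984133642843070107942890185259667552914661325762111155902818097160373238954725707998841144724487345292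9317269173563208934047904787508817301956393233885647215562895541326488405516984351700652222623146943146172476953487014919071688980990959654392032026947788182953610613959788169564976131425936060567553535926760385527112069783846509044211146266773616351978879183488364196292399202940553933090557135847713241045591674028753011053748737398816257444357709352879232734784131905840990642507644707424696203054819292737067341630945790616671565866915670958155425064013117202452162585589188114907354180490711052

def vals101 : ℕ :=
  1342830710290026102952385751020839175352244196358893555797638505364885524532011853761419959421443292933558407214019417150696121406229935199310584478627526941349536142528567208459551879281756127567467967839256958240302260863641334747279828982008473673831500767811386566324934212164369312335919104997610894349581314715344758276643035176621889900483829260531924007876369622015838571175034950640485084983341132563014801448460104357201938999730784098895002212659240602588868581124587466901886501157259913518798948373259104965750170459408099499435541029543547281581956270249606365463814040774633163802935870513844220613205157489342862576237960942192829607197509087333884612771624313172113734804603396989586416860583438785243008916914855738529231659651951919646359068981027202854144995476691998950799686769540025940668996750754884485547933180103649481899038065466694614810437524433942635888974748495738655832051736720280237852303351179110209432872346158582347923855585884808599197281290333909609903919994833389504022547422319731411055358274374459353353808572981921472672434816279100348823047461497096290139064611120237883332315887743284954043591040626304588540605951856212791435014231681069311775579191147840881920211500130008784801141765335836370495309598738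3897815243758811432525053230625296192455312156128762512199426294796192062847332261841750583168281589906055864174759624353333456526488740065167257920946510024046014080113260429437486751340782282254099188762334832787358365329121657632736648224468990260020493480303254803903132278292268379982236240614696208042482408936065865611601991474631795655044556165491756254173514677217934296601267642864551899793720688402795397478101811661844008731047364053095247341004415100457417637909101615088542230613828871357945566995049760589352225895858194355222097033536823382184603363560309893796664236187261429788536338033066706228437220072639700078115067817732910748481033262360186892

def vals102 : ℕ :=
  1316617636065884143026155157479249108510178176300594884463700994558093826914324454152748521844440650004688410981442337316325932540004220704985483058417085068856932588296636617263977610918651855552906237422679246779814088197095670779785149217766197859836322404628906752194140784414921029687268025019267067352508164206190554441810168398678275573091524440311292534719638719226705719176742966476689138656802061352423215541223999342847239261974158888202895629125089262172861671450621323812074515710281681654010148011891759001439205287463797689899903451536030013601172625487623691796119882583669616487028896614994097529459889517023311059351562151187813348341578259244793448778720357758892374016788769999723120376081500941292096147805612164495402847018152089657981595414037675099574026934636580471341696665574679544109015834895817499483592422799016401985329451515661207531749092335682213528841090337005601114335662086338088267579052935397669451721861226234341530124094376413034567435858445375435799670907280833421128847479446222171617489911250877921864865448918270655362909633024090637394381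6042442659977250578036929195837345328034621923900164524098441098088983629635934188406414669380359890177275523622094205342395297194472629673490076409350879879239604655576445651893159435914044066171789264160465730171932445867506124467203464752767478266205927947467699918298672514682668143034330862022059054912637005684525754729866633155485483130456455296475319917487261507267988098492389864386261116869610289290535364118895740309726266731909986774254349365262786485466137636138498237783829327595322084278801299618283886629549088054343756587429306913421468784763596845810402119385020124285443915059654241490073813913074294737082265402696445370658171109213674104797437871570770662820161410984584500281930998874763261195305691465676163843131736238020929735967931493514257212865691623712177139082444830881651375946947452217466912717470191628

def vals110 : ℕ :=
  8378589528594944319243697667288850631982408354879918272048576574959226469517792285662486659912819232237770244617996764833062034059386090870421010613828800729990576749945035855408231512639696553280154638862509407044351132059261102302814394612731808555648167453308710264053922938023167457698578424009822971385921373901628525528444090647407642023089107929096209350717157560813150189693906020089419833609576197936611592871340176021534823066269624677122683496290619668966445813439347883595059568001614704306183343251543382323270140695540787484377874808459793284255702941525183585525044141480386061229815414431677398121379063212345964833777346770246466287429471820572660506388926102533395340114565771908058554342397496910015029237909400614532231862183942689065608998689345165812176572767105643521369350142551209092123648067686957748190686614980955550828183982517000504073220287967980653747925681516270440185335786669781452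205739497662847339659011999974389394827383694978922465622990448807769595558944179444837347384257174934565123418328622206940684199215473336793621582396592918167793209360807109720072400278753045727699635787675958961783819984307052872996715231105108037176837744013989902422231685982502321946930767382818565001569119216406564657761469933636913956700511811661712295409100743949227833020317335977456205546314052753762380813504370204517510707085927062112991562748637630317706909272636361335660845734144489293560486347568003241788737319116305225539292357179226666332171663002531870414055315811812836837248246210240159849313321549808340556085941612713738441993356405569680263503478798546438201649785278532926837161461191450881390155992542339256628217213680375882588586865932322158720844242627905612801760729963713863335527515532627899217527988919652914679176412528621875926382532730358527436209747114644424071926040735310615668689328668005011934403026366362078420803090186224752421752727075107441442518113075208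

def vals111 : ℕ :=
  4412371604781242788832255139152264062636914179085026323249353402953211645859824457434073970949849409528901313839536924311049001166633709871125002740171900611660569221534499942220190429124441432244367435463462399824113656684061171655423952778349899449689035524663699649074527680125332883096284546832025558579494411340797481746769676298917859942811419036664012126181806802355524646250041981386862736715749410036605535412866122789655106291127774539977162592424865589382334416783521748306017633250442263832741645052119111961782074440495488141906282602673817942521850158738143661325439280114467611818218951589519386644494200162084385926330493319109736526954135209610532857116825197346087935285125425430242986158542600342129200255908910264019573897840789493760850299358555461225041910704768839564148157263683432398689071618010768529878402764131606689015145792500654407771281178956699360139900461932732467946618426798048172820715456127105165695537623602230417411720805019571270927750718218580293906417847242539612999658294986301512300786826531336643287591813108447488458987321425588326656520288220613927871515096769766820115421745688486386604462296659258605842116443716297165903129008935085024600681883525513365718449685392189137500482100060793374847164592486653403405390138033833129048532838341279739686987746244343822268114899934932673288349557150977281974402367568460956766373313640398324328771974370619445541115545068178380282801255629346670632650930225392936889811054308076724555725844710583023811706276346073777836834098850758388983802095063325903518105341768279498634902638060875642284139792096951638052336781442222680003313583554090512587050799428013561768420873699474412070313780309223511606577778949777885167750361197162031931811230132879906766259139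156331560102877567959189937712010618402167513560892331530858218919069990074118219061954689737772219261460247090325945213732784132021439177607900986824548112358457352

def vals120 : ℕ :=
  1322902250881489364162354531965549002395894310458538219691489958307115565369202727926303939333903465321906115605215357204853771551134133131603315989572756122817312237794585780715929205646191840929008379260614701101347184598561367797963301451953374042631402355426842195339292930176800013630408952619875414806541804238188687286407317225341109049239476483583171043528671408365438256824383722695767937253626229184584935106296359013590971405811588039472452185119169489381943355334312349190253481389026540760040897904232377583099301445742313731224298509799834667586847048216462034850911151986184307774379399699803624391187354598787561928761400659998360545560760406781301528730886447658164316895897379069552971210866495400594694823166175233775421741966925528828736216903156356294475400373178373828845528121816966660082347088955787465243189516958525749164817360255214967694524699263376697687794052973886835541772670768581594703760979111093914551681187750440228297616054044723153542051743429159115344231299644243553531094633515745229827685413272626928009292861066548996350468289068121478688170721551027804011418050732386829463885458361358581449876404274495408366812433233966637767084431892910166043953792390900083456652474231337447726735060074112606311690078389281530187221798188022564151626686562172276784183285865291329276688354119297434020963555391720497240413349415247019731009776924678091275857465533568167969651818273289381546702033088940768563808124349412573177514215191984812884176220389697833014970632491682755777322053741918452110733030530975033317017327207261054155980281952177909746305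4428009549526426455580887780807631131201788482829319999894861694894763439142468844909250120087492037537738229350465789288423564894390109228538289483231722804404403481631428838596908729603564790497283468896881664522394972174555294494083581562256414148802973182099648978503199256505173080939677548502879612381541483177761315593338888

def vals200 : ℕ :=
  8453628959143630102414163983765516209059404020208122288215543374274316000278437009222511831926592495148726592143456841333397046479731747212654659022889680915307508866676902348417843401067328959588901021921885188521187671007438068622877060801342584595862470797266163138612676474422934333401521719238193893743400665637200177454910417102166242656644274301139463839494097861267869153325975436707152720106231322641334625591239296285584190954173157377488881871479757231385053941150678503989350953641992260371416803972503911672301374484780989893455096088149862128984186409982415261047682159346781264147757835982364682288349291702117423863898558636757227738340207147829663629340928019028549416982514698950682774894433419493743467002879087903527696922623491071253246428305199641910309107478441882763690614468577117325972680265074526991786553923093131104778902070729054276080167048779062853914647439577838321214686568065481308474968516073419122694594630893337253938097111676727608202658684866064358976729159137427412422413849933134091777166456127268945096905606468063187461903473718874017323735298510229771096980213265348420406802628106151071923016341881675701198875836988013941554467143376553598514725759765604208342294572772096895524595498035505471756550257462440224703247123941216844880045665878728257524058669310020330125287533882198563093112022827941103969092483154111135751237014530195310305029123561770513110148376446504314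547311538186561125587791898900012587276346095314862257377537135435686617678607334516922314665444024891118870116688785188764146352783112679921826562344242720494864907718604115854416273223803408250725872173491828573647805690218152399292439086170419737847551575833313872020016083750176254789949484651105748617231073963849181910420747245239844909426764772512028743311499639515346860110210011387366038688310413072422404741760582610126873955460695459586472803051635562848091759348415456532520579026472972

def vals201 : ℕ :=
  4189305907459602197104138441383686357288869959047822636275417956810691815964302871363388182882472264282207307488546359911973461331050901254032018085485776933312424638384145688135045508405974169160559571111647429495195535235963478842186094411923596276368036201768588792639341803147783007786764163737468465021892517901332293290121949171201042469396557201987134211772434247735647545449294963405764474250445964523358436848724682401296334866127274535386825077202918588531991799442170897455910035509367371910850777521734563506161119875167843894312208555871227595373318498520330124324314493143885435310121786103648493563673725145757811101534866986956910732251962544369835018495676962418247781038341447953185420860616397061191190300151049236276443485663417955551077646770692381683060090145356693471360850601374684905200210005063226256742451832482843556280073665943266446463821267477483797225601549845104276555485019660204442116954714007674601017617871822170072747063703720303628553280925421129294213162346465877098987012951807801976846285356091419122347946681369891530609845799718559163922180519350477079106235877625489067009822123630616250297826972686124362184779585703691153569540177071567458220593740368249408405889262621185845111600993577551344137026425935351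041470778776572282144185255313197952665069214606050863373018382521255177157543091341709979908458222391339325886836432032284054278282128860508767839335561305033767794437134365593416299944031074669675348807947898392907692378770593765617425032036021137117641951386487144266510230336405181719738296897500918853702556147233666987302511950852017436241847149282073437401632245797983489420083326280818617734008532863664136403882606421346616629256659041855391975189922213941251961457025042147413969728719699858960534083905538413125541695989434029037151513455941236480990763730510155021781747552603223832255703748234536718528536770158626719296907530375012060903005407432716

def vals210 : ℕ :=
  1342003441532024980699172445048101480321225408239129022045838540847707033272511868970980872671792772627996038669266486087843434679488803475267300553156005803126526688146127306203597324639973649659999841252793177138737259441411056564276315360680131154152110928611609466415336477095095870059549874995639255140496826366077332479376197686690734827315708812517949769879531659162288417937689312522845042815493095763828389496910069920546359872618584930016977884723788498357707152616279325744537931155378676123021797357456062326082567186486432336068437331110751527876829352648068640749689146585017753558477443059063605801410370717551099474455629941044733467175926117802645655096407972292583295381390793322888386521056999525621450665873000701835005472484573343031072367590838364397939431342402701771813986206758184174410466930422493839837955144050289279523149804713384861629083968746909304094895500669021976021266596272516227524907718682374204643985519214248324770425716798119283797596397589592613064483161119647252072887593770188084434622478477445738803681673005408327586064626002363833546127046729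3924858428828344676001100655654773459903533655912632332977454999848927931979765161911543786928992025485820503636551173105042401886867200366925832470131930991650851596959761628808303295445879538567871078277574004980109715232431704789259455063030495162199355871360570818082393509866631871540344900036665776240763965743305166621238269169624654701288188906583650333786776849107244884652061716977583876499442232304476369450822845392325420167330756898969206390726265894446044018253408178821935563015217087139380611422351739195671841267742986692662524923108627121905725386367648437890613140544978194499117341823442457129539051796164633349094976775880851978412133253785116326377919856718883806854766200767317390187117430200625549675408636403985502853776604232719227091111236069121778399203772774903399543118547267160254981991986063360008

def vals220 : ℕ :=
  4483842315188044387134754025499441941916576401113254311726844493697560396543352429967418135334922429688854437474649579787601568121567880702388283889399641398127208163493493155455734372914490421135118027367347952451596460345817970240080830399393146540502640752380082565099198821786500170064093118321089231382316959436290199656860035986980378467110536473387528351354241926855371897155446418996144256022838763281470204453089314111662767786939437821447256674830035880087672474892187247865476874095330471204046605517744408887669858972024442948114018767930440277989857301222668494022197172048528792175386888332072800400450045380965963335285836213063336026998640901884049110008243027387887388676762758384376873686106327092868385623624066384506636308746788180976322215154012499664229792124936585084592658087575782674501298712859803181930983854546935351958161207032367104259590380907130414436355354535415721012858111682234002032286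839083612547811125364297422519858279520321688293335299331552721361526019494010716249812509600274348115930796716742167453033429442642895723718771113399153381920017374151439921432468461634460469401671447741701062053721406862901861939473551617678844535509246057164647411487219644022569676587863465591103913393204991175438230381375745635506063014519678507328271099968808469931516507901804232785879601362831031893613892194579231155239403017972474529548413284568979538687458219910475806697869617295100503722504710453715409739242739481452446196287862871179322473922324966709990929141309317921994064353468520059948538278130969731949879665922387407325739549025245610228068377547095558065978290706437067054329611905180192886849973968458085487586033171800459894750998601055354959459396965782591707475837084080291846573662623459908512028900069469512078693099018310359880849083855182220048973824865445334771503882547581150879076166917884400820784501886965644785455257461764760513737794555584396014979247718408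

def vals300 : ℕ :=
  1361973554528695960944504197384444278126237314366426760362012787803745302784377028529267569893487502361499828836754733179634714412710948703628130220674108114090477824965940268854880685813651450335692384178023692951505572438255035566578620652149794406705895254950308980021588246855281349479889584174586345445635477909499475701236623175547360650763360423213531487406973643812204261084445863311930210070216052651962832614613109277284459430242890659793980092669846509651887508423644416722013803408203925545859411844987425979739094478784148414145556047254453027728958870953678477515086165558119139957065279098526019678604205600092992530397829837091941437929083835542959685047630758923898266200034667990397800670398389370480001566502509579173938696068037471163423879551109557871589960995599999783940743674187471689629404276822538030221747521467756661920531371013641301763821347430332084662443909532946965060614318532389327618479685962792344870336920058334511923071364527627571113532777112610509445850699072275601994951463093881166303571960139942248284515831506079968143156037644113074791896172632408474633752721887008838626119391552629570902336780081480263393762580708302053350425064144568264281752841250036095371814860192522009396579316844931458601210443724760762604722857033611118380566436085693097412395693781537056257939158399847068751178519348402971781155516504628560164011170243512302734010760576823534909336765813935222800667589234263461551362452458675743525979134197848872744522050684782957118227916200633390226608353602703192295531907445853453812013411049545331069701041098956069299334786191597736409672797052254712159099572640924550018516274311674002370436045551568104598228275630724174670037320718915463526161090912288612326489510613305258628228910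5074836010908093094293166163389238322427046311887276690987153781354749739689948073375346769048697209096943755450805959257100111660739950956332100179713186765496209420

def vals310 : ℕ :=
  4389018023181534363657962068143133478793349780284395044744340040621170590581101439132774403989817238657604434018917724370501286474646775647032685888889681151314203451622927268164721717186644197867797830892042145076313806501105634925863888911505417045917360580171883681913595931953431431968479434043131650776186422271341646671515840546317161735068004001506592675482632560507462527726468696989788037999968991248367012227547258905970718957809129024057276017046460860138212939607533748447965166879090933746176886526061307550344270613409602537140646716806873318995816572606381077920853476562535554800385757422226049929604929513701909339940608346966181058331912482894614756094140871785892323033079014816894466968218701752702825206496848627221205262748241035569513376217799016652548977394642000221004865178469580356985068338866279630587626774493552252449363111675106297830151515244849855389522419404426065102200754834899195945297440566909863519261840747589168869116070231540205045617357604356641354435377494981470796569613156468175836962052445036803745817839018459049820663967360974913907400836608660683777446603674740951134583266276635179934375750204801460856776364576304238489999705528265717060250864826357445014031153974122851430473317254245100184543840748733690325327924602518251737055500131457628402382470932431967972325537384614346155272310407002631863018402197136613943519798444626997700006675529624307029086068479310767809809110279698602515110659481746100199533188449983608959644432806140589027994891716610487561016684940678014286883453239182118862660692992640423127360180758500888779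132605546481659071473832973112261667627478564436215937496187476847305206094894404688249599757183163737557723248732807755158513104693257624053265375762266556640372903964218711566455368432299050884821199245846668124594172665944201664028907050838342165181776583085105428081652987008317975830306822203406710931628563664518614635378524168

def vals400 : ℕ :=
  4226814479571815051207081991882758104529702010103579126803148486835437533770523760944819096299768799108382619764643529523390416958271766993619668032449076370920369596138617039866928428194219592065902663721451234696586458732551701351064184165913682142144537760950840395231367388317530145838331491998967476102932855669362261419873887842864474925911702451478099445204441066534187541419148217272437827474399453445741531241304709292151675393520305341456374832126215223493455675948461496760670124071083117745031026614158587108045804308834023224423925490268850095285083109411129454789096427256422980489238402254083942311234968240223950811093963344439528579852777259383989969798365950416047993717206304805494530578635931725416132179645493394445330107002028605464737611208689984382661997676718335566486518801328035760961284481719592734239219117455751533641006268197301891095343308963380747068722852977423332013704971827060226467912899616784196171219369768249187879284000072274325403331946181406021157807763620005736646333008988752169205453760744158205963808644829772838919538856090781868624058982858545234205638484443698800862018044269319140690764874970104115409364139707922659620779194510526709400517103105815312352371769975129363701811573987302687768687830508171023129871121799802966018876270417055450095230588252403105273991100010148195146553030340007166640406002085788221888541162874778065731017294955659314419856481933277255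973644399695124629306706265117637957180072921336452667006068534100909579246408249407838443223959152950164784965218842155076030632771546122782451741001968184155518939669807066159880431167325061099660538659626040656598835533154834340474901299412305616283833465171361170676737771683668310246990208339402805740328853911603925498791690092743424336672732671928321768483131425690639938963981882014507641152918184789324848376819278324903723213083473520674079018093226253822899085880606309440409608934215692

def vals410 : ℕ :=
  1304405334485432732938863559777546116753164532664307258281382014325352366421433980233260535077643027400214753497258999053901121722145583940269385244507358033655180730031814815943387376624808337074331925157188525382033339745284425355731122848218080280804855015082684368966377843738368163095418668914934529477200094840072271057990638150542500249500627308112681386663253355842578147549118038031017013479699921675491506002332236347671232317789811464667649800285619828304209777401323718815469246762246277350179399466097321757564047938221896749149849617864828711275389525016814722607616426382226299714537232544997499355875803598325384368798940464423103222263051949270500684386391425915158215711737070489798841258024889244578138208186988595108126743914517117062481295668917730051373018539341873624618897188511886126156332248687624490585416019796124204530134309722911166867082912500480403543422140295535631280097924116419115070053570823988390071648015040140987797634206287846211070488194067329404492535613884322016659545382402636639498236331637936534926958916379382764602585958975424642402340711494574946317440028970201950679092101970014061523653291978159420633549500201151471464971789615296796336138974496797469119569868756121790014647983090974091158476515679420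6181696587474836601925825635538611998181733428529457433919669398392338349811622044845524860323789061184759425147775893459245308115614221759000600038776330039456383580605840826430646676304783952425134433902509101156812137622139703054626669417322578430160767791838833732309976663490882647707373707120737116183474730233750108436287946874130325265165262279251435194372369243742638657888707864893984657626349542286333236268004938236020750040972145005034236806387703570467147621825777003884425155951026896596068874405190340921323822285009069675197447945861272560816517871019691589296533471377172656066057267355473250377455319331901739359242605539696610783718242719252488

def vals500 : ℕ :=
  1315008949200120238153314397474635854742573958698444971575217306736098652757593740750946663604805788499259679539783568912883958655618347639518954169103749688348987638865384958287440922766120441048719376349661312029814194699714462616118782245629892527747878611400227509469541246377025867058678668901005458480665952637409771660456614123644000138680830977984480772535894672227546737813032388992279682547532327241051377675791609180313877422711814233621028240149984926091389903357322571054460535666715472037476956537774933927828828012311525332621265479553075389422207117199796791383548699270570922711147453192265503572771087265710490544308457250212934182816546951755903558213161789526633930154533581517574436082580470922489052322477350647353772054107499205705474575588157827062398695101544241736672652971129906428096152451076085992476531094567384885904825523077997080727287030786967330273411140033418454014757075719626154333824624166190473278294876044946266219389898010731149374110271405738478956467448893933046570711408657268316742484652012998590631111528324418510516216585652750528192272781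2097222982543563269677681228851384113825973490069555727698619500230350644622290040612608533932554071155797691099072369411278035810258905586258639871245627370255373250141243763095400269558239822350628351601220719461511575883767831958934362082437970793929154538711392535400995394741144925039917689859822734381397813938772489748436255933028576419654102723816083979079272291621638127829772199789066980420666947622655034155799592701511633295580765649765805564072094162491179050002534230126427406249222620684146004950760760121130387223351591678164278428029769311334999286345369192211618791931879220577735155361129462713214551755804398389924810328766251643957104718250851699773540850558568119816210929264769136568340951787765375407164929133668688724801782238891399813629586534516373570153596091357414616661031054935367293035443110517493772

def vals510 : ℕ :=
  1015672042745786712080427222773939786451720029078368625020288329481621062525635051300361855236034971531322286907543101721087669178862413382415855207529262491761534258589975119789646890810012330952548254939525616136479659335465901307998580750085193375844756336453289575168343429950486860052023810888558375515163384425899537936102182271203966222378618287333529977332320299116519901752396566885663946116649274140187112800408446554918323978814758265865556857812036208395862183196714249702569814410218734495600056242819296432158468627248983231290438471185265082168708954355305100553290215336677421086224848727159731391296045915614877685616535945075842392025904603468454242500757249394313846743632901724824904895008219301718969969890619709610241574324613325865690382922325000651076040930816512315003394538940647021947820233540047547428315640800702116878553757592903188655545017967387377130415868121376843652157551080531554695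7915236874457435453057208167200625384790087152360911651102011668762472854082922469770429565854454989880803653088687311064389628736820597954711445744658559888745450746502906498288441102892875387207914247368318220056943018846436143283948950588238905095872273111897320414456229751116013786272108753471537470475740470296226709365765219405014210077701989413802338344538260033877768146450065036249991060901241895635884541072189412966883249676497072630170158973341945420768521159391547667607325309268522184037421745014844685896433795440336578601822054866035165998488363154169269370750988603371807523048147353865301659041053351360128775741126412652158321332392253481855714276796422466169798867837039104044062459140154932922015745626482470168136474045538399676877128230180176353197321513207346682808597983299369041587068025169281209203160955796682106639484574263910053664774202505490243836420956435189274413666349583094203705480781846833256448546362610817882282055368308512362549783150838651815992044513280008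

def vals600 : ℕ :=
  1033221317228665901406175598015785314440593824691743214872514981074462569639674381791565381042756855514381954664177432049802789363548622165557925041983036576275419998211455346787230792439343115507024278932844318950344870016772307458902650996608002548961135321839223056813034153355054849380148397703158485276416837973582000575897384803450058583245816982620335461624663437050692170395317950779084278759434744251025451434076805959681608822496938402305329929462593348485199713654177039560402468489476679364879258940353067652224663559735244350765685892138585959076386846828759553536043054428361211084642112514660000422618681019620770882305630260110663407668698891096030929158976539366156176703125207600957366214504448244956648439639729732545661565266309200087371187281038490210577557126383910722734327229745909410822935497577846269557130809554777271429624403179047434793142596614889211231299003762315193959089927229134900439638133050176400561930137796483951921222493780605899509593996703837294225858461226143413697563767016291451640593073241420250975843592354056775392608397733262399798982969076940636148237552084371535462746669174035706854826665364669523106263249383167320641950591569175881239241344695678306762557515748264027734555308286060205424489497400679781580508362637938424456887024891381406282112615138170790763061695306813518799439154051023015524806779147355766354127484857844639524660442809864914620988144006113414587308588834360578132845675414709552080951895028850845555207858212445039143214308781843158405800238509190799702003073137466139187186829140147340510970909685703869936861661408140952547065357648535831065902436001808037440004626334681469567668431898858694031610887542039851470178845230716629125888051554205365164562328998298201250391521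4682666751087049314988473837310814713115439785041052439922242589856770666668306202902853804284256190427832818092844246044438645453441430122737051786248231644114014220

def vals700 : ℕ :=
  6575044746000601190766571987373179273712869793499455117445434538206300259318389858751285612976986513023662722217374639657825397820358079162290181486576459736069008530573799748688679941202902112423520730613591557110328334750740923169927450468229879347833733511632685380657585770845464406574294918431132789711206258366372624736277678788870201084723769502562787532188470211206749394218233709056772917907961796982369307323056523041412745036329217204438514195194533999290306404875225131330570043961896683351040815103409235133382364678945304992782406887682047325056354198380716337282693657758684855759344918190694301437101613843486866022331809737072750079370026115507873117923636441282902719326299609685755332335181003512101807561535789196759753258300805742197378856802982206801768601551796717373542394019519015490458099960838254523743459665269069827897000104626671547937418358145019953350016201609584753072085957742060585333299289031824348270724955540936347268316445166844272841018958137129069795759829589642231423617020714360409903156742938046022512296999359704507997148093544668990423461469613445791579470647424021382573879438332671129386465244890570172026294452918027176766022881898630174397980546236574593579741153584675763430916813051550636995392654578103842030417457558745459316401744528649865353706472239352089505738221228906227794307435943189221294913947546229159727987376304673639625805207941033882976362763972648389175404271097364322254348048380714651479615052045166479826983592268890662339820698183703578922496196523844232748325844809810600176571442998066806490525211917297112778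047057420823473096508397982336939788239442239416137420198088322260943876974804720643887761223210432498315246200184307287474719671357659286405004268954066493550787950414055133804899551984994934522007564926926565435197086738878342780004558973806053140899829603323483628128755676378525770704425036111200523146473176881020598973807022092

def vals800 : ℕ :=
  5166106586143329507030877990078926572202969123460001453841570106176900758514891225401658424316531359314059581157126434556768777024069109060792514310439377177670834886148980336727666412992640642269151361284916535207112722008844848687900304906419781451587855018167615753530482226385116516404114422946583184223382893073738728684467133760082923796350758179514744270600718634437973070260144637400731443403397327568209454464915031674693691737744150278405096642983563803897573682867441013583181503302040788688086898886132154341075104017722379675322686974038879725572908893543061905969181794515895571798664107480106669122575409669064412319092828650330530858929056932336655419347567642053630209108286032100135707813371515277896254487371695479842836297855691247899252027597826184863268712288475556621490564624840012812227967460606141487119775891647568896476916656630150051588195591348217794910711351787905238364785567538611318015957947345774359519909253833482992909307369078766659466259205257916163220895004675494874369688672263808783235912349796813538026000823339380256464695033764026344952274467333488596791423685094950781397867337578541584860967103384733166140284702356916246053347023668079971773377378589752232674897285483312907438217468248920867410764642696779874541579939980939015433609784401741442565865680017643832313597543234417585175515952746284913934185139858514050788047718807695400531333953255397025311677570945680044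890824447498085296368581709579009705783764649999686917298444474583046222185970065484066275297302904182463987540751397472649712673362048428610705268400675451767866220324747131664525648550342533418640693563656337527433832448035555907969970356426459945954185958973877895746962543055605964555456478017726867367512680849270535403899826305963963209779567035712358196629373923152661620405616810226617857187026342978548074798347408196383814529058556073983406440462908812224783315137927382297384220125122572

def vals900 : ℕ :=
  3287522373000300595383285993686589636856434896751012938201712469907738039975714245819474325591241657492474814410025397818503040204803015994697062629098928604515170118640726911237083236968058808234490909045512225550154572606032086740527751852590825081858546085978776406572159385959284146571602028267180694806361751842647587661360759841264200657456948389279666321793632447878451329181329808812487182879305165828233213442557845780741348935393713889520302316839923576116792445440667252410987124810325094030323940730715453143386022690927670466347245048589034147119082103023817819706394234463271784998640180757819422573044482960893746544793277089164508611574147593689720043243720694671189728697224688555041799453054274401005989807666860670865365026175597955234896221407203109009052063056981892345188419563188326468391015335473615224599077713802773277143278753450120927810872618904363487233266823658021522719425463470359906760311705615325145847119739037188532466915143611177529133351785234715565959808275084820210459300162185400454995636782435168827297257330614676806130575871329493676936300108204778179034726830531993159680956130528122297558627648115023906102455854125373964826404792967783268412013934699089215306888476986213988760216629643414335956717764873008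137750429315073473694768049450530249033637808400679608422603852522281945507389624268925284076338805638792444339012993090948321760509915281556506027484931935006073716795109713484519104941200982053777627816730614321779638673443777276820284220480186293166788463674342180978223046790045665761764943896363421741158376375989121126401670068959370615776180916364268676650239934272042914943019999790400522758700007862152654442310379327252662114074916604739772334460759410975021500864670475851550030286061755098280832288521256823883516524513251032548061411798062292071628868612237650979088680441014006608977144526041782599933254633790498178946410294454637939320403078238220

def vals1000 : ℕ :=
  1080185922557241624197365397925593737824257180359628600198385822081765126392718720836598923398732727886494329909038603772735787574109607725645813965043701055717896057853742364252246470514150156341543344151071649422679128324214630885151880758861948510238520780744206120146853568704754290320026059801640646648036429055637711222781125600077170884173010744435806919815768432659906944822321756709052954657936097004721988392248767373669661428575534523415493336968999371138407269835278057546080826610230723249097389349325258859174425143654073954790987851171076355346003238437924724579493219358428616213276407117536500400749006174929467072538151171338605882597506992469356987646355192800280923496917389760443038590350891681271496204359632245674685115249625115159670768027082132399423473136139238171513600866867305125000733179912980928488076961649032504773257244024033042312981011309222295490806068802732775212876679203093799842910376314296205273584373412604025398011526178662095993062901658522455532843326641676523799857906929609255945317767145475415731224774306852495772316431618141615865832290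7106952080291017343989600406010007052183452862311627408475158594483349269909257113047586552130915486310743287190349661846710019170730615471958933302749839882939373614870274254531429697914552160067606177581696224836469245291647308364347017274289032633204592308981330832972584867423733870274628108557749222103378290081119163199108755641543834005220508999979092232533921756455734422795073971894789512881060921815155335850809109030225089141076053077081516815376083221835540480835438229237393325266453655276122393493945677225484525292792640549384453177252980508516441241118243927979459834225066000496443874898937128621005676759511432440153944939332666966883361000583503617533295454228965214015313173754348122157367729172325716923844071911513702420966301748111341020587428378600029951326959312429880744752502068260845378480418327175188492

def hypMon : List (ℕ × ℕ × ℕ) :=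
  [(0, 0, 0), (1, 0, 0), (2, 0, 0), (3, 0, 0), (4, 0, 0), (5, 0, 0), (6, 0, 0), (7, 0, 0),
   (8, 0, 0), (9, 0, 0), (10, 0, 0), (0, 1, 0), (1, 1, 0), (2, 1, 0), (3, 1, 0), (4, 1, 0),
   (5, 1, 0)]

def hypVals : List ℕ :=
  [vals000, vals100, vals200, vals300, vals400, vals500, vals600, vals700, vals800, vals900,
   vals1000, vals010, vals110, vals210, vals310, vals410, vals510]

def coneMon : List (ℕ × ℕ × ℕ) :=
  [(0, 0, 0), (1, 0, 0), (2, 0, 0), (3, 0, 0), (4, 0, 0), (5, 0, 0), (6, 0, 0), (0, 1, 0),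
   (1, 1, 0), (2, 1, 0), (3, 1, 0), (4, 1, 0), (0, 2, 0), (1, 2, 0), (2, 2, 0)]

def coneVals : List ℕ :=
  [vals000, vals100, vals200, vals300, vals400, vals500, vals600, vals010, vals110, vals210,
   vals310, vals410, vals020, vals120, vals220]

def ellMon : List (ℕ × ℕ × ℕ) :=
  [(0, 0, 0), (1, 0, 0), (2, 0, 0), (3, 0, 0), (0, 0, 1), (1, 0, 1), (2, 0, 1), (0, 0, 2),
   (1, 0, 2), (0, 1, 0), (1, 1, 0), (2, 1, 0), (0, 1, 1), (1, 1, 1), (0, 1, 2)]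

def ellVals : List ℕ :=
  [vals000, vals100, vals200, vals300, vals001, vals101, vals201, vals002, vals102, vals010,
   vals110, vals210, vals011, vals111, vals012]

def subMask2 : ℕ :=
  1285

def subMask3 : ℕ :=
  150994953

def subMask4 : ℕ :=
  207303627025679672151739282518725515608083636268549661550672230932204076427619581513664660025002438838293668649261467294873964060694459977826321

def subMask5 : ℕ :=
  48229554031919796300721599479637339648645773918241

theorem isMask_one : isMask 1 tbl1 0 0 = true := by decide +kernel
theorem isMask_two : isMask 2 tbl2 1 subMask2 = true := by decide +kernel
theorem isMask_three : isMask 3 tbl3 1 subMask3 = true := by decide +kernel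
theorem isMask_four : isMask 4 tbl4 2 subMask4 = true := by decide +kernel
theorem isMask_five : isMask 5 tbl5 1 subMask5 = true := by decide +kernel

theorem valTable_hyp : ValTable ((0, 2, 0) :: hypMon) (vals020 :: hypVals) := by
  constructor <;> decide +kernel

theorem valTable_cone : ValTable ((0, 3, 0) :: coneMon) (vals030 :: coneVals) := by
  constructor <;> decide +kernel

theorem valTable_ell : ValTable ((0, 0, 3) :: ellMon) (vals003 :: ellVals) := by
  constructor <;> decide +kernel

end Tables

end CFF

namespace CFF

open Polynomial

/-- The number of zeros of degree `e` in a packed value table. -/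
def npts (e o G v : ℕ) : ℕ := cz e (4 ^ e) ((v >>> o) ||| G) 0

namespace PlaneModel

variable {K : Type} [Field K] [Algebra (ZMod 2) K] [IsG4 K] {D : Divisor (ZMod 2) K} {x y : K}

theorem npts_le {ms : List (ℕ × ℕ × ℕ)} {vs : List ℕ} (hl : ms.length = vs.length) {e t e' o G : ℕ}
    [TableField e t] (hv : isVals e t o ms vs = true) (hG : isMask e t e' G = true)
    (he' : ∀ d, d ∣ e → d ≠ e → d ∣ e') (h5 : 0 < e ∧ e ≤ 5) {c : List Bool}
    (h : PlaneModel D x y (polyOf c ms)) {N : ℕ}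
    (hN : ∀ R : Finset (Place (ZMod 2) K),
      (∀ P ∈ R, placeDegree (ZMod 2) P = e ∧ D P = 0) → R.card ≤ N) :
    npts e o G (xorOf c vs) ≤ N * e := by
  obtain ⟨s, hs, hs2⟩ := exists_points hl hv hG he' c
  rw [npts, ← hs]
  refine card_points_le h.tr (TF.finrank_eq (e := e) (t := t)) h.gen
    (fun P hx hy => (h.pole P).2 ⟨hx, hy⟩) ?_ s (fun q hq => ⟨(hs2 q hq).1, fun p hp => ?_⟩) hN
  · intro m hm
    rw [h.deg]
    have h12 := lf_large K (n := 12) (by norm_num)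
    have hmax := lf_le_max K (12 - (e : ℤ) * m)
    have hmul : (e : ℤ) * 2 ≤ (e : ℤ) * m :=
      mul_le_mul_of_nonneg_left (by exact_mod_cast hm) (by positivity)
    rcases Nat.lt_or_ge e 5 with h4 | h4
    · zify; omega
    · obtain rfl : e = 5 := by omega
      have := lf_le_of_le_two K (n := 12 - ((5 : ℕ) : ℤ) * m) (by push_cast at hmul ⊢; omega)
      zify at this ⊢; omega
  · obtain ⟨r, rfl⟩ := h.dvd p hp
    rw [map_mul, (hs2 q hq).2, zero_mul]

theorem cz_pos {ms : List (ℕ × ℕ × ℕ)} {vs : List ℕ} (hl : ms.length = vs.length) {e t o : ℕ}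
    [TableField e t] (hv : isVals e t o ms vs = true) {c : List Bool}
    (h : PlaneModel D x y (polyOf c ms)) {P : Place (ZMod 2) K} (hP : D P = 0)
    (hd : placeDegree (ZMod 2) P = e) : 0 < cz e (4 ^ e) (xorOf c vs >>> o) 0 := by
  obtain ⟨hx, hy⟩ := (h.pole P).1 hP
  have _ : Finite (Res P) := Module.finite_of_finite (ZMod 2)
  obtain ⟨φ⟩ := FiniteField.nonempty_algHom_of_finrank_dvd (F := ZMod 2) (K := Res P) (L := TF e t)
    (by rw [TF.finrank_eq, ← placeDegree_eq, hd])
  refine cz_pos_of_point hl hv c (a := φ (IsLocalRing.residue P.1 ⟨x, hx⟩))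
    (b := φ (IsLocalRing.residue P.1 ⟨y, hy⟩)) ?_
  rw [← aevalAeval_map, ← residue_aevalAeval P hx hy]
  have : (⟨aevalAeval x y (polyOf c ms), mem_of_aevalAeval P hx hy _⟩ : P.1) = 0 :=
    Subtype.ext h.rel
  rw [this, map_zero, map_zero]

section Counts

variable {ms : List (ℕ × ℕ × ℕ)} {vs : List ℕ} {c : List Bool} {N : ℕ}

theorem npts_one_le (hv : ValTable ms vs) (h : PlaneModel D x y (polyOf c ms))
    (hN : ∀ R : Finset (Place (ZMod 2) K),
    (∀ P ∈ R, placeDegree (ZMod 2) P = 1 ∧ D P = 0) → R.card ≤ N) :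
    npts 1 0 0 (xorOf c vs) ≤ N * 1 :=
  h.npts_le hv.len hv.v1 isMask_one (by intro d h1 h2; simp_all) (by norm_num) hN

theorem npts_two_le (hv : ValTable ms vs) (h : PlaneModel D x y (polyOf c ms))
    (hN : ∀ R : Finset (Place (ZMod 2) K),
    (∀ P ∈ R, placeDegree (ZMod 2) P = 2 ∧ D P = 0) → R.card ≤ N) :
    npts 2 4 subMask2 (xorOf c vs) ≤ N * 2 :=
  h.npts_le hv.len hv.v2 isMask_two (fun d h1 h2 => by
    rcases (Nat.dvd_prime (by norm_num)).1 h1 with h | h <;> simp_all) (by norm_num) hN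

theorem npts_three_le (hv : ValTable ms vs) (h : PlaneModel D x y (polyOf c ms))
    (hN : ∀ R : Finset (Place (ZMod 2) K),
    (∀ P ∈ R, placeDegree (ZMod 2) P = 3 ∧ D P = 0) → R.card ≤ N) :
    npts 3 36 subMask3 (xorOf c vs) ≤ N * 3 :=
  h.npts_le hv.len hv.v3 isMask_three (fun d h1 h2 => by
    rcases (Nat.dvd_prime (by norm_num)).1 h1 with h | h <;> simp_all) (by norm_num) hN

theorem npts_four_le (hv : ValTable ms vs) (h : PlaneModel D x y (polyOf c ms))
    (hN : ∀ R : Finset (Place (ZMod 2) K),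
    (∀ P ∈ R, placeDegree (ZMod 2) P = 4 ∧ D P = 0) → R.card ≤ N) :
    npts 4 228 subMask4 (xorOf c vs) ≤ N * 4 :=
  h.npts_le hv.len hv.v4 isMask_four (fun d h1 h2 => by
    have h3 := Nat.le_of_dvd (by norm_num) h1
    interval_cases d <;> simp_all) (by norm_num) hN

theorem npts_five_le (hv : ValTable ms vs) (h : PlaneModel D x y (polyOf c ms))
    (hN : ∀ R : Finset (Place (ZMod 2) K),
    (∀ P ∈ R, placeDegree (ZMod 2) P = 5 ∧ D P = 0) → R.card ≤ N) :
    npts 5 1252 subMask5 (xorOf c vs) ≤ N * 5 :=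
  h.npts_le hv.len hv.v5 isMask_five (fun d h1 h2 => by
    rcases (Nat.dvd_prime (by norm_num)).1 h1 with h | h <;> simp_all) (by norm_num) hN

end Counts

end PlaneModel

end CFF

namespace CFF

section Search

/-- The coefficient lists of the sextic models which pass all point counts. -/
def ellGood : List (List Bool) :=
  [[true, false, false, false, true, false, true, false, true,
    true, true, true, false, false, true],
   [true, false, true, true, true, false, false, false, false,
    false, false, false, true, false, true],
   [true, true, false, true, false, false, true, false, false,
    false, false, false, true, true, false],
   [true, true, true, true, true, true, false, true, true,
    true, true, true, false, true, false],
   [true, false, false, true, false, false, true, true, false,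
    true, false, false, true, false, false],
   [true, false, true, true, false, false, false, false, true,
    false, true, false, true, false, false],
   [true, true, false, true, true, true, true, true, true,
    false, true, true, false, true, true],
   [true, true, true, false, false, false, false, true, false,
    true, false, true, false, true, true],
   [true, false, false, true, false, false, false, false, false,
    true, false, false, false, true, false],
   [true, false, true, true, false, false, false, false, true,
    false, true, false, false, false, true],
   [true, true, false, true, true, true, true, false, false,
    false, true, true, true, false, true],
   [true, true, true, false, false, false, true, true, true,
    true, false, true, true, true, false],
   [true, false, false, true, false, false, false, false, false,
    false, true, false, false, false, true],
   [true, false, true, true, false, true, false, true, true,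
    true, false, true, true, true, false],
   [true, true, false, true, false, false, true, false, false,
    true, false, false, false, true, false],
   [true, true, true, false, true, false, true, false, true,
    false, true, true, true, false, true],
   [true, false, false, false, true, true, true, true, true,
    true, true, true, false, true, false],
   [true, false, true, true, true, true, false, false, true,
    false, false, false, true, false, true],
   [true, true, false, true, false, true, false, false, false,
    false, false, false, true, true, false],
   [true, true, true, true, true, false, true, false, false,
    true, true, true, false, false, true],
   [true, false, false, true, false, true, false, false, true,
    false, true, false, true, false, false],
   [true, false, true, true, false, false, true, true, true,
    true, false, true, false, true, true],
   [true, true, false, true, false, true, true, true, false,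
    true, false, false, true, false, false],
   [true, true, true, false, true, true, false, true, false,
    false, true, true, false, true, true]]

def hypLeaf (v : ℕ) (_ : List Bool) : Bool :=
  or (not (Nat.beq (v % 16) 15)) <| or (Nat.blt 4 (npts 2 4 subMask2 v)) <|
    or (Nat.blt 0 (npts 3 36 subMask3 v)) <| or (Nat.blt 4 (npts 4 228 subMask4 v)) <|
      Nat.blt 15 (npts 5 1252 subMask5 v)

def coneLeaf (v : ℕ) (_ : List Bool) : Bool :=
  or (not (Nat.beq (v % 16) 15)) <| or (Nat.blt 2 (npts 2 4 subMask2 v)) <|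
    or (Nat.blt 6 (npts 3 36 subMask3 v)) <| or (Nat.blt 8 (npts 4 228 subMask4 v)) <|
      and (Nat.blt 4 (npts 4 228 subMask4 v)) (Nat.blt 0 (npts 5 1252 subMask5 v))

def ellLeaf (v : ℕ) (c : List Bool) : Bool :=
  cond (Nat.beq (v % 16) 15)
    (or (Nat.blt 2 (npts 2 4 subMask2 v)) <| or (Nat.blt 3 (npts 3 36 subMask3 v)) <|
      or (Nat.blt 8 (npts 4 228 subMask4 v)) <| and (Nat.beq 0 (cz 2 (4 ^ 2) (v >>> 4) 0)) <|
        or (Nat.blt 4 (npts 4 228 subMask4 v)) <| or (Nat.beq 0 (cz 4 (4 ^ 4) (v >>> 228) 0)) <|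
          ellGood.elem c.reverse)
    (or (Nat.blt 1 (npts 1 0 0 v)) <| or (Nat.blt 0 (npts 2 4 subMask2 v)) <|
      or (Nat.blt 0 (npts 3 36 subMask3 v)) <| or (Nat.blt 8 (npts 4 228 subMask4 v)) <|
        Nat.blt 20 (npts 5 1252 subMask5 v))

theorem npts_one_eq_zero {v : ℕ} : npts 1 0 0 v = 0 ↔ v % 16 = 15 := by
  have h0 : (v >>> 0 ||| 0) = v := by simp
  have h : npts 1 0 0 v = cz 1 4 (v % 16) 0 := by
    rw [npts, cz_eq, cz_eq, h0]
    congr 1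
    refine congrArg _ (Finset.filter_congr fun i hi => ?_)
    have hi := Finset.mem_range.1 hi
    simp only [nib, Nat.shiftRight_eq_div_pow]
    interval_cases i <;> omega
  rw [h]
  have := Nat.mod_lt v (show 0 < 16 by norm_num)
  generalize v % 16 = u at this
  revert u
  decide +kernel

theorem tree_hyp : tree hypLeaf hypVals vals020 [] = true := by decide +kernel

theorem tree_cone : tree coneLeaf coneVals vals030 [] = true := by decide +kernel

theorem tree_ell : tree ellLeaf ellVals vals003 [] = true := by decide +kernel

end Search

end CFF

namespace CFF

section AffinePlaces

variable {K : Type} [Field K] [Algebra (ZMod 2) K] [IsG4 K]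

/-- There are at most `N` places of degree `e` outside the support of `D`. -/
def AtMost (D : Divisor (ZMod 2) K) (e N : ℕ) : Prop :=
  ∀ R : Finset (Place (ZMod 2) K), (∀ P ∈ R, placeDegree (ZMod 2) P = e ∧ D P = 0) → R.card ≤ N

namespace PlaneModel

variable {D : Divisor (ZMod 2) K} {x y : K} {c : List Bool}

theorem not_hyp (hc : c.length = 17)
    (h : PlaneModel D x y (polyOf (true :: c) ((0, 2, 0) :: hypMon))) (h1 : AtMost D 1 0)
    (h2 : AtMost D 2 2) (h3 : AtMost D 3 0) (h4 : AtMost D 4 1) (h5 : AtMost D 5 3) : False := by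
  have t := of_tree tree_hyp hc
  change hypLeaf (xorOf (true :: c) (vals020 :: hypVals)) _ = true at t
  have b1 := h.npts_one_le valTable_hyp h1
  have b2 := h.npts_two_le valTable_hyp h2
  have b3 := h.npts_three_le valTable_hyp h3
  have b4 := h.npts_four_le valTable_hyp h4
  have b5 := h.npts_five_le valTable_hyp h5
  generalize xorOf (true :: c) (vals020 :: hypVals) = v at *
  have b0 := npts_one_eq_zero.1 (Nat.le_zero.1 b1)
  simp only [hypLeaf, Bool.or_eq_true, Bool.not_eq_true', Nat.blt_eq, b0, Nat.beq_refl] at t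
  simp at t
  omega

theorem not_cone (hc : c.length = 15)
    (h : PlaneModel D x y (polyOf (true :: c) ((0, 3, 0) :: coneMon))) (h1 : AtMost D 1 0)
    (h2 : AtMost D 2 1) (h3 : AtMost D 3 2) (h4 : AtMost D 4 2)
    (h45 : AtMost D 4 1 ∨ AtMost D 5 0) : False := by
  have t := of_tree tree_cone hc
  change coneLeaf (xorOf (true :: c) (vals030 :: coneVals)) _ = true at t
  have b1 := h.npts_one_le valTable_cone h1
  have b2 := h.npts_two_le valTable_cone h2
  have b3 := h.npts_three_le valTable_cone h3
  have b4 := h.npts_four_le valTable_cone h4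
  have b4' := fun h4 => h.npts_four_le (N := 1) valTable_cone h4
  have b5 := fun h5 => h.npts_five_le (N := 0) valTable_cone h5
  generalize xorOf (true :: c) (vals030 :: coneVals) = v at *
  have b0 := npts_one_eq_zero.1 (Nat.le_zero.1 b1)
  simp only [coneLeaf, Bool.or_eq_true, Bool.and_eq_true, Bool.not_eq_true', Nat.blt_eq, b0,
    Nat.beq_refl] at t
  simp at t
  rcases h45 with h | h
  · have := b4' h; omega
  · have := b5 h; omega

theorem not_ell_of_one (hc : c.length = 15)
    (h : PlaneModel D x y (polyOf (true :: c) ((0, 0, 3) :: ellMon)))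
    {P : Place (ZMod 2) K} (hP : D P = 0) (hd : placeDegree (ZMod 2) P = 1) (h1 : AtMost D 1 1)
    (h2 : AtMost D 2 0) (h3 : AtMost D 3 0) (h4 : AtMost D 4 2) (h5 : AtMost D 5 4) : False := by
  have t := of_tree tree_ell hc
  change ellLeaf (xorOf (true :: c) (vals003 :: ellVals)) _ = true at t
  have b1 := h.npts_one_le valTable_ell h1
  have b2 := h.npts_two_le valTable_ell h2
  have b3 := h.npts_three_le valTable_ell h3
  have b4 := h.npts_four_le valTable_ell h4
  have b5 := h.npts_five_le valTable_ell h5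
  have b6 := h.cz_pos valTable_ell.len valTable_ell.v1 hP hd
  generalize xorOf (true :: c) (vals003 :: ellVals) = v at *
  have b0 : npts 1 0 0 v ≠ 0 := by
    rw [npts, Nat.or_zero]
    exact b6.ne'
  rw [ne_eq, npts_one_eq_zero] at b0
  rw [ellLeaf, Bool.eq_false_iff.2 fun h => b0 (Nat.eq_of_beq_eq_true h), cond_false] at t
  simp only [Bool.or_eq_true, Nat.blt_eq] at t
  omega

theorem ell_of_npts (hc : c.length = 15)
    (h : PlaneModel D x y (polyOf (true :: c) ((0, 0, 3) :: ellMon))) (h1 : AtMost D 1 0)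
    (h2 : AtMost D 2 1) (h3 : AtMost D 3 1) (h4 : AtMost D 4 2) :
    cz 2 (4 ^ 2) (xorOf (true :: c) (vals003 :: ellVals) >>> 4) 0 = 0 ∧
      (4 < npts 4 228 subMask4 (xorOf (true :: c) (vals003 :: ellVals)) ∨
        cz 4 (4 ^ 4) (xorOf (true :: c) (vals003 :: ellVals) >>> 228) 0 = 0 ∨ c ∈ ellGood) := by
  have t := of_tree tree_ell hc
  change ellLeaf (xorOf (true :: c) (vals003 :: ellVals)) _ = true at t
  have b1 := h.npts_one_le valTable_ell h1
  have b2 := h.npts_two_le valTable_ell h2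
  have b3 := h.npts_three_le valTable_ell h3
  have b4 := h.npts_four_le valTable_ell h4
  generalize xorOf (true :: c) (vals003 :: ellVals) = v at *
  have b0 := npts_one_eq_zero.1 (Nat.le_zero.1 b1)
  have hr : (c.reverseAux []).reverse = c := by
    rw [List.reverseAux_eq, List.append_nil, List.reverse_reverse]
  rw [ellLeaf, b0, Nat.beq_refl, cond_true, hr] at t
  simp only [Bool.or_eq_true, Bool.and_eq_true, Nat.blt_eq, List.elem_eq_mem,
    decide_eq_true_eq] at t
  rcases t with t | t | t | ⟨t1, t | t | t⟩
  · omega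
  · omega
  · omega
  · exact ⟨(Nat.eq_of_beq_eq_true t1).symm, .inl t⟩
  · exact ⟨(Nat.eq_of_beq_eq_true t1).symm, .inr (.inl (Nat.eq_of_beq_eq_true t).symm)⟩
  · exact ⟨(Nat.eq_of_beq_eq_true t1).symm, .inr (.inr t)⟩

theorem not_ell_of_two (hc : c.length = 15)
    (h : PlaneModel D x y (polyOf (true :: c) ((0, 0, 3) :: ellMon)))
    {P : Place (ZMod 2) K} (hP : D P = 0) (hd : placeDegree (ZMod 2) P = 2) (h1 : AtMost D 1 0)
    (h2 : AtMost D 2 1) (h3 : AtMost D 3 1) (h4 : AtMost D 4 2) : False :=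
  (h.cz_pos valTable_ell.len valTable_ell.v2 hP hd).ne' (h.ell_of_npts hc h1 h2 h3 h4).1

theorem mem_ellGood (hc : c.length = 15)
    (h : PlaneModel D x y (polyOf (true :: c) ((0, 0, 3) :: ellMon)))
    {P : Place (ZMod 2) K} (hP : D P = 0) (hd : placeDegree (ZMod 2) P = 4) (h1 : AtMost D 1 0)
    (h2 : AtMost D 2 1) (h3 : AtMost D 3 1) (h4 : AtMost D 4 1) : c ∈ ellGood := by
  have b4 := h.npts_four_le valTable_ell h4
  rcases (h.ell_of_npts hc h1 h2 h3 fun R hR => (h4 R hR).trans (by norm_num)).2 with h5 | h5 | h5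
  · omega
  · exact absurd h5 (h.cz_pos valTable_ell.len valTable_ell.v4 hP hd).ne'
  · exact h5

end PlaneModel

end AffinePlaces

end CFF

namespace CFF

open Polynomial

section Isometries

variable {K : Type} [Field K]

/-- The homogeneous cubic form corresponding to a sextic model. -/
def cubic (w : Fin 4 → K) : List Bool → List (ℕ × ℕ × ℕ) → K
  | b :: c, m :: ms =>
    (if b then w 0 ^ m.1 * w 1 ^ m.2.1 * w 2 ^ m.2.2 * w 3 ^ (3 - m.1 - m.2.1 - m.2.2) else 0) +
      cubic w c ms
  | _, _ => 0

theorem cubic_smul (t : K) (w : Fin 4 → K) : ∀ (c : List Bool) (ms : List (ℕ × ℕ × ℕ)),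
    (∀ m ∈ ms, m.1 + m.2.1 + m.2.2 ≤ 3) → cubic (t • w) c ms = t ^ 3 * cubic w c ms
  | [], _, _ => by simp [cubic]
  | _ :: _, [], _ => by simp [cubic]
  | b :: c, m :: ms, h => by
    obtain ⟨d, hd⟩ := Nat.exists_eq_add_of_le (h m (by simp))
    have hd' : 3 - m.1 - m.2.1 - m.2.2 = d := by omega
    rw [cubic, cubic, cubic_smul t w c ms fun m hm => h m (by simp [hm]), mul_add, hd', hd]
    congr 1
    split_ifs
    · simp only [Pi.smul_apply, smul_eq_mul]; ring
    · simp

theorem cubic_eq [Algebra (ZMod 2) K] {w : Fin 4 → K} (h : w 2 = w 0 ^ 2 + w 0 * w 1 + w 1 ^ 2)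
    (h1 : w 3 = 1) : ∀ (c : List Bool) (ms : List (ℕ × ℕ × ℕ)),
    cubic w c ms = aevalAeval (w 0) (w 1) (polyOf c ms)
  | [], _ => by simp [cubic, polyOf]
  | _ :: _, [] => by simp [cubic, polyOf]
  | b :: c, m :: ms => by
    rw [cubic, polyOf, map_add, cubic_eq h h1 c ms, h, h1]
    congr 1
    split_ifs
    · simp [mono, mul_comm (w 1)]
    · simp

variable [CharP K 2] [Algebra (ZMod 2) K]

/-- The substitution `M` preserves the norm quadric and the cubic form given by `c`. -/
def IsIsometry (K : Type) [Field K] [Algebra (ZMod 2) K] (M : Matrix (Fin 4) (Fin 4) (ZMod 2))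
    (c : List Bool) : Prop :=
  ∀ x y z t : K, z * t = x ^ 2 + x * y + y ^ 2 → ∀ v,
    v = (M.map (algebraMap (ZMod 2) K)).mulVec ![x, y, z, t] →
      v 2 * v 3 = v 0 ^ 2 + v 0 * v 1 + v 1 ^ 2 ∧
      (t = 1 → cubic v (true :: c) ((0, 0, 3) :: ellMon) =
        cubic ![x, y, z, t] (true :: c) ((0, 0, 3) :: ellMon))

theorem isIsometry_one {c : List Bool} (hc : c ∈
    [[true, false, false, false, true, false, true, false, true,
      true, true, true, false, false, true],
     [true, false, true, true, true, false, false, false, false,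
      false, false, false, true, false, true],
     [true, true, false, true, false, false, true, false, false,
      false, false, false, true, true, false],
     [true, true, true, true, true, true, false, true, true,
      true, true, true, false, true, false]]) :
    IsIsometry K
      !![0, 1, 0, 0; 1, 0, 0, 1; 0, 0, 0, 1; 0, 1, 1, 1] c := by
  intro x y z t hz v hv
  have h0 : v 0 = y := by rw [hv]; simp [Matrix.mulVec, dotProduct, Fin.sum_univ_four]
  have h1 : v 1 = x + t := by rw [hv]; simp [Matrix.mulVec, dotProduct, Fin.sum_univ_four]
  have h2 : v 2 = t := by rw [hv]; simp [Matrix.mulVec, dotProduct, Fin.sum_univ_four]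
  have h3 : v 3 = y + z + t := by rw [hv]; simp [Matrix.mulVec, dotProduct, Fin.sum_univ_four]
  refine ⟨by rw [h0, h1, h2, h3]; grind, fun ht => ?_⟩
  subst ht
  obtain rfl : z = x ^ 2 + x * y + y ^ 2 := by rw [← hz, mul_one]
  simp only [List.mem_cons, List.not_mem_nil, or_false] at hc
  rcases hc with rfl | rfl | rfl | rfl <;>
  · simp only [cubic, ellMon, h0, h1, h2, h3, if_true, Bool.false_eq_true, if_false]
    simp
    grind

theorem isIsometry_two {c : List Bool} (hc : c ∈
    [[true, false, false, true, false, false, true, true, false,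
      true, false, false, true, false, false],
     [true, false, true, true, false, false, false, false, true,
      false, true, false, true, false, false],
     [true, true, false, true, true, true, true, true, true,
      false, true, true, false, true, true],
     [true, true, true, false, false, false, false, true, false,
      true, false, true, false, true, true]]) :
    IsIsometry K
      !![0, 1, 0, 0; 1, 0, 1, 0; 0, 1, 1, 1; 0, 0, 1, 0] c := by
  intro x y z t hz v hv
  have h0 : v 0 = y := by rw [hv]; simp [Matrix.mulVec, dotProduct, Fin.sum_univ_four]
  have h1 : v 1 = x + z := by rw [hv]; simp [Matrix.mulVec, dotProduct, Fin.sum_univ_four]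
  have h2 : v 2 = y + z + t := by rw [hv]; simp [Matrix.mulVec, dotProduct, Fin.sum_univ_four]
  have h3 : v 3 = z := by rw [hv]; simp [Matrix.mulVec, dotProduct, Fin.sum_univ_four]
  refine ⟨by rw [h0, h1, h2, h3]; grind, fun ht => ?_⟩
  subst ht
  obtain rfl : z = x ^ 2 + x * y + y ^ 2 := by rw [← hz, mul_one]
  simp only [List.mem_cons, List.not_mem_nil, or_false] at hc
  rcases hc with rfl | rfl | rfl | rfl <;>
  · simp only [cubic, ellMon, h0, h1, h2, h3, if_true, Bool.false_eq_true, if_false]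
    simp
    grind

theorem isIsometry_three {c : List Bool} (hc : c ∈
    [[true, false, false, true, false, false, false, false, false,
      true, false, false, false, true, false],
     [true, false, true, true, false, false, false, false, true,
      false, true, false, false, false, true],
     [true, true, false, true, true, true, true, false, false,
      false, true, true, true, false, true],
     [true, true, true, false, false, false, true, true, true,
      true, false, true, true, true, false]]) :
    IsIsometry K
      !![1, 0, 0, 1; 1, 1, 0, 0; 0, 0, 0, 1; 1, 1, 1, 1] c := by
  intro x y z t hz v hv
  have h0 : v 0 = x + t := by rw [hv]; simp [Matrix.mulVec, dotProduct, Fin.sum_univ_four]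
  have h1 : v 1 = x + y := by rw [hv]; simp [Matrix.mulVec, dotProduct, Fin.sum_univ_four]
  have h2 : v 2 = t := by rw [hv]; simp [Matrix.mulVec, dotProduct, Fin.sum_univ_four]
  have h3 : v 3 = x + y + z + t := by rw [hv]; simp [Matrix.mulVec, dotProduct, Fin.sum_univ_four]
  refine ⟨by rw [h0, h1, h2, h3]; grind, fun ht => ?_⟩
  subst ht
  obtain rfl : z = x ^ 2 + x * y + y ^ 2 := by rw [← hz, mul_one]
  simp only [List.mem_cons, List.not_mem_nil, or_false] at hc
  rcases hc with rfl | rfl | rfl | rfl <;>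
  · simp only [cubic, ellMon, h0, h1, h2, h3, if_true, Bool.false_eq_true, if_false]
    simp
    grind

theorem isIsometry_four {c : List Bool} (hc : c ∈
    [[true, false, false, true, false, false, false, false, false,
      false, true, false, false, false, true],
     [true, false, true, true, false, true, false, true, true,
      true, false, true, true, true, false],
     [true, true, false, true, false, false, true, false, false,
      true, false, false, false, true, false],
     [true, true, true, false, true, false, true, false, true,
      false, true, true, true, false, true]]) :
    IsIsometry K
      !![1, 0, 0, 1; 1, 1, 0, 1; 0, 0, 0, 1; 0, 1, 1, 1] c := by
  intro x y z t hz v hv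
  have h0 : v 0 = x + t := by rw [hv]; simp [Matrix.mulVec, dotProduct, Fin.sum_univ_four]
  have h1 : v 1 = x + y + t := by rw [hv]; simp [Matrix.mulVec, dotProduct, Fin.sum_univ_four]
  have h2 : v 2 = t := by rw [hv]; simp [Matrix.mulVec, dotProduct, Fin.sum_univ_four]
  have h3 : v 3 = y + z + t := by rw [hv]; simp [Matrix.mulVec, dotProduct, Fin.sum_univ_four]
  refine ⟨by rw [h0, h1, h2, h3]; grind, fun ht => ?_⟩
  subst ht
  obtain rfl : z = x ^ 2 + x * y + y ^ 2 := by rw [← hz, mul_one]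
  simp only [List.mem_cons, List.not_mem_nil, or_false] at hc
  rcases hc with rfl | rfl | rfl | rfl <;>
  · simp only [cubic, ellMon, h0, h1, h2, h3, if_true, Bool.false_eq_true, if_false]
    simp
    grind

theorem isIsometry_five {c : List Bool} (hc : c ∈
    [[true, false, false, false, true, true, true, true, true,
      true, true, true, false, true, false],
     [true, false, true, true, true, true, false, false, true,
      false, false, false, true, false, true],
     [true, true, false, true, false, true, false, false, false,
      false, false, false, true, true, false],
     [true, true, true, true, true, false, true, false, false,
      true, true, true, false, false, true]]) :
    IsIsometry K
      !![1, 1, 0, 0; 0, 1, 0, 1; 0, 0, 0, 1; 1, 1, 1, 1] c := by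
  intro x y z t hz v hv
  have h0 : v 0 = x + y := by rw [hv]; simp [Matrix.mulVec, dotProduct, Fin.sum_univ_four]
  have h1 : v 1 = y + t := by rw [hv]; simp [Matrix.mulVec, dotProduct, Fin.sum_univ_four]
  have h2 : v 2 = t := by rw [hv]; simp [Matrix.mulVec, dotProduct, Fin.sum_univ_four]
  have h3 : v 3 = x + y + z + t := by rw [hv]; simp [Matrix.mulVec, dotProduct, Fin.sum_univ_four]
  refine ⟨by rw [h0, h1, h2, h3]; grind, fun ht => ?_⟩
  subst ht
  obtain rfl : z = x ^ 2 + x * y + y ^ 2 := by rw [← hz, mul_one]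
  simp only [List.mem_cons, List.not_mem_nil, or_false] at hc
  rcases hc with rfl | rfl | rfl | rfl <;>
  · simp only [cubic, ellMon, h0, h1, h2, h3, if_true, Bool.false_eq_true, if_false]
    simp
    grind

theorem isIsometry_six {c : List Bool} (hc : c ∈
    [[true, false, false, true, false, true, false, false, true,
      false, true, false, true, false, false],
     [true, false, true, true, false, false, true, true, true,
      true, false, true, false, true, true],
     [true, true, false, true, false, true, true, true, false,
      true, false, false, true, false, false],
     [true, true, true, false, true, true, false, true, false,
      false, true, true, false, true, true]]) :
    IsIsometry K
      !![1, 1, 0, 0; 0, 1, 1, 0; 1, 1, 1, 1; 0, 0, 1, 0] c := by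
  intro x y z t hz v hv
  have h0 : v 0 = x + y := by rw [hv]; simp [Matrix.mulVec, dotProduct, Fin.sum_univ_four]
  have h1 : v 1 = y + z := by rw [hv]; simp [Matrix.mulVec, dotProduct, Fin.sum_univ_four]
  have h2 : v 2 = x + y + z + t := by rw [hv]; simp [Matrix.mulVec, dotProduct, Fin.sum_univ_four]
  have h3 : v 3 = z := by rw [hv]; simp [Matrix.mulVec, dotProduct, Fin.sum_univ_four]
  refine ⟨by rw [h0, h1, h2, h3]; grind, fun ht => ?_⟩
  subst ht
  obtain rfl : z = x ^ 2 + x * y + y ^ 2 := by rw [← hz, mul_one]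
  simp only [List.mem_cons, List.not_mem_nil, or_false] at hc
  rcases hc with rfl | rfl | rfl | rfl <;>
  · simp only [cubic, ellMon, h0, h1, h2, h3, if_true, Bool.false_eq_true, if_false]
    simp
    grind

theorem exists_isometry {c : List Bool} (hc : c ∈ ellGood) :
    ∃ M : Matrix (Fin 4) (Fin 4) (ZMod 2), M ^ 5 = 1 ∧ M ≠ 1 ∧ IsIsometry K M c := by
  simp only [ellGood, List.mem_cons, List.not_mem_nil, or_false] at hc
  rcases hc with h | h | h | h |
      h | h | h | h |
      h | h | h | h |
      h | h | h | h |
      h | h | h | h |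
      h | h | h | h
  iterate 4 exact ⟨_, by decide, by decide, isIsometry_one (by simp [h])⟩
  iterate 4 exact ⟨_, by decide, by decide, isIsometry_two (by simp [h])⟩
  iterate 4 exact ⟨_, by decide, by decide, isIsometry_three (by simp [h])⟩
  iterate 4 exact ⟨_, by decide, by decide, isIsometry_four (by simp [h])⟩
  iterate 4 exact ⟨_, by decide, by decide, isIsometry_five (by simp [h])⟩
  iterate 4 exact ⟨_, by decide, by decide, isIsometry_six (by simp [h])⟩

end Isometries

end CFF

namespace CFF

open Polynomial IntermediateField

section Substitution

variable {F K : Type} [Field F] [Field K] [Algebra F K] [IsCF F K]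

theorem exists_mul_eq_aevalAeval {x y : K} (hx : Transcendental F x)
    (h : adjoin (adjoin F {x}) {y} = ⊤) (f : K) :
    ∃ d : F[X], d ≠ 0 ∧ ∃ r : F[X][X], aeval x d * f = aevalAeval x y r := by
  have hinj := transcendental_iff_injective.1 hx
  have hfin := finiteDimensional_adjoin hx
  have hyint : IsIntegral (adjoin F {x}) y := Algebra.IsIntegral.isIntegral y
  have hf : f ∈ adjoin (adjoin F {x}) {y} := h ▸ mem_top
  rw [← mem_toSubalgebra, adjoin_simple_toSubalgebra_of_isAlgebraic hyint.isAlgebraic,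
    Algebra.adjoin_singleton_eq_range_aeval] at hf
  obtain ⟨q, rfl⟩ := hf
  induction q using Polynomial.induction_on' with
  | add p q hp hq =>
    obtain ⟨d, hd, r, hr⟩ := hp
    obtain ⟨e, he, s, hs⟩ := hq
    refine ⟨d * e, mul_ne_zero hd he, C e * r + C d * s, ?_⟩
    simp only [map_mul, map_add, aevalAeval_C, ← hr, ← hs]
    ring
  | monomial n a =>
    obtain ⟨r, s, hrs⟩ := (mem_adjoin_simple_iff F _).1 a.2
    by_cases hs : s = 0
    · refine ⟨1, one_ne_zero, 0, ?_⟩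
      have h0 : (a : K) = 0 := by rw [hrs, hs, map_zero, div_zero]
      change _ * aeval y (monomial n a) = _
      rw [aeval_monomial, IntermediateField.algebraMap_apply, h0]
      simp
    · refine ⟨s, hs, C r * X ^ n, ?_⟩
      have hs0 : aeval x s ≠ 0 := fun h => hs (hinj (by rw [h, map_zero]))
      change _ * aeval y (monomial n a) = _
      rw [aeval_monomial, IntermediateField.algebraMap_apply, hrs, map_mul, map_pow, aevalAeval_C]
      have hY : aevalAeval x y (X : F[X][X]) = y := by simp
      rw [hY, ← mul_assoc, mul_div_cancel₀ _ hs0]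

/-- A substitution which respects all relations between generators is an endomorphism. -/
theorem exists_algHom {x y x' y' : K} (hx : Transcendental F x) (hx' : Transcendental F x')
    (h : adjoin (adjoin F {x}) {y} = ⊤)
    (hrel : ∀ p : F[X][X], aevalAeval x y p = 0 → aevalAeval x' y' p = 0) :
    ∃ φ : K →ₐ[F] K, φ x = x' ∧ φ y = y' := by
  choose d hd r hr using exists_mul_eq_aevalAeval hx h
  have hne : ∀ {x : K}, Transcendental F x → ∀ {e : F[X]}, e ≠ 0 → aeval x e ≠ 0 :=
    fun hx e he h => he (transcendental_iff_injective.1 hx (by rw [h, map_zero]))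
  set g : K → K := fun f => aevalAeval x' y' (r f) / aeval x' (d f) with hg
  have hgr : ∀ f, aeval x' (d f) * g f = aevalAeval x' y' (r f) := fun f =>
    mul_div_cancel₀ _ (hne hx' (hd f))
  have key : ∀ {f : K} {e : F[X]} {s : F[X][X]}, e ≠ 0 → aeval x e * f = aevalAeval x y s →
      aeval x' e * g f = aevalAeval x' y' s := by
    intro f e s he hs
    have h1 := hrel (C (d f) * s - C e * r f) (by
      rw [map_sub, map_mul, map_mul, aevalAeval_C, aevalAeval_C, ← hs, ← hr f]; ring)
    rw [map_sub, map_mul, map_mul, aevalAeval_C, aevalAeval_C, ← hgr f, sub_eq_zero] at h1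
    refine mul_left_cancel₀ (hne hx' (hd f)) ?_
    rw [h1]; ring
  have hpoly : ∀ s : F[X][X], g (aevalAeval x y s) = aevalAeval x' y' s := fun s => by
    simpa using key (f := aevalAeval x y s) (e := 1) (s := s) one_ne_zero (by simp)
  have hadd : ∀ a b, g (a + b) = g a + g b := fun a b => by
    have h1 := key (f := a + b) (e := d a * d b) (s := C (d b) * r a + C (d a) * r b)
      (mul_ne_zero (hd a) (hd b)) (by
        simp only [map_mul, map_add, aevalAeval_C, ← hr]; ring)
    refine mul_left_cancel₀ (hne hx' (mul_ne_zero (hd a) (hd b))) (h1.trans ?_)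
    simp only [map_mul, map_add, aevalAeval_C, ← hgr]; ring
  have hmul : ∀ a b, g (a * b) = g a * g b := fun a b => by
    have h1 := key (f := a * b) (e := d a * d b) (s := r a * r b)
      (mul_ne_zero (hd a) (hd b)) (by
        simp only [map_mul, ← hr]; ring)
    refine mul_left_cancel₀ (hne hx' (mul_ne_zero (hd a) (hd b))) (h1.trans ?_)
    simp only [map_mul, ← hgr]; ring
  have hconst : ∀ c : F, g (algebraMap F K c) = algebraMap F K c := fun c => by
    have := hpoly (C (C c))
    rwa [aevalAeval_C, aevalAeval_C, aeval_C, aeval_C] at this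
  refine ⟨{ toFun := g, map_one' := ?_, map_mul' := hmul, map_zero' := ?_, map_add' := hadd,
            commutes' := hconst }, ?_, ?_⟩
  · simpa using hconst 1
  · simpa using hconst 0
  · have := hpoly (C X)
    rwa [aevalAeval_C, aevalAeval_C, aeval_X, aeval_X] at this
  · simpa using hpoly X

theorem algHom_ext_of_adjoin {x y : K} (hx : Transcendental F x)
    (h : adjoin (adjoin F {x}) {y} = ⊤) {φ ψ : K →ₐ[F] K} (h1 : φ x = ψ x) (h2 : φ y = ψ y) :
    φ = ψ := by
  refine AlgHom.ext fun f => ?_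
  obtain ⟨d, hd, r, hr⟩ := exists_mul_eq_aevalAeval hx h f
  have hd' : φ (aeval x d) ≠ 0 := by
    rw [_root_.map_ne_zero]
    exact fun h => hd (transcendental_iff_injective.1 hx (by rw [h, map_zero]))
  have hr1 := congrArg φ hr
  have hr2 := congrArg ψ hr
  have e1 : φ (aeval x d) = ψ (aeval x d) := by
    rw [← aeval_algHom_apply, ← aeval_algHom_apply, h1]
  have e2 : φ (aevalAeval x y r) = ψ (aevalAeval x y r) := by
    rw [aevalAeval_map φ, aevalAeval_map ψ, h1, h2]
  rw [map_mul] at hr1 hr2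
  rw [← e1, ← e2, ← hr1] at hr2
  exact (mul_left_cancel₀ hd' hr2).symm

end Substitution

end CFF

namespace CFF

open Polynomial IntermediateField

section Automorphism

variable {K : Type} [Field K] [Algebra (ZMod 2) K] [IsG4 K]

theorem PlaneModel.exists_algHom_of_isIsometry {D : Divisor (ZMod 2) K} {x y : K} {c : List Bool}
    (h : PlaneModel D x y (polyOf (true :: c) ((0, 0, 3) :: ellMon)))
    (hgen : adjoin (adjoin (ZMod 2) {x}) {y} = ⊤)
    (hli : LinearIndependent (ZMod 2) ![x, y, x ^ 2 + x * y + y ^ 2, 1])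
    {M : Matrix (Fin 4) (Fin 4) (ZMod 2)} (hM5 : M ^ 5 = 1) (hM1 : M ≠ 1)
    (hM : IsIsometry K M c) :
    ∃ φ : K →ₐ[ZMod 2] K, (∀ f, φ (φ (φ (φ (φ f)))) = f) ∧ ∃ f, φ f ≠ f := by
  set w : Fin 4 → K := ![x, y, x ^ 2 + x * y + y ^ 2, 1] with hw
  set A := M.map (algebraMap (ZMod 2) K) with hA
  set v := A.mulVec w with hv
  have hA5 : A ^ 5 = 1 := by
    have : A = (algebraMap (ZMod 2) K).mapMatrix M := rfl
    rw [this, ← map_pow, hM5, map_one]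
  have hli' : ∀ r : Fin 4 → ZMod 2, ∑ i, algebraMap (ZMod 2) K (r i) * w i = 0 → r = 0 := by
    intro r hr
    refine funext (Fintype.linearIndependent_iff.1 hli r ?_)
    simpa only [Algebra.smul_def] using hr
  have hrow : ∀ r : Fin 4 → ZMod 2,
      ∑ i, algebraMap (ZMod 2) K (r i) * v i = 0 → r = 0 := by
    intro r hr
    have h0 : Matrix.vecMul r M = 0 := by
      refine hli' _ ?_
      rw [← hr]
      simp only [hv, Matrix.mulVec, Matrix.vecMul, dotProduct, hA, Matrix.map_apply, map_sum,
        map_mul, Finset.sum_mul, Finset.mul_sum]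
      rw [Finset.sum_comm]
      simp only [mul_assoc]
    have h1 : Matrix.vecMul r (M ^ 5) = 0 := by
      rw [pow_succ', ← Matrix.vecMul_vecMul, h0, Matrix.zero_vecMul]
    rwa [hM5, Matrix.vecMul_one] at h1
  have hv3 : v 3 ≠ 0 := by
    intro h0
    have := hrow (Pi.single 3 1) (by
      rw [Finset.sum_eq_single 3 (fun b _ hb => by rw [Pi.single_eq_of_ne hb]; simp) (by simp)]
      simp [h0])
    simpa using congrFun this 3
  have hiso := hM x y (x ^ 2 + x * y + y ^ 2) 1 (mul_one _) v rfl
  set u := (v 3)⁻¹ • v with hu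
  have hu3 : u 3 = 1 := by simp [hu, hv3]
  have hu2 : u 2 = u 0 ^ 2 + u 0 * u 1 + u 1 ^ 2 := by
    have h1 := hiso.1
    simp only [hu, Pi.smul_apply, smul_eq_mul]
    field_simp
    linear_combination h1
  have hcub : cubic u (true :: c) ((0, 0, 3) :: ellMon) = 0 := by
    rw [hu, cubic_smul _ _ _ _ (by decide), hiso.2 rfl]
    have : cubic w (true :: c) ((0, 0, 3) :: ellMon) = 0 := by
      rw [cubic_eq (w := w) rfl rfl]
      exact h.rel
    rw [← hw, this, mul_zero]
  rw [cubic_eq hu2 hu3] at hcub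
  have hu0 : Transcendental (ZMod 2) (u 0) := by
    refine transcendental_of_not_mem ?_
    rintro ⟨a, ha⟩
    have := hrow (Pi.single 0 1 - Pi.single 3 a) (by
      have e : v 0 = algebraMap (ZMod 2) K a * v 3 := by
        rw [ha, hu]; simp only [Pi.smul_apply, smul_eq_mul]; field_simp
      simp [Fin.sum_univ_four, e])
    simpa using congrFun this 0
  obtain ⟨φ, hφx, hφy⟩ := exists_algHom h.tr hu0 hgen (y' := u 1) (fun p hp => by
    obtain ⟨q, rfl⟩ := h.dvd p hp
    rw [map_mul, hcub, zero_mul])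
  have hφw : ∀ i, φ (w i) = u i := by
    intro i
    fin_cases i
    · exact hφx
    · exact hφy
    · change φ (x ^ 2 + x * y + y ^ 2) = u 2
      rw [hu2, map_add, map_add, map_mul, map_pow, map_pow, hφx, hφy]
    · change φ 1 = u 3
      rw [hu3, map_one]
  have hφA : ∀ (s : Fin 4 → K) (i : Fin 4),
      φ (A.mulVec s i) = A.mulVec (fun j => φ (s j)) i := by
    intro s i
    simp only [Matrix.mulVec, dotProduct, map_sum, map_mul, hA, Matrix.map_apply,
      AlgHom.commutes]
  have hiter : ∀ n : ℕ, ∃ C : K, ∀ i, (φ ^ n) (w i) = C * (A ^ n).mulVec w i := by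
    intro n
    induction n with
    | zero => exact ⟨1, fun i => by simp⟩
    | succ n ih =>
      obtain ⟨C, hC⟩ := ih
      refine ⟨φ C * (v 3)⁻¹, fun i => ?_⟩
      have hcomm : ∀ (n : ℕ) (s : Fin 4 → K) (i : Fin 4),
          φ ((A ^ n).mulVec s i) = (A ^ n).mulVec (fun j => φ (s j)) i := by
        intro n
        induction n with
        | zero => intro s i; simp
        | succ n ih =>
          intro s i
          rw [pow_succ, ← Matrix.mulVec_mulVec, ih, ← Matrix.mulVec_mulVec]
          simp only [hφA]
      rw [pow_succ', AlgHom.mul_apply, hC, map_mul, hcomm]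
      have e : (fun j => φ (w j)) = (v 3)⁻¹ • A.mulVec w := funext hφw
      rw [e, Matrix.mulVec_smul, Matrix.mulVec_mulVec, ← pow_succ, Pi.smul_apply, smul_eq_mul,
        mul_assoc]
  refine ⟨φ, ?_, ?_⟩
  · obtain ⟨C, hC⟩ := hiter 5
    rw [hA5, Matrix.one_mulVec] at hC
    have hC1 : C = 1 := by
      have := hC 3
      change (φ ^ 5) 1 = C * 1 at this
      rw [map_one, mul_one] at this
      exact this.symm
    rw [hC1] at hC
    have h1 : φ ^ 5 = AlgHom.id (ZMod 2) K :=
      algHom_ext_of_adjoin h.tr hgen ((hC 0).trans (one_mul _)) ((hC 1).trans (one_mul _))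
    intro f
    exact congrArg (fun ψ : K →ₐ[ZMod 2] K => ψ f) h1
  · by_contra! hid
    have hvw : A.mulVec w = v 3 • w := by
      funext i
      have h1 := (hφw i).symm.trans (hid _)
      rw [Pi.smul_apply, smul_eq_mul, ← h1, hu, Pi.smul_apply, smul_eq_mul,
        mul_inv_cancel_left₀ hv3]
    have hpow : ∀ n : ℕ, (A ^ n).mulVec w = v 3 ^ n • w := by
      intro n
      induction n with
      | zero => simp
      | succ n ih =>
        rw [pow_succ, ← Matrix.mulVec_mulVec, hvw, Matrix.mulVec_smul, ih, smul_smul, pow_succ,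
          mul_comm]
    have h5 : v 3 ^ 5 = 1 := by
      have h1 := congrFun (hpow 5) 3
      rw [hA5, Matrix.one_mulVec, Pi.smul_apply, smul_eq_mul] at h1
      change 1 = v 3 ^ 5 * 1 at h1
      rw [h1, mul_one]
    have hv31 : v 3 = 1 := by
      have halg : IsAlgebraic (ZMod 2) (v 3) :=
        ⟨X ^ 5 - 1, (monic_X_pow_sub_C (1 : ZMod 2) (by norm_num)).ne_zero, by simp [h5]⟩
      obtain ⟨a, ha⟩ := IsCF.const (F := ZMod 2) _ halg
      rcases algebraMap_eq_zero_or_one (K := K) a with h1 | h1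
      · exact absurd (ha.symm.trans h1) hv3
      · exact ha.symm.trans h1
    rw [hv31, one_smul] at hvw
    refine hM1 ?_
    ext i j
    have := hli' (fun j => M i j - (1 : Matrix (Fin 4) (Fin 4) (ZMod 2)) i j) (by
      have h1 := congrFun hvw i
      simp only [map_sub, sub_mul, Finset.sum_sub_distrib]
      have h2 : ∑ j, algebraMap (ZMod 2) K ((1 : Matrix (Fin 4) (Fin 4) (ZMod 2)) i j) * w j =
          w i := by
        simp [Matrix.one_apply, Finset.sum_ite_eq]
      rw [h2, sub_eq_zero]
      exact h1)
    exact sub_eq_zero.1 (congrFun this j)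

theorem fdeg_map (φ : K →ₐ[ZMod 2] K) (hφ : Function.Surjective φ) (x : K) :
    fdeg (ZMod 2) (φ x) = fdeg (ZMod 2) x := by
  have h := relfinrank_map_map (adjoin (ZMod 2) {x}) ⊤ φ
  rw [relfinrank_top_right, adjoin_map, Set.image_singleton, ← AlgHom.fieldRange_eq_map,
    AlgHom.fieldRange_eq_top.2 hφ, relfinrank_top_right] at h
  exact h

theorem eq_of_moebius (φ : K →ₐ[ZMod 2] K) (h5 : ∀ f, φ (φ (φ (φ (φ f)))) = f) {T : K}
    {a b c d : ZMod 2} (hab : a ≠ 0 ∨ b ≠ 0)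
    (hT : Transcendental (ZMod 2) T)
    (h : φ T * (algebraMap (ZMod 2) K a + algebraMap (ZMod 2) K b * T) =
      algebraMap (ZMod 2) K c + algebraMap (ZMod 2) K d * T) : φ T = T := by
  have := charP_of_injective_algebraMap (algebraMap (ZMod 2) K).injective 2
  have h2 : φ (φ T) * (algebraMap (ZMod 2) K a + algebraMap (ZMod 2) K b * φ T) =
      algebraMap (ZMod 2) K c + algebraMap (ZMod 2) K d * φ T := by
    simpa using congrArg φ h
  have h3 : φ (φ (φ T)) * (algebraMap (ZMod 2) K a + algebraMap (ZMod 2) K b * φ (φ T)) =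
      algebraMap (ZMod 2) K c + algebraMap (ZMod 2) K d * φ (φ T) := by
    simpa using congrArg φ h2
  have hnc : ∀ e : ZMod 2, φ T ≠ algebraMap (ZMod 2) K e := by
    intro e he
    rw [← φ.commutes] at he
    exact hT (φ.injective he ▸ isAlgebraic_algebraMap e)
  have hn0 : φ T ≠ 0 := by simpa using hnc 0
  have hn1 : φ T ≠ 1 := by simpa using hnc 1
  have hT0 : T ≠ 0 := fun h => hn0 (by rw [h, map_zero])
  have hT1 : T + 1 ≠ 0 := fun h => hn1 (by
    have : T = 1 := by grind
    rw [this, map_one])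
  have key : φ (φ T) = T := by
    have two : ∀ e : ZMod 2, e = 0 ∨ e = 1 := by decide
    rcases two a with rfl | rfl <;> rcases two b with rfl | rfl <;>
      rcases two c with rfl | rfl <;> rcases two d with rfl | rfl <;>
      simp only [map_zero, map_one, zero_mul, one_mul, zero_add, add_zero, mul_one] at h h2 h3 <;>
      first
      | (exfalso; simp at hab; done)
      | (exfalso; grind)
      | grind
  have h1 := h5 T
  rwa [key, key] at h1

theorem map_eq_of_lf_one (hl : lf K 1 = 0) (φ : K →ₐ[ZMod 2] K)
    (h5 : ∀ f, φ (φ (φ (φ (φ f)))) = f) {T : K} (hT : Transcendental (ZMod 2) T)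
    (hT5 : fdeg (ZMod 2) T = 5) : φ T = T := by
  have hsurj : Function.Surjective φ := fun f => ⟨_, h5 f⟩
  have hT' : Transcendental (ZMod 2) (φ T) := by
    intro h
    exact hT ((isAlgebraic_algHom_iff φ φ.injective).1 h)
  obtain ⟨f, hf0, hf⟩ := IsG4.equiv (pdiv (ZMod 2) (φ T)) (pdiv (ZMod 2) T) (by
    rw [deg_pdiv hT, deg_pdiv hT', fdeg_map φ hsurj])
  have hspan : Submodule.span (ZMod 2) (Set.range fun i : Fin 2 => T ^ (i : ℕ)) =
      RRspace (ZMod 2) (pdiv (ZMod 2) T) := by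
    refine span_eq_RRspace ((linearIndependent_pow_self hT).comp _ Fin.val_injective) ?_ ?_
    · intro i
      have := pow_mem_RR_le (mem_RR_pdiv T) (pdiv_nonneg (F := ZMod 2) T) (Nat.lt_succ_iff.1 i.2)
      rwa [one_smul] at this
    · rw [ell_eq, deg_pdiv hT, hT5]
      have := lf_five K
      simp only [Nat.cast_ofNat, Fintype.card_fin]
      omega
  have hform : ∀ g ∈ RRspace (ZMod 2) (pdiv (ZMod 2) T), ∃ a b : ZMod 2,
      g = algebraMap (ZMod 2) K a + algebraMap (ZMod 2) K b * T := by
    intro g hg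
    rw [← hspan, Submodule.mem_span_range_iff_exists_fun] at hg
    obtain ⟨e, he⟩ := hg
    refine ⟨e 0, e 1, ?_⟩
    rw [← he, Fin.sum_univ_two]
    simp [Algebra.smul_def]
  obtain ⟨a, b, hab⟩ := hform f ((mem_RRspace_iff hf0).2 (hf ▸ pdiv_nonneg _))
  obtain ⟨c, d, hcd⟩ := hform (φ T * f) (by
    have h0 := ne_zero_of_transcendental hT'
    rw [mem_RRspace_iff (mul_ne_zero h0 hf0), dv_mul h0 hf0, add_left_comm, hf, add_comm]
    exact (mem_RRspace_iff h0).1 (mem_RR_pdiv _))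
  refine eq_of_moebius φ h5 (a := a) (b := b) (c := c) (d := d) ?_ hT (by rw [← hab, hcd])
  by_contra! h
  rw [h.1, h.2] at hab
  exact hf0 (by rw [hab]; simp)

end Automorphism

end CFF

namespace CFF

open Polynomial IntermediateField

section Hyperelliptic

variable {K : Type} [Field K] [Algebra (ZMod 2) K] [IsG4 K]

theorem exists_mem_of_RRspace_le {E : Divisor (ZMod 2) K} (hE : degHom (ZMod 2) K E = 5)
    {W : IntermediateField (ZMod 2) K} (h : ∀ f ∈ RRspace (ZMod 2) E, f ∈ W) :
    ∃ T ∈ W, fdeg (ZMod 2) T = 5 := by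
  obtain ⟨T, hT, hT5⟩ := IsG4.exists_T (K := K)
  obtain ⟨f, hf0, hf⟩ := IsG4.equiv (pdiv (ZMod 2) T) E (by rw [hE, deg_pdiv hT, hT5]; rfl)
  have h0 := ne_zero_of_transcendental hT
  have h1 : f ∈ W := h f ((mem_RRspace_iff hf0).2 (hf ▸ pdiv_nonneg _))
  have h2 : T * f ∈ W := h _ (by
    rw [mem_RRspace_iff (mul_ne_zero h0 hf0), dv_mul h0 hf0, add_left_comm, hf, add_comm]
    exact (mem_RRspace_iff h0).1 (mem_RR_pdiv _))
  refine ⟨T, ?_, hT5⟩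
  have := W.mul_mem h2 (W.inv_mem h1)
  rwa [mul_inv_cancel_right₀ hf0] at this

theorem exists_fdeg_eq {n : ℕ} (h : 2 ≤ lf K n) (hm : ∀ m : ℕ, m < n → lf K m ≤ 1) :
    ∃ x : K, Transcendental (ZMod 2) x ∧ fdeg (ZMod 2) x = n := by
  obtain ⟨D, hD, hd⟩ := exists_mem_effs (K := K) (n := n) (by omega)
  obtain ⟨x, hx, htr⟩ := exists_transcendental (D := D) (by rw [ell_eq, hd]; omega)
  refine ⟨x, htr, le_antisymm ?_ ?_⟩
  · have := fdeg_le_of_mem hD htr hx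
    rw [hd] at this
    exact_mod_cast this
  · by_contra! hlt
    have h1 := hm _ hlt
    have h2 := succ_le_ell (pdiv_nonneg (F := ZMod 2) x) htr (mem_RR_pdiv x) 1
    rw [one_smul, ell_eq, deg_pdiv htr] at h2
    omega

theorem exists_not_mem_adjoin {x : K} (hx : Transcendental (ZMod 2) x) {n : ℕ}
    (h : n + 2 ≤ lf K (n * fdeg (ZMod 2) x : ℕ)) :
    ∃ y ∈ RRspace (ZMod 2) (n • pdiv (ZMod 2) x), y ∉ adjoin (ZMod 2) {x} := by
  by_contra! hc
  have hle : RRspace (ZMod 2) (n • pdiv (ZMod 2) x) ≤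
      Submodule.span (ZMod 2) (Set.range fun i : Fin (n + 1) => x ^ (i : ℕ)) := by
    intro w hw
    obtain ⟨p, hp, rfl⟩ := exists_aeval_eq hx hw (hc w hw)
    rw [aeval_eq_sum_range' (Nat.lt_succ_of_le hp), Finset.sum_range]
    exact Submodule.sum_mem _ fun i _ => Submodule.smul_mem _ _ (Submodule.subset_span ⟨i, rfl⟩)
  have h1 : ell (ZMod 2) (n • pdiv (ZMod 2) x) ≤ n + 1 := by
    have := FiniteDimensional.span_of_finite (ZMod 2)
      (Set.finite_range fun i : Fin (n + 1) => x ^ (i : ℕ))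
    refine (Submodule.finrank_mono hle).trans ?_
    exact (finrank_range_le_card _).trans (by simp)
  rw [ell_eq, map_nsmul, deg_pdiv hx, nsmul_eq_mul] at h1
  push_cast at h
  exact absurd (h.trans h1) (by omega)

theorem lf_two_le_one : lf K 2 ≤ 1 := by
  by_contra! h
  have h22 : lf K 2 = 2 := le_antisymm (lf_two_le K) h
  have h11 := lf_one_le K
  have h0 := lf_zero K
  obtain ⟨x, hx, hx2⟩ := exists_fdeg_eq (K := K) (n := 2) h (fun m hm => by
    interval_cases m
    · exact h0.le
    · exact h11)
  have hdx : degHom (ZMod 2) K (pdiv (ZMod 2) x) = 2 := by rw [deg_pdiv hx, hx2]; rfl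
  have hD := pdiv_nonneg (F := ZMod 2) x
  have hxa := mem_adjoin_simple_self (ZMod 2) x
  have hpow : ∀ {n : ℕ} {E : Divisor (ZMod 2) K}, n • pdiv (ZMod 2) x ≤ E →
      degHom (ZMod 2) K E = 5 → lf K 5 ≤ n + 1 → False := by
    intro n E hE hE5 hl
    have hspan : Submodule.span (ZMod 2) (Set.range fun i : Fin (n + 1) => x ^ (i : ℕ)) =
        RRspace (ZMod 2) E := by
      refine span_eq_RRspace ((linearIndependent_pow_self hx).comp _ Fin.val_injective) ?_ ?_
      · intro i
        exact RRspace_mono hE (pow_mem_RR_le (mem_RR_pdiv x) hD (Nat.lt_succ_iff.1 i.2))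
      · rw [ell_eq, hE5, Fintype.card_fin]
        exact hl
    obtain ⟨T, hT, hT5⟩ := exists_mem_of_RRspace_le hE5 (W := adjoin (ZMod 2) {x}) (fun f hf => by
      rw [← hspan] at hf
      refine Submodule.span_induction (p := fun f _ => f ∈ adjoin (ZMod 2) {x}) ?_ (zero_mem _)
        (fun _ _ _ _ => add_mem) (fun a _ _ h => (adjoin (ZMod 2) {x}).smul_mem h) hf
      rintro _ ⟨i, rfl⟩
      exact pow_mem hxa _)
    have := fdeg_dvd_of_mem hT
    rw [hx2, hT5] at this
    omega
  have h5 := lf_five K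
  rcases Nat.eq_zero_or_pos (lf K 1) with h1 | h1
  swap
  · obtain ⟨E, hE, hE1⟩ := exists_mem_effs h1
    exact hpow (n := 2) (E := 2 • pdiv (ZMod 2) x + E) (le_add_of_nonneg_right hE)
      (by rw [map_add, map_nsmul, hdx, hE1]; norm_num) (by omega)
  have hN3 : ∀ P : Place (ZMod 2) K, placeDegree (ZMod 2) P ≠ 3 := by
    intro P hP
    refine hpow (n := 1) (E := 1 • pdiv (ZMod 2) x + Finsupp.single P 1) ?_ ?_ (by omega)
    · exact le_add_of_nonneg_right (Finsupp.single_nonneg.2 zero_le_one)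
    · rw [map_add, map_nsmul, hdx, degHom_single, hP]; norm_num
  have hsp : ∀ m : ℤ, 0 < m → m < 2 → lf K m = 0 ∨ lf K (2 - m) = 0 := by
    intro m hm hm2
    obtain rfl : m = 1 := by omega
    exact Or.inl h1
  obtain ⟨Q, hQ, hQx⟩ := eq_single_of_mem_effs two_pos hsp
    (show pdiv (ZMod 2) x ∈ effs K 2 from ⟨hD, hdx⟩)
  obtain ⟨y, hy, hyx⟩ := exists_not_mem_adjoin hx (n := 5) (by
    rw [hx2]
    have := lf_large K (n := (5 * 2 : ℕ)) (by norm_num)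
    push_cast at this ⊢
    omega)
  have hgen := adjoin_eq_top_of_prime (by rw [hx2]; exact Nat.prime_two) hyx
  have hli := linearIndependent_pow_of_adjoin_eq_top hx hgen
  rw [hx2] at hli
  have hz : x ^ 2 + x * y + y ^ 2 ∈ RRspace (ZMod 2) (10 • pdiv (ZMod 2) x) := by
    have hx1 : x ∈ RRspace (ZMod 2) (5 • pdiv (ZMod 2) x) := by
      have := pow_mem_RR_le (mem_RR_pdiv (F := ZMod 2) x) hD (show 1 ≤ 5 by norm_num)
      rwa [pow_one] at this
    rw [show (10 : ℕ) = 5 + 5 by norm_num, add_smul, pow_two, pow_two]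
    exact add_mem (add_mem (mul_mem_RRspace hx1 hx1) (mul_mem_RRspace hx1 hy))
      (mul_mem_RRspace hy hy)
  obtain ⟨c, hc, hmod⟩ := exists_planeModel hx (r := 5) (r' := 10) (N := 6) (N' := 10) (j := 2)
    (k := 0) (by norm_num) (by rw [hx2]) hy hz hli
    (J := {(0, 0), (1, 0)})
    (by
      have := hli.comp (fun s : ({(0, 0), (1, 0)} : Finset (ℕ × ℕ)) =>
        (⟨s.1.1, by revert s; decide⟩ : Fin 2)) (by decide)
      convert this using 1
      funext s
      have h0 : s.1.2 = 0 := by revert s; decide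
      simp [h0])
    (ms := [(0, 0, 0), (1, 0, 0), (2, 0, 0), (3, 0, 0), (4, 0, 0), (5, 0, 0), (6, 0, 0),
      (0, 1, 0), (1, 1, 0)]) (ms' := hypMon)
    (by decide) (by rw [hx2]; decide) (by norm_num) (by norm_num)
  have hpole : ∀ P, (6 • pdiv (ZMod 2) x) P = 0 → P ≠ Q := by
    rintro P hP rfl
    rw [hQx] at hP
    simp at hP
  refine hmod.not_hyp hc ?_ ?_ ?_ ?_ ?_
  · intro R hR
    refine (Finset.card_eq_zero.2 (Finset.eq_empty_of_forall_notMem fun P hP => ?_)).le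
    have := lf_pos P
    rw [(hR P hP).1] at this
    norm_num at this
    omega
  · intro R hR
    have := card_add_effs Q 2 R (fun P hP => ⟨hpole P (hR P hP).2, by rw [(hR P hP).1]; rfl⟩)
    rw [hQ, sub_self, h0, h22] at this
    omega
  · intro R hR
    exact (Finset.card_eq_zero.2
      (Finset.eq_empty_of_forall_notMem fun P hP => hN3 P (hR P hP).1)).le
  · intro R hR
    obtain ⟨S, hS, hS3⟩ := exists_finset_places K two_pos hsp
    have := card_pairs_add 2 (by norm_num) S R (fun P hP => by exact_mod_cast hS P hP)
      (fun P hP => (hR P hP).1)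
    have h4 := lf_four K
    rw [hS3, h22] at this
    norm_num at this
    rw [h4, h22] at this
    simp [Nat.choose] at this
    omega
  · intro R hR
    have := card_le_effs 5 R (fun P hP => by rw [(hR P hP).1]; rfl)
    rw [h5, h1] at this
    exact this

end Hyperelliptic

end CFF

namespace CFF

open Polynomial IntermediateField

section Trigonal

variable {K : Type} [Field K] [Algebra (ZMod 2) K] [IsG4 K]

theorem exists_pdiv_eq {n : ℕ} {D : Divisor (ZMod 2) K} (hD : D ∈ effs K n) (h : 2 ≤ lf K n)
    (hm : ∀ m : ℕ, m < n → lf K m ≤ 1) :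
    ∃ x : K, Transcendental (ZMod 2) x ∧ fdeg (ZMod 2) x = n ∧ pdiv (ZMod 2) x = D := by
  obtain ⟨x, hx, htr⟩ := exists_transcendental (D := D) (by rw [ell_eq, hD.2]; omega)
  have hn : n ≤ fdeg (ZMod 2) x := by
    by_contra! hlt
    have h1 := hm _ hlt
    have h2 := succ_le_ell (pdiv_nonneg (F := ZMod 2) x) htr (mem_RR_pdiv x) 1
    rw [one_smul, ell_eq, deg_pdiv htr] at h2
    omega
  have h3 := fdeg_le_of_mem hD.1 htr hx
  rw [hD.2] at h3
  refine ⟨x, htr, le_antisymm (by exact_mod_cast h3) hn, pdiv_eq hD.1 htr hx ?_⟩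
  rw [hD.2]
  exact_mod_cast hn

theorem exists_model_of_fdeg_three {x : K} (hx : Transcendental (ZMod 2) x)
    (hx3 : fdeg (ZMod 2) x = 3) :
    ∃ (y : K) (c : List Bool), c.length = 15 ∧
      PlaneModel (4 • pdiv (ZMod 2) x) x y (polyOf (true :: c) ((0, 3, 0) :: coneMon)) := by
  have hD := pdiv_nonneg (F := ZMod 2) x
  obtain ⟨y, hy, hyx⟩ := exists_not_mem_adjoin hx (n := 2) (by
    rw [hx3]
    exact (lf_six K).ge)
  have hgen := adjoin_eq_top_of_prime (by rw [hx3]; exact Nat.prime_three) hyx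
  have hli := linearIndependent_pow_of_adjoin_eq_top hx hgen
  rw [hx3] at hli
  have hz : x ^ 2 + x * y + y ^ 2 ∈ RRspace (ZMod 2) (4 • pdiv (ZMod 2) x) := by
    have hx1 : x ∈ RRspace (ZMod 2) (2 • pdiv (ZMod 2) x) := by
      have := pow_mem_RR_le (mem_RR_pdiv (F := ZMod 2) x) hD (show 1 ≤ 2 by norm_num)
      rwa [pow_one] at this
    rw [show (4 : ℕ) = 2 + 2 by norm_num, add_smul, pow_two, pow_two]
    exact add_mem (add_mem (mul_mem_RRspace hx1 hx1) (mul_mem_RRspace hx1 hy))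
      (mul_mem_RRspace hy hy)
  obtain ⟨c, hc, hmod⟩ := exists_planeModel hx (r := 2) (r' := 4) (N := 4) (N' := 6) (j := 3)
    (k := 0) (by norm_num) (by rw [hx3]) hy hz hli
    (J := {(0, 0), (1, 0), (2, 0)})
    (by
      have := hli.comp (fun s : ({(0, 0), (1, 0), (2, 0)} : Finset (ℕ × ℕ)) =>
        (⟨s.1.1, by revert s; decide⟩ : Fin 3)) (by decide)
      convert this using 1
      funext s
      have h0 : s.1.2 = 0 := by revert s; decide
      simp [h0])
    (ms := [(0, 0, 0), (1, 0, 0), (2, 0, 0), (3, 0, 0), (4, 0, 0), (0, 1, 0), (1, 1, 0),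
      (2, 1, 0), (0, 2, 0)]) (ms' := coneMon)
    (by decide) (by rw [hx3]; decide) (by norm_num) (by norm_num)
  exact ⟨y, c, hc, hmod⟩

theorem lf_three_le_one : lf K 3 ≤ 1 := by
  by_contra! h
  have h22 : lf K 2 ≤ 1 := lf_two_le_one
  have h33 : lf K 3 = 2 := le_antisymm (lf_three_le K h22) h
  have h11 := lf_one_le K
  have h0 := lf_zero K
  have h4 := lf_four K
  have h5 := lf_five K
  have hm : ∀ m : ℕ, m < 3 → lf K m ≤ 1 := fun m hm => by
    interval_cases m
    · exact h0.le
    · exact h11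
    · exact h22
  rcases Nat.eq_zero_or_pos (lf K 1) with h1 | h1
  swap
  · obtain ⟨P, hP⟩ := exists_place_of_lf one_pos (fun m _ _ => by omega) h1
    have hP1 : placeDegree (ZMod 2) P = 1 := by exact_mod_cast hP
    have h1 : lf K 1 = 1 := by omega
    have h2 : lf K 2 = 1 := by
      refine le_antisymm h22 (lf_pos_of_mem (D := 2 • Finsupp.single P 1) ⟨?_, ?_⟩)
      · exact nsmul_nonneg (Finsupp.single_nonneg.2 zero_le_one) _
      · rw [map_nsmul, degHom_single, hP]; norm_num
    obtain ⟨x, hx, hx3, hxP⟩ := exists_pdiv_eq (n := 3) (D := 3 • Finsupp.single P 1)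
      ⟨nsmul_nonneg (Finsupp.single_nonneg.2 zero_le_one) _,
        by rw [map_nsmul, degHom_single, hP]; norm_num⟩ h hm
    obtain ⟨y, c, hc, hmod⟩ := exists_model_of_fdeg_three hx hx3
    have hpole : ∀ Q, (4 • pdiv (ZMod 2) x) Q = 0 → Q ≠ P := by
      rintro Q hQ rfl
      rw [hxP] at hQ
      simp at hQ
    have key : ∀ {n : ℕ} {R : Finset (Place (ZMod 2) K)},
        (∀ Q ∈ R, placeDegree (ZMod 2) Q = n ∧ (4 • pdiv (ZMod 2) x) Q = 0) →
        R.card + (2 ^ lf K (n - 1) - 1) ≤ 2 ^ lf K n - 1 := by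
      intro n R hR
      have := card_add_effs P n R (fun Q hQ => ⟨hpole Q (hR Q hQ).2, by rw [(hR Q hQ).1]⟩)
      rwa [hP] at this
    refine hmod.not_cone hc ?_ ?_ ?_ ?_ (Or.inl ?_)
    all_goals
      intro R hR
      have := key hR
      norm_num [h0, h1, h2, h33, h4, -Finset.card_eq_zero] at this
      omega
  · obtain ⟨D, hD⟩ := exists_mem_effs (K := K) (n := 3) (by omega)
    obtain ⟨P, hP, rfl⟩ := eq_single_of_mem_effs three_pos (fun m hm hm3 => by
      obtain rfl | rfl : m = 1 ∨ m = 2 := by omega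
      · exact Or.inl h1
      · exact Or.inr h1) hD
    obtain ⟨x, hx, hx3, hxP⟩ := exists_pdiv_eq (n := 3) hD h hm
    obtain ⟨y, c, hc, hmod⟩ := exists_model_of_fdeg_three hx hx3
    have hpole : ∀ Q, (4 • pdiv (ZMod 2) x) Q = 0 → Q ≠ P := by
      rintro Q hQ rfl
      rw [hxP] at hQ
      simp at hQ
    have key : ∀ {n : ℕ} {R : Finset (Place (ZMod 2) K)},
        (∀ Q ∈ R, placeDegree (ZMod 2) Q = n ∧ (4 • pdiv (ZMod 2) x) Q = 0) →
        R.card ≤ 2 ^ lf K n - 1 := fun {n} {R} hR =>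
      card_le_effs n R (fun Q hQ => by rw [(hR Q hQ).1])
    have hb3 : AtMost (4 • pdiv (ZMod 2) x) 3 2 := by
      intro R hR
      have := card_add_effs P 3 R (fun Q hQ => ⟨hpole Q (hR Q hQ).2, by rw [(hR Q hQ).1]; rfl⟩)
      rw [hP, sub_self, h0, h33] at this
      omega
    have hb1 : AtMost (4 • pdiv (ZMod 2) x) 1 0 := by
      intro R hR
      have := key hR
      rw [Nat.cast_one, h1] at this
      exact this
    have hb2 : AtMost (4 • pdiv (ZMod 2) x) 2 1 := by
      intro R hR
      have := key hR
      rw [Nat.cast_ofNat] at this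
      exact this.trans (Nat.sub_le_sub_right (Nat.pow_le_pow_right two_pos h22) 1)
    rcases Nat.eq_zero_or_pos (lf K 2) with h2 | h2
    · have hb4 : AtMost (4 • pdiv (ZMod 2) x) 4 1 := by
        intro R hR
        have := key hR
        rw [Nat.cast_ofNat, h4, h2] at this
        exact this
      exact hmod.not_cone hc hb1 hb2 hb3 (fun R hR => (hb4 R hR).trans one_le_two) (Or.inl hb4)
    · obtain ⟨Q, hQ⟩ := exists_place_of_lf two_pos (fun m hm hm2 => by
        obtain rfl : m = 1 := by omega
        exact Or.inl h1) h2
      have h2 : lf K 2 = 1 := by omega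
      have key2 : ∀ {n : ℕ} {R : Finset (Place (ZMod 2) K)}, n ≠ 2 →
          (∀ Q ∈ R, placeDegree (ZMod 2) Q = n ∧ (4 • pdiv (ZMod 2) x) Q = 0) →
          R.card + (2 ^ lf K (n - 2) - 1) ≤ 2 ^ lf K n - 1 := by
        intro n R hn hR
        have := card_add_effs Q n R (fun P hP => ⟨fun h => hn (by
          rw [← (hR P hP).1, h]; exact_mod_cast hQ), by rw [(hR P hP).1]⟩)
        rwa [hQ] at this
      refine hmod.not_cone hc hb1 hb2 hb3 ?_ (Or.inr ?_)
      all_goals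
        intro R hR
        have := key2 (by norm_num) hR
        norm_num [h0, h1, h2, h33, h4, h5, -Finset.card_eq_zero] at this
        omega

end Trigonal

end CFF

namespace CFF

open Polynomial IntermediateField

section Quadric

variable {K : Type} [Field K] [Algebra (ZMod 2) K]

/-- Linear independence over the field with two elements of four given elements. -/
def Indep (x y z t : K) : Prop :=
  ∀ a b c d : ZMod 2, algebraMap (ZMod 2) K a * x + algebraMap (ZMod 2) K b * y +
    algebraMap (ZMod 2) K c * z + algebraMap (ZMod 2) K d * t = 0 →
    a = 0 ∧ b = 0 ∧ c = 0 ∧ d = 0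

theorem indep_iff {x y z t : K} :
    Indep x y z t ↔ LinearIndependent (ZMod 2) ![x, y, z, t] := by
  rw [Fintype.linearIndependent_iff]
  constructor
  · intro h g hg
    rw [Fin.sum_univ_four] at hg
    have := h (g 0) (g 1) (g 2) (g 3) (by simpa [Algebra.smul_def] using hg)
    intro i
    fin_cases i
    exacts [this.1, this.2.1, this.2.2.1, this.2.2.2]
  · intro h a b c d he
    have := h ![a, b, c, d] (by
      rw [Fin.sum_univ_four]
      simpa [Algebra.smul_def] using he)
    exact ⟨this 0, this 1, this 2, this 3⟩

theorem Indep.ne_zero {x y z t : K} (h : Indep x y z t) :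
    x ≠ 0 ∧ y ≠ 0 ∧ z ≠ 0 ∧ t ≠ 0 ∧ x + y ≠ 0 ∧ x + z ≠ 0 ∧ x + t ≠ 0 ∧ y + z ≠ 0 ∧ y + t ≠ 0 ∧
      z + t ≠ 0 ∧ x + y + z ≠ 0 ∧ x + y + t ≠ 0 ∧ x + z + t ≠ 0 ∧ y + z + t ≠ 0 ∧
      x + y + z + t ≠ 0 := by
  refine ⟨?_, ?_, ?_, ?_, ?_, ?_, ?_, ?_, ?_, ?_, ?_, ?_, ?_, ?_, ?_⟩ <;> intro h0
  · simpa using h 1 0 0 0 (by simpa using h0)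
  · simpa using h 0 1 0 0 (by simpa using h0)
  · simpa using h 0 0 1 0 (by simpa using h0)
  · simpa using h 0 0 0 1 (by simpa using h0)
  · simpa using h 1 1 0 0 (by simpa using h0)
  · simpa using h 1 0 1 0 (by simpa using h0)
  · simpa using h 1 0 0 1 (by simpa using h0)
  · simpa using h 0 1 1 0 (by simpa using h0)
  · simpa using h 0 1 0 1 (by simpa using h0)
  · simpa using h 0 0 1 1 (by simpa using h0)
  · simpa using h 1 1 1 0 (by simpa using h0)
  · simpa using h 1 1 0 1 (by simpa using h0)
  · simpa using h 1 0 1 1 (by simpa using h0)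
  · simpa using h 0 1 1 1 (by simpa using h0)
  · simpa using h 1 1 1 1 (by simpa using h0)

theorem Indep.swap {x y z t : K} (h : Indep x y z t) : Indep z t x y := fun a b c d he => by
  have := h c d a b (by linear_combination he)
  exact ⟨this.2.2.1, this.2.2.2, this.1, this.2.1⟩

theorem Indep.swap_left {x y z t : K} (h : Indep x y z t) : Indep y x z t := fun a b c d he => by
  have := h b a c d (by linear_combination he)
  exact ⟨this.2.1, this.1, this.2.2⟩

theorem Indep.swap_mid {x y z t : K} (h : Indep x y z t) : Indep x z y t := fun a b c d he => by
  have := h a c b d (by linear_combination he)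
  exact ⟨this.1, this.2.2.1, this.2.1, this.2.2.2⟩

theorem Indep.add_left {x y z t : K} (h : Indep x y z t) (e f : ZMod 2) :
    Indep (x + (algebraMap (ZMod 2) K e * z + algebraMap (ZMod 2) K f * t)) y z t :=
  fun a b c d he => by
    have := h a b (c + a * e) (d + a * f) (by
      simp only [map_add, map_mul]; linear_combination he)
    obtain ⟨rfl, rfl, h1, h2⟩ := this
    exact ⟨rfl, rfl, by simpa using h1, by simpa using h2⟩

theorem Indep.add_right {x y z t : K} (h : Indep x y z t) : Indep x (x + y) z t :=
  fun a b c d he => by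
    have := h (a + b) b c d (by simp only [map_add]; linear_combination he)
    obtain ⟨h0, rfl, h1, h2⟩ := this
    exact ⟨by simpa using h0, rfl, h1, h2⟩

/-- A binary quadratic form with nonzero polar form is the norm form or is split. -/
theorem norm_or_split {V : Submodule (ZMod 2) K} {x y : K} (hx : x ∈ V) (hy : y ∈ V) {a b : K}
    (ha : a = 0 ∨ a = 1) (hb : b = 0 ∨ b = 1) :
    (a = 1 ∧ b = 1) ∨ ∃ u ∈ V, ∃ v ∈ V, a * x ^ 2 + x * y + b * y ^ 2 = u * v ∧
      ∀ z t, Indep x y z t → Indep u v z t := by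
  rcases ha with rfl | rfl <;> rcases hb with rfl | rfl
  · exact Or.inr ⟨x, hx, y, hy, by ring, fun z t h => h⟩
  · exact Or.inr ⟨y, hy, y + x, add_mem hy hx, by ring, fun z t h => h.swap_left.add_right⟩
  · exact Or.inr ⟨x, hx, x + y, add_mem hx hy, by ring, fun z t h => h.add_right⟩
  · exact Or.inl ⟨rfl, rfl⟩

variable [IsG4 K]

theorem lf_le_one {n : ℤ} (hn : n ≤ 3) : lf K n ≤ 1 := by
  rcases lt_or_ge n 0 with h | h
  · rw [lf_neg K h]; exact zero_le_one
  · interval_cases n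
    exacts [(lf_zero K).le, lf_one_le K, lf_two_le_one, lf_three_le_one]

/-- The canonical model lies on no quadric containing a pencil of planes or lines. -/
theorem false_of_mul_eq_mul {D : Divisor (ZMod 2) K} (hD : degHom (ZMod 2) K D = 6) {a b c d : K}
    (ha : a ∈ RRspace (ZMod 2) D) (hb : b ∈ RRspace (ZMod 2) D) (hc : c ∈ RRspace (ZMod 2) D)
    (hd : d ∈ RRspace (ZMod 2) D) (h : a * b = c * d) (ha0 : a ≠ 0) (hb0 : b ≠ 0) (hc0 : c ≠ 0)
    (hac : a ≠ c) (hbc : b ≠ c) : False := by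
  have htr : Transcendental (ZMod 2) (a / c) := by
    refine transcendental_of_not_mem ?_
    rintro ⟨e, he⟩
    rcases algebraMap_eq_zero_or_one (K := K) e with h1 | h1
    · rw [h1] at he; exact div_ne_zero ha0 hc0 he.symm
    · rw [h1] at he; exact hac ((div_eq_one_iff_eq hc0).1 he.symm)
  have hmem : ∀ f, f ≠ 0 → f ∈ RRspace (ZMod 2) D → a / c * f ∈ RRspace (ZMod 2) D →
      f ∈ RRspace (ZMod 2) (D - pdiv (ZMod 2) (a / c)) := by
    intro f hf h1 h2
    have ht0 := ne_zero_of_transcendental htr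
    rw [mem_RRspace_iff hf] at h1 ⊢
    rw [mem_RRspace_iff (mul_ne_zero ht0 hf), dv_mul ht0 hf] at h2
    have : pdiv (ZMod 2) (a / c) ≤ D + dv (ZMod 2) f := by
      refine sup_le ?_ h1
      rw [dv_inv, ← sub_nonneg, sub_neg_eq_add, add_assoc, add_comm (dv (ZMod 2) f)]
      exact h2
    rw [← sub_nonneg] at this
    convert this using 1
    abel
  have h1 := hmem c hc0 hc (by rwa [div_mul_cancel₀ _ hc0])
  have h2 := hmem b hb0 hb (by rwa [div_mul_eq_mul_div, h, mul_div_cancel_left₀ _ hc0])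
  have hli : LinearIndependent (ZMod 2) ![b, c] := by
    rw [LinearIndependent.pair_iff' hb0]
    intro e
    rw [Algebra.smul_def]
    rcases algebraMap_eq_zero_or_one (K := K) e with h3 | h3
    · rw [h3, zero_mul]; exact hc0.symm
    · rw [h3, one_mul]; exact hbc
  have h3 := card_le_ell hli (D := D - pdiv (ZMod 2) (a / c)) (fun i => by
    fin_cases i
    exacts [h2, h1])
  have h4 := succ_le_ell (pdiv_nonneg (F := ZMod 2) (a / c)) htr (mem_RR_pdiv _) 1
  rw [one_smul, ell_eq, deg_pdiv htr] at h4
  rw [ell_eq, map_sub, hD, deg_pdiv htr, Fintype.card_fin] at h3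
  rcases le_or_gt (fdeg (ZMod 2) (a / c) : ℤ) 3 with h5 | h5
  · exact absurd (lf_le_one (K := K) h5) (by omega)
  · exact absurd (lf_le_one (K := K) (n := 6 - fdeg (ZMod 2) (a / c)) (by omega)) (by omega)

/-- Four independent elements of `V` satisfying the norm equation. -/
def HasNorm (V : Submodule (ZMod 2) K) : Prop :=
  ∃ x ∈ V, ∃ y ∈ V, ∃ z ∈ V, ∃ t ∈ V, Indep x y z t ∧ z * t = x ^ 2 + x * y + y ^ 2

theorem hasNorm_of_diagonal {D : Divisor (ZMod 2) K} (hD : degHom (ZMod 2) K D = 6) {x y z t : K}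
    (hx : x ∈ RRspace (ZMod 2) D) (hy : y ∈ RRspace (ZMod 2) D) (hz : z ∈ RRspace (ZMod 2) D)
    (ht : t ∈ RRspace (ZMod 2) D) (hi : Indep x y z t) {a b c d e : K} (ha : a = 0 ∨ a = 1)
    (hb : b = 0 ∨ b = 1) (hc : c = 0 ∨ c = 1) (hd : d = 0 ∨ d = 1) (he : e = 0 ∨ e = 1)
    (h : a * x ^ 2 + x * y + b * y ^ 2 + (c * z ^ 2 + e * (z * t) + d * t ^ 2) = 0) :
    HasNorm (RRspace (ZMod 2) D) := by
  have := charP_of_injective_algebraMap (algebraMap (ZMod 2) K).injective 2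
  have hF := @false_of_mul_eq_mul K _ _ _ D hD
  have hn := hi.ne_zero
  have hadd := fun u v => (RRspace (ZMod 2) D).add_mem (x := u) (y := v)
  rcases he with rfl | rfl
  · obtain ⟨s, hs, hss, hs'⟩ : ∃ s ∈ RRspace (ZMod 2) D,
        c * z ^ 2 + 0 * (z * t) + d * t ^ 2 = s ^ 2 ∧ (s = 0 ∨ s = z ∨ s = t ∨ s = z + t) := by
      rcases hc with rfl | rfl <;> rcases hd with rfl | rfl
      · exact ⟨0, zero_mem _, by ring, by simp⟩
      · exact ⟨t, ht, by ring, by simp⟩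
      · exact ⟨z, hz, by ring, by simp⟩
      · exact ⟨z + t, add_mem hz ht, by grind, by simp⟩
    rw [hss] at h
    exfalso
    rcases norm_or_split hx hy ha hb with ⟨rfl, rfl⟩ | ⟨u, hu, v, hv, huv, hi'⟩
    · refine hF hx (add_mem hx hy) (add_mem hy hs) (add_mem hy hs) ?_ ?_ ?_ ?_ ?_ ?_ <;> grind
    · have hn' := (hi' _ _ hi).ne_zero
      rw [huv] at h
      refine hF hu hv hs hs ?_ ?_ ?_ ?_ ?_ ?_ <;> grind
  · have h' : a * x ^ 2 + x * y + b * y ^ 2 = c * z ^ 2 + z * t + d * t ^ 2 := by grind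
    rcases norm_or_split hx hy ha hb with ⟨rfl, rfl⟩ | ⟨u, hu, v, hv, huv, hi'⟩ <;>
      rcases norm_or_split hz ht hc hd with ⟨rfl, rfl⟩ | ⟨u', hu', v', hv', huv', hi''⟩
    · exfalso
      refine hF (add_mem hx hz) (add_mem (add_mem hx hz) hy) (add_mem hy ht)
        (add_mem (add_mem hy ht) hz) ?_ ?_ ?_ ?_ ?_ ?_ <;> grind
    · exact ⟨x, hx, y, hy, u', hu', v', hv', (hi'' _ _ hi.swap).swap, by grind⟩
    · exact ⟨z, hz, t, ht, u, hu, v, hv, (hi' _ _ hi).swap, by grind⟩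
    · exfalso
      have hn' := (hi'' _ _ (hi' _ _ hi).swap).ne_zero
      refine hF hu hv hu' hv' ?_ ?_ ?_ ?_ ?_ ?_ <;> grind

theorem hasNorm_of_cross {D : Divisor (ZMod 2) K} (hD : degHom (ZMod 2) K D = 6) {x y z t : K}
    (hx : x ∈ RRspace (ZMod 2) D) (hy : y ∈ RRspace (ZMod 2) D) (hz : z ∈ RRspace (ZMod 2) D)
    (ht : t ∈ RRspace (ZMod 2) D) (hi : Indep x y z t)
    (a b c d e f g k l : ZMod 2)
    (h : algebraMap (ZMod 2) K a * x ^ 2 + x * y + algebraMap (ZMod 2) K b * y ^ 2 +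
      algebraMap (ZMod 2) K c * z ^ 2 + algebraMap (ZMod 2) K d * t ^ 2 +
      algebraMap (ZMod 2) K e * (z * t) + algebraMap (ZMod 2) K f * (x * z) +
      algebraMap (ZMod 2) K g * (x * t) + algebraMap (ZMod 2) K k * (y * z) +
      algebraMap (ZMod 2) K l * (y * t) = 0) :
    HasNorm (RRspace (ZMod 2) D) := by
  have := charP_of_injective_algebraMap (algebraMap (ZMod 2) K).injective 2
  have hmem : ∀ r s : ZMod 2, ∀ u v w : K, u ∈ RRspace (ZMod 2) D → v ∈ RRspace (ZMod 2) D →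
      w ∈ RRspace (ZMod 2) D → u + (algebraMap (ZMod 2) K r * v + algebraMap (ZMod 2) K s * w) ∈
        RRspace (ZMod 2) D := fun r s u v w hu hv hw => by
    rw [← Algebra.smul_def, ← Algebra.smul_def]
    exact add_mem hu (add_mem (Submodule.smul_mem _ _ hv) (Submodule.smul_mem _ _ hw))
  have hpow : ∀ r : ZMod 2, algebraMap (ZMod 2) K r ^ 2 = algebraMap (ZMod 2) K r := fun r => by
    rcases algebraMap_eq_zero_or_one (K := K) r with h | h <;> simp [h]
  refine hasNorm_of_diagonal hD (hmem k l x z t hx hz ht) (hmem f g y z t hy hz ht) hz ht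
    ((hi.add_left k l).swap_left.add_left f g).swap_left
    (algebraMap_eq_zero_or_one a) (algebraMap_eq_zero_or_one b)
    (algebraMap_eq_zero_or_one (c + a * k + b * f + k * f))
    (algebraMap_eq_zero_or_one (d + a * l + b * g + l * g))
    (algebraMap_eq_zero_or_one (e + k * g + l * f)) ?_
  simp only [map_add, map_mul]
  have h1 := hpow k
  have h2 := hpow l
  have h3 := hpow f
  have h4 := hpow g
  grind

theorem exists_hasNorm {D : Divisor (ZMod 2) K} (hD : degHom (ZMod 2) K D = 6) :
    HasNorm (RRspace (ZMod 2) D) := by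
  have := charP_of_injective_algebraMap (algebraMap (ZMod 2) K).injective 2
  have hfr : Module.finrank (ZMod 2) (RRspace (ZMod 2) D) = 4 := by
    have := ell_eq D
    rwa [hD, lf_six] at this
  let w := Module.finBasisOfFinrankEq (ZMod 2) (RRspace (ZMod 2) D) hfr
  have hi : Indep (w 0 : K) (w 1) (w 2) (w 3) := by
    rw [indep_iff]
    have := w.linearIndependent.map' (RRspace (ZMod 2) D).subtype (Submodule.ker_subtype _)
    have hw : (RRspace (ZMod 2) D).subtype ∘ w = ![(w 0 : K), w 1, w 2, w 3] := by
      funext i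
      fin_cases i <;> rfl
    rw [hw] at this
    exact this
  have h0 := (w 0).2
  have h1 := (w 1).2
  have h2 := (w 2).2
  have h3 := (w 3).2
  generalize (w 0 : K) = x at *
  generalize (w 1 : K) = y at *
  generalize (w 2 : K) = z at *
  generalize (w 3 : K) = t at *
  have hdep : ¬ LinearIndependent (ZMod 2)
      ![x * x, y * y, z * z, t * t, x * y, x * z, x * t, y * z, y * t, z * t] := by
    intro hli
    have := card_le_ell hli (D := D + D) (fun i => by
      fin_cases i
      exacts [mul_mem_RRspace h0 h0, mul_mem_RRspace h1 h1, mul_mem_RRspace h2 h2,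
        mul_mem_RRspace h3 h3, mul_mem_RRspace h0 h1, mul_mem_RRspace h0 h2, mul_mem_RRspace h0 h3,
        mul_mem_RRspace h1 h2, mul_mem_RRspace h1 h3, mul_mem_RRspace h2 h3])
    rw [ell_eq, map_add, hD, Fintype.card_fin] at this
    have h12 := lf_large K (n := 6 + 6) (by norm_num)
    omega
  rw [Fintype.not_linearIndependent_iff] at hdep
  obtain ⟨g, hg, i, hgi⟩ := hdep
  have hg' : algebraMap (ZMod 2) K (g 0) * x ^ 2 + algebraMap (ZMod 2) K (g 1) * y ^ 2 +
      algebraMap (ZMod 2) K (g 2) * z ^ 2 + algebraMap (ZMod 2) K (g 3) * t ^ 2 +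
      algebraMap (ZMod 2) K (g 4) * (x * y) + algebraMap (ZMod 2) K (g 5) * (x * z) +
      algebraMap (ZMod 2) K (g 6) * (x * t) + algebraMap (ZMod 2) K (g 7) * (y * z) +
      algebraMap (ZMod 2) K (g 8) * (y * t) + algebraMap (ZMod 2) K (g 9) * (z * t) = 0 := by
    rw [← hg]
    simp only [Fin.sum_univ_succ, Algebra.smul_def, pow_two]
    simp [add_assoc]
  have two : ∀ e : ZMod 2, e = 0 ∨ e = 1 := by decide
  rcases two (g 4) with h4 | h4
  swap
  · rw [h4] at hg'
    refine hasNorm_of_cross hD h0 h1 h2 h3 hi (g 0) (g 1) (g 2) (g 3) (g 9) (g 5) (g 6) (g 7)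
      (g 8) (by simp only [map_one] at hg'; linear_combination hg')
  rcases two (g 5) with h5 | h5
  swap
  · rw [h5] at hg'
    refine hasNorm_of_cross hD h0 h2 h1 h3 hi.swap_mid (g 0) (g 2) (g 1) (g 3) (g 8) (g 4) (g 6)
      (g 7) (g 9) (by simp only [map_one] at hg'; linear_combination hg')
  rcases two (g 7) with h7 | h7
  swap
  · rw [h7] at hg'
    refine hasNorm_of_cross hD h1 h2 h0 h3 hi.swap_left.swap_mid (g 1) (g 2) (g 0) (g 3) (g 6)
      (g 4) (g 8) (g 5) (g 9) (by simp only [map_one] at hg'; linear_combination hg')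
  rcases two (g 9) with h9 | h9
  swap
  · rw [h9] at hg'
    refine hasNorm_of_cross hD h2 h3 h0 h1 hi.swap (g 2) (g 3) (g 0) (g 1) (g 4) (g 5) (g 7)
      (g 6) (g 8) (by simp only [map_one] at hg'; linear_combination hg')
  rcases two (g 6) with h6 | h6
  swap
  · rw [h6] at hg'
    refine hasNorm_of_cross hD h3 h0 h2 h1 (fun a b c d he => by
        have := hi b d c a (by linear_combination he)
        exact ⟨this.2.2.2, this.1, this.2.2.1, this.2.1⟩) (g 3) (g 0) (g 2)
      (g 1) (g 7) (g 9) (g 8) (g 5) (g 4) (by simp only [map_one] at hg'; linear_combination hg')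
  rcases two (g 8) with h8 | h8
  swap
  · rw [h8] at hg'
    refine hasNorm_of_cross hD h3 h1 h2 h0 (fun a b c d he => by
        have := hi d b c a (by linear_combination he)
        exact ⟨this.2.2.2, this.2.1, this.2.2.1, this.1⟩) (g 3) (g 1) (g 2)
      (g 0) (g 5) (g 9) (g 6) (g 7) (g 4) (by simp only [map_one] at hg'; linear_combination hg')
  exfalso
  have hpow : ∀ r : ZMod 2, algebraMap (ZMod 2) K r ^ 2 = algebraMap (ZMod 2) K r := fun r => by
    rcases algebraMap_eq_zero_or_one (K := K) r with h | h <;> simp [h]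
  have hsq := hi (g 0) (g 1) (g 2) (g 3) (by
    simp only [h4, h5, h6, h7, h8, h9, map_zero, zero_mul, add_zero] at hg'
    refine pow_eq_zero_iff two_ne_zero |>.1 ?_
    have e0 := hpow (g 0)
    have e1 := hpow (g 1)
    have e2 := hpow (g 2)
    have e3 := hpow (g 3)
    grind)
  refine hgi ?_
  fin_cases i
  exacts [hsq.1, hsq.2.1, hsq.2.2.1, hsq.2.2.2, h4, h5, h6, h7, h8, h9]

end Quadric

end CFF

namespace CFF

open Polynomial IntermediateField

section TangentPlane

variable {K : Type} [Field K] [Algebra (ZMod 2) K] [IsG4 K]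

theorem eq_of_mem_effs {n : ℤ} (hn : n ≤ 3) {D E : Divisor (ZMod 2) K} (hD : D ∈ effs K n)
    (hE : E ∈ effs K n) : D = E := by
  by_contra hne
  have h := card_le_of_effs {D, E} (by
    intro A hA
    rcases Finset.mem_insert.1 hA with rfl | hA
    · exact hD
    · rw [Finset.mem_singleton.1 hA]; exact hE)
  rw [Finset.card_pair hne] at h
  have h2 := Nat.pow_le_pow_right two_pos (lf_le_one (K := K) hn)
  omega

/-- An effective divisor of degree six is prime or contains a place of degree at most three. -/
theorem prime_or_split {D : Divisor (ZMod 2) K} (hD : D ∈ effs K 6) :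
    (∃ P : Place (ZMod 2) K, placeDegree (ZMod 2) P = 6 ∧ D = Finsupp.single P 1) ∨
    ∃ P : Place (ZMod 2) K, placeDegree (ZMod 2) P ≤ 3 ∧
      ∃ E ∈ effs K (6 - placeDegree (ZMod 2) P), D = Finsupp.single P 1 + E := by
  obtain ⟨P, E, hE, rfl⟩ := exists_place_add (by norm_num) hD
  rcases le_or_gt (placeDegree (ZMod 2) P) 3 with h | h
  · exact Or.inr ⟨P, h, E, hE, rfl⟩
  by_cases h6 : (6 : ℤ) - placeDegree (ZMod 2) P = 0
  · rw [h6] at hE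
    rw [eq_of_mem_effs (by norm_num) hE ⟨le_rfl, map_zero _⟩, add_zero]
    exact Or.inl ⟨P, by omega, rfl⟩
  · obtain ⟨Q, E', hE', rfl⟩ := exists_place_add h6 hE
    have h0 : (0 : ℤ) ≤ 6 - placeDegree (ZMod 2) P - placeDegree (ZMod 2) Q := by
      have := degHom_mono (F := ZMod 2) hE'.1
      rwa [hE'.2, map_zero] at this
    refine Or.inr ⟨Q, by omega, Finsupp.single P 1 + E', ⟨?_, ?_⟩, by abel⟩
    · exact add_nonneg (Finsupp.single_nonneg.2 zero_le_one) hE'.1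
    · rw [map_add, degHom_single, hE'.2]; ring

theorem forall_mem_of_sum_eq_zero {W : Submodule (ZMod 2) K} {f : Fin 5 → K}
    (hf : Function.Injective f) (h0 : ∑ i, f i = 0) {b : K} (h : ∀ i, f i ∈ W ∨ f i = b) (i) :
    f i ∈ W := by
  by_contra hi
  have hb := (h i).resolve_left hi
  refine hi ?_
  rw [Fintype.sum_eq_add_sum_compl i, add_eq_zero_iff_eq_neg] at h0
  rw [h0]
  refine W.neg_mem (W.sum_mem fun j hj => (h j).resolve_right fun hj' => ?_)
  simp only [Finset.mem_compl, Finset.mem_singleton] at hj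
  exact hj (hf (hj'.trans hb.symm))

/-- All but at most one of the effective divisors of degree six which are not prime lie in a proper
linear subsystem. -/
theorem exists_subspace {D : Divisor (ZMod 2) K} (hD : degHom (ZMod 2) K D = 6) :
    ∃ (W : Submodule (ZMod 2) K) (b : K), FiniteDimensional (ZMod 2) W ∧
      Module.finrank (ZMod 2) W ≤ 3 ∧
      ∀ f ∈ RRspace (ZMod 2) D, f ≠ 0 →
      (∃ P : Place (ZMod 2) K, placeDegree (ZMod 2) P = 6 ∧
        D + dv (ZMod 2) f = Finsupp.single P 1) ∨ f ∈ W ∨ f = b := by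
  have hmem : ∀ {f : K} {A B : Divisor (ZMod 2) K}, f ≠ 0 → 0 ≤ B → D + dv (ZMod 2) f = A + B →
      f ∈ RRspace (ZMod 2) (D - A) := by
    intro f A B hf hB h
    rw [mem_RRspace_iff hf, sub_add_eq_add_sub, h, add_sub_cancel_left]
    exact hB
  rcases Nat.eq_zero_or_pos (lf K 1) with h1 | h1
  swap
  · obtain ⟨P, hP⟩ := exists_place_of_lf one_pos (fun m _ _ => by omega) h1
    refine ⟨RRspace (ZMod 2) (D - Finsupp.single P 1), 0, inferInstance, ?_, ?_⟩
    · have := ell_eq (D - Finsupp.single P 1)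
      rw [map_sub, hD, degHom_single, hP] at this
      have h5 := lf_five K
      have h11 := lf_one_le K
      norm_num at this
      rw [ell] at this
      omega
    · intro f hf hf0
      rcases prime_or_split (⟨(mem_RRspace_iff hf0).1 hf, by rw [map_add, hD, degHom_dv (F := ZMod 2) f,
        add_zero]⟩ : D + dv (ZMod 2) f ∈ effs K 6) with h | ⟨Q, hQ, E, hE, hfE⟩
      · exact Or.inl h
      right; left
      have hQ0 := placeDegree_pos (F := ZMod 2) Q
      have hQP := eq_of_mem_effs (by exact_mod_cast hQ) (single_mem_effs Q)
        (⟨nsmul_nonneg (Finsupp.single_nonneg.2 zero_le_one) _, by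
          rw [map_nsmul, degHom_single, hP]; simp⟩ :
          placeDegree (ZMod 2) Q • Finsupp.single P 1 ∈ effs K (placeDegree (ZMod 2) Q))
      obtain ⟨m, hm⟩ : ∃ m, placeDegree (ZMod 2) Q = m + 1 := ⟨_, (Nat.sub_add_cancel hQ0).symm⟩
      rw [hQP, hm, add_smul, one_smul, add_comm (m • _), add_assoc] at hfE
      exact hmem hf0 (add_nonneg (nsmul_nonneg (Finsupp.single_nonneg.2 zero_le_one) _) hE.1) hfE
  · obtain ⟨W, hWf, hW3, hW⟩ : ∃ W : Submodule (ZMod 2) K, FiniteDimensional (ZMod 2) W ∧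
        Module.finrank (ZMod 2) W ≤ 3 ∧ ∀ f, f ≠ 0 → ∀ A ∈ effs K 2, ∀ B, 0 ≤ B →
          D + dv (ZMod 2) f = A + B → f ∈ W := by
      by_cases h2 : ∃ A, A ∈ effs K 2
      · obtain ⟨A, hA⟩ := h2
        refine ⟨RRspace (ZMod 2) (D - A), inferInstance, ?_, ?_⟩
        · have := ell_eq (D - A)
          rw [map_sub, hD, hA.2] at this
          have h4 := lf_four K
          have h22 := lf_two_le_one (K := K)
          norm_num at this
          rw [ell] at this
          omega
        · intro f hf A' hA' B hB h
          rw [eq_of_mem_effs (by norm_num) hA' hA] at h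
          exact hmem hf hB h
      · push Not at h2
        exact ⟨⊥, inferInstance, by simp, fun f _ A hA => absurd hA (h2 A)⟩
    obtain ⟨b, hb⟩ : ∃ b : K, ∀ f, f ≠ 0 → ∀ A ∈ effs K 3, D + dv (ZMod 2) f = A + A →
        f = b := by
      by_cases h3 : ∃ b : K, b ≠ 0 ∧ ∃ A ∈ effs K 3, D + dv (ZMod 2) b = A + A
      · obtain ⟨b, hb, A, hA, hbA⟩ := h3
        refine ⟨b, fun f hf A' hA' h => dv_injOn hf hb (add_left_cancel (a := D) ?_)⟩
        rw [h, hbA, eq_of_mem_effs le_rfl hA' hA]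
      · push Not at h3
        exact ⟨0, fun f hf A hA h => absurd h (h3 f hf A hA)⟩
    refine ⟨W, b, hWf, hW3, fun f hf hf0 => ?_⟩
    rcases prime_or_split (⟨(mem_RRspace_iff hf0).1 hf, by rw [map_add, hD, degHom_dv (F := ZMod 2) f,
      add_zero]⟩ : D + dv (ZMod 2) f ∈ effs K 6) with h | ⟨Q, hQ, E, hE, hfE⟩
    · exact Or.inl h
    right
    have hQ0 := placeDegree_pos (F := ZMod 2) Q
    have hQe := single_mem_effs Q
    obtain hQ1 | hQ1 | hQ1 : placeDegree (ZMod 2) Q = 1 ∨ placeDegree (ZMod 2) Q = 2 ∨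
      placeDegree (ZMod 2) Q = 3 := by omega
    · have := lf_pos Q
      rw [hQ1, Nat.cast_one] at this
      omega
    · rw [hQ1] at hQe
      exact Or.inl (hW f hf0 _ hQe E hE.1 hfE)
    · rw [hQ1] at hQe hE
      rw [eq_of_mem_effs (by norm_num) hE hQe] at hfE
      exact Or.inr (hb f hf0 _ hQe hfE)

theorem injective_five {x y z t : K} (hi : Indep x y z t) :
    Function.Injective ![t, z, z + t + y, z + t + x, z + t + (x + y)] := by
  have := charP_of_injective_algebraMap (algebraMap (ZMod 2) K).injective 2
  have h : ∀ i j : Fin 5, i < j → ![t, z, z + t + y, z + t + x, z + t + (x + y)] i +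
      ![t, z, z + t + y, z + t + x, z + t + (x + y)] j ≠ 0 := by
    obtain ⟨h1, h2, h3, h4, h5, h6, h7, h8, h9, h10, h11, h12, h13, h14, h15⟩ := hi.ne_zero
    intro i j hij
    fin_cases i <;> fin_cases j <;> first | exact absurd hij (by decide) | skip
    all_goals
      dsimp
      intro h0
      grind
  intro i j hij
  by_contra hne
  rcases lt_or_gt_of_ne hne with h' | h'
  · exact h i j h' (by rw [hij, CharTwo.add_self_eq_zero])
  · exact h j i h' (by rw [hij, CharTwo.add_self_eq_zero])

theorem exists_prime_norm : ∃ (P : Place (ZMod 2) K) (x y : K), placeDegree (ZMod 2) P = 6 ∧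
    x ∈ RRspace (ZMod 2) (Finsupp.single P 1) ∧ y ∈ RRspace (ZMod 2) (Finsupp.single P 1) ∧
    x ^ 2 + x * y + y ^ 2 ∈ RRspace (ZMod 2) (Finsupp.single P 1) ∧
    Indep x y (x ^ 2 + x * y + y ^ 2) 1 := by
  have := charP_of_injective_algebraMap (algebraMap (ZMod 2) K).injective 2
  obtain ⟨D, hD⟩ : ∃ D : Divisor (ZMod 2) K, degHom (ZMod 2) K D = 6 := ⟨dvs K 6, deg_dvs K 6⟩
  obtain ⟨x, hx, y, hy, z, hz, t, ht, hi, h⟩ := exists_hasNorm hD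
  suffices H : ∃ x ∈ RRspace (ZMod 2) D, ∃ y ∈ RRspace (ZMod 2) D, ∃ z ∈ RRspace (ZMod 2) D,
      ∃ t ∈ RRspace (ZMod 2) D, Indep x y z t ∧ z * t = x ^ 2 + x * y + y ^ 2 ∧
      ∃ P : Place (ZMod 2) K, placeDegree (ZMod 2) P = 6 ∧
        D + dv (ZMod 2) t = Finsupp.single P 1 by
    obtain ⟨x, hx, y, hy, z, hz, t, ht, hi, h, P, hP, hDP⟩ := H
    have ht0 : t ≠ 0 := hi.ne_zero.2.2.2.1
    have hdiv : ∀ f ∈ RRspace (ZMod 2) D, f / t ∈ RRspace (ZMod 2) (Finsupp.single P 1) := by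
      intro f hf
      have h1 : t⁻¹ ∈ RRspace (ZMod 2) (dv (ZMod 2) t) := by
        rw [mem_RRspace_iff (inv_ne_zero ht0), dv_inv, add_neg_cancel]
      rw [← hDP, div_eq_mul_inv]
      exact mul_mem_RRspace hf h1
    have hz' : (x / t) ^ 2 + x / t * (y / t) + (y / t) ^ 2 = z / t := by
      field_simp
      linear_combination -h
    refine ⟨P, x / t, y / t, hP, hdiv x hx, hdiv y hy, by rw [hz']; exact hdiv z hz, ?_⟩
    rw [hz']
    intro a b c d he
    refine hi a b c d ?_
    field_simp at he
    linear_combination he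
  have hxy := add_mem hx hy
  have hzt := add_mem hz ht
  obtain ⟨W, b, hWf, hW3, hW⟩ := exists_subspace hD
  by_contra hcon
  have key : ∀ x ∈ RRspace (ZMod 2) D, ∀ y ∈ RRspace (ZMod 2) D, ∀ z ∈ RRspace (ZMod 2) D,
      ∀ t ∈ RRspace (ZMod 2) D, Indep x y z t → z * t = x ^ 2 + x * y + y ^ 2 →
      t ∈ W ∨ t = b := fun x hx y hy z hz t ht hi h =>
    (hW t ht hi.ne_zero.2.2.2.1).resolve_left fun hP =>
      hcon ⟨x, hx, y, hy, z, hz, t, ht, hi, h, hP⟩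
  have hmem := forall_mem_of_sum_eq_zero (W := W) (b := b)
    (f := ![t, z, z + t + y, z + t + x, z + t + (x + y)]) (injective_five hi) (by
      simp only [Fin.sum_univ_succ]
      simp
      grind) (fun i => by
      fin_cases i
      · exact key x hx y hy z hz t ht hi h
      · exact key x hx y hy t ht z hz (fun a b c d he => by
          have := hi a b d c (by linear_combination he)
          exact ⟨this.1, this.2.1, this.2.2.2, this.2.2.1⟩) (by rw [mul_comm, h])
      · exact key (x + z) (add_mem hx hz) y hy z hz (z + t + y) (add_mem hzt hy)
          (fun a b c d he => by
            have := hi a (b + d) (a + c + d) d (by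
              simp only [map_add]; linear_combination he)
            grind) (by grind)
      · exact key x hx (y + z) (add_mem hy hz) z hz (z + t + x) (add_mem hzt hx)
          (fun a b c d he => by
            have := hi (a + d) b (b + c + d) d (by
              simp only [map_add]; linear_combination he)
            grind) (by grind)
      · exact key (x + y) hxy (y + z) (add_mem hy hz) z hz (z + t + (x + y)) (add_mem hzt hxy)
          (fun a b c d he => by
            have := hi (a + d) (a + b + d) (b + c + d) d (by
              simp only [map_add]; linear_combination he)
            grind) (by grind))
  have ht' : t ∈ W := hmem 0
  have hz' : z ∈ W := hmem 1
  have hy' : y ∈ W := by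
    have := W.sub_mem (hmem 2) (W.add_mem hz' ht')
    simpa using this
  have hx' : x ∈ W := by
    have := W.sub_mem (hmem 3) (W.add_mem hz' ht')
    simpa using this
  have hle : Submodule.span (ZMod 2) (Set.range ![x, y, z, t]) ≤ W := by
    rw [Submodule.span_le]
    rintro _ ⟨i, rfl⟩
    fin_cases i
    exacts [hx', hy', hz', ht']
  have h4 := Submodule.finrank_mono hle
  rw [finrank_span_eq_card (indep_iff.1 hi), Fintype.card_fin] at h4
  omega

end TangentPlane

end CFF

namespace CFF

open Polynomial IntermediateField

theorem finrank_add_finrank_le {V : Type} [AddCommGroup V] [Module (ZMod 2) V]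
    {A B C : Submodule (ZMod 2) V} [FiniteDimensional (ZMod 2) C] (hA : A ≤ C) (hB : B ≤ C) :
    Module.finrank (ZMod 2) A + Module.finrank (ZMod 2) B ≤
      Module.finrank (ZMod 2) C + Module.finrank (ZMod 2) (A ⊓ B : Submodule (ZMod 2) V) := by
  have := Submodule.finiteDimensional_of_le hA
  have := Submodule.finiteDimensional_of_le hB
  rw [← Submodule.finrank_sup_add_finrank_inf_eq A B]
  exact Nat.add_le_add_right (Submodule.finrank_mono (sup_le hA hB)) _

section Elliptic

variable {K : Type} [Field K] [Algebra (ZMod 2) K] [IsG4 K]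

theorem exists_const_of_mem_lev {P : Place (ZMod 2) K} {f : K}
    (hf : f ∈ RRspace (ZMod 2) (Finsupp.single P 1)) (h0 : f ∈ lev P 0) :
    ∃ e : ZMod 2, algebraMap (ZMod 2) K e = f := by
  have : f ∈ RRspace (ZMod 2) (0 : Divisor (ZMod 2) K) := by
    rw [mem_RRspace] at hf ⊢
    intro Q
    by_cases hQ : P = Q
    · subst hQ
      simpa using h0
    · simpa [Finsupp.single_apply, hQ] using hf Q
  rw [RRspace_zero, Submodule.mem_span_singleton] at this
  obtain ⟨e, he⟩ := this
  exact ⟨e, by rw [← he, Algebra.smul_def, mul_one]⟩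

theorem Indep.not_mem_lev {P : Place (ZMod 2) K} {x y z : K} (hi : Indep x y z 1)
    (hx : x ∈ RRspace (ZMod 2) (Finsupp.single P 1)) : x ∉ lev P 0 := by
  intro h0
  obtain ⟨e, he⟩ := exists_const_of_mem_lev hx h0
  have := charP_of_injective_algebraMap (algebraMap (ZMod 2) K).injective 2
  simpa using hi 1 0 0 e (by simp [he, CharTwo.add_self_eq_zero])

theorem Indep.coeff_eq_zero {P : Place (ZMod 2) K} {x y z : K} (hi : Indep x y z 1)
    (hx : x ∈ RRspace (ZMod 2) (Finsupp.single P 1)) (hy : y ∈ RRspace (ZMod 2) (Finsupp.single P 1))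
    (hz : z ∈ RRspace (ZMod 2) (Finsupp.single P 1)) (h : z = x ^ 2 + x * y + y ^ 2)
    (a : Fin 8 → ZMod 2)
    (ha : ∑ i, a i • ![1, x, y, z, x ^ 2, x * y, x * z, y * z] i = 0) (i : Fin 8) : a i = 0 := by
  have := charP_of_injective_algebraMap (algebraMap (ZMod 2) K).injective 2
  simp only [Fin.sum_univ_succ, Algebra.smul_def] at ha
  simp at ha
  have hx0 := hi.ne_zero.1
  have hlev : ∀ {f : K}, f ∈ RRspace (ZMod 2) (Finsupp.single P 1) → f ∈ lev P (-1) := by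
    intro f hf
    have := mem_RRspace.1 hf P
    simpa using this
  have hw : x⁻¹ ∈ lev P 1 := by
    have h0 := hi.not_mem_lev hx
    rw [mem_lev_iff hx0] at h0
    rw [mem_lev_iff (inv_ne_zero hx0), ordAt_inv]
    omega
  have hc : ∀ {n : ℤ} {f : K} (e : ZMod 2), f ∈ lev P n → algebraMap (ZMod 2) K e * f ∈ lev P n := by
    intro n f e hf
    rw [← Algebra.smul_def]
    exact Submodule.smul_mem _ _ hf
  have h1 : (1 : K) ∈ lev P 0 := by
    rw [mem_lev_zero]
    exact one_mem _
  have hce : ∀ e : ZMod 2, algebraMap (ZMod 2) K e ∈ lev P 0 := fun e => by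
    simpa using hc e h1
  have hmul : ∀ {m n : ℤ} {f g : K}, f ∈ lev P m → g ∈ lev P n → f * g ∈ lev P (m + n) :=
    fun hf hg => mul_mem_lev hf hg
  have hρ : y * x⁻¹ ∈ lev P 0 := by simpa using hmul (hlev hy) hw
  have hζ : z * x⁻¹ ∈ lev P 0 := by simpa using hmul (hlev hz) hw
  have hL : ∀ {f : K} (e : ZMod 2), f ∈ RRspace (ZMod 2) (Finsupp.single P 1) →
      algebraMap (ZMod 2) K e * f ∈ RRspace (ZMod 2) (Finsupp.single P 1) := by
    intro f e hf
    rw [← Algebra.smul_def]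
    exact Submodule.smul_mem _ _ hf
  obtain h7 | h7 : a 7 = 0 ∨ a 7 = 1 := by
    generalize a 7 = e
    revert e
    decide
  · rw [h7, map_zero, zero_mul, add_zero] at ha
    have hg : algebraMap (ZMod 2) K (a 4) * x + algebraMap (ZMod 2) K (a 5) * y +
        algebraMap (ZMod 2) K (a 6) * z = (algebraMap (ZMod 2) K (a 0) * x⁻¹ +
        algebraMap (ZMod 2) K (a 1) + algebraMap (ZMod 2) K (a 2) * (y * x⁻¹) +
        algebraMap (ZMod 2) K (a 3) * (z * x⁻¹)) := by
      field_simp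
      grind
    obtain ⟨e, he⟩ := exists_const_of_mem_lev (P := P)
      (add_mem (add_mem (hL (a 4) hx) (hL (a 5) hy)) (hL (a 6) hz)) (by
        rw [hg]
        exact add_mem (add_mem (add_mem (hc _ (lev_anti zero_le_one hw)) (hce _)) (hc _ hρ))
          (hc _ hζ))
    obtain ⟨h4, h5, h6, -⟩ := hi (a 4) (a 5) (a 6) e (by
      rw [he, mul_one, CharTwo.add_self_eq_zero])
    rw [h4, h5, h6] at ha
    obtain ⟨h1, h2, h3, h0⟩ := hi (a 1) (a 2) (a 3) (a 0) (by
      simp at ha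
      linear_combination ha)
    fin_cases i <;> assumption
  · exfalso
    rw [h7, map_one, one_mul] at ha
    have hm1 : 1 + y * x⁻¹ + (y * x⁻¹) ^ 2 ∈ lev P 1 := by
      have h2 := hmul hζ hw
      have h3 : z * x⁻¹ * x⁻¹ = 1 + y * x⁻¹ + (y * x⁻¹) ^ 2 := by
        rw [h]; field_simp
      rwa [h3, zero_add] at h2
    have hm2 : y * x⁻¹ * (z * x⁻¹) + algebraMap (ZMod 2) K (a 4) +
        algebraMap (ZMod 2) K (a 5) * (y * x⁻¹) + algebraMap (ZMod 2) K (a 6) * (z * x⁻¹) ∈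
        lev P 1 := by
      have h2 := hmul (add_mem (add_mem (add_mem (hc (a 0) (lev_anti zero_le_one hw)) (hce (a 1)))
        (hc (a 2) hρ)) (hc (a 3) hζ)) hw
      rw [zero_add] at h2
      convert h2 using 1
      field_simp
      grind
    have hm := hmul (add_mem (hmul (add_mem (add_mem hρ (hce (a 6))) h1) hm2)
      (hmul (add_mem hζ (hce (a 5))) hm1)) (hlev hx)
    change _ ∈ lev P 0 at hm
    obtain ⟨e, he⟩ := exists_const_of_mem_lev (P := P)
      (add_mem (add_mem (hL (a 6 * a 4 + a 4 + a 5) hx) (hL (a 4 + a 6 * a 5) hy)) hz) (by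
        have h6 : algebraMap (ZMod 2) K (a 6) ^ 2 = algebraMap (ZMod 2) K (a 6) := by
          rw [← map_pow, ZMod.pow_card]
        convert hm using 1
        simp only [map_add, map_mul]
        field_simp
        clear * - h6 this
        grind)
    simpa using (hi (a 6 * a 4 + a 4 + a 5) (a 4 + a 6 * a 5) 1 e (by
      rw [he, map_one, one_mul, mul_one, CharTwo.add_self_eq_zero])).2.2.1

theorem adjoin_eq_top_of_norm {P : Place (ZMod 2) K} {x y z : K}
    (hP : placeDegree (ZMod 2) P = 6) (hi : Indep x y z 1)
    (hx : x ∈ RRspace (ZMod 2) (Finsupp.single P 1)) (hy : y ∈ RRspace (ZMod 2) (Finsupp.single P 1))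
    (hz : z ∈ RRspace (ZMod 2) (Finsupp.single P 1)) (h : z = x ^ 2 + x * y + y ^ 2)
    (hx6 : fdeg (ZMod 2) x = 6) :
    adjoin (adjoin (ZMod 2) {x}) {y} = ⊤ := by
  set u : Fin 8 → K := ![1, x, y, z, x ^ 2, x * y, x * z, y * z] with hu
  have hli : LinearIndependent (ZMod 2) u :=
    Fintype.linearIndependent_iff.2 fun a ha => hi.coeff_eq_zero hx hy hz h a ha
  set B := Submodule.span (ZMod 2) (Set.range u) with hB
  set V := RRspace (ZMod 2) (Finsupp.single P 1 + Finsupp.single P 1) with hV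
  have hdV : degHom (ZMod 2) K (Finsupp.single P 1 + Finsupp.single P 1) = 12 := by
    rw [map_add, degHom_single, hP]; rfl
  have hV9 : Module.finrank (ZMod 2) V = 9 := by
    have h1 := ell_eq (Finsupp.single P 1 + Finsupp.single P 1)
    rw [hdV, ell] at h1
    have h2 := lf_large K (n := 12) (by norm_num)
    change Module.finrank (ZMod 2) V = _ at h1
    omega
  have hB8 : Module.finrank (ZMod 2) B = 8 := by
    rw [finrank_span_eq_card hli, Fintype.card_fin]
  have hBV : B ≤ V := by
    rw [hB, Submodule.span_le]
    have h1 : (1 : K) ∈ RRspace (ZMod 2) (Finsupp.single P 1) :=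
      RRspace_mono (Finsupp.single_nonneg.2 zero_le_one)
        (by rw [RRspace_zero]; exact Submodule.mem_span_singleton_self _)
    have hm : ∀ {f g : K}, f ∈ RRspace (ZMod 2) (Finsupp.single P 1) →
        g ∈ RRspace (ZMod 2) (Finsupp.single P 1) → f * g ∈ V := fun hf hg =>
      mul_mem_RRspace hf hg
    have hm1 : ∀ {f : K}, f ∈ RRspace (ZMod 2) (Finsupp.single P 1) → f ∈ V := fun hf => by
      simpa using hm hf h1
    rintro _ ⟨i, rfl⟩
    fin_cases i
    exacts [hm1 h1, hm1 hx, hm1 hy, hm1 hz, by simpa [hu, pow_two] using hm hx hx, hm hx hy,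
      hm hx hz, hm hy hz]
  obtain ⟨T, hT, hT5⟩ := IsG4.exists_T (K := K)
  have hT0 := ne_zero_of_transcendental hT
  set E := Finsupp.single P 1 + Finsupp.single P 1 - pdiv (ZMod 2) T with hE
  have hE4 : Module.finrank (ZMod 2) (RRspace (ZMod 2) E) = 4 := by
    have h1 := ell_eq E
    rw [hE, map_sub, hdV, deg_pdiv hT, hT5] at h1
    have h2 := lf_large K (n := 7) (by norm_num)
    norm_num at h1
    change Module.finrank (ZMod 2) (RRspace (ZMod 2) E) = _ at h1
    omega
  have hEV : RRspace (ZMod 2) E ≤ V := RRspace_mono (sub_le_self _ (pdiv_nonneg _))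
  have h3 := finrank_add_finrank_le hEV hBV
  set S := RRspace (ZMod 2) E ⊓ B with hS
  set S' := S.map (LinearMap.mulLeft (ZMod 2) T) with hS'
  have hS'S : Module.finrank (ZMod 2) S' = Module.finrank (ZMod 2) S :=
    (S.equivMapOfInjective (LinearMap.mulLeft (ZMod 2) T) (mul_right_injective₀ hT0)).finrank_eq.symm
  have hS'V : S' ≤ V := by
    rintro _ ⟨f, hf, rfl⟩
    have := mul_mem_RRspace (mem_RR_pdiv (F := ZMod 2) T) hf.1
    rwa [hE, add_sub_cancel] at this
  have h4 := finrank_add_finrank_le hS'V hBV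
  obtain ⟨f, hf, hf0⟩ : ∃ f ∈ S' ⊓ B, f ≠ 0 := by
    refine (Submodule.ne_bot_iff _).1 fun h0 => ?_
    rw [h0, finrank_bot] at h4
    omega
  obtain ⟨⟨g, hg, rfl⟩, hgB⟩ := hf
  have hg0 : g ≠ 0 := fun h0 => hf0 (by rw [h0, map_zero])
  set W := adjoin (ZMod 2) ({x, y} : Set K) with hW
  have hxW : x ∈ W := subset_adjoin _ _ (by simp)
  have hyW : y ∈ W := subset_adjoin _ _ (by simp)
  have hzW : z ∈ W := by
    rw [h]
    exact add_mem (add_mem (pow_mem hxW 2) (mul_mem hxW hyW)) (pow_mem hyW 2)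
  have hBW : ∀ f ∈ B, f ∈ W := by
    have : B ≤ Subalgebra.toSubmodule W.toSubalgebra := by
      rw [hB, Submodule.span_le]
      rintro _ ⟨i, rfl⟩
      fin_cases i
      exacts [W.one_mem, hxW, hyW, hzW, (show x ^ 2 ∈ W from pow_mem hxW 2),
        W.mul_mem hxW hyW, W.mul_mem hxW hzW, W.mul_mem hyW hzW]
    exact this
  have hTW : T ∈ W := by
    have := mul_mem (hBW _ hgB) (inv_mem (hBW _ hg.2))
    rwa [LinearMap.mulLeft_apply, mul_inv_cancel_right₀ hg0] at this
  have h5 : Module.finrank W K ∣ fdeg (ZMod 2) T :=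
    finrank_dvd_of_le_left (adjoin_simple_le_iff.2 hTW)
  have h6 : Module.finrank W K ∣ fdeg (ZMod 2) x :=
    finrank_dvd_of_le_left (adjoin_simple_le_iff.2 hxW)
  rw [hT5] at h5
  rw [hx6] at h6
  have h1 : Module.finrank W K = 1 := by
    have := Nat.dvd_gcd h5 h6
    norm_num at this
    exact this
  rw [← restrictScalars_eq_top_iff (K := ZMod 2), adjoin_simple_adjoin_simple]
  exact finrank_eq_one_iff_eq_top.1 h1

theorem linearIndependent_mul_pow {x y z : K} (hx : Transcendental (ZMod 2) x)
    (hx6 : fdeg (ZMod 2) x = 6)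
    (h : z = x ^ 2 + x * y + y ^ 2)
    (hli : LinearIndependent (adjoin (ZMod 2) {x}) (fun i : Fin 6 => y ^ (i : ℕ))) :
    LinearIndependent (adjoin (ZMod 2) {x})
      (fun s : ({0, 1} ×ˢ {0, 1, 2} : Finset (ℕ × ℕ)) => y ^ s.1.1 * z ^ s.1.2) := by
  have := charP_of_injective_algebraMap (algebraMap (ZMod 2) K).injective 2
  have := finiteDimensional_adjoin hx
  refine linearIndependent_of_top_le_span_of_card_eq_finrank ?_ (by
    rw [← fdeg, hx6]; rfl)
  rw [← hli.span_eq_top_of_card_eq_finrank' (by rw [← fdeg, hx6]; rfl), Submodule.span_le]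
  set S := Submodule.span (adjoin (ZMod 2) {x}) (Set.range
    (fun s : ({0, 1} ×ˢ {0, 1, 2} : Finset (ℕ × ℕ)) => y ^ s.1.1 * z ^ s.1.2)) with hS
  have hm : ∀ i j, (i, j) ∈ ({0, 1} ×ˢ {0, 1, 2} : Finset (ℕ × ℕ)) → y ^ i * z ^ j ∈ S :=
    fun i j hij => Submodule.subset_span ⟨⟨(i, j), hij⟩, rfl⟩
  have hs : ∀ (n : ℕ) {f : K}, f ∈ S → x ^ n * f ∈ S := fun n f hf =>
    S.smul_mem ((⟨x, mem_adjoin_simple_self _ x⟩ : adjoin (ZMod 2) {x}) ^ n) hf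
  have h00 := hm 0 0 (by decide)
  have h01 := hm 0 1 (by decide)
  have h02 := hm 0 2 (by decide)
  have h10 := hm 1 0 (by decide)
  have h11 := hm 1 1 (by decide)
  have h12 := hm 1 2 (by decide)
  have e2 : y ^ 2 = y ^ 0 * z ^ 1 + x ^ 1 * (y ^ 1 * z ^ 0) + x ^ 2 * (y ^ 0 * z ^ 0) := by grind
  have e3 : y ^ 3 = y ^ 1 * z ^ 1 + x ^ 1 * (y ^ 0 * z ^ 1) + x ^ 3 * (y ^ 0 * z ^ 0) := by grind
  have e4 : y ^ 4 = y ^ 0 * z ^ 2 + x ^ 2 * (y ^ 0 * z ^ 1) + x ^ 3 * (y ^ 1 * z ^ 0) := by grind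
  have e5 : y ^ 5 = y ^ 1 * z ^ 2 + x ^ 2 * (y ^ 1 * z ^ 1) + x ^ 3 * (y ^ 0 * z ^ 1) +
      x ^ 4 * (y ^ 1 * z ^ 0) + x ^ 5 * (y ^ 0 * z ^ 0) := by grind
  rintro _ ⟨i, rfl⟩
  fin_cases i
  · simpa using h00
  · simpa using h10
  · change y ^ 2 ∈ S
    rw [e2]
    exact add_mem (add_mem h01 (hs 1 h10)) (hs 2 h00)
  · change y ^ 3 ∈ S
    rw [e3]
    exact add_mem (add_mem h11 (hs 1 h01)) (hs 3 h00)
  · change y ^ 4 ∈ S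
    rw [e4]
    exact add_mem (add_mem h02 (hs 2 h01)) (hs 3 h10)
  · change y ^ 5 ∈ S
    rw [e5]
    exact add_mem (add_mem (add_mem (add_mem h12 (hs 2 h11)) (hs 3 h01)) (hs 4 h10)) (hs 5 h00)

theorem exists_ell_model : ∃ (P : Place (ZMod 2) K) (x y : K) (c : List Bool),
    placeDegree (ZMod 2) P = 6 ∧ c.length = 15 ∧
    PlaneModel (2 • Finsupp.single P 1) x y (polyOf (true :: c) ((0, 0, 3) :: ellMon)) ∧
    adjoin (adjoin (ZMod 2) {x}) {y} = ⊤ ∧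
    LinearIndependent (ZMod 2) ![x, y, x ^ 2 + x * y + y ^ 2, 1] := by
  obtain ⟨P, x, y, hP, hx, hy, hz, hi⟩ := exists_prime_norm (K := K)
  have hdP : degHom (ZMod 2) K (Finsupp.single P 1) = 6 := by rw [degHom_single, hP]; rfl
  have hP0 : (0 : Divisor (ZMod 2) K) ≤ Finsupp.single P 1 := Finsupp.single_nonneg.2 zero_le_one
  have hxt : Transcendental (ZMod 2) x := by
    refine transcendental_of_not_mem fun ⟨e, he⟩ => ?_
    refine hi.not_mem_lev hx ?_
    rw [← he, mem_lev_zero]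
    exact P.2.2 e
  have hpx : pdiv (ZMod 2) x = Finsupp.single P 1 := by
    have hle := pdiv_le hP0 hi.ne_zero.1 hx
    have h0 := pdiv_nonneg (F := ZMod 2) x
    have hPx : pdiv (ZMod 2) x P ≠ 0 := fun h =>
      hi.not_mem_lev hx (mem_lev_zero.2 (mem_of_pdiv_eq_zero.2 h))
    ext Q
    have h1 := hle Q
    have h2 := h0 Q
    rw [Finsupp.coe_zero, Pi.zero_apply] at h2
    rcases eq_or_ne P Q with rfl | hQ
    · rw [Finsupp.single_eq_same] at h1 ⊢
      omega
    · rw [Finsupp.single_eq_of_ne' hQ] at h1 ⊢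
      omega
  have hx6 : fdeg (ZMod 2) x = 6 := by
    have := deg_pdiv hxt
    rw [hpx, hdP] at this
    exact_mod_cast this.symm
  have hgen := adjoin_eq_top_of_norm hP hi hx hy hz rfl hx6
  have hli := linearIndependent_pow_of_adjoin_eq_top hxt hgen
  rw [hx6] at hli
  rw [← hpx] at hy hz
  obtain ⟨c, hc, hmod⟩ := exists_planeModel hxt (r := 1) (r' := 1) (N := 2) (N' := 3) (j := 0)
    (k := 3) (by norm_num) (by rw [hx6]) (by rwa [one_smul]) (by rwa [one_smul]) hli
    (linearIndependent_mul_pow hxt hx6 rfl hli)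
    (ms := [(0, 0, 0), (1, 0, 0), (2, 0, 0), (0, 1, 0), (1, 1, 0), (0, 0, 1), (1, 0, 1),
      (0, 1, 1), (0, 0, 2)]) (ms' := ellMon)
    (by decide) (by rw [hx6]; decide) (by norm_num) (by norm_num)
  exact ⟨P, x, y, c, hP, hc, hpx ▸ hmod, hgen, indep_iff.1 hi⟩

end Elliptic

end CFF

namespace CFF

open Polynomial IntermediateField

section Automorphism

variable {K : Type} [Field K] [Algebra (ZMod 2) K] [IsG4 K]

/-- A function field of genus four and class number one over `𝔽₂` has an automorphism of order five
which fixes every function of degree five. -/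
theorem exists_algHom_of_order_five : ∃ φ : K →ₐ[ZMod 2] K, (∀ f, φ (φ (φ (φ (φ f)))) = f) ∧
    (∃ f, φ f ≠ f) ∧ ∀ T : K, Transcendental (ZMod 2) T → fdeg (ZMod 2) T = 5 → φ T = T := by
  obtain ⟨P, x, y, c, hP, hc, hmod, hgen, hli⟩ := exists_ell_model (K := K)
  have h0 := lf_zero K
  have h4 := lf_four K
  have h5 := lf_five K
  have h11 : lf K 1 ≤ 1 := lf_le_one (by norm_num)
  have h22 : lf K 2 ≤ 1 := lf_le_one (by norm_num)
  have h33 : lf K 3 ≤ 1 := lf_le_one le_rfl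
  have hz : ∀ {Q : Place (ZMod 2) K}, placeDegree (ZMod 2) Q ≠ 6 →
      (2 • Finsupp.single P 1 : Divisor (ZMod 2) K) Q = 0 := by
    intro Q hQ
    have : P ≠ Q := fun h => hQ (h ▸ hP)
    rw [Finsupp.smul_apply, Finsupp.single_eq_of_ne' this, smul_zero]
  have hb : ∀ {e N : ℕ}, 2 ^ lf K e - 1 ≤ N → AtMost (2 • Finsupp.single P 1) e N :=
    fun h R hR => (card_le_effs _ R fun Q hQ => by rw [(hR Q hQ).1]).trans h
  have hpl : ∀ {n : ℕ}, 0 < n → (∀ m : ℤ, 0 < m → m < n → lf K m = 0 ∨ lf K (n - m) = 0) →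
      1 ≤ lf K n → ∃ Q : Place (ZMod 2) K, placeDegree (ZMod 2) Q = n := by
    intro n hn h h1
    obtain ⟨Q, hQ⟩ := exists_place_of_lf (by exact_mod_cast hn) h h1
    exact ⟨Q, by exact_mod_cast hQ⟩
  have hb' : ∀ {d e N : ℕ} {Q : Place (ZMod 2) K}, placeDegree (ZMod 2) Q = d → d ≠ e →
      2 ^ lf K e - 1 - (2 ^ lf K (e - d) - 1) ≤ N → AtMost (2 • Finsupp.single P 1) e N := by
    intro d e N Q hQ hde h R hR
    have := card_add_effs Q e R fun p hp => ⟨fun h => hde (by rw [← hQ, ← h, (hR p hp).1]),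
      by rw [(hR p hp).1]⟩
    rw [hQ] at this
    omega
  rcases Nat.eq_zero_or_pos (lf K 1) with h1 | h1
  swap
  · exfalso
    replace h1 : lf K 1 = 1 := by omega
    obtain ⟨Q, hQ⟩ := hpl (n := 1) one_pos (fun m _ _ => by push_cast at *; omega)
      (by rw [Nat.cast_one, h1])
    have heff : ∀ n : ℕ, lf K n ≤ 1 → lf K n = 1 := by
      intro n hn
      refine le_antisymm hn (lf_pos_of_mem (D := n • Finsupp.single Q 1) ⟨?_, ?_⟩)
      · exact nsmul_nonneg (Finsupp.single_nonneg.2 zero_le_one) _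
      · rw [map_nsmul, degHom_single, hQ]; simp
    have h2 : lf K 2 = 1 := heff 2 h22
    have h3 : lf K 3 = 1 := heff 3 h33
    rw [h2] at h4
    rw [h1] at h5
    refine hmod.not_ell_of_one hc (hz (by omega)) hQ (hb ?_) (hb' hQ (by norm_num) ?_)
      (hb' hQ (by norm_num) ?_) (hb' hQ (by norm_num) ?_) (hb' hQ (by norm_num) ?_) <;>
    norm_num [h1, h2, h3, h4, h5]
  have hb1 : AtMost (2 • Finsupp.single P 1 : Divisor (ZMod 2) K) 1 0 := hb (by norm_num [h1])
  have hb3 : AtMost (2 • Finsupp.single P 1 : Divisor (ZMod 2) K) 3 1 :=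
    hb (Nat.sub_le_sub_right (Nat.pow_le_pow_right two_pos h33) 1)
  have hb2 : AtMost (2 • Finsupp.single P 1 : Divisor (ZMod 2) K) 2 1 :=
    hb (Nat.sub_le_sub_right (Nat.pow_le_pow_right two_pos h22) 1)
  rcases Nat.eq_zero_or_pos (lf K 2) with h2 | h2
  swap
  · exfalso
    replace h2 : lf K 2 = 1 := by omega
    obtain ⟨Q, hQ⟩ := hpl (n := 2) two_pos (fun m _ _ => by
      obtain rfl : m = 1 := by push_cast at *; omega
      exact Or.inl h1) (by rw [Nat.cast_ofNat, h2])
    rw [h2] at h4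
    exact hmod.not_ell_of_two hc (hz (by omega)) hQ hb1 hb2 hb3
      (hb' hQ (by norm_num) (by norm_num [h2, h4]))
  rw [h2] at h4
  obtain ⟨Q, hQ⟩ := hpl (n := 4) (by norm_num) (fun m _ _ => by
    obtain rfl | rfl | rfl : m = 1 ∨ m = 2 ∨ m = 3 := by push_cast at *; omega
    · exact Or.inl h1
    · exact Or.inl h2
    · exact Or.inr h1) (by rw [Nat.cast_ofNat, h4])
  have := charP_of_injective_algebraMap (algebraMap (ZMod 2) K).injective 2
  obtain ⟨M, hM5, hM1, hM⟩ := exists_isometry (K := K)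
    (hmod.mem_ellGood hc (hz (by omega)) hQ hb1 hb2 hb3 (hb (by norm_num [h4])))
  obtain ⟨φ, hφ, hφ1⟩ := hmod.exists_algHom_of_isIsometry hgen hli hM5 hM1 hM
  exact ⟨φ, hφ, hφ1, fun T hT hT5 => map_eq_of_lf_one h1 φ hφ hT hT5⟩

end Automorphism

end CFF

namespace CFF

open IntermediateField

section RationalSubfield

variable {K : Type} [Field K] [Algebra (ZMod 2) K] [Algebra (RatFunc (ZMod 2)) K]
  [IsScalarTower (ZMod 2) (RatFunc (ZMod 2)) K]

theorem fdeg_algebraMap_X : fdeg (ZMod 2) (algebraMap (RatFunc (ZMod 2)) K RatFunc.X) =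
    Module.finrank (RatFunc (ZMod 2)) K := by
  let ι : RatFunc (ZMod 2) →ₐ[ZMod 2] K := IsScalarTower.toAlgHom _ _ _
  have h : adjoin (ZMod 2) {algebraMap (RatFunc (ZMod 2)) K RatFunc.X} = ι.fieldRange := by
    have := adjoin_map (ZMod 2) {(RatFunc.X : RatFunc (ZMod 2))} ι
    rw [RatFunc.adjoin_X, ← AlgHom.fieldRange_eq_map, Set.image_singleton] at this
    exact this.symm
  rw [fdeg, h]
  exact (Algebra.finrank_eq_of_equiv_equiv (algebraMap (RatFunc (ZMod 2)) K).rangeRestrictFieldEquiv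
    (RingEquiv.refl K) (by ext; rfl)).symm

theorem algHom_comp_eq {φ : K →ₐ[ZMod 2] K}
    (h : φ (algebraMap (RatFunc (ZMod 2)) K RatFunc.X) =
      algebraMap (RatFunc (ZMod 2)) K RatFunc.X) (r : RatFunc (ZMod 2)) :
    φ (algebraMap _ K r) = algebraMap _ K r := by
  let ι : RatFunc (ZMod 2) →ₐ[ZMod 2] K := IsScalarTower.toAlgHom _ _ _
  have := algHom_ext_of_eq_adjoin _ (RatFunc.adjoin_X (K := ZMod 2)).symm
    (φ₁ := (φ.comp ι).comp (val ⊤)) (φ₂ := ι.comp (val ⊤)) (by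
      rintro x rfl
      exact h)
  exact DFunLike.congr_fun this ⟨r, mem_top⟩

theorem normal_of_genus_four (hFF : IsFunctionField (ZMod 2) K)
    (hconst : HasExactConstants (ZMod 2) K) (hg : genus (ZMod 2) K = 4)
    (hh : classNumber (ZMod 2) K = 1) (hdeg : Module.finrank (RatFunc (ZMod 2)) K = 5) :
    Normal (RatFunc (ZMod 2)) K := by
  have : IsCF (ZMod 2) K := ⟨hFF, hconst⟩
  have hX : Transcendental (ZMod 2) (algebraMap (RatFunc (ZMod 2)) K RatFunc.X) :=
    (transcendental_algebraMap_iff (algebraMap (RatFunc (ZMod 2)) K).injective).2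
      RatFunc.transcendental_X
  have hX5 := fdeg_algebraMap_X (K := K)
  rw [hdeg] at hX5
  have := isG4_of K hg hh hX hX5
  obtain ⟨φ, hφ, ⟨f, hf⟩, hT⟩ := exists_algHom_of_order_five (K := K)
  have hp : (Module.finrank (RatFunc (ZMod 2)) K).Prime := by rw [hdeg]; exact Nat.prime_five
  have : FiniteDimensional (RatFunc (ZMod 2)) K := Module.finite_of_finrank_pos hp.pos
  have : IsSimpleOrder (IntermediateField (RatFunc (ZMod 2)) K) :=
    isSimpleOrder_of_finrank_prime _ _ hp
  let ψ : K →ₐ[RatFunc (ZMod 2)] K := ⟨φ.toRingHom, algHom_comp_eq (hT _ hX hX5)⟩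
  have hψ : Function.Bijective ψ := ⟨ψ.toRingHom.injective, fun f => ⟨_, hφ f⟩⟩
  have : IsGalois (RatFunc (ZMod 2)) K := by
    refine IsGalois.of_fixedField_eq_bot _ _ ((eq_bot_or_eq_top _).resolve_right fun h => hf ?_)
    have hmem : f ∈ fixedField (⊤ : Subgroup Gal(K/RatFunc (ZMod 2))) := h ▸ mem_top
    exact hmem ⟨AlgEquiv.ofBijective ψ hψ, trivial⟩
  infer_instance

end RationalSubfield

end CFF

open CFF in
/-- For a congruence function field `K` over `𝔽₂` of genus `4` and class
number `1` with rational subfield `k = 𝔽₂(T)` of degree `5`: if `K/k` were not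
normal, then the Galois closure `K̃` of `K/k` (a minimal Galois extension of
`k` containing `K`) would have exact field of constants `𝔽₂`, and `K̃/K` would
be unramified at every place. -/
theorem galois_closure_constants_and_unramified
    (K : Type) [Field K] [Algebra (ZMod 2) K]
    [Algebra (RatFunc (ZMod 2)) K] [IsScalarTower (ZMod 2) (RatFunc (ZMod 2)) K]
    (hFF : IsFunctionField (ZMod 2) K)
    (hconst : HasExactConstants (ZMod 2) K)
    (hg : genus (ZMod 2) K = 4)
    (hh : classNumber (ZMod 2) K = 1)
    (hdeg : Module.finrank (RatFunc (ZMod 2)) K = 5)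
    (hnn : ¬ Normal (RatFunc (ZMod 2)) K)
    (N : Type) [Field N] [Algebra (ZMod 2) N] [Algebra (RatFunc (ZMod 2)) N]
    [Algebra K N] [IsScalarTower (ZMod 2) (RatFunc (ZMod 2)) N]
    [IsScalarTower (RatFunc (ZMod 2)) K N]
    (hGal : IsGalois (RatFunc (ZMod 2)) N)
    (hmin : ∀ E : IntermediateField (RatFunc (ZMod 2)) N,
      (∀ x : K, algebraMap K N x ∈ E) → Normal (RatFunc (ZMod 2)) E → E = ⊤) :
    HasExactConstants (ZMod 2) N ∧
    ∀ P : Place (ZMod 2) N, ∀ x : K,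
      ordAt P.1 (algebraMap K N x) = ordAt (P.1.comap (algebraMap K N)) x := by
  exact absurd (normal_of_genus_four hFF hconst hg hh hdeg) hnn
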